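/- Real analyticity of modes near a non-degenerate Killing horizon in adapted coordinates (coordinate version of Theorem 3): Let n, N ≥ 1, κ ∈ ℝ with κ ≠ 0, and σ ∈ ℂ. Let U ⊂ ℝⁿ be open (coordinates x' = (x₁,…,xₙ)) with U ∩ {x₁ = 0} ≠ ∅. Let g : U → real symmetric (n+1)×(n+1) matrices (indices 0,…,n) be real analytic with g(x') invertible for every x' ∈ U, and suppose that for every x' ∈ U with x₁ = 0: g₀₀(x') = 0, g₀₁(x') = 1, g₀ⱼ(x') = 0 for 2 ≤ j ≤ n, g₁₁(x') = 0, g₁ⱼ(x') = 0 for 2 ≤ j ≤ n, the submatrix (g_{ij}(x'))_{2 ≤ i,j ≤ n} is positive definite, and ∂₁g₀₀(x') = −2κ. Let A⁰,…,Aⁿ, B : U → N×N complex matrices be real analytic. For smooth u : ℝ × U → ℂᴺ (first variable x₀) define Pu := −Σ_{α,β=0}^{n} (g⁻¹)_{αβ} ∂_α∂_β u + Σ_{α=0}^{n} A^α ∂_α u + B u (all coefficients evaluated at x' only). If u : ℝ × U → ℂᴺ is smooth, ∂₀u = −iσu, and Pu is real analytic on ℝ × U, then there is an open set V ⊂ U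 containing U ∩ {x₁ = 0} such that u is real analytic on ℝ × V. -/

import Mathlib

open Set

noncomputable section

namespace HorizonModes

/-- Partial derivative of `w : ℝ × ℝᵏ → ℂ` in the coordinate `x_α`, `α ∈ {0, 1, …, k}`:
`α = 0` is the `ℝ`-factor coordinate `x₀`, and `α = j ≥ 1` is the `j`-th coordinate `xⱼ`
of the `ℝᵏ`-factor (indexed by `j − 1 : Fin k`). -/
def D {k : ℕ} (α : Fin (k + 1)) (w : ℝ × (Fin k → ℝ) → ℂ) (p : ℝ × (Fin k → ℝ)) : ℂ :=
  if h : α = 0 then deriv (fun s => w (s, p.2)) p.1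
  else deriv (fun s => w (p.1, Function.update p.2 (α.pred h) s)) (p.2 (α.pred h))

end HorizonModes

open HorizonModes


open scoped ContDiff
set_option linter.unusedSectionVars false

namespace HM
open MeasureTheory Filter Topology

/-! ### Directional derivative calculus -/

/-- directional derivative -/
def dd {E F : Type*} [NormedAddCommGroup E] [NormedSpace ℝ E] [NormedAddCommGroup F]
    [NormedSpace ℝ F] (v : E) (f : E → F) : E → F := fun z => fderiv ℝ f z v

section
variable {E : Type*} [NormedAddCommGroup E] [NormedSpace ℝ E]
  {F : Type*} [NormedAddCommGroup F] [NormedSpace ℝ F]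
  {G : Type*} [NormedAddCommGroup G] [NormedSpace ℝ G]
  {W : Type*} [NormedAddCommGroup W] [NormedSpace ℝ W]
  {H : Type*} [NormedAddCommGroup H] [InnerProductSpace ℝ H]

lemma dd_smooth {v : E} {f : E → F} (hf : ContDiff ℝ ∞ f) : ContDiff ℝ ∞ (dd v f) := by
  unfold dd
  exact (hf.fderiv_right (m := ∞) (by simp)).clm_apply contDiff_const

lemma sm_diff {f : E → F} (hf : ContDiff ℝ ∞ f) (z : E) : DifferentiableAt ℝ f z :=
  (hf.differentiable (by simp)) z

lemma ddit_smooth {v : E} {f : E → F} (hf : ContDiff ℝ ∞ f) (k : ℕ) :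
    ContDiff ℝ ∞ ((dd v)^[k] f) := by
  induction k with
  | zero => simpa
  | succ k ih => rw [Function.iterate_succ_apply']; exact dd_smooth ih

lemma dd_comm {v w : E} {f : E → F} (hf : ContDiff ℝ ∞ f) : dd v (dd w f) = dd w (dd v f) := by
  have key : ∀ (a b : E) (z : E), dd a (dd b f) z = fderiv ℝ (fderiv ℝ f) z a b := by
    intro a b z
    have h1 : DifferentiableAt ℝ (fderiv ℝ f) z :=
      sm_diff (hf.fderiv_right (m := ∞) (by simp)) z
    unfold dd
    rw [fderiv_clm_apply h1 (by fun_prop)]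
    simp
  funext z
  rw [key, key]
  have h := hf.contDiffAt (x := z)
  have hs : IsSymmSndFDerivAt ℝ f z := h.isSymmSndFDerivAt (by
    simp only [minSmoothness_of_isRCLikeNormedField]
    exact WithTop.coe_le_coe.2 le_top)
  exact hs v w

lemma dd_bilin (B : F →L[ℝ] G →L[ℝ] W) {v : E} {f : E → F} {g : E → G} {z : E}
    (hf : DifferentiableAt ℝ f z) (hg : DifferentiableAt ℝ g z) :
    dd v (fun y => B (f y) (g y)) z = B (dd v f z) (g z) + B (f z) (dd v g z) := by
  unfold dd
  have := (B.hasFDerivAt_of_bilinear hf.hasFDerivAt hg.hasFDerivAt).fderiv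
  rw [this]
  simp [add_comm]

lemma dd_smul {v : E} {f : E → ℝ} {g : E → G} {z : E}
    (hf : DifferentiableAt ℝ f z) (hg : DifferentiableAt ℝ g z) :
    dd v (fun y => f y • g y) z = dd v f z • g z + f z • dd v g z :=
  dd_bilin (ContinuousLinearMap.lsmul ℝ ℝ) hf hg

lemma dd_mul {v : E} {f : E → ℝ} {g : E → ℝ} {z : E}
    (hf : DifferentiableAt ℝ f z) (hg : DifferentiableAt ℝ g z) :
    dd v (fun y => f y * g y) z = dd v f z * g z + f z * dd v g z :=
  dd_smul hf hg

lemma dd_clm {v : E} {f : E → (F →L[ℝ] G)} {g : E → F} {z : E}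
    (hf : DifferentiableAt ℝ f z) (hg : DifferentiableAt ℝ g z) :
    dd v (fun y => f y (g y)) z = dd v f z (g z) + f z (dd v g z) :=
  dd_bilin (ContinuousLinearMap.id ℝ (F →L[ℝ] G)) hf hg

lemma dd_inner {v : E} {f : E → H} {g : E → H} {z : E}
    (hf : DifferentiableAt ℝ f z) (hg : DifferentiableAt ℝ g z) :
    dd v (fun y => inner ℝ (f y) (g y)) z
      = inner ℝ (dd v f z) (g z) + inner ℝ (f z) (dd v g z) :=
  dd_bilin (innerSL ℝ) hf hg

lemma dd_add {v : E} {f : E → F} {g : E → F} {z : E}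
    (hf : DifferentiableAt ℝ f z) (hg : DifferentiableAt ℝ g z) :
    dd v (fun y => f y + g y) z = dd v f z + dd v g z := by
  unfold dd; rw [fderiv_fun_add hf hg]; rfl

lemma dd_sub {v : E} {f : E → F} {g : E → F} {z : E}
    (hf : DifferentiableAt ℝ f z) (hg : DifferentiableAt ℝ g z) :
    dd v (fun y => f y - g y) z = dd v f z - dd v g z := by
  unfold dd; rw [fderiv_fun_sub hf hg]; rfl

lemma dd_sum {ι : Type*} {s : Finset ι} {v : E} {f : ι → E → F} {z : E}
    (hf : ∀ i ∈ s, DifferentiableAt ℝ (f i) z) :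
    dd v (fun y => ∑ i ∈ s, f i y) z = ∑ i ∈ s, dd v (f i) z := by
  unfold dd; rw [fderiv_fun_sum hf]; simp

lemma dd_congr {v : E} {f g : E → F} {z : E} (h : f =ᶠ[𝓝 z] g) : dd v f z = dd v g z := by
  unfold dd; rw [h.fderiv_eq]

lemma dd_congr_nhds {v : E} {f g : E → F} {z : E} (h : f =ᶠ[𝓝 z] g) :
    dd v f =ᶠ[𝓝 z] dd v g := by
  filter_upwards [h.eventuallyEq_nhds] with y hy using dd_congr hy

lemma ddit_congr_nhds {v : E} {f g : E → F} {z : E} (h : f =ᶠ[𝓝 z] g) (k : ℕ) :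
    (dd v)^[k] f =ᶠ[𝓝 z] (dd v)^[k] g := by
  induction k with
  | zero => simpa
  | succ k ih => rw [Function.iterate_succ_apply', Function.iterate_succ_apply']
                 exact dd_congr_nhds ih

lemma dd_lin {v : E} (L : E →L[ℝ] F) (z : E) : dd v (fun y => L y) z = L v := by
  unfold dd; rw [ContinuousLinearMap.fderiv]

lemma dd_add_vec {v w : E} {f : E → F} : dd (v + w) f = fun z => dd v f z + dd w f z := by
  funext z; simp [dd]

lemma dd_smul_vec {c : ℝ} {v : E} {f : E → F} : dd (c • v) f = fun z => c • dd v f z := by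
  funext z; simp [dd]

lemma dd_sum_vec {ι : Type*} {s : Finset ι} {v : ι → E} {f : E → F} :
    dd (∑ i ∈ s, v i) f = fun z => ∑ i ∈ s, dd (v i) f z := by
  funext z; simp [dd]

lemma dd_cpt {v : E} {f : E → F} (hf : HasCompactSupport f) : HasCompactSupport (dd v f) := by
  unfold dd; exact hf.fderiv_apply ℝ v

lemma ddit_comm {v w : E} {f : E → F} (hf : ContDiff ℝ ∞ f) (k : ℕ) :
    dd w ((dd v)^[k] f) = (dd v)^[k] (dd w f) := by
  induction k generalizing f with
  | zero => rfl
  | succ k ih => rw [Function.iterate_succ_apply, ih (dd_smooth hf), Function.iterate_succ_apply,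
      dd_comm hf]

/-- Leibniz rule for iterated directional derivatives -/
lemma ddit_bilin (B : F →L[ℝ] G →L[ℝ] W) {v : E} {f : E → F} {g : E → G}
    (hf : ContDiff ℝ ∞ f) (hg : ContDiff ℝ ∞ g) (k : ℕ) (z : E) :
    (dd v)^[k] (fun y => B (f y) (g y)) z =
      ∑ ij ∈ Finset.HasAntidiagonal.antidiagonal k, (k.choose ij.1 : ℕ) •
        B ((dd v)^[ij.1] f z) ((dd v)^[ij.2] g z) := by
  induction k generalizing z with
  | zero => simp
  | succ k ih =>
    rw [Function.iterate_succ_apply']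
    have : (dd v)^[k] (fun y => B (f y) (g y)) = fun z => ∑ ij ∈ Finset.HasAntidiagonal.antidiagonal k,
        (k.choose ij.1 : ℕ) • B ((dd v)^[ij.1] f z) ((dd v)^[ij.2] g z) := by
      funext z; exact ih z
    rw [this]
    have hd : ∀ ij : ℕ × ℕ, ContDiff ℝ ∞ (fun z => B ((dd v)^[ij.1] f z) ((dd v)^[ij.2] g z)) := by
      intro ij
      exact (B.contDiff.comp (ddit_smooth hf _)).clm_apply (ddit_smooth hg _)
    rw [dd_sum (fun ij _ => by
      have := sm_diff (hd ij) z
      exact this.const_smul (k.choose ij.1))]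
    have h2 : ∀ ij ∈ Finset.HasAntidiagonal.antidiagonal k, dd v (fun z =>
        (k.choose ij.1 : ℕ) • B ((dd v)^[ij.1] f z) ((dd v)^[ij.2] g z)) z =
        (k.choose ij.1 : ℕ) • B ((dd v)^[ij.1+1] f z) ((dd v)^[ij.2] g z) +
        (k.choose ij.1 : ℕ) • B ((dd v)^[ij.1] f z) ((dd v)^[ij.2+1] g z) := by
      intro ij _
      have e : dd v (fun z =>
        (k.choose ij.1 : ℕ) • B ((dd v)^[ij.1] f z) ((dd v)^[ij.2] g z)) z
         = (k.choose ij.1 : ℕ) • dd v (fun z => B ((dd v)^[ij.1] f z) ((dd v)^[ij.2] g z)) z := by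
        change fderiv ℝ _ z v = _ • fderiv ℝ _ z v
        rw [fderiv_fun_const_smul (sm_diff (hd ij) z)]; rfl
      rw [e, dd_bilin B (sm_diff (ddit_smooth hf _) z) (sm_diff (ddit_smooth hg _) z), smul_add,
        Function.iterate_succ_apply', Function.iterate_succ_apply']
    rw [Finset.sum_congr rfl h2, Finset.sum_add_distrib,
      Finset.sum_antidiagonal_choose_succ_nsmul
        (fun i j => B ((dd v)^[i] f z) ((dd v)^[j] g z)) k, add_comm]
    congr 1
    apply Finset.sum_congr rfl
    intro ij hij
    rw [Finset.HasAntidiagonal.mem_antidiagonal] at hij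
    rw [← hij, Nat.choose_symm_add]

lemma ddit_add {v : E} {f g : E → F} (hf : ContDiff ℝ ∞ f) (hg : ContDiff ℝ ∞ g) (k : ℕ) :
    (dd v)^[k] (fun y => f y + g y) = fun z => (dd v)^[k] f z + (dd v)^[k] g z := by
  induction k with
  | zero => rfl
  | succ k ih =>
    rw [Function.iterate_succ_apply', ih]
    funext z
    rw [dd_add (sm_diff (ddit_smooth hf k) z) (sm_diff (ddit_smooth hg k) z),
      Function.iterate_succ_apply', Function.iterate_succ_apply']

lemma ddit_sum {ι : Type*} {s : Finset ι} {v : E} {f : ι → E → F}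
    (hf : ∀ i, ContDiff ℝ ∞ (f i)) (k : ℕ) :
    (dd v)^[k] (fun y => ∑ i ∈ s, f i y) = fun z => ∑ i ∈ s, (dd v)^[k] (f i) z := by
  induction k with
  | zero => rfl
  | succ k ih =>
    rw [Function.iterate_succ_apply', ih]
    funext z
    rw [dd_sum (fun i _ => sm_diff (ddit_smooth (hf i) k) z)]
    simp_rw [Function.iterate_succ_apply']

/-! ### The weight `X_+^m` -/

/-- positive part power -/
def pp (X : E →L[ℝ] ℝ) (m : ℕ) (z : E) : ℝ := (max (X z) 0) ^ m

lemma pp_nonneg (X : E →L[ℝ] ℝ) (m : ℕ) (z : E) : 0 ≤ pp X m z := by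
  unfold pp; positivity

lemma pp_cont (X : E →L[ℝ] ℝ) (m : ℕ) : Continuous (pp X m) := by
  unfold pp; fun_prop

lemma pp_mul (X : E →L[ℝ] ℝ) (m : ℕ) (hm : 1 ≤ m) (z : E) : X z * pp X m z = pp X (m+1) z := by
  unfold pp
  rcases le_total (X z) 0 with h | h
  · rw [max_eq_right h, zero_pow (by omega), zero_pow (by omega)]; ring
  · rw [max_eq_left h]; ring

lemma posPow_hasDerivAt (m : ℕ) (t : ℝ) :
    HasDerivAt (fun s : ℝ => (max s 0) ^ (m+2)) ((m+2 : ℕ) * (max t 0) ^ (m+1)) t := by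
  rcases lt_trichotomy t 0 with h | h | h
  · have : (fun s : ℝ => (max s 0) ^ (m+2)) =ᶠ[𝓝 t] fun _ => 0 := by
      filter_upwards [gt_mem_nhds h] with s hs
      rw [max_eq_right hs.le]; simp
    rw [max_eq_right h.le]
    simpa using (hasDerivAt_const t (0:ℝ)).congr_of_eventuallyEq this
  · subst h
    simp only [max_self]
    rw [zero_pow (by omega), mul_zero]
    rw [hasDerivAt_iff_isLittleO]
    simp only [max_self, sub_zero, smul_zero]
    rw [zero_pow (by omega)]
    simp only [sub_zero]
    have h1 : (fun s : ℝ => (max s 0) ^ (m+2)) =O[𝓝 0] fun s : ℝ => s ^ (m+2) := by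
      apply Asymptotics.IsBigO.of_bound 1
      filter_upwards with s
      rw [norm_pow, norm_pow, one_mul]
      gcongr
      rw [Real.norm_eq_abs, Real.norm_eq_abs, abs_of_nonneg (le_max_right _ _)]
      exact max_le (le_abs_self _) (abs_nonneg _)
    refine h1.trans_isLittleO ?_
    have := Asymptotics.isLittleO_pow_pow (𝕜 := ℝ) (m := 1) (n := m+2) (by omega)
    simpa using this
  · have : (fun s : ℝ => (max s 0) ^ (m+2)) =ᶠ[𝓝 t] fun s => s ^ (m+2) := by
      filter_upwards [lt_mem_nhds h] with s hs
      rw [max_eq_left hs.le]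
    rw [max_eq_left h.le]
    exact (hasDerivAt_pow (m+2) t).congr_of_eventuallyEq this

lemma pp_hasFDerivAt (X : E →L[ℝ] ℝ) (m : ℕ) (z : E) :
    HasFDerivAt (pp X (m+2)) (((m+2 : ℕ) * pp X (m+1) z) • X) z :=
  (posPow_hasDerivAt m (X z)).comp_hasFDerivAt z X.hasFDerivAt

lemma pp_diff (X : E →L[ℝ] ℝ) (m : ℕ) (z : E) : DifferentiableAt ℝ (pp X (m+2)) z :=
  (pp_hasFDerivAt X m z).differentiableAt

lemma dd_pp (X : E →L[ℝ] ℝ) (m : ℕ) (v z : E) :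
    dd v (pp X (m+2)) z = (m+2 : ℕ) * pp X (m+1) z * X v := by
  unfold dd; rw [(pp_hasFDerivAt X m z).fderiv]; simp

end

section
variable {E : Type*} [NormedAddCommGroup E] [NormedSpace ℝ E] [FiniteDimensional ℝ E]
  [MeasurableSpace E] [BorelSpace E] (μ : Measure E) [μ.IsAddHaarMeasure]
  {F : Type*} [NormedAddCommGroup F] [NormedSpace ℝ F]

/-- integral of a directional derivative vanishes -/
lemma integral_dd_eq_zero {v : E} {f : E → ℝ} (hf : Differentiable ℝ f)
    (hc : HasCompactSupport f) (hi : Integrable (dd v f) μ) : ∫ z, dd v f z ∂μ = 0 := by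
  have := integral_mul_fderiv_eq_neg_fderiv_mul_of_integrable (μ := μ) (v := v) (f := fun _ : E => (1:ℝ))
    (g := f) (by simp) (by simp only [one_mul]; exact hi)
    (by simpa using hf.continuous.integrable_of_hasCompactSupport hc) (by intro z _; fun_prop) (fun z _ => hf z)
  simpa [dd] using this

end
end HM

namespace HM
open MeasureTheory Filter Topology

section
variable {E : Type*} [NormedAddCommGroup E] [NormedSpace ℝ E] [FiniteDimensional ℝ E]
  [MeasurableSpace E] [BorelSpace E] (μ : Measure E) [μ.IsAddHaarMeasure]
  {H : Type*} [NormedAddCommGroup H] [InnerProductSpace ℝ H]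

/-- continuous with compact support -/
def Cc {F : Type*} [TopologicalSpace F] [Zero F] (f : E → F) : Prop :=
  Continuous f ∧ HasCompactSupport f

lemma cc_of_smooth {f : E → H} (hf : ContDiff ℝ ∞ f) (hc : HasCompactSupport f) : Cc f :=
  ⟨hf.continuous, hc⟩

/-- weighted bilinear form -/
def II (X : E →L[ℝ] ℝ) (m : ℕ) (f g : E → H) : ℝ := ∫ z, pp X m z * inner ℝ (f z) (g z) ∂μ

variable (X : E →L[ℝ] ℝ)

lemma II_integrable (m : ℕ) {f g : E → H} (hf : Cc f) (hg : Continuous g) :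
    Integrable (fun z => pp X m z * inner ℝ (f z) (g z)) μ := by
  apply Continuous.integrable_of_hasCompactSupport
  · exact (pp_cont X m).mul (hf.1.inner hg)
  · refine hf.2.mono' ?_
    intro z hz
    apply subset_tsupport
    intro h0
    apply hz
    simp [h0]

lemma II_symm (m : ℕ) (f g : E → H) : II μ X m f g = II μ X m g f := by
  unfold II; simp_rw [real_inner_comm]

lemma II_add_left (m : ℕ) {f g h : E → H} (hf : Cc f) (hg : Cc g) (hh : Continuous h) :
    II μ X m (fun z => f z + g z) h = II μ X m f h + II μ X m g h := by
  unfold II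
  rw [← integral_add (II_integrable μ X m hf hh) (II_integrable μ X m hg hh)]
  simp_rw [inner_add_left, mul_add]

lemma II_smul_left (m : ℕ) (c : ℝ) (f g : E → H) :
    II μ X m (fun z => c • f z) g = c * II μ X m f g := by
  unfold II
  rw [← integral_const_mul]
  congr 1; funext z; rw [real_inner_smul_left]; ring

lemma II_sum_left {ι : Type*} (s : Finset ι) (m : ℕ) {f : ι → E → H} {h : E → H}
    (hf : ∀ i, Cc (f i)) (hh : Continuous h) :
    II μ X m (fun z => ∑ i ∈ s, f i z) h = ∑ i ∈ s, II μ X m (f i) h := by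
  unfold II
  rw [← integral_finsetSum _ (fun i _ => II_integrable μ X m (hf i) hh)]
  simp_rw [sum_inner, Finset.mul_sum]

lemma II_X_left (m : ℕ) (f g : E → H) :
    II μ X (m+1) (fun z => X z • f z) g = II μ X (m+2) f g := by
  unfold II
  congr 1; funext z; rw [real_inner_smul_left, ← pp_mul X (m+1) (by omega)]; ring

lemma II_self_nonneg (m : ℕ) (f : E → H) : 0 ≤ II μ X m f f := by
  unfold II
  apply integral_nonneg
  intro z
  exact mul_nonneg (pp_nonneg X m z) real_inner_self_nonneg

/-- weighted integration by parts -/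
lemma II_ibp (m : ℕ) (v : E) {f g : E → H} (hf : ContDiff ℝ ∞ f) (hfc : HasCompactSupport f)
    (hg : ContDiff ℝ ∞ g) :
    II μ X (m+2) (dd v f) g
      = - II μ X (m+2) f (dd v g) - (m+2 : ℕ) * X v * II μ X (m+1) f g := by
  have hF : Cc f := ⟨hf.continuous, hfc⟩
  have hF' : Cc (dd v f) := ⟨(dd_smooth hf).continuous, dd_cpt hfc⟩
  have i1 := II_integrable μ X (m+2) hF' hg.continuous
  have i2 := II_integrable μ X (m+2) hF (dd_smooth (v := v) hg).continuous
  have i3 := II_integrable μ X (m+1) hF hg.continuous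
  have e : ∀ z, dd v (fun y => pp X (m+2) y * inner ℝ (f y) (g y)) z =
      ((m+2 : ℕ) * X v) * (pp X (m+1) z * inner ℝ (f z) (g z)) +
      (pp X (m+2) z * inner ℝ (dd v f z) (g z) + pp X (m+2) z * inner ℝ (f z) (dd v g z)) := by
    intro z
    have hi : DifferentiableAt ℝ (fun y => inner ℝ (f y) (g y)) z :=
      (sm_diff hf z).inner ℝ (sm_diff hg z)
    rw [dd_mul (pp_diff X m z) hi, dd_pp, dd_inner (sm_diff hf z) (sm_diff hg z)]
    ring
  have h0 : ∫ z, dd v (fun y => pp X (m+2) y * inner ℝ (f y) (g y)) z ∂μ = 0 := by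
    apply integral_dd_eq_zero
    · intro z
      exact (pp_diff X m z).mul ((sm_diff hf z).inner ℝ (sm_diff hg z))
    · refine hfc.mono' ?_
      intro z hz
      apply subset_tsupport
      intro h0
      apply hz
      simp [h0]
    · have : dd v (fun y => pp X (m+2) y * inner ℝ (f y) (g y)) = _ := funext e
      rw [this]
      exact (i3.const_mul _).add (i1.add i2)
  simp_rw [e] at h0
  have h1 := integral_add (i3.const_mul ((m+2 : ℕ) * X v)) (i1.add i2)
  have h2 := integral_add i1 i2
  simp only [Pi.add_apply] at h1
  rw [h1, integral_const_mul, h2] at h0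
  unfold II
  linarith

/-- The model operator. -/
def MM {ι : Type*} [Fintype ι] (β : ℝ) (v : E) (b : ι → E) (w : E → H) : E → H := fun z =>
  X z • dd v (dd v w) z + β • dd v w z + ∑ j, dd (b j) (dd (b j) w) z

/-- Model identity -/
lemma model_identity {ι : Type*} [Fintype ι] (β : ℝ) (v : E) (b : ι → E) (hv : X v = 1)
    (hb : ∀ j, X (b j) = 0) {w : E → H} (hw : ContDiff ℝ ∞ w) (hwc : HasCompactSupport w) :
    II μ X 2 (MM X β v b w) (MM X β v b w) =
      II μ X 4 (dd v (dd v w)) (dd v (dd v w)) + (β^2 - 3*β) * II μ X 2 (dd v w) (dd v w)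
      + 2 * ∑ j, II μ X 3 (dd v (dd (b j) w)) (dd v (dd (b j) w))
      + ∑ j, ∑ l, II μ X 2 (dd (b j) (dd (b l) w)) (dd (b j) (dd (b l) w))
      + (2*β - 6) * ∑ j, II μ X 1 (dd (b j) w) (dd (b j) w) := by
  have sm1 : ∀ a, ContDiff ℝ ∞ (dd a w) := fun a => dd_smooth hw
  have sm2 : ∀ a a', ContDiff ℝ ∞ (dd a (dd a' w)) := fun a a' => dd_smooth (sm1 a')
  have c1 : ∀ a, Cc (dd a w) := fun a => ⟨(sm1 a).continuous, dd_cpt hwc⟩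
  have c2 : ∀ a a', Cc (dd a (dd a' w)) := fun a a' => ⟨(sm2 a a').continuous, dd_cpt (dd_cpt hwc)⟩
  have hD : Cc (fun z => ∑ j, dd (b j) (dd (b j) w) z) := by
    refine ⟨continuous_finsetSum _ fun j _ => (c2 _ _).1, ?_⟩
    have : (fun z => ∑ j, dd (b j) (dd (b j) w) z) = ∑ j, dd (b j) (dd (b j) w) := by
      funext z; simp
    rw [this]
    refine hwc.mono' ?_
    intro z hz
    by_contra hcon
    apply hz
    simp only [Finset.sum_apply]
    apply Finset.sum_eq_zero
    intro j _
    have : w =ᶠ[𝓝 z] (fun _ => 0) := notMem_tsupport_iff_eventuallyEq.1 hcon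
    have h2 := (dd_congr_nhds (v := b j) (dd_congr_nhds (v := b j) this)).eq_of_nhds
    rw [h2]
    have h3 : (dd (b j) fun _ : E => (0:H)) = fun _ => 0 := by funext y; simp [dd]
    rw [h3, h3]
  have hX : Cc (fun z => X z • dd v (dd v w) z) :=
    ⟨X.continuous.smul (c2 v v).1, (c2 v v).2.smul_left⟩
  have hβ : Cc (fun z => β • dd v w z) :=
    ⟨continuous_const.smul (c1 v).1, (c1 v).2.smul_left (f := fun _ => β)⟩
  have h12 : Cc (fun z => X z • dd v (dd v w) z + β • dd v w z) :=
    ⟨hX.1.add hβ.1, hX.2.add hβ.2⟩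
  have hM : Cc (MM X β v b w) := ⟨h12.1.add hD.1, h12.2.add hD.2⟩
  -- linear expansion
  have lin : ∀ h : E → H, Continuous h → II μ X 2 (MM X β v b w) h =
      II μ X 3 (dd v (dd v w)) h + β * II μ X 2 (dd v w) h
        + ∑ j, II μ X 2 (dd (b j) (dd (b j) w)) h := by
    intro h hh
    unfold MM
    rw [II_add_left μ X 2 h12 hD hh, II_add_left μ X 2 hX hβ hh, II_smul_left,
      II_X_left μ X 1, II_sum_left μ X _ 2 (fun j => c2 _ _) hh]
  have lin3 : ∀ h : E → H, Continuous h → II μ X 3 (MM X β v b w) h =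
      II μ X 4 (dd v (dd v w)) h + β * II μ X 3 (dd v w) h
        + ∑ j, II μ X 3 (dd (b j) (dd (b j) w)) h := by
    intro h hh
    unfold MM
    rw [II_add_left μ X 3 h12 hD hh, II_add_left μ X 3 hX hβ hh, II_smul_left,
      II_X_left μ X 2, II_sum_left μ X _ 3 (fun j => c2 _ _) hh]
  rw [lin _ hM.1]
  have e1 : II μ X 3 (dd v (dd v w)) (MM X β v b w) = _ :=
    (II_symm μ X 3 _ _).trans (lin3 _ (c2 v v).1)
  have e2 : II μ X 2 (dd v w) (MM X β v b w) = _ :=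
    (II_symm μ X 2 _ _).trans (lin _ (c1 v).1)
  have e3 : ∀ j, II μ X 2 (dd (b j) (dd (b j) w)) (MM X β v b w) = _ := fun j =>
    (II_symm μ X 2 _ _).trans (lin _ (c2 (b j) (b j)).1)
  rw [e1, e2, Finset.sum_congr rfl (fun j _ => e3 j)]
  -- integrations by parts
  have p1 : II μ X 3 (dd v (dd v w)) (dd v w) = - (3/2) * II μ X 2 (dd v w) (dd v w) := by
    have := II_ibp μ X 1 v (sm1 v) (c1 v).2 (sm1 v)
    rw [hv, II_symm μ X 3 (dd v w)] at this
    norm_num at this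
    linarith
  have p1' : II μ X 3 (dd v w) (dd v (dd v w)) = - (3/2) * II μ X 2 (dd v w) (dd v w) := by
    rw [II_symm, p1]
  have p2 : ∀ j, II μ X 3 (dd (b j) (dd (b j) w)) (dd v (dd v w)) =
      II μ X 3 (dd v (dd (b j) w)) (dd v (dd (b j) w))
       + 3 * II μ X 2 (dd v (dd (b j) w)) (dd (b j) w) := by
    intro j
    have q1 := II_ibp μ X 1 (b j) (sm1 (b j)) (c1 (b j)).2 (sm2 v v)
    rw [hb] at q1
    have q2 := II_ibp μ X 1 v (sm2 v (b j)) (c2 v (b j)).2 (sm1 (b j))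
    rw [hv] at q2
    have q3 : dd (b j) (dd v (dd v w)) = dd v (dd v (dd (b j) w)) := by
      rw [dd_comm (sm1 v), dd_comm hw]
    rw [q3, II_symm μ X 3 (dd (b j) w)] at q1
    norm_num at q1 q2
    linarith
  have p3 : ∀ j, II μ X 2 (dd (b j) (dd (b j) w)) (dd v w) =
      - II μ X 2 (dd v (dd (b j) w)) (dd (b j) w) := by
    intro j
    have q1 := II_ibp μ X 0 (b j) (sm1 (b j)) (c1 (b j)).2 (sm1 v)
    rw [hb, dd_comm (v := b j) (w := v) hw, II_symm μ X 2 (dd (b j) w)] at q1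
    norm_num at q1
    linarith
  have p3' : ∀ j, II μ X 2 (dd v (dd (b j) w)) (dd (b j) w) =
      - II μ X 1 (dd (b j) w) (dd (b j) w) := by
    intro j
    have q1 := II_ibp μ X 0 v (sm1 (b j)) (c1 (b j)).2 (sm1 (b j))
    rw [hv, II_symm μ X 2 (dd (b j) w)] at q1
    norm_num at q1
    linarith
  have p4 : ∀ j l, II μ X 2 (dd (b l) (dd (b l) w)) (dd (b j) (dd (b j) w)) =
      II μ X 2 (dd (b j) (dd (b l) w)) (dd (b j) (dd (b l) w)) := by
    intro j l
    have q1 := II_ibp μ X 0 (b j) (sm1 (b j)) (c1 (b j)).2 (sm2 (b l) (b l))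
    have q2 := II_ibp μ X 0 (b l) (sm2 (b l) (b j)) (c2 (b l) (b j)).2 (sm1 (b j))
    have q3 : dd (b j) (dd (b l) (dd (b l) w)) = dd (b l) (dd (b l) (dd (b j) w)) := by
      rw [dd_comm (sm1 (b l)), dd_comm (v := b j) (w := b l) hw]
    rw [hb, q3, II_symm μ X 2 (dd (b j) w)] at q1
    rw [hb] at q2
    rw [II_symm, dd_comm (v := b j) (w := b l) hw]
    norm_num at q1 q2
    linarith
  have p5 : ∀ j, II μ X 3 (dd v (dd v w)) (dd (b j) (dd (b j) w)) = _ := fun j =>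
    (II_symm μ X 3 _ _).trans (p2 j)
  have p6 : ∀ j, II μ X 2 (dd v w) (dd (b j) (dd (b j) w)) = _ := fun j =>
    (II_symm μ X 2 _ _).trans (p3 j)
  simp_rw [p5, p6, p2, p3, p4, p3', p1, p1']
  simp only [Finset.sum_add_distrib, ← Finset.mul_sum, mul_neg, neg_neg,
    Finset.sum_neg_distrib]
  ring
end
end HM

namespace HM
open MeasureTheory Filter Topology

section
variable {E : Type*} [NormedAddCommGroup E] [NormedSpace ℝ E] [FiniteDimensional ℝ E]
  [MeasurableSpace E] [BorelSpace E] (μ : Measure E) [μ.IsAddHaarMeasure]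
  {H : Type*} [NormedAddCommGroup H] [InnerProductSpace ℝ H]
variable (X : E →L[ℝ] ℝ)

/-- weighted norm -/
def NN (f : E → ℝ) : ℝ := Real.sqrt (∫ z, pp X 2 z * f z ^ 2 ∂μ)

lemma NN_nonneg (f : E → ℝ) : 0 ≤ NN μ X f := Real.sqrt_nonneg _

lemma NN_int_nonneg (f : E → ℝ) : 0 ≤ ∫ z, pp X 2 z * f z ^ 2 ∂μ :=
  integral_nonneg fun z => mul_nonneg (pp_nonneg X 2 z) (sq_nonneg _)

lemma NN_sq (f : E → ℝ) : NN μ X f ^ 2 = ∫ z, pp X 2 z * f z ^ 2 ∂μ :=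
  Real.sq_sqrt (NN_int_nonneg μ X f)

lemma NN_prod_integrable {f g : E → ℝ} (hf : Cc f) (hg : Continuous g) :
    Integrable (fun z => pp X 2 z * (f z * g z)) μ := by
  have := II_integrable μ X 2 hf hg
  simpa [mul_comm] using this

lemma NN_integrable {f : E → ℝ} (hf : Cc f) : Integrable (fun z => pp X 2 z * f z ^ 2) μ := by
  simpa [sq] using NN_prod_integrable μ X hf hf.1

lemma pp2_zero_of_nonpos {z : E} (h : X z ≤ 0) : pp X 2 z = 0 := by
  unfold pp; rw [max_eq_right h]; simp

lemma NN_mono {f g : E → ℝ} (hf : Cc f) (hg : Cc g) (h : ∀ z, 0 < X z → |f z| ≤ g z) :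
    NN μ X f ≤ NN μ X g := by
  unfold NN
  apply Real.sqrt_le_sqrt
  apply integral_mono (NN_integrable μ X hf) (NN_integrable μ X hg)
  intro z
  rcases le_or_gt (X z) 0 with h0 | h0
  · simp [pp2_zero_of_nonpos X h0]
  · have := h z h0
    have h2 : f z ^ 2 ≤ g z ^ 2 := by
      rw [← sq_abs (f z)]; gcongr
    exact mul_le_mul_of_nonneg_left h2 (pp_nonneg X 2 z)

lemma NN_cs {f g : E → ℝ} (hf : Cc f) (hg : Cc g) :
    ∫ z, pp X 2 z * (f z * g z) ∂μ ≤ NN μ X f * NN μ X g := by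
  have key : ∀ t : ℝ, 0 < t → 2 * ∫ z, pp X 2 z * (f z * g z) ∂μ
      ≤ t * NN μ X f ^ 2 + t⁻¹ * NN μ X g ^ 2 := by
    intro t ht
    rw [NN_sq, NN_sq, ← integral_const_mul, ← integral_const_mul, ← integral_const_mul,
      ← integral_add ((NN_integrable μ X hf).const_mul t) ((NN_integrable μ X hg).const_mul t⁻¹)]
    apply integral_mono ((NN_prod_integrable μ X hf hg.1).const_mul 2)
      (((NN_integrable μ X hf).const_mul t).add ((NN_integrable μ X hg).const_mul t⁻¹))
    intro z
    have h1 : 2 * (f z * g z) ≤ t * f z ^ 2 + t⁻¹ * g z ^ 2 := by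
      have : 0 ≤ t⁻¹ * (t * f z - g z)^2 := by positivity
      have e : t⁻¹ * (t * f z - g z)^2 = t * f z ^ 2 + t⁻¹ * g z ^ 2 - 2 * (f z * g z) := by
        field_simp; ring
      linarith
    have := mul_le_mul_of_nonneg_left h1 (pp_nonneg X 2 z)
    simp only [Pi.add_apply]
    nlinarith
  set a := NN μ X f
  set b := NN μ X g
  have ha : 0 ≤ a := NN_nonneg μ X f
  have hb : 0 ≤ b := NN_nonneg μ X g
  set c := ∫ z, pp X 2 z * (f z * g z) ∂μ
  apply le_of_forall_pos_le_add
  intro ε hε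
  -- choose t = (b+δ)/(a+δ)
  obtain ⟨δ, hδ, hδ2⟩ : ∃ δ : ℝ, 0 < δ ∧ δ * (a + b) + δ^2 ≤ ε := by
    refine ⟨min 1 (ε / (a + b + 1)), by positivity, ?_⟩
    have h1 : min 1 (ε / (a + b + 1)) ≤ 1 := min_le_left _ _
    have h2 : min 1 (ε / (a + b + 1)) ≤ ε / (a+b+1) := min_le_right _ _
    have h3 : 0 < min 1 (ε / (a + b + 1)) := by positivity
    rw [le_div_iff₀ (by positivity)] at h2
    nlinarith
  have := key ((b+δ)/(a+δ)) (by positivity)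
  have h1 : (b+δ)/(a+δ) * a^2 ≤ (b+δ)*(a+δ) := by
    rw [div_mul_eq_mul_div, div_le_iff₀ (by positivity)]
    have : a^2 ≤ (a+δ)^2 := by gcongr; linarith
    nlinarith
  have h2 : ((b+δ)/(a+δ))⁻¹ * b^2 ≤ (b+δ)*(a+δ) := by
    rw [inv_div, div_mul_eq_mul_div, div_le_iff₀ (by positivity)]
    have : b^2 ≤ (b+δ)^2 := by gcongr; linarith
    nlinarith
  nlinarith

lemma cc_add {F : Type*} [NormedAddCommGroup F] {f g : E → F} (hf : Cc f) (hg : Cc g) :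
    Cc (fun z => f z + g z) := ⟨hf.1.add hg.1, hf.2.add hg.2⟩

lemma cc_zero {F : Type*} [NormedAddCommGroup F] : Cc (fun _ : E => (0 : F)) :=
  ⟨continuous_const, HasCompactSupport.zero⟩

lemma cc_sum {F : Type*} [NormedAddCommGroup F] {ι : Type*} (s : Finset ι) {f : ι → E → F}
    (hf : ∀ i ∈ s, Cc (f i)) :
    Cc (fun z => ∑ i ∈ s, f i z) := by
  classical
  induction s using Finset.induction_on with
  | empty => simpa using cc_zero
  | insert a s ha ih =>
    simp_rw [Finset.sum_insert ha]
    exact cc_add (hf a (by simp)) (ih fun i hi => hf i (by simp [hi]))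

lemma cc_mul_left {f g : E → ℝ} (hf : Continuous f) (hg : Cc g) : Cc (fun z => f z * g z) :=
  ⟨hf.mul hg.1, hg.2.mul_left⟩

lemma cc_mul_right {f g : E → ℝ} (hf : Cc f) (hg : Continuous g) : Cc (fun z => f z * g z) :=
  ⟨hf.1.mul hg, hf.2.mul_right⟩

lemma cc_smul_right {F : Type*} [NormedAddCommGroup F] [NormedSpace ℝ F] {f : E → ℝ} {g : E → F}
    (hf : Cc f) (hg : Continuous g) : Cc (fun z => f z • g z) :=
  ⟨hf.1.smul hg, hf.2.smul_right⟩

lemma cc_norm {F : Type*} [NormedAddCommGroup F] {f : E → F} (hf : Cc f) :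
    Cc (fun z => ‖f z‖) := ⟨hf.1.norm, hf.2.norm⟩

lemma NN_add {f g : E → ℝ} (hf : Cc f) (hg : Cc g) :
    NN μ X (fun z => f z + g z) ≤ NN μ X f + NN μ X g := by
  have h := NN_cs μ X hf hg
  have h1 : NN μ X (fun z => f z + g z) ^ 2 ≤ (NN μ X f + NN μ X g)^2 := by
    have e : NN μ X (fun z => f z + g z) ^ 2
        = NN μ X f ^ 2 + 2 * (∫ z, pp X 2 z * (f z * g z) ∂μ) + NN μ X g ^ 2 := by
      rw [NN_sq, NN_sq, NN_sq, ← integral_const_mul]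
      rw [← integral_add (NN_integrable μ X hf) ((NN_prod_integrable μ X hf hg.1).const_mul 2)]
      rw [← integral_add _ (NN_integrable μ X hg)]
      · congr 1; funext z; ring
      · exact (NN_integrable μ X hf).add ((NN_prod_integrable μ X hf hg.1).const_mul 2)
    nlinarith
  exact (sq_le_sq₀ (NN_nonneg _ _ _) (add_nonneg (NN_nonneg _ _ _) (NN_nonneg _ _ _))).1 h1

lemma NN_const_mul (c : ℝ) (hc : 0 ≤ c) (f : E → ℝ) : NN μ X (fun z => c * f z) = c * NN μ X f := by
  unfold NN
  have : (fun z => pp X 2 z * (c * f z)^2) = fun z => c^2 * (pp X 2 z * f z ^ 2) := by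
    funext z; ring
  rw [this, integral_const_mul, Real.sqrt_mul (sq_nonneg c), Real.sqrt_sq hc]

lemma NN_zero : NN μ X (fun _ => 0) = 0 := by simp [NN]

lemma NN_sum {ι : Type*} (s : Finset ι) {f : ι → E → ℝ} (hf : ∀ i ∈ s, Cc (f i)) :
    NN μ X (fun z => ∑ i ∈ s, f i z) ≤ ∑ i ∈ s, NN μ X (f i) := by
  classical
  induction s using Finset.induction_on with
  | empty => simp [NN_zero]
  | insert a s ha ih =>
    simp_rw [Finset.sum_insert ha]
    have h1 : ∀ i ∈ s, Cc (f i) := fun i hi => hf i (by simp [hi])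
    exact (NN_add μ X (hf a (by simp)) (cc_sum s h1)).trans (by gcongr; exact ih h1)

/-- weighted norm of a vector function with cutoff -/
def Nw (φ : E → ℝ) (f : E → H) : ℝ := NN μ X (fun z => φ z * ‖f z‖)

lemma Nw_nonneg (φ : E → ℝ) (f : E → H) : 0 ≤ Nw μ X φ f := NN_nonneg _ _ _

lemma cc_w {φ : E → ℝ} {f : E → H} (hφ : Cc φ) (hf : Continuous f) : Cc (fun z => φ z * ‖f z‖) :=
  cc_mul_right hφ hf.norm

lemma II2_eq_NN {f : E → H} (_hf : Cc f) : II μ X 2 f f = NN μ X (fun z => ‖f z‖) ^ 2 := by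
  rw [NN_sq]; unfold II; simp_rw [real_inner_self_eq_norm_sq]

lemma II3_eq_NN {f : E → H} (_hf : Cc f) :
    II μ X 3 f f = NN μ X (fun z => Real.sqrt (max (X z) 0) * ‖f z‖) ^ 2 := by
  rw [NN_sq]; unfold II; simp_rw [real_inner_self_eq_norm_sq]
  congr 1; funext z
  rw [mul_pow, Real.sq_sqrt (le_max_right _ _)]
  unfold pp; ring

lemma II4_eq_NN {f : E → H} (_hf : Cc f) :
    II μ X 4 f f = NN μ X (fun z => max (X z) 0 * ‖f z‖) ^ 2 := by
  rw [NN_sq]; unfold II; simp_rw [real_inner_self_eq_norm_sq]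
  congr 1; funext z
  unfold pp; ring

/-- individual model estimates -/
lemma model_est {ι : Type*} [Fintype ι] (β : ℝ) (hβ : 6 ≤ β) (v : E) (b : ι → E) (hv : X v = 1)
    (hb : ∀ j, X (b j) = 0) {w : E → H} (hw : ContDiff ℝ ∞ w) (hwc : HasCompactSupport w) :
    NN μ X (fun z => max (X z) 0 * ‖dd v (dd v w) z‖) ≤ NN μ X (fun z => ‖MM X β v b w z‖) ∧
    β * NN μ X (fun z => ‖dd v w z‖) ≤ 2 * NN μ X (fun z => ‖MM X β v b w z‖) ∧
    (∀ j, NN μ X (fun z => Real.sqrt (max (X z) 0) * ‖dd v (dd (b j) w) z‖)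
        ≤ NN μ X (fun z => ‖MM X β v b w z‖)) ∧
    (∀ j l, NN μ X (fun z => ‖dd (b j) (dd (b l) w) z‖)
        ≤ NN μ X (fun z => ‖MM X β v b w z‖)) := by
  have id := model_identity μ X β v b hv hb hw hwc
  have sm1 : ∀ a, ContDiff ℝ ∞ (dd a w) := fun a => dd_smooth hw
  have sm2 : ∀ a a', ContDiff ℝ ∞ (dd a (dd a' w)) := fun a a' => dd_smooth (sm1 a')
  have c1 : ∀ a, Cc (dd a w) := fun a => ⟨(sm1 a).continuous, dd_cpt hwc⟩
  have c2 : ∀ a a', Cc (dd a (dd a' w)) := fun a a' => ⟨(sm2 a a').continuous, dd_cpt (dd_cpt hwc)⟩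
  have hM : II μ X 2 (MM X β v b w) (MM X β v b w) = NN μ X (fun z => ‖MM X β v b w z‖) ^ 2 := by
    rw [NN_sq]; unfold II; simp_rw [real_inner_self_eq_norm_sq]
  rw [hM] at id
  set S := NN μ X (fun z => ‖MM X β v b w z‖) with hS
  have hS0 : 0 ≤ S := NN_nonneg _ _ _
  have n1 := II_self_nonneg μ X 4 (dd v (dd v w))
  have n2 := II_self_nonneg μ X 2 (dd v w)
  have n3 : ∀ j, 0 ≤ II μ X 3 (dd v (dd (b j) w)) (dd v (dd (b j) w)) :=
    fun j => II_self_nonneg μ X 3 _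
  have n4 : ∀ j l, 0 ≤ II μ X 2 (dd (b j) (dd (b l) w)) (dd (b j) (dd (b l) w)) :=
    fun j l => II_self_nonneg μ X 2 _
  have n5 : ∀ j, 0 ≤ II μ X 1 (dd (b j) w) (dd (b j) w) := fun j => II_self_nonneg μ X 1 _
  have s3 := Finset.sum_nonneg (fun j (_ : j ∈ Finset.univ) => n3 j)
  have s4 := Finset.sum_nonneg (fun j (_ : j ∈ Finset.univ) =>
    Finset.sum_nonneg (fun l (_ : l ∈ Finset.univ) => n4 j l))
  have s5 := Finset.sum_nonneg (fun j (_ : j ∈ Finset.univ) => n5 j)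
  have s5' := mul_nonneg (by linarith : 0 ≤ 2*β-6) s5
  have hb2 : β^2/2 ≤ β^2 - 3*β := by nlinarith
  have s2' := mul_le_mul_of_nonneg_right hb2 n2
  have s2'' : 0 ≤ β^2/2 * II μ X 2 (dd v w) (dd v w) := by positivity
  refine ⟨?_, ?_, ?_, ?_⟩
  · rw [← sq_le_sq₀ (NN_nonneg _ _ _) hS0, ← II4_eq_NN μ X (c2 v v)]
    linarith
  · rw [← sq_le_sq₀ (mul_nonneg (by linarith) (NN_nonneg _ _ _)) (by positivity), mul_pow,
      ← II2_eq_NN μ X (c1 v)]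
    nlinarith
  · intro j
    rw [← sq_le_sq₀ (NN_nonneg _ _ _) hS0, ← II3_eq_NN μ X (c2 v (b j))]
    have := Finset.single_le_sum (fun j (_ : j ∈ Finset.univ) => n3 j) (Finset.mem_univ j)
    linarith
  · intro j l
    rw [← sq_le_sq₀ (NN_nonneg _ _ _) hS0, ← II2_eq_NN μ X (c2 (b j) (b l))]
    have h1 := Finset.single_le_sum (fun l (_ : l ∈ Finset.univ) => n4 j l) (Finset.mem_univ l)
    have h2 := Finset.single_le_sum (fun j (_ : j ∈ Finset.univ) =>
      Finset.sum_nonneg (fun l (_ : l ∈ Finset.univ) => n4 j l)) (Finset.mem_univ j)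
    linarith
end
end HM

namespace HM
open MeasureTheory Filter Topology

section
variable {E : Type*} [NormedAddCommGroup E] [NormedSpace ℝ E] [FiniteDimensional ℝ E]
  [MeasurableSpace E] [BorelSpace E] (μ : Measure E) [μ.IsAddHaarMeasure]
  {H : Type*} [NormedAddCommGroup H] [InnerProductSpace ℝ H]
variable (X : E →L[ℝ] ℝ)

lemma dd_pow {ζ : E → ℝ} (hζ : ContDiff ℝ ∞ ζ) (a : E) (q : ℕ) :
    dd a (fun z => ζ z ^ (q+1)) = fun z => (q+1 : ℕ) * (ζ z ^ q * dd a ζ z) := by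
  funext z
  unfold dd
  rw [fderiv_fun_pow _ (sm_diff hζ z)]
  simp; ring

/-- hypotheses on the cutoff -/
structure Cut (S : Set E) (c : ℝ) (ζ : E → ℝ) : Prop where
  sm : ContDiff ℝ ∞ ζ
  cpt : HasCompactSupport ζ
  nn : ∀ z, 0 ≤ ζ z
  le1 : ∀ z, ζ z ≤ 1
  c1 : 1 ≤ c
  X1 : ∀ z, ζ z ≠ 0 → X z ≤ 1
  d1 : ∀ a ∈ S, ∀ z, |dd a ζ z| ≤ c
  d2 : ∀ a ∈ S, ∀ a' ∈ S, ∀ z, |dd a (dd a' ζ) z| ≤ c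

variable {X} {S : Set E} {c : ℝ} {ζ : E → ℝ}

lemma Cut.cc (h : Cut X S c ζ) (q : ℕ) : Cc (fun z => ζ z ^ (q+1)) := by
  refine ⟨h.sm.continuous.pow _, ?_⟩
  refine h.cpt.mono' ?_
  intro z hz
  apply subset_tsupport
  intro h0
  apply hz
  simp [h0]

lemma cut_d1 (h : Cut X S c ζ) {U : E → H} (hU : ContDiff ℝ ∞ U) (q : ℕ) {a : E} (ha : a ∈ S)
    (z : E) : ‖dd a (fun z => ζ z ^ (q+1) • U z) z - ζ z ^ (q+1) • dd a U z‖
      ≤ (q+1 : ℕ) * c * ζ z ^ q * ‖U z‖ := by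
  rw [dd_smul (sm_diff (h.sm.pow _) z) (sm_diff hU z), add_sub_cancel_right, norm_smul, dd_pow h.sm]
  have h0 := h.nn z
  have := h.d1 a ha z
  rw [Real.norm_eq_abs, abs_mul, abs_mul, abs_of_nonneg (by positivity : 0 ≤ ζ z ^ q),
    abs_of_nonneg (by positivity : (0:ℝ) ≤ ((q+1 : ℕ) : ℝ))]
  gcongr ?_ * ‖U z‖
  calc _ ≤ ((q+1 : ℕ) : ℝ) * (ζ z ^ q * c) := by gcongr
    _ = _ := by ring

lemma cut_d2 (h : Cut X S c ζ) {U : E → H} (hU : ContDiff ℝ ∞ U) (q : ℕ) {a a' : E} (ha : a ∈ S)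
    (ha' : a' ∈ S) (z : E) :
    ‖dd a (dd a' (fun z => ζ z ^ (q+2) • U z)) z - ζ z ^ (q+2) • dd a (dd a' U) z‖
      ≤ (q+2 : ℕ) * c * ζ z ^ (q+1) * (‖dd a U z‖ + ‖dd a' U z‖)
        + 2 * c^2 * (q+2 : ℕ)^2 * ζ z ^ q * ‖U z‖ := by
  have hp : ∀ m : ℕ, ContDiff ℝ ∞ (fun z => ζ z ^ m) := fun m => h.sm.pow m
  have e1 : dd a' (fun z => ζ z ^ (q+2) • U z) =
      fun z => dd a' (fun z => ζ z ^ (q+2)) z • U z + ζ z ^ (q+2) • dd a' U z := by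
    funext z; exact dd_smul (sm_diff (hp _) z) (sm_diff hU z)
  rw [e1, dd_add (f := fun z => dd a' (fun z => ζ z ^ (q+2)) z • U z)
      (g := fun z => ζ z ^ (q+2) • dd a' U z) (sm_diff ((dd_smooth (hp _)).smul hU) z)
      (sm_diff ((hp _).smul (dd_smooth hU)) z),
    dd_smul (sm_diff (dd_smooth (hp _)) z) (sm_diff hU z),
    dd_smul (sm_diff (hp _) z) (sm_diff (dd_smooth hU) z)]
  have e2 : dd a (dd a' (fun z => ζ z ^ (q+2))) z = ((q+2 : ℕ) : ℝ) *
      (((q+1 : ℕ) : ℝ) * (ζ z ^ q * dd a ζ z) * dd a' ζ z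
        + ζ z ^ (q+1) * dd a (dd a' ζ) z) := by
    rw [dd_pow h.sm a' (q+1)]
    have s1 : ContDiff ℝ ∞ (fun z => ζ z ^ (q+1) * dd a' ζ z) := (hp _).mul (dd_smooth h.sm)
    rw [dd_mul (by fun_prop) (sm_diff s1 z), dd_mul (sm_diff (hp _) z)
      (sm_diff (dd_smooth h.sm) z), dd_pow h.sm]
    have : dd a (fun _ : E => ((q+1+1 : ℕ) : ℝ)) z = 0 := by simp [dd]
    rw [this]; push_cast; ring
  have z0 := h.nn z
  have z1 := h.le1 z
  have c1 := h.c1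
  have b1 : |dd a (fun z => ζ z ^ (q+2)) z| ≤ (q+2 : ℕ) * c * ζ z ^ (q+1) := by
    rw [dd_pow h.sm a (q+1), abs_mul, abs_mul, abs_of_nonneg (by positivity : 0 ≤ ζ z ^ (q+1)),
      abs_of_nonneg (by positivity : (0:ℝ) ≤ ((q+1+1 : ℕ) : ℝ))]
    calc _ ≤ ((q+1+1 : ℕ) : ℝ) * (ζ z ^ (q+1) * c) := by gcongr; exact h.d1 a ha z
      _ = _ := by ring
  have b1' : |dd a' (fun z => ζ z ^ (q+2)) z| ≤ (q+2 : ℕ) * c * ζ z ^ (q+1) := by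
    rw [dd_pow h.sm a' (q+1), abs_mul, abs_mul, abs_of_nonneg (by positivity : 0 ≤ ζ z ^ (q+1)),
      abs_of_nonneg (by positivity : (0:ℝ) ≤ ((q+1+1 : ℕ) : ℝ))]
    calc _ ≤ ((q+1+1 : ℕ) : ℝ) * (ζ z ^ (q+1) * c) := by gcongr; exact h.d1 a' ha' z
      _ = _ := by ring
  have b2 : |dd a (dd a' (fun z => ζ z ^ (q+2))) z| ≤ 2 * c^2 * (q+2 : ℕ)^2 * ζ z ^ q := by
    rw [e2, abs_mul, abs_of_nonneg (by positivity : (0:ℝ) ≤ ((q+2 : ℕ) : ℝ))]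
    have t1 : |((q+1 : ℕ) : ℝ) * (ζ z ^ q * dd a ζ z) * dd a' ζ z| ≤ (q+2 : ℕ) * ζ z ^ q * c^2 := by
      rw [abs_mul, abs_mul, abs_mul, abs_of_nonneg (by positivity : 0 ≤ ζ z ^ q),
        abs_of_nonneg (by positivity : (0:ℝ) ≤ ((q+1 : ℕ) : ℝ))]
      calc _ ≤ ((q+2 : ℕ) : ℝ) * (ζ z ^ q * c) * c := by
            gcongr
            · omega
            · exact h.d1 a ha z
            · exact h.d1 a' ha' z
        _ = _ := by ring
    have t2 : |ζ z ^ (q+1) * dd a (dd a' ζ) z| ≤ (q+2 : ℕ) * ζ z ^ q * c^2 := by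
      rw [abs_mul, abs_of_nonneg (by positivity : 0 ≤ ζ z ^ (q+1))]
      calc _ ≤ ζ z ^ q * c :=
            mul_le_mul (pow_le_pow_of_le_one z0 z1 (by omega)) (h.d2 a ha a' ha' z)
              (abs_nonneg _) (by positivity)
        _ ≤ 1 * ζ z ^ q * c^2 := by
            rw [one_mul]
            gcongr
            nlinarith
        _ ≤ _ := by
            gcongr
            push_cast; linarith [(Nat.cast_nonneg q : (0:ℝ) ≤ q)]
    calc _ ≤ ((q+2 : ℕ) : ℝ) * ((q+2 : ℕ) * ζ z ^ q * c^2 + (q+2 : ℕ) * ζ z ^ q * c^2) := by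
          gcongr
          exact (abs_add_le _ _).trans (add_le_add t1 t2)
      _ = _ := by ring
  have e3 : (dd a (dd a' fun z => ζ z ^ (q + 2)) z • U z + dd a' (fun z => ζ z ^ (q + 2)) z • dd a U z +
      (dd a (fun y => ζ y ^ (q + 2)) z • dd a' U z + ζ z ^ (q + 2) • dd a (dd a' U) z) -
      ζ z ^ (q + 2) • dd a (dd a' U) z) = dd a (dd a' fun z => ζ z ^ (q + 2)) z • U z +
      (dd a' (fun z => ζ z ^ (q + 2)) z • dd a U z + dd a (fun y => ζ y ^ (q + 2)) z • dd a' U z) := by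
    abel
  rw [e3]
  refine (norm_add_le _ _).trans ?_
  rw [add_comm]
  apply add_le_add
  · refine (norm_add_le _ _).trans ?_
    rw [norm_smul, norm_smul, Real.norm_eq_abs, Real.norm_eq_abs, mul_add]
    gcongr
  · rw [norm_smul, Real.norm_eq_abs]
    gcongr

section
variable {ι : Type*} [Fintype ι] (v : E) (b : ι → E)

/-- second order quantity -/
def TT (X : E →L[ℝ] ℝ) (k : ℝ) (q : ℕ) (ζ : E → ℝ) (U : E → H) : ℝ :=
  Nw μ X (fun z => ζ z ^ q * max (X z) 0) (dd v (dd v U)) + k * Nw μ X (fun z => ζ z ^ q) (dd v U)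
  + ∑ j, Nw μ X (fun z => ζ z ^ q * Real.sqrt (max (X z) 0)) (dd v (dd (b j) U))
  + ∑ j, ∑ l, Nw μ X (fun z => ζ z ^ q) (dd (b j) (dd (b l) U))

/-- first order quantity -/
def KK (X : E →L[ℝ] ℝ) (q : ℕ) (ζ : E → ℝ) (U : E → H) : ℝ :=
  Nw μ X (fun z => ζ z ^ q * Real.sqrt (max (X z) 0)) (dd v U)
  + ∑ j, Nw μ X (fun z => ζ z ^ q) (dd (b j) U)

/-- error function -/
def PP (X : E →L[ℝ] ℝ) (c : ℝ) (r : ℕ) (ζ : E → ℝ) (U : E → H) (z : E) : ℝ :=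
  2 * (r+3 : ℕ) * c * (ζ z ^ (r+2) * Real.sqrt (max (X z) 0) * ‖dd v U z‖
    + ∑ j, ζ z ^ (r+2) * ‖dd (b j) U z‖) + 2 * c^2 * (r+3 : ℕ)^2 * (ζ z ^ (r+1) * ‖U z‖)

variable {v b}

lemma sqrt_pos_cont : Continuous (fun z => Real.sqrt (max (X z) 0)) := by fun_prop

lemma PP_cc (h : Cut X S c ζ) {U : E → H} (hU : ContDiff ℝ ∞ U) (r : ℕ) :
    Cc (PP v b X c r ζ U) := by
  unfold PP
  refine cc_add (cc_mul_left continuous_const (cc_add ?_ (cc_sum _ fun j _ => ?_)))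
    (cc_mul_left continuous_const ?_)
  · exact cc_w (cc_mul_right (h.cc (r+1)) sqrt_pos_cont) (dd_smooth hU).continuous
  · exact cc_w (h.cc (r+1)) (dd_smooth hU).continuous
  · exact cc_w (h.cc r) hU.continuous

lemma PP_est (h : Cut X S c ζ) {U : E → H} (hU : ContDiff ℝ ∞ U) (r : ℕ) :
    NN μ X (PP v b X c r ζ U) ≤ 2 * (r+3 : ℕ) * c * KK μ v b X (r+2) ζ U
      + 2 * c^2 * (r+3 : ℕ)^2 * Nw μ X (fun z => ζ z ^ (r+1)) U := by
  have c0 : 0 ≤ c := by linarith [h.c1]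
  have i1 : Cc (fun z => ζ z ^ (r+2) * Real.sqrt (max (X z) 0) * ‖dd v U z‖) :=
    cc_w (cc_mul_right (h.cc (r+1)) sqrt_pos_cont) (dd_smooth hU).continuous
  have i2 : ∀ j ∈ Finset.univ, Cc (fun z => ζ z ^ (r+2) * ‖dd (b j) U z‖) := fun j _ =>
    cc_w (h.cc (r+1)) (dd_smooth hU).continuous
  have i3 : Cc (fun z => ζ z ^ (r+1) * ‖U z‖) := cc_w (h.cc r) hU.continuous
  unfold PP
  refine (NN_add μ X (cc_mul_left continuous_const (cc_add i1 (cc_sum _ i2)))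
    (cc_mul_left continuous_const i3)).trans ?_
  rw [NN_const_mul _ _ _ (by positivity), NN_const_mul _ _ _ (by positivity)]
  unfold KK Nw
  gcongr
  refine (NN_add μ X i1 (cc_sum _ i2)).trans ?_
  gcongr
  exact NN_sum μ X _ i2

lemma PP_pw (h : Cut X S c ζ) {U : E → H} (hU : ContDiff ℝ ∞ U) (r : ℕ) {a a' : E} (ha : a ∈ S)
    (ha' : a' ∈ S) (z : E) (wt : ℝ) (h0 : 0 ≤ wt) (h1 : ζ z ≠ 0 → wt ≤ 1)
    (hb : ζ z ≠ 0 → wt * ‖dd a U z‖ ≤ Real.sqrt (max (X z) 0) * ‖dd v U z‖ + ∑ j, ‖dd (b j) U z‖)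
    (hb' : ζ z ≠ 0 → wt * ‖dd a' U z‖ ≤ Real.sqrt (max (X z) 0) * ‖dd v U z‖ + ∑ j, ‖dd (b j) U z‖) :
    wt * ‖dd a (dd a' (fun z => ζ z ^ (r+3) • U z)) z - ζ z ^ (r+3) • dd a (dd a' U) z‖
      ≤ PP v b X c r ζ U z := by
  have key := cut_d2 h hU (r+1) ha ha' z
  have c0 : 0 ≤ c := by linarith [h.c1]
  have z0 := h.nn z
  by_cases hz : ζ z = 0
  · have e : ζ z ^ (r+1+1) = 0 := by rw [hz]; simp
    have e' : ζ z ^ (r+1) = 0 := by rw [hz]; simp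
    rw [e, e'] at key
    simp only [mul_zero, zero_mul, add_zero] at key
    have := norm_nonneg (dd a (dd a' (fun z => ζ z ^ (r+3) • U z)) z - ζ z ^ (r+3) • dd a (dd a' U) z)
    have e2 : ‖dd a (dd a' (fun z => ζ z ^ (r+3) • U z)) z - ζ z ^ (r+3) • dd a (dd a' U) z‖ = 0 :=
      le_antisymm key this
    rw [e2, mul_zero]
    unfold PP; positivity
  · have := mul_le_mul_of_nonneg_left key h0
    refine this.trans ?_
    have g1 := hb hz
    have g2 := hb' hz
    have g3 := h1 hz
    have e : PP v b X c r ζ U z = (r+1+2 : ℕ) * c * ζ z ^ (r+2) *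
        (2 * (Real.sqrt (max (X z) 0) * ‖dd v U z‖ + ∑ j, ‖dd (b j) U z‖)) +
        2 * c^2 * (r+1+2 : ℕ)^2 * ζ z ^ (r+1) * (1 * ‖U z‖) := by
      unfold PP
      rw [← Finset.mul_sum]; ring
    rw [e]
    calc _ = (r+1+2 : ℕ) * c * ζ z ^ (r+2) * (wt * ‖dd a U z‖ + wt * ‖dd a' U z‖)
        + 2 * c^2 * (r+1+2 : ℕ)^2 * ζ z ^ (r+1) * (wt * ‖U z‖) := by ring
      _ ≤ _ := by
        gcongr
        linarith

end
end
end HM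

namespace HM
open MeasureTheory Filter Topology

section
variable {E : Type*} [NormedAddCommGroup E] [NormedSpace ℝ E] [FiniteDimensional ℝ E]
  [MeasurableSpace E] [BorelSpace E] (μ : Measure E) [μ.IsAddHaarMeasure]
  {H : Type*} [NormedAddCommGroup H] [InnerProductSpace ℝ H]
variable {X : E →L[ℝ] ℝ} {S : Set E} {c : ℝ} {ζ : E → ℝ}
variable {ι : Type*} [Fintype ι] {v : E} {b : ι → E}

lemma MM_cont {k : ℝ} {U : E → H} (hU : ContDiff ℝ ∞ U) : Continuous (MM X k v b U) := by
  unfold MM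
  have := fun a a' => (dd_smooth (v := a) (dd_smooth (v := a') hU)).continuous
  exact ((X.continuous.smul (this v v)).add (continuous_const.smul (dd_smooth hU).continuous)).add
    (continuous_finsetSum _ fun j _ => this _ _)

lemma est_c1 (h : Cut X S c ζ) (hS : insert v (range b) ⊆ S) (hv : X v = 1) (hb : ∀ j, X (b j) = 0)
    {U : E → H} (hU : ContDiff ℝ ∞ U) (r : ℕ) (k : ℝ) (hk : 6 ≤ k) (hkr : k ≤ (r+3 : ℕ)) :
    TT μ v b X k (r+3) ζ U ≤ (3 + Fintype.card ι + Fintype.card ι ^ 2) *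
      (2 * Nw μ X (fun z => ζ z ^ (r+3)) (MM X k v b U) +
        (2 * Fintype.card ι + 5) * NN μ X (PP v b X c r ζ U)) := by
  classical
  set w : E → H := fun z => ζ z ^ (r+3) • U z with hwdef
  have hw : ContDiff ℝ ∞ w := (h.sm.pow _).smul hU
  have hwc : HasCompactSupport w := (cc_smul_right (h.cc (r+2)) hU.continuous).2
  have vS : v ∈ S := hS (by simp)
  have bS : ∀ j, b j ∈ S := fun j => hS (by simp)
  have c1 := h.c1
  have c0 : 0 ≤ c := by linarith
  set d : ℝ := (Fintype.card ι : ℝ) with hd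
  have d0 : 0 ≤ d := by positivity
  obtain ⟨m1, m2, m3, m4⟩ := model_est μ X k hk v b hv hb hw hwc
  set Mw := NN μ X (fun z => ‖MM X k v b w z‖) with hMw
  set P := NN μ X (PP v b X c r ζ U) with hP
  have P0 : 0 ≤ P := NN_nonneg _ _ _
  have Mw0 : 0 ≤ Mw := NN_nonneg _ _ _
  have hPc : Cc (PP v b X c r ζ U) := PP_cc h hU r
  have xpos : ∀ z, 0 < X z → max (X z) 0 = X z := fun z hz => max_eq_left hz.le
  -- pointwise bounds
  have sle : ∀ z, 0 < X z → ζ z ≠ 0 → Real.sqrt (max (X z) 0) ≤ 1 := by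
    intro z hz hzz
    rw [xpos z hz]; exact Real.sqrt_le_one.2 (h.X1 z hzz)
  have xle : ∀ z, 0 < X z → ζ z ≠ 0 → max (X z) 0 ≤ Real.sqrt (max (X z) 0) := by
    intro z hz hzz
    have h1 := sle z hz hzz
    have h2 := Real.mul_self_sqrt (le_max_right (X z) 0)
    nlinarith [Real.sqrt_nonneg (max (X z) 0)]
  have bsum : ∀ z j, ‖dd (b j) U z‖ ≤ ∑ j, ‖dd (b j) U z‖ := fun z j =>
    Finset.single_le_sum (f := fun j => ‖dd (b j) U z‖) (fun j _ => norm_nonneg _)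
      (Finset.mem_univ j)
  have sum0 : ∀ z, 0 ≤ ∑ j, ‖dd (b j) U z‖ := fun z => Finset.sum_nonneg fun j _ => norm_nonneg _
  have pvv : ∀ z, 0 < X z → max (X z) 0 * ‖dd v (dd v w) z - ζ z ^ (r+3) • dd v (dd v U) z‖
      ≤ PP v b X c r ζ U z := by
    intro z hz
    refine PP_pw h hU r vS vS z _ (le_max_right _ _) ?_ ?_ ?_
    · intro hzz; exact (xle z hz hzz).trans (sle z hz hzz)
    · intro hzz
      have := mul_le_mul_of_nonneg_right (xle z hz hzz) (norm_nonneg (dd v U z))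
      linarith [sum0 z]
    · intro hzz
      have := mul_le_mul_of_nonneg_right (xle z hz hzz) (norm_nonneg (dd v U z))
      linarith [sum0 z]
  have pvj : ∀ j z, 0 < X z → Real.sqrt (max (X z) 0) *
      ‖dd v (dd (b j) w) z - ζ z ^ (r+3) • dd v (dd (b j) U) z‖ ≤ PP v b X c r ζ U z := by
    intro j z hz
    refine PP_pw h hU r vS (bS j) z _ (Real.sqrt_nonneg _) (sle z hz) ?_ ?_
    · intro hzz
      linarith [sum0 z]
    · intro hzz
      have := mul_le_mul_of_nonneg_right (sle z hz hzz) (norm_nonneg (dd (b j) U z))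
      have h2 : 0 ≤ Real.sqrt (max (X z) 0) * ‖dd v U z‖ := by positivity
      linarith [bsum z j]
  have pjl : ∀ j l z,
      ‖dd (b j) (dd (b l) w) z - ζ z ^ (r+3) • dd (b j) (dd (b l) U) z‖ ≤ PP v b X c r ζ U z := by
    intro j l z
    have h2 : 0 ≤ Real.sqrt (max (X z) 0) * ‖dd v U z‖ := by positivity
    have := PP_pw (v := v) (b := b) h hU r (bS j) (bS l) z 1 zero_le_one (fun _ => le_rfl) ?_ ?_
    · simpa using this
    · intro hzz
      rw [one_mul]; linarith [bsum z j]
    · intro hzz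
      rw [one_mul]; linarith [bsum z l]
  have pv : ∀ z, k * ‖dd v w z - ζ z ^ (r+3) • dd v U z‖ ≤ PP v b X c r ζ U z := by
    intro z
    have key := cut_d1 h hU (r+2) vS z
    have z0 := h.nn z
    have := mul_le_mul_of_nonneg_left key (by linarith : 0 ≤ k)
    refine this.trans ?_
    have e : 2 * c^2 * (r+3 : ℕ)^2 * (ζ z ^ (r+1) * ‖U z‖) ≤ PP v b X c r ζ U z := by
      unfold PP
      have : 0 ≤ 2 * (r+3 : ℕ) * c * (ζ z ^ (r+2) * Real.sqrt (max (X z) 0) * ‖dd v U z‖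
          + ∑ j, ζ z ^ (r+2) * ‖dd (b j) U z‖) := by positivity
      linarith
    refine le_trans ?_ e
    calc k * (((r+2+1 : ℕ) : ℝ) * c * ζ z ^ (r+2) * ‖U z‖)
        ≤ (r+3 : ℕ) * (((r+3 : ℕ) : ℝ) * (2 * c^2) * ζ z ^ (r+1) * ‖U z‖) := by
          have hz1 : ζ z ^ (r+2) ≤ ζ z ^ (r+1) := pow_le_pow_of_le_one z0 (h.le1 z) (by omega)
          have hcc : c ≤ 2 * c^2 := by nlinarith
          gcongr
      _ = _ := by ring
  have pM : ∀ z, 0 < X z → ‖MM X k v b w z‖ ≤ ζ z ^ (r+3) * ‖MM X k v b U z‖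
      + (d + 2) * PP v b X c r ζ U z := by
    intro z hz
    have e : MM X k v b w z = ζ z ^ (r+3) • MM X k v b U z +
        (X z • (dd v (dd v w) z - ζ z ^ (r+3) • dd v (dd v U) z)
        + k • (dd v w z - ζ z ^ (r+3) • dd v U z)
        + ∑ j, (dd (b j) (dd (b j) w) z - ζ z ^ (r+3) • dd (b j) (dd (b j) U) z)) := by
      unfold MM
      rw [Finset.sum_sub_distrib, ← Finset.smul_sum]
      simp only [smul_add, smul_sub, smul_smul]
      rw [mul_comm (ζ z ^ (r+3)) (X z), mul_comm (ζ z ^ (r+3)) k]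
      abel
    rw [e]
    refine (norm_add_le _ _).trans ?_
    rw [norm_smul, Real.norm_eq_abs, abs_of_nonneg (by have := h.nn z; positivity)]
    gcongr
    refine (norm_add₃_le).trans ?_
    rw [norm_smul, norm_smul, Real.norm_eq_abs, Real.norm_eq_abs, abs_of_pos hz,
      abs_of_nonneg (by linarith : 0 ≤ k)]
    have q1 := pvv z hz
    rw [xpos z hz] at q1
    have q2 := pv z
    have q3 : ‖∑ j, (dd (b j) (dd (b j) w) z - ζ z ^ (r+3) • dd (b j) (dd (b j) U) z)‖
        ≤ d * PP v b X c r ζ U z := by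
      refine (norm_sum_le _ _).trans ?_
      refine (Finset.sum_le_sum fun j _ => pjl j j z).trans ?_
      simp [hd]
    linarith
  have hMU : Cc (fun z => ζ z ^ (r+3) * ‖MM X k v b U z‖) := cc_w (h.cc (r+2)) (MM_cont hU)
  have wc2 : ∀ a a', Cc (dd a (dd a' w)) := fun a a' =>
    ⟨(dd_smooth (dd_smooth hw)).continuous, dd_cpt (dd_cpt hwc)⟩
  have wc1 : ∀ a, Cc (dd a w) := fun a => ⟨(dd_smooth hw).continuous, dd_cpt hwc⟩
  have hMwc : Cc (MM X k v b w) := by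
    unfold MM
    refine cc_add (cc_add ⟨X.continuous.smul (wc2 v v).1, (wc2 v v).2.smul_left⟩ ?_)
      (cc_sum _ fun j _ => wc2 _ _)
    exact ⟨continuous_const.smul (wc1 v).1, (wc1 v).2.smul_left (f := fun _ => k)⟩
  have bM : Mw ≤ Nw μ X (fun z => ζ z ^ (r+3)) (MM X k v b U) + (d+2) * P := by
    have := NN_mono μ X (cc_norm hMwc) (cc_add hMU (cc_mul_left (continuous_const (y := d+2)) hPc))
      (fun z hz => by rw [abs_norm]; exact pM z hz)
    refine this.trans ?_
    refine (NN_add μ X hMU (cc_mul_left continuous_const hPc)).trans ?_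
    rw [NN_const_mul _ _ _ (by positivity)]
    rfl
  -- generic transfer
  have gen : ∀ (wt : E → ℝ) (f g : E → H), Continuous wt → (∀ z, 0 ≤ wt z) → Cc f → Continuous g →
      (∀ z, 0 < X z → wt z * ‖f z - ζ z ^ (r+3) • g z‖ ≤ PP v b X c r ζ U z) →
      Nw μ X (fun z => ζ z ^ (r+3) * wt z) g ≤ NN μ X (fun z => wt z * ‖f z‖) + P := by
    intro wt f g hwt hwt0 hf hg hle
    refine le_trans ?_ (NN_add μ X (cc_mul_left hwt (cc_norm hf)) hPc)
    refine NN_mono μ X (cc_w (cc_mul_right (h.cc (r+2)) hwt) hg)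
      (cc_add (cc_mul_left hwt (cc_norm hf)) hPc) ?_
    intro z hz
    have z0 := h.nn z
    have w0 := hwt0 z
    rw [abs_of_nonneg (by positivity)]
    have h1 : ‖ζ z ^ (r+3) • g z‖ ≤ ‖f z‖ + ‖f z - ζ z ^ (r+3) • g z‖ := by
      have := norm_sub_le (f z) (f z - ζ z ^ (r+3) • g z)
      simpa using this
    rw [norm_smul, Real.norm_eq_abs, abs_of_nonneg (by positivity)] at h1
    have h2 := mul_le_mul_of_nonneg_left h1 w0
    have h3 := hle z hz
    nlinarith
  have Uc2 : ∀ a a', Continuous (dd a (dd a' U)) := fun a a' => (dd_smooth (dd_smooth hU)).continuous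
  have t1 := gen (fun z => max (X z) 0) (dd v (dd v w)) (dd v (dd v U)) (by fun_prop)
    (fun z => le_max_right _ _) (wc2 v v) (Uc2 v v) pvv
  have t2 := gen (fun z => k) (dd v w) (dd v U) (by fun_prop)
    (fun z => by linarith) (wc1 v) (dd_smooth hU).continuous (fun z _ => pv z)
  have t3 := fun j => gen (fun z => Real.sqrt (max (X z) 0)) (dd v (dd (b j) w)) (dd v (dd (b j) U))
    (by fun_prop) (fun z => Real.sqrt_nonneg _) (wc2 v _) (Uc2 v _) (pvj j)
  have t4 := fun j l => gen (fun z => 1) (dd (b j) (dd (b l) w)) (dd (b j) (dd (b l) U))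
    (by fun_prop) (fun z => zero_le_one) (wc2 _ _) (Uc2 _ _) (fun z _ => by simpa using pjl j l z)
  have e2 : Nw μ X (fun z => ζ z ^ (r+3) * k) (dd v U) = k * Nw μ X (fun z => ζ z ^ (r+3)) (dd v U) := by
    unfold Nw
    rw [← NN_const_mul _ _ _ (by linarith)]
    congr 1; funext z; ring
  have k0 : 0 ≤ k := by linarith
  rw [e2, NN_const_mul _ _ _ k0] at t2
  simp only [mul_one, one_mul] at t4
  unfold TT
  have b1 := t1.trans (add_le_add_left m1 P)
  have b2 := t2.trans (add_le_add_left m2 P)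
  have b3 : ∑ j, Nw μ X (fun z => ζ z ^ (r+3) * Real.sqrt (max (X z) 0)) (dd v (dd (b j) U))
      ≤ d * (Mw + P) := by
    refine (Finset.sum_le_sum fun j _ => (t3 j).trans (add_le_add_left (m3 j) P)).trans ?_
    simp [hd, mul_add]
  have b4 : ∑ j, ∑ l, Nw μ X (fun z => ζ z ^ (r+3)) (dd (b j) (dd (b l) U))
      ≤ d * (d * (Mw + P)) := by
    refine (Finset.sum_le_sum fun j _ => Finset.sum_le_sum fun l _ =>
      (t4 j l).trans (add_le_add_left (m4 j l) P)).trans ?_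
    simp [hd, mul_add]
  set Q := Nw μ X (fun z => ζ z ^ (r+3)) (MM X k v b U)
  have Q0 : 0 ≤ Q := Nw_nonneg _ _ _ _
  have : (3 + d + d^2) * (Mw + P) ≤ (3+d+d^2) * (2 * Q + (2*d+5) * P) := by
    refine mul_le_mul_of_nonneg_left ?_ (by positivity)
    nlinarith
  nlinarith

lemma II_cs_bound {φ₁ φ₂ : E → ℝ} {f g : E → H} (hf : Cc (fun z => φ₁ z * ‖f z‖))
    (hg : Cc (fun z => φ₂ z * ‖g z‖)) {F : E → ℝ} (hF : Integrable (fun z => pp X 2 z * F z) μ)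
    (hle : ∀ z, 0 < X z → F z ≤ (φ₁ z * ‖f z‖) * (φ₂ z * ‖g z‖)) :
    ∫ z, pp X 2 z * F z ∂μ ≤ Nw μ X φ₁ f * Nw μ X φ₂ g := by
  refine le_trans ?_ (NN_cs μ X hf hg)
  apply integral_mono hF (NN_prod_integrable μ X hf hg.1)
  intro z
  rcases le_or_gt (X z) 0 with h0 | h0
  · simp [pp2_zero_of_nonpos X h0]
  · exact mul_le_mul_of_nonneg_left (hle z h0) (pp_nonneg X 2 z)

/-- Caccioppoli type estimate -/
lemma est_c2 (h : Cut X S c ζ) (hS : insert v (range b) ⊆ S) (hv : X v = 1) (hb : ∀ j, X (b j) = 0)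
    {U : E → H} (hU : ContDiff ℝ ∞ U) (r : ℕ) (k : ℝ) (hk : 6 ≤ k) :
    KK μ v b X (r+2) ζ U ^ 2 ≤ (1 + Fintype.card ι) *
      (Nw μ X (fun z => ζ z ^ (r+1)) U * (TT μ v b X k (r+3) ζ U
        + 2 * (r+3 : ℕ) * c * KK μ v b X (r+2) ζ U)) := by
  classical
  have vS : v ∈ S := hS (by simp)
  have bS : ∀ j, b j ∈ S := fun j => hS (by simp)
  have c1 := h.c1
  have c0 : 0 ≤ c := by linarith
  set d : ℝ := (Fintype.card ι : ℝ) with hd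
  set φ : E → ℝ := fun z => ζ z ^ (2*r+4) with hφ
  have φs : ContDiff ℝ ∞ φ := h.sm.pow _
  have φc : Cc φ := h.cc (2*r+3)
  have U1 : ∀ a, ContDiff ℝ ∞ (dd a U) := fun a => dd_smooth hU
  have U2 : ∀ a a', ContDiff ℝ ∞ (dd a (dd a' U)) := fun a a' => dd_smooth (U1 a')
  have φU : ∀ a, ContDiff ℝ ∞ (fun z => φ z • dd a U z) := fun a => φs.smul (U1 a)
  have φUc : ∀ a, HasCompactSupport (fun z => φ z • dd a U z) := fun a =>
    (cc_smul_right φc (U1 a).continuous).2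
  -- derivative of φ
  have dφ : ∀ a ∈ S, ∀ z, |dd a φ z| ≤ 2 * (r+3 : ℕ) * c * (ζ z ^ (r+2) * ζ z ^ (r+1)) := by
    intro a ha z
    rw [hφ, dd_pow h.sm a (2*r+3), abs_mul, abs_mul]
    have z0 := h.nn z
    rw [abs_of_nonneg (by positivity : 0 ≤ ζ z ^ (2*r+3)),
      abs_of_nonneg (by positivity : (0:ℝ) ≤ ((2*r+3+1 : ℕ) : ℝ))]
    calc _ ≤ (2 * (r+3 : ℕ) : ℝ) * (ζ z ^ (2*r+3) * c) := by
          gcongr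
          · push_cast; linarith
          · exact h.d1 a ha z
      _ = _ := by ring
  -- IBP
  have dφU : ∀ a, dd a (fun z => φ z • dd a U z) = fun z => dd a φ z • dd a U z + φ z • dd a (dd a U) z :=
    fun a => funext fun z => dd_smul (sm_diff φs z) (sm_diff (U1 a) z)
  have dφc : ∀ a, Cc (dd a φ) := fun a => ⟨(dd_smooth φs).continuous, dd_cpt φc.2⟩
  set n0 := Nw μ X (fun z => ζ z ^ (r+1)) U with hn0
  have n00 : 0 ≤ n0 := Nw_nonneg _ _ _ _
  set Kv := Nw μ X (fun z => ζ z ^ (r+2) * Real.sqrt (max (X z) 0)) (dd v U) with hKv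
  set Kj := fun j => Nw μ X (fun z => ζ z ^ (r+2)) (dd (b j) U) with hKj
  have iZ : Cc (fun z => ζ z ^ (r+1) * ‖U z‖) := cc_w (h.cc r) hU.continuous
  have ev : Kv ^ 2 ≤ n0 * (Nw μ X (fun z => ζ z ^ (r+3) * max (X z) 0) (dd v (dd v U))
      + 3 * Nw μ X (fun z => ζ z ^ (r+3)) (dd v U) + 2 * (r+3 : ℕ) * c * Kv) := by
    have e0 : Kv^2 = II μ X 3 (fun z => φ z • dd v U z) (dd v U) := by
      rw [hKv]; unfold Nw; rw [NN_sq]; unfold II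
      congr 1; funext z
      rw [real_inner_smul_left, real_inner_self_eq_norm_sq, mul_pow, mul_pow,
        Real.sq_sqrt (le_max_right _ _), hφ]
      unfold pp; ring
    have e1 := II_ibp μ X 1 v (φU v) (φUc v) hU
    rw [hv, dφU, II_add_left μ X 3 (cc_smul_right (dφc v) (U1 v).continuous)
      (cc_smul_right φc (U2 v v).continuous) hU.continuous] at e1
    have f1 : -II μ X 3 (fun z => φ z • dd v (dd v U) z) U
        ≤ Nw μ X (fun z => ζ z ^ (r+3) * max (X z) 0) (dd v (dd v U)) * n0 := by
      have : -II μ X 3 (fun z => φ z • dd v (dd v U) z) U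
          = ∫ z, pp X 2 z * (max (X z) 0 * (inner ℝ (-φ z • dd v (dd v U) z) (U z))) ∂μ := by
        unfold II; rw [← integral_neg]; congr 1; funext z
        rw [real_inner_smul_left, real_inner_smul_left]; unfold pp; ring
      rw [this]
      apply II_cs_bound μ (cc_w (cc_mul_right (h.cc (r+2)) (by fun_prop)) (U2 v v).continuous) iZ
      · have := II_integrable μ X 3 (cc_smul_right (f := fun z => - φ z) ⟨φc.1.neg, φc.2.neg⟩
          (U2 v v).continuous) hU.continuous
        refine this.congr (Eventually.of_forall fun z => ?_)
        simp only; unfold pp; ring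
      · intro z hz
        have z0 := h.nn z
        have := real_inner_le_norm (-φ z • dd v (dd v U) z) (U z)
        rw [norm_smul, norm_neg, Real.norm_eq_abs, abs_of_nonneg (by rw [hφ]; positivity)] at this
        calc _ ≤ max (X z) 0 * (φ z * ‖dd v (dd v U) z‖ * ‖U z‖) := by
              gcongr
          _ = _ := by rw [hφ]; ring
    have f2 : -II μ X 2 (fun z => φ z • dd v U z) U
        ≤ Nw μ X (fun z => ζ z ^ (r+3)) (dd v U) * n0 := by
      have : -II μ X 2 (fun z => φ z • dd v U z) U
          = ∫ z, pp X 2 z * (inner ℝ (-φ z • dd v U z) (U z)) ∂μ := by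
        unfold II; rw [← integral_neg]; congr 1; funext z
        rw [real_inner_smul_left, real_inner_smul_left]; ring
      rw [this]
      apply II_cs_bound μ (cc_w (h.cc (r+2)) (U1 v).continuous) iZ
      · exact II_integrable μ X 2 (cc_smul_right (f := fun z => - φ z) ⟨φc.1.neg, φc.2.neg⟩
          (U1 v).continuous) hU.continuous
      · intro z hz
        have z0 := h.nn z
        have := real_inner_le_norm (-φ z • dd v U z) (U z)
        rw [norm_smul, norm_neg, Real.norm_eq_abs, abs_of_nonneg (by rw [hφ]; positivity)] at this
        calc _ ≤ (φ z * ‖dd v U z‖ * ‖U z‖) := this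
          _ = _ := by rw [hφ]; ring
    have f3 : -II μ X 3 (fun z => dd v φ z • dd v U z) U ≤ 2 * (r+3 : ℕ) * c * Kv * n0 := by
      have : -II μ X 3 (fun z => dd v φ z • dd v U z) U
          = ∫ z, pp X 2 z * (max (X z) 0 * (inner ℝ (-dd v φ z • dd v U z) (U z))) ∂μ := by
        unfold II; rw [← integral_neg]; congr 1; funext z
        rw [real_inner_smul_left, real_inner_smul_left]; unfold pp; ring
      rw [this]
      have e5 : 2 * (r+3 : ℕ) * c * Kv = Nw μ X (fun z => 2 * (r+3 : ℕ) * c *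
          (ζ z ^ (r+2) * Real.sqrt (max (X z) 0))) (dd v U) := by
        rw [hKv]; unfold Nw; rw [← NN_const_mul _ _ _ (by positivity)]
        congr 1; funext z; ring
      rw [e5]
      apply II_cs_bound μ (cc_w (cc_mul_left continuous_const
        (cc_mul_right (h.cc (r+1)) sqrt_pos_cont)) (U1 v).continuous) iZ
      · have := II_integrable μ X 3 (cc_smul_right (f := fun z => - dd v φ z)
          ⟨(dφc v).1.neg, (dφc v).2.neg⟩ (U1 v).continuous) hU.continuous
        refine this.congr (Eventually.of_forall fun z => ?_)
        simp only; unfold pp; ring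
      · intro z hz
        have z0 := h.nn z
        have := real_inner_le_norm (-dd v φ z • dd v U z) (U z)
        rw [norm_smul, norm_neg, Real.norm_eq_abs] at this
        have d3 := dφ v vS z
        rcases eq_or_ne (ζ z) 0 with hz0 | hz0
        · have : dd v φ z = 0 := by
            rw [hz0] at d3; simp at d3; exact d3
          rw [this, hz0]; simp
        · have hs : max (X z) 0 ≤ Real.sqrt (max (X z) 0) := by
            have h1 : Real.sqrt (max (X z) 0) ≤ 1 := by
              rw [max_eq_left hz.le]; exact Real.sqrt_le_one.2 (h.X1 z hz0)
            have h2 := Real.mul_self_sqrt (le_max_right (X z) 0)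
            nlinarith [Real.sqrt_nonneg (max (X z) 0)]
          calc _ ≤ max (X z) 0 * (|dd v φ z| * ‖dd v U z‖ * ‖U z‖) := by gcongr
            _ ≤ Real.sqrt (max (X z) 0) * (2 * (r+3 : ℕ) * c * (ζ z ^ (r+2) * ζ z ^ (r+1))
                * ‖dd v U z‖ * ‖U z‖) := by gcongr
            _ = _ := by ring
    rw [e0]
    norm_num at e1 f1 f2 f3 ⊢
    linarith
  have ej : ∀ j, Kj j ^ 2 ≤ n0 * (Nw μ X (fun z => ζ z ^ (r+3)) (dd (b j) (dd (b j) U))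
      + 2 * (r+3 : ℕ) * c * Kj j) := by
    intro j
    have e0 : Kj j^2 = II μ X 2 (fun z => φ z • dd (b j) U z) (dd (b j) U) := by
      rw [hKj]; simp only; unfold Nw; rw [NN_sq]; unfold II
      congr 1; funext z
      rw [real_inner_smul_left, real_inner_self_eq_norm_sq, mul_pow, hφ]
      ring
    have e1 := II_ibp μ X 0 (b j) (φU (b j)) (φUc (b j)) hU
    rw [hb, dφU, II_add_left μ X 2 (cc_smul_right (dφc (b j)) (U1 (b j)).continuous)
      (cc_smul_right φc (U2 (b j) (b j)).continuous) hU.continuous] at e1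
    have f1 : -II μ X 2 (fun z => φ z • dd (b j) (dd (b j) U) z) U
        ≤ Nw μ X (fun z => ζ z ^ (r+3)) (dd (b j) (dd (b j) U)) * n0 := by
      have : -II μ X 2 (fun z => φ z • dd (b j) (dd (b j) U) z) U
          = ∫ z, pp X 2 z * (inner ℝ (-φ z • dd (b j) (dd (b j) U) z) (U z)) ∂μ := by
        unfold II; rw [← integral_neg]; congr 1; funext z
        rw [real_inner_smul_left, real_inner_smul_left]; ring
      rw [this]
      apply II_cs_bound μ (cc_w (h.cc (r+2)) (U2 _ _).continuous) iZ
      · exact II_integrable μ X 2 (cc_smul_right (f := fun z => - φ z) ⟨φc.1.neg, φc.2.neg⟩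
          (U2 _ _).continuous) hU.continuous
      · intro z hz
        have z0 := h.nn z
        have := real_inner_le_norm (-φ z • dd (b j) (dd (b j) U) z) (U z)
        rw [norm_smul, norm_neg, Real.norm_eq_abs, abs_of_nonneg (by rw [hφ]; positivity)] at this
        calc _ ≤ (φ z * ‖dd (b j) (dd (b j) U) z‖ * ‖U z‖) := this
          _ = _ := by rw [hφ]; ring
    have f3 : -II μ X 2 (fun z => dd (b j) φ z • dd (b j) U z) U ≤ 2 * (r+3 : ℕ) * c * Kj j * n0 := by
      have : -II μ X 2 (fun z => dd (b j) φ z • dd (b j) U z) U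
          = ∫ z, pp X 2 z * (inner ℝ (-dd (b j) φ z • dd (b j) U z) (U z)) ∂μ := by
        unfold II; rw [← integral_neg]; congr 1; funext z
        rw [real_inner_smul_left, real_inner_smul_left]; ring
      rw [this]
      have e5 : 2 * (r+3 : ℕ) * c * Kj j = Nw μ X (fun z => 2 * (r+3 : ℕ) * c *
          (ζ z ^ (r+2))) (dd (b j) U) := by
        rw [hKj]; simp only; unfold Nw; rw [← NN_const_mul _ _ _ (by positivity)]
        congr 1; funext z; ring
      rw [e5]
      apply II_cs_bound μ (cc_w (cc_mul_left continuous_const (h.cc (r+1))) (U1 _).continuous) iZ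
      · exact II_integrable μ X 2 (cc_smul_right (f := fun z => - dd (b j) φ z)
          ⟨(dφc _).1.neg, (dφc _).2.neg⟩ (U1 _).continuous) hU.continuous
      · intro z hz
        have z0 := h.nn z
        have := real_inner_le_norm (-dd (b j) φ z • dd (b j) U z) (U z)
        rw [norm_smul, norm_neg, Real.norm_eq_abs] at this
        have d3 := dφ (b j) (bS j) z
        calc _ ≤ (|dd (b j) φ z| * ‖dd (b j) U z‖ * ‖U z‖) := this
            _ ≤ (2 * (r+3 : ℕ) * c * (ζ z ^ (r+2) * ζ z ^ (r+1))
                * ‖dd (b j) U z‖ * ‖U z‖) := by gcongr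
            _ = _ := by ring
    rw [e0]
    norm_num at e1 f1 f3 ⊢
    linarith
  -- sum up
  have ksum : KK μ v b X (r+2) ζ U = Kv + ∑ j, Kj j := rfl
  have csq : (Kv + ∑ j, Kj j)^2 ≤ (1 + d) * (Kv^2 + ∑ j, Kj j ^ 2) := by
    have h1 : (∑ j, Kj j)^2 ≤ d * ∑ j, Kj j ^ 2 := by
      have := sq_sum_le_card_mul_sum_sq (s := (Finset.univ : Finset ι)) (f := Kj)
      simpa [hd] using this
    rcases isEmpty_or_nonempty ι with hι | hι
    · simp [hd]
    · have dpos : 0 < d := by rw [hd]; exact_mod_cast Fintype.card_pos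
      set T := ∑ j, Kj j ^ 2
      set Q := ∑ j, Kj j
      have : 0 ≤ (d * Kv - Q)^2 := sq_nonneg _
      have h2 : d * (Kv + Q)^2 ≤ d * ((1 + d) * (Kv^2 + T)) := by nlinarith
      exact le_of_mul_le_mul_left h2 dpos
  rw [ksum]
  refine csq.trans ?_
  gcongr
  have s2 : ∑ j, Kj j ^ 2 ≤ n0 * (∑ j, Nw μ X (fun z => ζ z ^ (r+3)) (dd (b j) (dd (b j) U))
      + 2 * (r+3 : ℕ) * c * ∑ j, Kj j) := by
    refine (Finset.sum_le_sum fun j _ => ej j).trans ?_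
    rw [← Finset.mul_sum, Finset.sum_add_distrib, ← Finset.mul_sum]
  refine (add_le_add ev s2).trans ?_
  rw [← mul_add]
  refine mul_le_mul_of_nonneg_left ?_ n00
  unfold TT
  have t3 : 0 ≤ ∑ j, Nw μ X (fun z => ζ z ^ (r+3) * Real.sqrt (max (X z) 0)) (dd v (dd (b j) U)) :=
    Finset.sum_nonneg fun j _ => Nw_nonneg _ _ _ _
  have t4 : ∑ j, Nw μ X (fun z => ζ z ^ (r+3)) (dd (b j) (dd (b j) U))
      ≤ ∑ j, ∑ l, Nw μ X (fun z => ζ z ^ (r+3)) (dd (b j) (dd (b l) U)) :=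
    Finset.sum_le_sum fun j _ => Finset.single_le_sum
      (f := fun l => Nw μ X (fun z => ζ z ^ (r+3)) (dd (b j) (dd (b l) U)))
      (fun l _ => Nw_nonneg _ _ _ _) (Finset.mem_univ j)
  have t2 := Nw_nonneg μ X (fun z => ζ z ^ (r+3)) (dd v U)
  have t5 : 3 * Nw μ X (fun z => ζ z ^ (r+3)) (dd v U) ≤ k * Nw μ X (fun z => ζ z ^ (r+3)) (dd v U) :=
    mul_le_mul_of_nonneg_right (by linarith) t2
  nlinarith
end
end HM

namespace HM
open MeasureTheory Filter Topology

section
variable {E : Type*} [NormedAddCommGroup E] [NormedSpace ℝ E] [FiniteDimensional ℝ E]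
  [MeasurableSpace E] [BorelSpace E] (μ : Measure E) [μ.IsAddHaarMeasure]
  {H : Type*} [NormedAddCommGroup H] [InnerProductSpace ℝ H]
variable {X : E →L[ℝ] ℝ} {S : Set E} {c : ℝ} {ζ : E → ℝ}
variable {ι : Type*} [Fintype ι] {v : E} {b : ι → E}

lemma quad_abs {Y T m D c ε : ℝ} (hY : 0 ≤ Y) (hT : 0 ≤ T) (hm : 0 ≤ m) (hD : 0 ≤ D) (hc : 0 ≤ c)
    (hε : 0 < ε) (h : Y^2 ≤ D * (m * T + 2 * c * m * Y)) :
    Y ≤ ε * T + (D / ε + 2 * c * D) * m := by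
  by_contra hcon
  push Not at hcon
  have h1 : D / ε * m ≤ Y := by
    have : 0 ≤ ε * T := by positivity
    have : 0 ≤ 2 * c * D * m := by positivity
    nlinarith
  have h2 : D * m ≤ ε * Y := by
    rw [div_mul_eq_mul_div, div_le_iff₀ hε] at h1
    linarith
  have hpos : 0 < Y := by
    have : 0 ≤ ε * T + (D / ε + 2 * c * D) * m := by positivity
    linarith
  have h3 : (ε * T + (D / ε + 2 * c * D) * m) * Y < Y * Y := mul_lt_mul_of_pos_right hcon hpos
  have h4 : D * m * T ≤ ε * Y * T := mul_le_mul_of_nonneg_right h2 hT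
  have h5 : 0 ≤ D / ε * m * Y := by positivity
  nlinarith

lemma TT_nonneg {k : ℝ} (hk : 0 ≤ k) (q : ℕ) (U : E → H) : 0 ≤ TT μ v b X k q ζ U := by
  unfold TT
  have := Nw_nonneg μ X (fun z => ζ z ^ q * max (X z) 0) (dd v (dd v U))
  have := Nw_nonneg μ X (fun z => ζ z ^ q) (dd v U)
  have : 0 ≤ ∑ j, Nw μ X (fun z => ζ z ^ q * Real.sqrt (max (X z) 0)) (dd v (dd (b j) U)) :=
    Finset.sum_nonneg fun _ _ => Nw_nonneg _ _ _ _
  have : 0 ≤ ∑ j, ∑ l, Nw μ X (fun z => ζ z ^ q) (dd (b j) (dd (b l) U)) :=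
    Finset.sum_nonneg fun _ _ => Finset.sum_nonneg fun _ _ => Nw_nonneg _ _ _ _
  positivity

lemma KK_nonneg (q : ℕ) (U : E → H) : 0 ≤ KK μ v b X q ζ U := by
  unfold KK
  have := Nw_nonneg μ X (fun z => ζ z ^ q * Real.sqrt (max (X z) 0)) (dd v U)
  have : 0 ≤ ∑ j, Nw μ X (fun z => ζ z ^ q) (dd (b j) U) :=
    Finset.sum_nonneg fun _ _ => Nw_nonneg _ _ _ _
  positivity

/-- small first order terms -/
lemma est_Y (h : Cut X S c ζ) (hS : insert v (range b) ⊆ S) (hv : X v = 1) (hb : ∀ j, X (b j) = 0)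
    {U : E → H} (hU : ContDiff ℝ ∞ U) (r : ℕ) (k : ℝ) (hk : 6 ≤ k) {ε : ℝ} (hε : 0 < ε) :
    (r+3 : ℕ) * KK μ v b X (r+2) ζ U ≤ ε * TT μ v b X k (r+3) ζ U
      + ((1 + Fintype.card ι) / ε + 2 * c * (1 + Fintype.card ι)) *
        ((r+3 : ℕ)^2 * Nw μ X (fun z => ζ z ^ (r+1)) U) := by
  have h2 := est_c2 μ h hS hv hb hU r k hk
  have c0 : 0 ≤ c := by linarith [h.c1]
  have K0 := KK_nonneg μ (v := v) (b := b) (X := X) (ζ := ζ) (r+2) U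
  have n0 := Nw_nonneg μ X (fun z => ζ z ^ (r+1)) U
  apply quad_abs (by positivity) (TT_nonneg μ (by linarith) _ _) (by positivity) (by positivity) c0 hε
  have := mul_le_mul_of_nonneg_left h2 (by positivity : (0:ℝ) ≤ ((r+3 : ℕ) : ℝ)^2)
  calc _ = ((r+3 : ℕ) : ℝ)^2 * KK μ v b X (r+2) ζ U ^ 2 := by ring
    _ ≤ _ := this
    _ = _ := by ring

/-- main a priori estimate -/
lemma est_T (d : ℕ) (hd : Fintype.card ι = d) (c : ℝ) (hc : 1 ≤ c) : ∃ C2 : ℝ, 0 ≤ C2 ∧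
    ∀ {S : Set E} {ζ : E → ℝ} {v : E} {b : ι → E} (_ : Cut X S c ζ) (_ : insert v (range b) ⊆ S)
    (_ : X v = 1) (_ : ∀ j, X (b j) = 0)
    {U : E → H} (_ : ContDiff ℝ ∞ U) (r : ℕ) (k : ℝ) (_ : 6 ≤ k) (_ : k ≤ (r + 3 : ℕ)),
    TT μ v b X k (r+3) ζ U ≤ 4 * (3 + d + d^2) * Nw μ X (fun z => ζ z ^ (r+3)) (MM X k v b U)
      + C2 * ((r+3 : ℕ)^2 * Nw μ X (fun z => ζ z ^ (r+1)) U) := by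
  set C0 : ℝ := 3 + d + d^2 with hC0
  have C00 : 0 ≤ C0 := by positivity
  set a := C0 * (2*d+5) * (2*c) with ha
  have a0 : 0 ≤ a := by positivity
  set ε := 1 / (2 * (a+1)) with he
  have e0 : 0 < ε := by positivity
  refine ⟨2 * ((a+1) * ((1 + (d:ℝ)) / ε + 2 * c * (1 + d)) + a * c), by positivity, ?_⟩
  intro S ζ v b h hS hv hb U hU r k hk hk2
  have h1 := est_c1 μ h hS hv hb hU r k hk hk2
  have hP := PP_est μ h hU r (v := v) (b := b)
  have hY := est_Y μ h hS hv hb hU r k hk e0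
  rw [hd] at h1 hY
  have K0 := KK_nonneg μ (v := v) (b := b) (X := X) (ζ := ζ) (r+2) U
  have n0 := Nw_nonneg μ X (fun z => ζ z ^ (r+1)) U
  have T0 := TT_nonneg μ (v := v) (b := b) (X := X) (ζ := ζ) (by linarith : 0 ≤ k) (r+3) U
  set T := TT μ v b X k (r+3) ζ U
  set Q := Nw μ X (fun z => ζ z ^ (r+3)) (MM X k v b U)
  set Y := ((r+3 : ℕ) : ℝ) * KK μ v b X (r+2) ζ U with hYd
  set m := ((r+3 : ℕ) : ℝ)^2 * Nw μ X (fun z => ζ z ^ (r+1)) U with hm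
  have Y0 : 0 ≤ Y := by positivity
  have m0 : 0 ≤ m := by positivity
  have hP' : NN μ X (PP v b X c r ζ U) ≤ 2 * c * Y + 2 * c^2 * m := by
    refine hP.trans (le_of_eq ?_); rw [hYd, hm]; ring
  have h3 : T ≤ C0 * (2 * Q + (2*d+5) * (2 * c * Y + 2 * c^2 * m)) := by
    refine h1.trans ?_
    gcongr
  have h4 : T ≤ 2 * C0 * Q + a * Y + a * c * m := by
    refine h3.trans (le_of_eq ?_); rw [ha]; ring
  have h5 : (a+1) * Y ≤ T / 2 + (a+1) * (((1 + (d:ℝ)) / ε + 2 * c * (1 + d)) * m) := by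
    have := mul_le_mul_of_nonneg_left hY (by positivity : 0 ≤ a+1)
    refine this.trans (le_of_eq ?_)
    have e1 : (a+1) * ε = 1/2 := by rw [he]; field_simp
    rw [mul_add, ← mul_assoc (a+1) ε T, e1]
    ring
  nlinarith

/-- discrete Gronwall -/
lemma rec_bound (A C : ℝ) (hA : 1 ≤ A) (hC : 1 ≤ C) (k0 : ℕ) (M0 : ℝ) (hM0 : 1 ≤ M0) (s : ℕ → ℝ)
    (hlow : ∀ k < k0, s k ≤ M0)
    (h : ∀ k, k0 ≤ k → s k ≤ C * (A^k * k.factorial +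
      ∑ i ∈ Finset.range k, (k.choose (i+1)) * A^(i+1) * (i+1).factorial * s (k-(i+1))))
    (k : ℕ) : s k ≤ M0 * C * (A * (1 + 2 * C))^k * k.factorial := by
  set R := A * (1 + 2 * C) with hR
  have R1 : 1 ≤ R := by nlinarith
  induction k using Nat.strong_induction_on with
  | _ k ih =>
  rcases lt_or_ge k k0 with hk | hk
  · refine (hlow k hk).trans ?_
    have h1 : (1:ℝ) ≤ R^k := one_le_pow₀ R1
    have h2 : (1:ℝ) ≤ k.factorial := by exact_mod_cast Nat.factorial_pos k
    calc M0 = M0 * 1 * 1 * 1 := by ring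
      _ ≤ _ := by gcongr
  · refine (h k hk).trans ?_
    rcases Nat.eq_zero_or_pos k with rfl | kpos
    · simp; nlinarith
    have hterm : ∀ i ∈ Finset.range k, (k.choose (i+1)) * A^(i+1) * (i+1).factorial * s (k-(i+1))
        ≤ M0 * C * k.factorial * (A^(i+1) * R^(k-(i+1))) := by
      intro i hi
      have hik : i + 1 ≤ k := Finset.mem_range.1 hi
      have := ih (k-(i+1)) (by omega)
      have e : ((k.choose (i+1) : ℕ) : ℝ) * ((i+1).factorial : ℝ) * ((k-(i+1)).factorial : ℝ) = k.factorial := by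
        exact_mod_cast Nat.choose_mul_factorial_mul_factorial hik
      calc _ ≤ (k.choose (i+1)) * A^(i+1) * (i+1).factorial * (M0 * C * R^(k-(i+1)) * (k-(i+1)).factorial) := by
            gcongr
        _ = M0 * C * (((k.choose (i+1) : ℕ) : ℝ) * ((i+1).factorial : ℝ) * ((k-(i+1)).factorial : ℝ))
            * (A^(i+1) * R^(k-(i+1))) := by ring
        _ = _ := by rw [e]
    have hgeom : ∀ j : ℕ, 2 * C * ∑ i ∈ Finset.range j, A^(i+1) * R^(j-(i+1)) ≤ R^j - A^j := by
      intro j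
      induction j with
      | zero => simp
      | succ j ihj =>
        rw [Finset.sum_range_succ']
        have e : ∑ i ∈ Finset.range j, A^(i+1+1) * R^(j+1-(i+1+1)) = A * ∑ i ∈ Finset.range j, A^(i+1) * R^(j-(i+1)) := by
          rw [Finset.mul_sum]; refine Finset.sum_congr rfl fun i _ => ?_
          rw [Nat.add_sub_add_right]; ring
        rw [e]
        simp only [zero_add, pow_one, Nat.add_sub_cancel]
        have : A * (2 * C * ∑ i ∈ Finset.range j, A^(i+1) * R^(j-(i+1))) ≤ A * (R^j - A^j) :=
          mul_le_mul_of_nonneg_left ihj (by linarith)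
        rw [pow_succ R j, pow_succ A j]
        nlinarith
    have hs := Finset.sum_le_sum hterm
    rw [← Finset.mul_sum] at hs
    have hg := hgeom k
    set G := ∑ i ∈ Finset.range k, A^(i+1) * R^(k-(i+1)) with hG
    have f0 : (0:ℝ) < k.factorial := by positivity
    have A0 : (0:ℝ) ≤ A^k := by positivity
    -- C (A^k k! + M0 C k! G) ≤ M0 C R^k k!
    have hGR : A^k ≤ G := by
      rw [hG]
      obtain ⟨j, rfl⟩ : ∃ j, k = j + 1 := ⟨k-1, by omega⟩
      have := Finset.single_le_sum (f := fun i => A^(i+1) * R^(j+1-(i+1)))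
        (fun i _ => by positivity) (Finset.mem_range.2 (Nat.lt_succ_self j))
      simpa using this
    calc _ ≤ C * (A^k * k.factorial + M0 * C * k.factorial * G) := by gcongr
      _ ≤ C * (M0 * C * G * k.factorial + M0 * C * k.factorial * G) := by
          gcongr
          have : 1 ≤ M0 * C := by nlinarith
          nlinarith
      _ = M0 * C * (2 * C * G) * k.factorial := by ring
      _ ≤ M0 * C * R^k * k.factorial := by
          gcongr
          linarith

end
end HM

namespace HM
open MeasureTheory Filter Topology

section
variable {E : Type*} [NormedAddCommGroup E] [NormedSpace ℝ E]
  {F : Type*} [NormedAddCommGroup F] [NormedSpace ℝ F]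
  {G : Type*} [NormedAddCommGroup G] [NormedSpace ℝ G]
  {W : Type*} [NormedAddCommGroup W] [NormedSpace ℝ W]

/-- combinatorial weight -/
def cw (A : ℝ) (k i : ℕ) : ℝ := (k.choose i) * A^i * i.factorial

lemma cw_nonneg {A : ℝ} (hA : 0 ≤ A) (k i : ℕ) : 0 ≤ cw A k i := by unfold cw; positivity

lemma cw_succ {A : ℝ} (hA : 0 ≤ A) (k i : ℕ) : cw A (k+1) (i+2) = A * cw A (k+1) (i+1) * ((k - i : ℕ) : ℝ) := by
  unfold cw
  have h := Nat.choose_succ_right_eq (k+1) (i+1)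
  have h' : (((k+1).choose (i+2) : ℕ) : ℝ) * ((i+1+1 : ℕ) : ℝ) = ((k+1).choose (i+1) : ℕ) * ((k - i : ℕ) : ℝ) := by
    rw [Nat.add_sub_add_right] at h
    exact_mod_cast h
  rw [Nat.factorial_succ (i+1)]
  push_cast at h' ⊢
  calc _ = (((k+1).choose (i+2) : ℕ) : ℝ) * ((i:ℝ)+1+1) * (A^(i+2) * ((i+1).factorial : ℝ)) := by ring
    _ = _ := by rw [h']; ring

lemma leib1 (B : F →L[ℝ] G →L[ℝ] W) (hB : ∀ x y, ‖B x y‖ ≤ ‖x‖ * ‖y‖) {v : E} {f : E → F} {g : E → G}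
    (hf : ContDiff ℝ ∞ f) (hg : ContDiff ℝ ∞ g) (k : ℕ) (z : E) {C A : ℝ}
    (hb : ∀ i, ‖(dd v)^[i] f z‖ ≤ C * A^i * i.factorial) :
    ‖(dd v)^[k] (fun y => B (f y) (g y)) z - B (f z) ((dd v)^[k] g z)‖ ≤
      C * ∑ i ∈ Finset.range k, cw A k (i+1) * ‖(dd v)^[k-(i+1)] g z‖ := by
  rw [ddit_bilin B hf hg, Finset.Nat.sum_antidiagonal_eq_sum_range_succ_mk, Finset.sum_range_succ']
  simp only [Nat.choose_zero_right, one_smul, Function.iterate_zero, id_eq, Nat.sub_zero,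
    add_sub_cancel_right]
  rw [Finset.mul_sum]
  refine norm_sum_le_of_le _ fun i _ => ?_
  rw [← Nat.cast_smul_eq_nsmul ℝ, norm_smul]
  have := (hB ((dd v)^[i+1] f z) ((dd v)^[k-(i+1)] g z)).trans
    (mul_le_mul_of_nonneg_right (hb (i+1)) (norm_nonneg _))
  unfold cw
  simp only [Real.norm_natCast]
  calc _ ≤ ((k.choose (i+1) : ℕ) : ℝ) * (C * A^(i+1) * (i+1).factorial * ‖(dd v)^[k-(i+1)] g z‖) := by
        gcongr
    _ = _ := by ring

lemma leib2 {v : E} {f : E → ℝ} {g : E → G}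
    (hf : ContDiff ℝ ∞ f) (hg : ContDiff ℝ ∞ g) (k : ℕ) (z : E) {C A : ℝ}
    (hb : ∀ i, ‖(dd v)^[i] f z‖ ≤ C * A^i * i.factorial) :
    ‖(dd v)^[k+1] (fun y => f y • g y) z - f z • ((dd v)^[k+1] g z)
        - ((k+1 : ℕ) : ℝ) • dd v f z • (dd v)^[k] g z‖ ≤
      C * ∑ i ∈ Finset.range k, cw A (k+1) (i+2) * ‖(dd v)^[k-(i+1)] g z‖ := by
  have := ddit_bilin (ContinuousLinearMap.lsmul ℝ ℝ) hf hg (v := v) (k+1) z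
  simp only [ContinuousLinearMap.lsmul_apply] at this
  rw [this, Finset.Nat.sum_antidiagonal_eq_sum_range_succ_mk, Finset.sum_range_succ',
    Finset.sum_range_succ']
  have e : ∀ x a b : G, x + a + b - b - a = x := by intros; abel
  simp only [Nat.choose_zero_right, one_smul, Function.iterate_zero, id_eq, Nat.sub_zero, zero_add,
    Nat.choose_one_right, Function.iterate_one, Nat.add_sub_cancel]
  rw [Nat.cast_smul_eq_nsmul ℝ, e, Finset.mul_sum]
  refine norm_sum_le_of_le _ fun i _ => ?_
  rw [← Nat.cast_smul_eq_nsmul ℝ, norm_smul, norm_smul]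
  have := mul_le_mul_of_nonneg_right (hb (i+2)) (norm_nonneg ((dd v)^[k-(i+1)] g z))
  unfold cw
  simp only [Real.norm_natCast]
  rw [Nat.add_sub_add_right]
  calc _ ≤ (((k+1).choose (i+2) : ℕ) : ℝ) * (C * A^(i+2) * (i+2).factorial * ‖(dd v)^[k-(i+1)] g z‖) := by
        gcongr
    _ = _ := by ring

/-- error sum -/
def EE (A : ℝ) (s : ℕ → ℝ) (k : ℕ) : ℝ := ∑ i ∈ Finset.range k, cw A k (i+1) * s (k-(i+1))

lemma leib1S {κ : Type*} [Fintype κ] (B : F →L[ℝ] G →L[ℝ] W) (hB : ∀ x y, ‖B x y‖ ≤ ‖x‖ * ‖y‖)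
    {v : E} {f : κ → E → F} {g : κ → E → G}
    (hf : ∀ p, ContDiff ℝ ∞ (f p)) (hg : ∀ p, ContDiff ℝ ∞ (g p)) (k : ℕ) (z : E) {C A : ℝ}
    (hC : 0 ≤ C) (hA : 0 ≤ A)
    (hb : ∀ p i, ‖(dd v)^[i] (f p) z‖ ≤ C * A^i * i.factorial) {s : ℕ → ℝ}
    (hs : ∀ m, ∑ p, ‖(dd v)^[m] (g p) z‖ ≤ s m) :
    ∑ p, ‖(dd v)^[k] (fun y => B (f p y) (g p y)) z - B (f p z) ((dd v)^[k] (g p) z)‖ ≤ C * EE A s k := by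
  refine (Finset.sum_le_sum fun p _ => leib1 B hB (hf p) (hg p) k z (hb p)).trans ?_
  rw [← Finset.mul_sum, Finset.sum_comm]
  unfold EE
  gcongr with i hi
  rw [← Finset.mul_sum]
  exact mul_le_mul_of_nonneg_left (hs _) (cw_nonneg hA _ _)

lemma leib2S {κ : Type*} [Fintype κ]
    {v : E} {f : κ → E → ℝ} {g : κ → E → G}
    (hf : ∀ p, ContDiff ℝ ∞ (f p)) (hg : ∀ p, ContDiff ℝ ∞ (g p)) (k : ℕ) (z : E) {C A : ℝ}
    (hC : 0 ≤ C) (hA : 0 ≤ A)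
    (hb : ∀ p i, ‖(dd v)^[i] (f p) z‖ ≤ C * A^i * i.factorial) {s : ℕ → ℝ} (hs0 : ∀ m, 0 ≤ s m)
    (hs : ∀ m, ((m+1 : ℕ) : ℝ) * ∑ p, ‖(dd v)^[m] (g p) z‖ ≤ s (m+1)) :
    ∑ p, ‖(dd v)^[k+1] (fun y => f p y • g p y) z - f p z • ((dd v)^[k+1] (g p) z)
        - ((k+1 : ℕ) : ℝ) • dd v (f p) z • (dd v)^[k] (g p) z‖ ≤ C * A * EE A s (k+1) := by
  refine (Finset.sum_le_sum fun p _ => leib2 (hf p) (hg p) k z (hb p)).trans ?_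
  rw [← Finset.mul_sum, Finset.sum_comm, mul_assoc]
  unfold EE
  gcongr
  rw [Finset.sum_range_succ, mul_add, Finset.mul_sum]
  have h0 : 0 ≤ A * (cw A (k+1) (k+1) * s (k+1-(k+1))) := mul_nonneg hA (mul_nonneg (cw_nonneg hA _ _) (hs0 _))
  have : ∑ i ∈ Finset.range k, ∑ p, cw A (k+1) (i+2) * ‖(dd v)^[k-(i+1)] (g p) z‖ ≤
      ∑ i ∈ Finset.range k, A * (cw A (k+1) (i+1) * s (k+1-(i+1))) := by
    refine Finset.sum_le_sum fun i hi => ?_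
    have hik : i < k := Finset.mem_range.1 hi
    rw [← Finset.mul_sum, cw_succ hA]
    have := hs (k-(i+1))
    have e1 : k - (i+1) + 1 = k - i := by omega
    have e2 : k + 1 - (i+1) = k - i := by omega
    rw [e1] at this
    rw [e2]
    have hw := cw_nonneg hA (k+1) (i+1)
    calc _ = A * (cw A (k+1) (i+1) * (((k-i : ℕ) : ℝ) * ∑ p, ‖(dd v)^[k-(i+1)] (g p) z‖)) := by ring
      _ ≤ _ := by gcongr
  linarith

end
end HM

namespace HM
open MeasureTheory Filter Topology

/-- coefficients of a second order operator in a frame -/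
structure Coef (E H ι : Type*) [NormedAddCommGroup E] [NormedSpace ℝ E]
    [NormedAddCommGroup H] [NormedSpace ℝ H] where
  a00 : E → ℝ
  a0 : ι → E → ℝ
  aa : ι → ι → E → ℝ
  A0 : E → (H →L[ℝ] H)
  A1 : ι → E → (H →L[ℝ] H)
  B : E → (H →L[ℝ] H)
  f : E → H

section
variable {E : Type*} [NormedAddCommGroup E] [NormedSpace ℝ E]
  {H : Type*} [NormedAddCommGroup H] [NormedSpace ℝ H]
  {ι : Type*} [Fintype ι]

/-- the operator -/
def Coef.LL (Q : Coef E H ι) (v : E) (b : ι → E) (u : E → H) (z : E) : H :=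
  Q.a00 z • dd v (dd v u) z + ∑ j, Q.a0 j z • dd v (dd (b j) u) z
    + ∑ j, ∑ l, Q.aa j l z • dd (b j) (dd (b l) u) z
    + Q.A0 z (dd v u z) + ∑ j, Q.A1 j z (dd (b j) u z) + Q.B z (u z)

/-- smoothness of the coefficients -/
structure Coef.Sm (Q : Coef E H ι) : Prop where
  a00 : ContDiff ℝ ∞ Q.a00
  a0 : ∀ j, ContDiff ℝ ∞ (Q.a0 j)
  aa : ∀ j l, ContDiff ℝ ∞ (Q.aa j l)
  A0 : ContDiff ℝ ∞ Q.A0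
  A1 : ∀ j, ContDiff ℝ ∞ (Q.A1 j)
  B : ContDiff ℝ ∞ Q.B
  f : ContDiff ℝ ∞ Q.f

/-- the quantitative bounds at a point -/
structure Coef.Bd [DecidableEq ι] (Q : Coef E H ι) (X : E →L[ℝ] ℝ) (v : E) (C A η : ℝ) (z : E) : Prop where
  a00 : ∀ i, ‖(dd v)^[i] Q.a00 z‖ ≤ C * A^i * i.factorial
  a0 : ∀ j i, ‖(dd v)^[i] (Q.a0 j) z‖ ≤ C * A^i * i.factorial
  aa : ∀ j l i, ‖(dd v)^[i] (Q.aa j l) z‖ ≤ C * A^i * i.factorial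
  A0 : ∀ i, ‖(dd v)^[i] Q.A0 z‖ ≤ C * A^i * i.factorial
  A1 : ∀ j i, ‖(dd v)^[i] (Q.A1 j) z‖ ≤ C * A^i * i.factorial
  B : ∀ i, ‖(dd v)^[i] Q.B z‖ ≤ C * A^i * i.factorial
  f : ∀ i, ‖(dd v)^[i] Q.f z‖ ≤ C * A^i * i.factorial
  n00 : |Q.a00 z - X z| ≤ η * X z
  n00' : |dd v Q.a00 z - 1| ≤ η
  n0 : ∀ j, |Q.a0 j z| ≤ η * Real.sqrt (X z)
  na : ∀ j l, |Q.aa j l z - if j = l then 1 else 0| ≤ η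

/-- pointwise control quantity -/
def sg (v : E) (b : ι → E) (u : E → H) (k : ℕ) (z : E) : ℝ :=
  ((k+1 : ℕ) : ℝ) * ‖dd v ((dd v)^[k] u) z‖ + ((k+1 : ℕ) : ℝ) * ∑ j, ‖dd (b j) ((dd v)^[k] u) z‖
    + ∑ j, ∑ l, ‖dd (b j) (dd (b l) ((dd v)^[k] u)) z‖ + ‖(dd v)^[k] u z‖

lemma sg_nonneg (v : E) (b : ι → E) (u : E → H) (k : ℕ) (z : E) : 0 ≤ sg v b u k z := by
  unfold sg; positivity

lemma bil_smul (x : ℝ) (y : H) : ‖(ContinuousLinearMap.lsmul ℝ ℝ : ℝ →L[ℝ] H →L[ℝ] H) x y‖ ≤ ‖x‖ * ‖y‖ := by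
  simp [norm_smul]

lemma bil_app (x : H →L[ℝ] H) (y : H) :
    ‖(ContinuousLinearMap.id ℝ (H →L[ℝ] H)) x y‖ ≤ ‖x‖ * ‖y‖ := by
  simpa using x.le_opNorm y

end

section
variable {E : Type*} [NormedAddCommGroup E] [NormedSpace ℝ E]
  {H : Type*} [NormedAddCommGroup H] [InnerProductSpace ℝ H]
  {ι : Type*} [Fintype ι] [DecidableEq ι]

/-- commuted equation, pointwise bound -/
lemma pw_est (Q : Coef E H ι) (hQ : Q.Sm) {X : E →L[ℝ] ℝ} {v : E} {b : ι → E} {C A η : ℝ}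
    (hC : 0 ≤ C) (hA : 1 ≤ A) (hη : 0 ≤ η) {u : E → H} (hu : ContDiff ℝ ∞ u) {z : E} (hX : 0 < X z)
    (hbd : Q.Bd X v C A η z) (heq : ∀ᶠ y in 𝓝 z, Q.LL v b u y = Q.f y) (k : ℕ) (hk : 1 ≤ k) :
    ‖MM X k v b ((dd v)^[k] u) z‖ ≤ C * A^k * k.factorial
      + η * (X z * ‖dd v (dd v ((dd v)^[k] u)) z‖ + k * ‖dd v ((dd v)^[k] u) z‖
        + ∑ j, Real.sqrt (X z) * ‖dd v (dd (b j) ((dd v)^[k] u)) z‖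
        + ∑ j, ∑ l, ‖dd (b j) (dd (b l) ((dd v)^[k] u)) z‖)
      + C * A * (‖dd v ((dd v)^[k] u) z‖ + ((k+1 : ℕ) : ℝ) * ∑ j, ‖dd (b j) ((dd v)^[k] u) z‖
        + ‖(dd v)^[k] u z‖)
      + 6 * (C * A) * EE A (fun m => sg v b u m z) k := by
  have A0 : 0 ≤ A := by linarith
  set Uk := (dd v)^[k] u with hUk
  have hUks : ContDiff ℝ ∞ Uk := ddit_smooth hu k
  set s : ℕ → ℝ := fun m => sg v b u m z with hs
  have s0 : ∀ m, 0 ≤ s m := fun m => sg_nonneg _ _ _ _ _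
  obtain ⟨k', rfl⟩ : ∃ k', k = k' + 1 := ⟨k-1, by omega⟩
  have u1 : ∀ a, ContDiff ℝ ∞ (dd a u) := fun a => dd_smooth hu
  have u2 : ∀ a a', ContDiff ℝ ∞ (dd a (dd a' u)) := fun a a' => dd_smooth (u1 a')
  have c1 : ∀ (m : ℕ) a, (dd v)^[m] (dd a u) = dd a ((dd v)^[m] u) := fun m a => (ddit_comm hu m).symm
  have c2 : ∀ (m : ℕ) a a', (dd v)^[m] (dd a (dd a' u)) = dd a (dd a' ((dd v)^[m] u)) := fun m a a' => by
    rw [← ddit_comm (u1 a'), c1]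
  have c3 : ∀ (m : ℕ) a, (dd v)^[m] (dd v (dd a u)) = dd a ((dd v)^[m+1] u) := fun m a => by
    rw [← c1 (m+1), Function.iterate_succ_apply]
  -- nonneg pieces of sg
  have sgv : ∀ m, ((m+1 : ℕ) : ℝ) * ‖dd v ((dd v)^[m] u) z‖ ≤ s m := fun m => by
    rw [hs]; simp only [sg]; 
    have : 0 ≤ ((m+1 : ℕ) : ℝ) * ∑ j, ‖dd (b j) ((dd v)^[m] u) z‖ + ∑ j, ∑ l, ‖dd (b j) (dd (b l) ((dd v)^[m] u)) z‖ + ‖(dd v)^[m] u z‖ := by positivity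
    linarith
  have sgj : ∀ m, ((m+1 : ℕ) : ℝ) * ∑ j, ‖dd (b j) ((dd v)^[m] u) z‖ ≤ s m := fun m => by
    rw [hs]; simp only [sg]; 
    have : 0 ≤ ((m+1 : ℕ) : ℝ) * ‖dd v ((dd v)^[m] u) z‖ + ∑ j, ∑ l, ‖dd (b j) (dd (b l) ((dd v)^[m] u)) z‖ + ‖(dd v)^[m] u z‖ := by positivity
    linarith
  have sgjl : ∀ m, ∑ j, ∑ l, ‖dd (b j) (dd (b l) ((dd v)^[m] u)) z‖ ≤ s m := fun m => by
    rw [hs]; simp only [sg]; 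
    have : 0 ≤ ((m+1 : ℕ) : ℝ) * ‖dd v ((dd v)^[m] u) z‖ + ((m+1 : ℕ) : ℝ) * ∑ j, ‖dd (b j) ((dd v)^[m] u) z‖ + ‖(dd v)^[m] u z‖ := by positivity
    linarith
  have sgu : ∀ m, ‖(dd v)^[m] u z‖ ≤ s m := fun m => by
    rw [hs]; simp only [sg]; 
    have : 0 ≤ ((m+1 : ℕ) : ℝ) * ‖dd v ((dd v)^[m] u) z‖ + ((m+1 : ℕ) : ℝ) * ∑ j, ‖dd (b j) ((dd v)^[m] u) z‖ + ∑ j, ∑ l, ‖dd (b j) (dd (b l) ((dd v)^[m] u)) z‖ := by positivity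
    linarith
  have one_le : ∀ (m : ℕ) (x : ℝ), 0 ≤ x → x ≤ ((m+1 : ℕ) : ℝ) * x := fun m x hx => by
    have : (1:ℝ) ≤ ((m+1 : ℕ) : ℝ) := by exact_mod_cast Nat.succ_pos m
    nlinarith
  have mono2 : ∀ (m : ℕ) (x : ℝ), 0 ≤ x → ((m+1 : ℕ) : ℝ) * x ≤ ((m+1+1 : ℕ) : ℝ) * x := fun m x hx => by
    gcongr; omega
  -- Leibniz
  have L1 := leib2S (κ := Unit) (v := v) (f := fun _ => Q.a00) (g := fun _ => dd v (dd v u)) (fun _ => hQ.a00)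
    (fun _ => u2 v v) k' z hC A0 (fun _ => hbd.a00) s0 (fun m => by
      simp only [Finset.univ_unique, Finset.sum_singleton]
      rw [c3]
      have := sgv (m+1)
      rw [← Function.iterate_succ_apply' (dd v)] at this
      rw [← Function.iterate_succ_apply' (dd v)]
      exact (mono2 _ _ (norm_nonneg _)).trans this)
  have L2 := leib2S (v := v) (f := Q.a0) (g := fun j => dd v (dd (b j) u)) hQ.a0
    (fun j => u2 v (b j)) k' z hC A0 hbd.a0 s0 (fun m => by
      simp only [c3]
      exact (mono2 _ _ (by positivity)).trans (sgj (m+1)))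
  have L3 := leib1S (κ := ι × ι) _ (bil_smul (H := H)) (v := v) (f := fun p => Q.aa p.1 p.2)
    (g := fun p => dd (b p.1) (dd (b p.2) u)) (fun p => hQ.aa _ _) (fun p => u2 _ _) (k'+1) z hC A0
    (fun p => hbd.aa _ _) (s := s) (fun m => by
      simp only [c2]
      rw [Fintype.sum_prod_type]; exact sgjl m)
  have L4 := leib1S (κ := Unit) _ (bil_app (H := H)) (v := v) (f := fun _ => Q.A0)
    (g := fun _ => dd v u) (fun p => hQ.A0) (fun p => u1 _) (k'+1) z hC A0
    (fun p => hbd.A0) (s := s) (fun m => by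
      simp only [c1, Finset.univ_unique, Finset.sum_singleton]
      exact (one_le m _ (norm_nonneg _)).trans (sgv m))
  have L5 := leib1S _ (bil_app (H := H)) (v := v) (f := Q.A1)
    (g := fun j => dd (b j) u) hQ.A1 (fun p => u1 _) (k'+1) z hC A0
    hbd.A1 (s := s) (fun m => by
      simp only [c1]
      exact (one_le m _ (by positivity)).trans (sgj m))
  have L6 := leib1S (κ := Unit) _ (bil_app (H := H)) (v := v) (f := fun _ => Q.B)
    (g := fun _ => u) (fun p => hQ.B) (fun p => hu) (k'+1) z hC A0
    (fun p => hbd.B) (s := s) (fun m => by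
      simp only [Finset.univ_unique, Finset.sum_singleton]
      exact sgu m)
  simp only [Finset.univ_unique, Finset.sum_singleton, ContinuousLinearMap.lsmul_apply,
    ContinuousLinearMap.id_apply, c1, c2] at L1 L2 L3 L4 L5 L6
  rw [Fintype.sum_prod_type] at L3
  -- differentiate equation
  have e0 : (dd v)^[k'+1] (Q.LL v b u) z = (dd v)^[k'+1] Q.f z :=
    (ddit_congr_nhds (v := v) (k := k'+1) (f := Q.LL v b u) (g := Q.f) heq).eq_of_nhds
  have t1s : ContDiff ℝ ∞ (fun z => Q.a00 z • dd v (dd v u) z) := hQ.a00.smul (u2 _ _)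
  have t2s : ∀ j, ContDiff ℝ ∞ (fun z => Q.a0 j z • dd v (dd (b j) u) z) := fun j => (hQ.a0 j).smul (u2 _ _)
  have t3s : ∀ j l, ContDiff ℝ ∞ (fun z => Q.aa j l z • dd (b j) (dd (b l) u) z) := fun j l =>
    (hQ.aa j l).smul (u2 _ _)
  have t4s : ContDiff ℝ ∞ (fun z => Q.A0 z (dd v u z)) := hQ.A0.clm_apply (u1 _)
  have t5s : ∀ j, ContDiff ℝ ∞ (fun z => Q.A1 j z (dd (b j) u z)) := fun j => (hQ.A1 j).clm_apply (u1 _)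
  have t6s : ContDiff ℝ ∞ (fun z => Q.B z (u z)) := hQ.B.clm_apply hu
  have t2S : ContDiff ℝ ∞ (fun z => ∑ j, Q.a0 j z • dd v (dd (b j) u) z) := ContDiff.sum fun j _ => t2s j
  have t3S' : ∀ j, ContDiff ℝ ∞ (fun z => ∑ l, Q.aa j l z • dd (b j) (dd (b l) u) z) :=
    fun j => ContDiff.sum fun l _ => t3s j l
  have t3S : ContDiff ℝ ∞ (fun z => ∑ j, ∑ l, Q.aa j l z • dd (b j) (dd (b l) u) z) :=
    ContDiff.sum fun j _ => t3S' j
  have t5S : ContDiff ℝ ∞ (fun z => ∑ j, Q.A1 j z (dd (b j) u z)) := ContDiff.sum fun j _ => t5s j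
  have e1 : (dd v)^[k'+1] (Q.LL v b u) z =
      (dd v)^[k'+1] (fun z => Q.a00 z • dd v (dd v u) z) z
      + ∑ j, (dd v)^[k'+1] (fun z => Q.a0 j z • dd v (dd (b j) u) z) z
      + ∑ j, ∑ l, (dd v)^[k'+1] (fun z => Q.aa j l z • dd (b j) (dd (b l) u) z) z
      + (dd v)^[k'+1] (fun z => Q.A0 z (dd v u z)) z
      + ∑ j, (dd v)^[k'+1] (fun z => Q.A1 j z (dd (b j) u z)) z
      + (dd v)^[k'+1] (fun z => Q.B z (u z)) z := by
    unfold Coef.LL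
    rw [ddit_add ((((t1s.add t2S).add t3S).add t4s).add t5S) t6s]
    simp only
    rw [ddit_add (((t1s.add t2S).add t3S).add t4s) t5S]
    simp only
    rw [ddit_add ((t1s.add t2S).add t3S) t4s]
    simp only
    rw [ddit_add (t1s.add t2S) t3S]
    simp only
    rw [ddit_add t1s t2S, ddit_sum t2s, ddit_sum t5s, ddit_sum t3S']
    simp only
    congr 4
    refine Finset.sum_congr rfl fun j _ => ?_
    rw [ddit_sum (t3s j)]
  rw [e1] at e0
  -- abbreviations
  set T1 := (dd v)^[k'+1] (fun z => Q.a00 z • dd v (dd v u) z) z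
  set T2 := fun j => (dd v)^[k'+1] (fun z => Q.a0 j z • dd v (dd (b j) u) z) z
  set T3 := fun j l => (dd v)^[k'+1] (fun z => Q.aa j l z • dd (b j) (dd (b l) u) z) z
  set T4 := (dd v)^[k'+1] (fun z => Q.A0 z (dd v u z)) z
  set T5 := fun j => (dd v)^[k'+1] (fun z => Q.A1 j z (dd (b j) u z)) z
  set T6 := (dd v)^[k'+1] (fun z => Q.B z (u z)) z
  have m3 : ∑ j, dd (b j) (dd (b j) Uk) z = ∑ j, ∑ l, (if j = l then (1:ℝ) else 0) • dd (b j) (dd (b l) Uk) z := by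
    refine Finset.sum_congr rfl fun j _ => ?_
    simp
  have key : MM X ((k'+1 : ℕ) : ℝ) v b Uk z = (dd v)^[k'+1] Q.f z
      - (T1 - X z • dd v (dd v Uk) z - ((k'+1 : ℕ) : ℝ) • dd v Uk z)
      - ∑ j, T2 j - ∑ j, ∑ l, (T3 j l - (if j = l then (1:ℝ) else 0) • dd (b j) (dd (b l) Uk) z)
      - T4 - ∑ j, T5 j - T6 := by
    simp only [Finset.sum_sub_distrib]
    rw [← m3, ← e0]
    unfold MM
    abel
  set Ee := EE A s (k'+1) with hEe
  have Ee0 : 0 ≤ Ee := Finset.sum_nonneg fun i _ => mul_nonneg (cw_nonneg A0 _ _) (s0 _)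
  have ci : ∀ a, dd a ((dd v)^[k'] (dd v u)) = dd a Uk := fun a => by rw [hUk, Function.iterate_succ_apply]
  have B1 : ‖T1 - X z • dd v (dd v Uk) z - ((k'+1 : ℕ) : ℝ) • dd v Uk z‖ ≤ C * A * Ee
      + η * X z * ‖dd v (dd v Uk) z‖ + η * ((k'+1 : ℕ) * ‖dd v Uk z‖) := by
    have hvv : dd v (dd v ((dd v)^[k'] u)) = dd v Uk := by
      rw [hUk, Function.iterate_succ_apply']
    rw [hvv] at L1
    have e : T1 - X z • dd v (dd v Uk) z - ((k'+1 : ℕ) : ℝ) • dd v Uk z =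
      (T1 - Q.a00 z • dd v (dd v Uk) z - ((k'+1 : ℕ) : ℝ) • dd v Q.a00 z • dd v Uk z)
      + ((Q.a00 z - X z) • dd v (dd v Uk) z + ((k'+1 : ℕ) : ℝ) • (dd v Q.a00 z - 1) • dd v Uk z) := by
      module
    rw [e]
    refine (norm_add_le _ _).trans ?_
    have g2 : ‖(Q.a00 z - X z) • dd v (dd v Uk) z + ((k'+1 : ℕ) : ℝ) • (dd v Q.a00 z - 1) • dd v Uk z‖
        ≤ η * X z * ‖dd v (dd v Uk) z‖ + η * ((k'+1 : ℕ) * ‖dd v Uk z‖) := by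
      refine (norm_add_le _ _).trans ?_
      rw [norm_smul, norm_smul, norm_smul, Real.norm_eq_abs, Real.norm_natCast, Real.norm_eq_abs]
      have := mul_le_mul_of_nonneg_right hbd.n00 (norm_nonneg (dd v (dd v Uk) z))
      have := mul_le_mul_of_nonneg_right hbd.n00' (by positivity : 0 ≤ ((k'+1 : ℕ) : ℝ) * ‖dd v Uk z‖)
      nlinarith
    linarith
  have B2 : ‖∑ j, T2 j‖ ≤ C * A * Ee + η * ∑ j, Real.sqrt (X z) * ‖dd v (dd (b j) Uk) z‖
      + C * A * (((k'+1 : ℕ) : ℝ) * ∑ j, ‖dd (b j) Uk z‖) := by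
    refine (norm_sum_le _ _).trans ?_
    rw [Finset.mul_sum, Finset.mul_sum, Finset.mul_sum, add_assoc, ← Finset.sum_add_distrib]
    refine le_trans ?_ (add_le_add_left L2 _)
    rw [← Finset.sum_add_distrib]
    refine Finset.sum_le_sum fun j _ => ?_
    have hvj : dd v (dd (b j) ((dd v)^[k'] u)) = dd (b j) Uk := by
      rw [dd_comm (ddit_smooth hu k'), hUk, Function.iterate_succ_apply']
    rw [hvj]
    have e : T2 j = (T2 j - Q.a0 j z • dd v (dd (b j) Uk) z - ((k'+1 : ℕ) : ℝ) • dd v (Q.a0 j) z • dd (b j) Uk z)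
      + (Q.a0 j z • dd v (dd (b j) Uk) z + ((k'+1 : ℕ) : ℝ) • dd v (Q.a0 j) z • dd (b j) Uk z) := by
      abel
    have g2 : ‖Q.a0 j z • dd v (dd (b j) Uk) z + ((k'+1 : ℕ) : ℝ) • dd v (Q.a0 j) z • dd (b j) Uk z‖
        ≤ η * (Real.sqrt (X z) * ‖dd v (dd (b j) Uk) z‖) + C * A * ((k'+1 : ℕ) * ‖dd (b j) Uk z‖) := by
      refine (norm_add_le _ _).trans ?_
      rw [norm_smul, norm_smul, norm_smul, Real.norm_eq_abs, Real.norm_natCast]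
      have := mul_le_mul_of_nonneg_right (hbd.n0 j) (norm_nonneg (dd v (dd (b j) Uk) z))
      have h1 := hbd.a0 j 1
      simp only [Function.iterate_one, pow_one, Nat.factorial_one, Nat.cast_one, mul_one] at h1
      have := mul_le_mul_of_nonneg_right h1 (by positivity : 0 ≤ ((k'+1 : ℕ) : ℝ) * ‖dd (b j) Uk z‖)
      nlinarith
    have g3 := norm_add_le (T2 j - Q.a0 j z • dd v (dd (b j) Uk) z - ((k'+1 : ℕ) : ℝ) • dd v (Q.a0 j) z • dd (b j) Uk z)
      (Q.a0 j z • dd v (dd (b j) Uk) z + ((k'+1 : ℕ) : ℝ) • dd v (Q.a0 j) z • dd (b j) Uk z)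
    rw [← e] at g3
    exact g3.trans (add_le_add le_rfl g2)
  have B3 : ‖∑ j, ∑ l, (T3 j l - (if j = l then (1:ℝ) else 0) • dd (b j) (dd (b l) Uk) z)‖ ≤
      C * Ee + η * ∑ j, ∑ l, ‖dd (b j) (dd (b l) Uk) z‖ := by
    refine (norm_sum_le _ _).trans ?_
    refine (Finset.sum_le_sum fun j _ => norm_sum_le _ _).trans ?_
    rw [Finset.mul_sum]
    refine le_trans ?_ (add_le_add_left L3 _)
    rw [← Finset.sum_add_distrib]
    refine Finset.sum_le_sum fun j _ => ?_
    rw [Finset.mul_sum, ← Finset.sum_add_distrib]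
    refine Finset.sum_le_sum fun l _ => ?_
    have e : T3 j l - (if j = l then (1:ℝ) else 0) • dd (b j) (dd (b l) Uk) z =
      (T3 j l - Q.aa j l z • dd (b j) (dd (b l) Uk) z) +
      (Q.aa j l z - (if j = l then (1:ℝ) else 0)) • dd (b j) (dd (b l) Uk) z := by
      module
    rw [e]
    refine (norm_add_le _ _).trans ?_
    gcongr
    rw [norm_smul]
    exact mul_le_mul_of_nonneg_right (hbd.na j l) (norm_nonneg _)
  have B4 : ‖T4‖ ≤ C * Ee + C * ‖dd v Uk z‖ := by
    have e : T4 = (T4 - Q.A0 z (dd v Uk z)) + Q.A0 z (dd v Uk z) := by abel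
    rw [e]
    refine (norm_add_le _ _).trans (add_le_add L4 ?_)
    refine ((Q.A0 z).le_opNorm _).trans ?_
    gcongr
    simpa using hbd.A0 0
  have B5 : ‖∑ j, T5 j‖ ≤ C * Ee + C * ∑ j, ‖dd (b j) Uk z‖ := by
    refine (norm_sum_le _ _).trans ?_
    rw [Finset.mul_sum]
    refine le_trans ?_ (add_le_add_left L5 _)
    rw [← Finset.sum_add_distrib]
    refine Finset.sum_le_sum fun j _ => ?_
    have e : T5 j = (T5 j - Q.A1 j z (dd (b j) Uk z)) + Q.A1 j z (dd (b j) Uk z) := by abel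
    calc ‖T5 j‖ ≤ ‖T5 j - Q.A1 j z (dd (b j) Uk z)‖ + ‖Q.A1 j z (dd (b j) Uk z)‖ := by
          conv_lhs => rw [e]
          exact norm_add_le _ _
      _ ≤ _ := by
        gcongr
        refine ((Q.A1 j z).le_opNorm _).trans ?_
        gcongr
        simpa using hbd.A1 j 0
  have B6 : ‖T6‖ ≤ C * Ee + C * ‖Uk z‖ := by
    have e : T6 = (T6 - Q.B z (Uk z)) + Q.B z (Uk z) := by abel
    rw [e]
    refine (norm_add_le _ _).trans (add_le_add L6 ?_)
    refine ((Q.B z).le_opNorm _).trans ?_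
    gcongr
    simpa using hbd.B 0
  have Bf := hbd.f (k'+1)
  rw [key]
  have n1 : ∀ x1 x2 x3 x4 x5 x6 x7 : H, ‖x1 - x2 - x3 - x4 - x5 - x6 - x7‖ ≤
      ‖x1‖ + ‖x2‖ + ‖x3‖ + ‖x4‖ + ‖x5‖ + ‖x6‖ + ‖x7‖ := by
    intro x1 x2 x3 x4 x5 x6 x7
    have := norm_sub_le (x1 - x2 - x3 - x4 - x5 - x6) x7
    have := norm_sub_le (x1 - x2 - x3 - x4 - x5) x6
    have := norm_sub_le (x1 - x2 - x3 - x4) x5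
    have := norm_sub_le (x1 - x2 - x3) x4
    have := norm_sub_le (x1 - x2) x3
    have := norm_sub_le x1 x2
    linarith
  refine (n1 _ _ _ _ _ _ _).trans ?_
  have hCA : C ≤ C * A := by nlinarith
  have q1 := mul_le_mul_of_nonneg_right hCA Ee0
  have q2 := mul_le_mul_of_nonneg_right hCA (norm_nonneg (dd v Uk z))
  have q3 := mul_le_mul_of_nonneg_right hCA (norm_nonneg (Uk z))
  have q4 := mul_le_mul_of_nonneg_right hCA (by positivity : 0 ≤ ∑ j, ‖dd (b j) Uk z‖)
  have q5 : (((k'+1+1 : ℕ) : ℝ)) = ((k'+1 : ℕ) : ℝ) + 1 := by push_cast; ring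
  rw [q5]
  simp only [mul_add, add_mul, one_mul]
  linarith
end
end HM

namespace HM
open MeasureTheory Filter Topology

section
variable {E : Type*} [NormedAddCommGroup E] [NormedSpace ℝ E] [FiniteDimensional ℝ E]
  [MeasurableSpace E] [BorelSpace E] (μ : Measure E) [μ.IsAddHaarMeasure]
  {H : Type*} [NormedAddCommGroup H] [InnerProductSpace ℝ H]
variable {X : E →L[ℝ] ℝ} {S : Set E} {c : ℝ} {ζ : E → ℝ}
variable {ι : Type*} [Fintype ι] [DecidableEq ι]

/-- weighted norms of `sg` -/
def ss (X : E →L[ℝ] ℝ) (ζ : E → ℝ) (v : E) (b : ι → E) (u : E → H) (k : ℕ) : ℝ :=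
  NN μ X (fun z => ζ z ^ (2*k+2) * sg v b u k z)

lemma sg_cont {v : E} {b : ι → E} {u : E → H} (hu : ContDiff ℝ ∞ u) (k : ℕ) : Continuous (sg v b u k) := by
  unfold sg
  have h0 : ContDiff ℝ ∞ ((dd v)^[k] u) := ddit_smooth hu k
  have h1 : ∀ a, Continuous (dd a ((dd v)^[k] u)) := fun a => (dd_smooth h0).continuous
  have h2 : ∀ a a', Continuous (dd a (dd a' ((dd v)^[k] u))) := fun a a' => (dd_smooth (dd_smooth h0)).continuous
  have h3 := h0.continuous
  have h4 : ∀ j, Continuous (fun z => ∑ l, ‖dd (b j) (dd (b l) ((dd v)^[k] u)) z‖) := fun j =>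
    continuous_finsetSum _ fun l _ => (h2 _ _).norm
  exact (((continuous_const.mul (h1 v).norm).add (continuous_const.mul
    (continuous_finsetSum _ fun j _ => (h1 _).norm))).add (continuous_finsetSum _ fun j _ => h4 j)).add h3.norm

set_option maxHeartbeats 4000000 in
lemma ss_step (d : ℕ) (hd : Fintype.card ι = d) (c : ℝ) (hc : 1 ≤ c) (C A : ℝ) (hC : 1 ≤ C) (hA : 1 ≤ A)
    {S : Set E} {ζ : E → ℝ} (hcut : Cut X S c ζ) {b : ι → E} (hbS : range b ⊆ S) (hb : ∀ j, X (b j) = 0)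
    {η : ℝ} (hη : 0 ≤ η) (hη1 : 16 * (3 + (d:ℝ) + d^2) * η ≤ 1) :
    ∃ K : ℝ, 1 ≤ K ∧ ∃ k0 : ℕ, ∀ (Q : Coef E H ι) (_ : Q.Sm) (v : E) (_ : v ∈ S) (_ : X v = 1)
      (u : E → H) (_ : ContDiff ℝ ∞ u)
      (_ : ∀ z, ζ z ≠ 0 → 0 < X z → Q.Bd X v C A η z ∧ ∀ᶠ y in 𝓝 z, Q.LL v b u y = Q.f y)
      (k : ℕ) (_ : k0 ≤ k), ss μ X ζ v b u k ≤ K * (A^k * k.factorial + EE A (ss μ X ζ v b u) k) := by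
  obtain ⟨C2, hC2, hT⟩ := est_T (H := H) (X := X) (ι := ι) μ d hd c hc
  set C0 : ℝ := 3 + (d:ℝ) + d^2 with hC0
  have C00 : 1 ≤ C0 := by rw [hC0]; nlinarith [(Nat.cast_nonneg d : (0:ℝ) ≤ d)]
  set Z := NN μ X ζ with hZ
  have Z0 : 0 ≤ Z := NN_nonneg _ _ _
  have CA1 : 1 ≤ C * A := by nlinarith
  set ε := 1 / (16 * C0 * (C * A)) with hε
  have ε0 : 0 < ε := by positivity
  set Cε := (1 + (d:ℝ)) / ε + 2 * c * (1 + d) with hCε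
  have Cε0 : 0 ≤ Cε := by positivity
  set K1 := 4 * (4 * C0 * (C * Z + C * A * Cε * 16 + C * A * 16 + 6 * (C * A)) + 16 * C2) with hK1
  have K10 : 0 ≤ K1 := by positivity
  obtain ⟨k1, hk1⟩ := exists_nat_ge (16 * C0 * (C * A))
  refine ⟨3 * K1 + 16 * (Cε + 1) + 1, by nlinarith, max 6 k1, ?_⟩
  intro Q hQ v hvS hv u hu hpt k hk
  have k6 : 6 ≤ k := le_trans (le_max_left _ _) hk
  have kk1 : k1 ≤ k := le_trans (le_max_right _ _) hk
  have kbig : 16 * C0 * (C * A) ≤ k := hk1.trans (by exact_mod_cast kk1)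
  have A0 : 0 ≤ A := by linarith
  have hS : insert v (range b) ⊆ S := insert_subset hvS hbS
  obtain ⟨r, hr⟩ : ∃ r, 2 * k = r + 1 := ⟨2*k-1, by omega⟩
  set U := (dd v)^[k] u with hU
  have hUs : ContDiff ℝ ∞ U := ddit_smooth hu k
  have U1 : ∀ a, Continuous (dd a U) := fun a => (dd_smooth hUs).continuous
  have U2 : ∀ a a', Continuous (dd a (dd a' U)) := fun a a' => (dd_smooth (dd_smooth hUs)).continuous
  have hT' := hT hcut hS hv hb hUs r k (by exact_mod_cast k6) (by exact_mod_cast (by omega : k ≤ r + 3))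
  have hY := est_Y μ hcut hS hv hb hUs r k (by exact_mod_cast k6) ε0
  have hY1 := est_Y μ hcut hS hv hb hUs r k (by exact_mod_cast k6) one_pos
  rw [hd] at hY hY1
  have T0 := TT_nonneg μ (v := v) (b := b) (X := X) (ζ := ζ) (by positivity : (0:ℝ) ≤ k) (r+3) U
  have KK0 := KK_nonneg μ (v := v) (b := b) (X := X) (ζ := ζ) (r+2) U
  set Y := ((r+3 : ℕ) : ℝ) * KK μ v b X (r+2) ζ U with hYd
  set n0 := Nw μ X (fun z => ζ z ^ (r+1)) U with hn0
  have n00 : 0 ≤ n0 := Nw_nonneg _ _ _ _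
  set m := ((r+3 : ℕ) : ℝ)^2 * n0 with hm
  have m0 : 0 ≤ m := by positivity
  -- Cc facts
  have z0 := hcut.nn
  have z1 := hcut.le1
  have q1 : Cc (fun z => ζ z ^ (r+3) * max (X z) 0 * ‖dd v (dd v U) z‖) :=
    cc_w (cc_mul_right (hcut.cc (r+2)) (by fun_prop)) (U2 v v)
  have q2 : Cc (fun z => ζ z ^ (r+3) * ‖dd v U z‖) := cc_w (hcut.cc (r+2)) (U1 v)
  have q3 : ∀ j ∈ Finset.univ, Cc (fun z => ζ z ^ (r+3) * Real.sqrt (max (X z) 0) * ‖dd v (dd (b j) U) z‖) :=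
    fun j _ => cc_w (cc_mul_right (hcut.cc (r+2)) sqrt_pos_cont) (U2 v _)
  have q4' : ∀ j, ∀ l ∈ Finset.univ, Cc (fun z => ζ z ^ (r+3) * ‖dd (b j) (dd (b l) U) z‖) :=
    fun j l _ => cc_w (hcut.cc (r+2)) (U2 _ _)
  have q4 : ∀ j ∈ Finset.univ, Cc (fun z => ∑ l, ζ z ^ (r+3) * ‖dd (b j) (dd (b l) U) z‖) :=
    fun j _ => cc_sum _ (q4' j)
  have q5 : ∀ j ∈ Finset.univ, Cc (fun z => ζ z ^ (r+3) * ‖dd (b j) U z‖) :=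
    fun j _ => cc_w (hcut.cc (r+2)) (U1 _)
  have q6 : Cc (fun z => ζ z ^ (r+3) * ‖U z‖) := cc_w (hcut.cc (r+2)) hUs.continuous
  have q7' : ∀ j, Cc (fun z => ζ z ^ (r+3) * sg v b u j z) := fun j =>
    cc_mul_right (hcut.cc (r+2)) (sg_cont hu _)
  have q7 : ∀ i ∈ Finset.range k, Cc (fun z => cw A k (i+1) * (ζ z ^ (r+3) * sg v b u (k-(i+1)) z)) :=
    fun i _ => cc_mul_left continuous_const (q7' _)
  have q8 : Cc (fun z => ζ z ^ (r+3)) := hcut.cc (r+2)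
  -- names of the norms
  set Nv := Nw μ X (fun z => ζ z ^ (r+3)) (dd v U) with hNv
  set Nj := ∑ j, Nw μ X (fun z => ζ z ^ (r+3)) (dd (b j) U) with hNj
  set Njl := ∑ j, ∑ l, Nw μ X (fun z => ζ z ^ (r+3)) (dd (b j) (dd (b l) U)) with hNjl
  set Nu := Nw μ X (fun z => ζ z ^ (r+3)) U with hNu
  have Nv0 : 0 ≤ Nv := Nw_nonneg _ _ _ _
  have Nj0 : 0 ≤ Nj := Finset.sum_nonneg fun j _ => Nw_nonneg _ _ _ _
  have Njl0 : 0 ≤ Njl := Finset.sum_nonneg fun j _ => Finset.sum_nonneg fun l _ => Nw_nonneg _ _ _ _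
  have Nu_le : Nu ≤ n0 := by
    rw [hNu, hn0]; unfold Nw
    refine NN_mono μ X q6 (cc_w (hcut.cc r) hUs.continuous) fun z _ => ?_
    have := z0 z
    rw [abs_of_nonneg (by positivity)]
    gcongr ?_ * _
    exact pow_le_pow_of_le_one this (z1 z) (by omega)
  have Nu0 : 0 ≤ Nu := Nw_nonneg _ _ _ _
  have Y_ge : ((k+1 : ℕ) : ℝ) * Nj ≤ Y := by
    rw [hYd]
    have h1 : Nj ≤ KK μ v b X (r+2) ζ U := by
      unfold KK
      have := Nw_nonneg μ X (fun z => ζ z ^ (r+2) * Real.sqrt (max (X z) 0)) (dd v U)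
      have h2 : Nj ≤ ∑ j, Nw μ X (fun z => ζ z ^ (r+2)) (dd (b j) U) := by
        refine Finset.sum_le_sum fun j hj => ?_
        unfold Nw
        refine NN_mono μ X (q5 j hj) (cc_w (hcut.cc (r+1)) (U1 _)) fun z _ => ?_
        have := z0 z
        rw [abs_of_nonneg (by positivity)]
        gcongr ?_ * _
        exact pow_le_pow_of_le_one this (z1 z) (by omega)
      linarith
    have h3 : ((k+1 : ℕ) : ℝ) ≤ ((r+3 : ℕ) : ℝ) := by exact_mod_cast (by omega)
    exact mul_le_mul h3 h1 Nj0 (by positivity)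
  have TTd : TT μ v b X k (r+3) ζ U = Nw μ X (fun z => ζ z ^ (r+3) * max (X z) 0) (dd v (dd v U)) + k * Nv
      + ∑ j, Nw μ X (fun z => ζ z ^ (r+3) * Real.sqrt (max (X z) 0)) (dd v (dd (b j) U)) + Njl := rfl
  have TT_ge : k * Nv + Njl ≤ TT μ v b X k (r+3) ζ U := by
    rw [TTd]
    have := Nw_nonneg μ X (fun z => ζ z ^ (r+3) * max (X z) 0) (dd v (dd v U))
    have : 0 ≤ ∑ j, Nw μ X (fun z => ζ z ^ (r+3) * Real.sqrt (max (X z) 0)) (dd v (dd (b j) U)) :=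
      Finset.sum_nonneg fun j _ => Nw_nonneg _ _ _ _
    linarith
  set T := TT μ v b X k (r+3) ζ U with hTd
  set s := ss μ X ζ v b u with hs
  have s0 : ∀ j, 0 ≤ s j := fun j => NN_nonneg _ _ _
  have hrk : 2 * k + 2 = r + 3 := by omega
  -- EE bound
  have EEs : NN μ X (fun z => ∑ i ∈ Finset.range k, cw A k (i+1) * (ζ z ^ (r+3) * sg v b u (k-(i+1)) z))
      ≤ EE A s k := by
    refine (NN_sum μ X _ q7).trans ?_
    unfold EE
    refine Finset.sum_le_sum fun i hi => ?_
    rw [NN_const_mul _ _ _ (cw_nonneg A0 _ _)]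
    refine mul_le_mul_of_nonneg_left ?_ (cw_nonneg A0 _ _)
    rw [hs]; unfold ss
    refine NN_mono μ X (q7' _) (cc_mul_right (hcut.cc _) (sg_cont hu _)) fun z _ => ?_
    have h1 := z0 z
    have h2 := sg_nonneg v b u (k-(i+1)) z
    rw [abs_of_nonneg (by positivity)]
    gcongr ?_ * _
    exact pow_le_pow_of_le_one h1 (z1 z) (by omega)
  have EE0 : 0 ≤ EE A s k := Finset.sum_nonneg fun i _ => mul_nonneg (cw_nonneg A0 _ _) (s0 _)
  have hm16 : m ≤ 16 * EE A s k := by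
    have h1 : k * n0 ≤ s (k-1) := by
      rw [hn0, hs]; unfold ss Nw
      rw [← NN_const_mul _ _ _ (by positivity)]
      refine NN_mono μ X (cc_mul_left continuous_const (cc_w (hcut.cc r) hUs.continuous))
        (cc_mul_right (hcut.cc _) (sg_cont hu _)) fun z _ => ?_
      have h1 := z0 z
      rw [abs_of_nonneg (by positivity)]
      have e1 : 2 * (k-1) + 2 = r + 1 := by omega
      have e2 : dd v ((dd v)^[k-1] u) = U := by
        rw [← Function.iterate_succ_apply' (dd v)]; rw [hU]; congr 1; omega
      have e3 : ((k - 1 + 1 : ℕ) : ℝ) = k := by congr 1; omega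
      rw [e1]
      have : (k:ℝ) * ‖U z‖ ≤ sg v b u (k-1) z := by
        unfold sg; rw [e2, e3]
        have : 0 ≤ (k:ℝ) * ∑ j, ‖dd (b j) ((dd v)^[k-1] u) z‖ + ∑ j, ∑ l, ‖dd (b j) (dd (b l) ((dd v)^[k-1] u)) z‖ + ‖(dd v)^[k-1] u z‖ := by positivity
        linarith
      calc _ = ζ z ^ (r+1) * (k * ‖U z‖) := by ring
        _ ≤ _ := by gcongr
    have h2 : k * s (k-1) ≤ EE A s k := by
      unfold EE
      have := Finset.single_le_sum (f := fun i => cw A k (i+1) * s (k-(i+1)))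
        (fun i _ => mul_nonneg (cw_nonneg A0 _ _) (s0 _)) (Finset.mem_range.2 (by omega : 0 < k))
      refine le_trans ?_ this
      simp only [zero_add]
      refine mul_le_mul_of_nonneg_right ?_ (s0 _)
      unfold cw
      simp only [Nat.choose_one_right, pow_one, Nat.factorial_one, Nat.cast_one, mul_one]
      exact le_mul_of_one_le_right (Nat.cast_nonneg k) hA
    have h3 : ((r+3 : ℕ) : ℝ) ≤ 4 * k := by exact_mod_cast (by omega : r + 3 ≤ 4 * k)
    have h4 : ((r+3 : ℕ) : ℝ)^2 ≤ 16 * k^2 := by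
      have h0 : (0:ℝ) ≤ ((r+3 : ℕ) : ℝ) := by positivity
      calc ((r+3 : ℕ) : ℝ)^2 ≤ (4 * k)^2 := pow_le_pow_left₀ h0 h3 2
        _ = _ := by ring
    have h5 : (k:ℝ) * (k * n0) ≤ k * s (k-1) := mul_le_mul_of_nonneg_left h1 (by positivity)
    calc m ≤ 16 * (k:ℝ)^2 * n0 := by rw [hm]; gcongr
      _ = 16 * (k * (k * n0)) := by ring
      _ ≤ _ := by linarith
  -- bound of Q
  set Qn := Nw μ X (fun z => ζ z ^ (r+3)) (MM X k v b U) with hQn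
  set F := A^k * (k.factorial : ℝ) with hF
  have F0 : 0 ≤ F := by positivity
  have ckk : (0:ℝ) ≤ ((k+1 : ℕ) : ℝ) := by positivity
  have hQ1 : Qn ≤ C * F * Z + (η * T + C * A * (Nv + ((k+1 : ℕ) : ℝ) * Nj + Nu)) + 6 * (C * A) * EE A s k := by
    have big : ∀ z, 0 < X z → |ζ z ^ (r+3) * ‖MM X k v b U z‖| ≤
        (C * F) * ζ z ^ (r+3) + (η * (ζ z ^ (r+3) * max (X z) 0 * ‖dd v (dd v U) z‖ +
          k * (ζ z ^ (r+3) * ‖dd v U z‖) + ∑ j, ζ z ^ (r+3) * Real.sqrt (max (X z) 0) * ‖dd v (dd (b j) U) z‖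
          + ∑ j, ∑ l, ζ z ^ (r+3) * ‖dd (b j) (dd (b l) U) z‖) +
          (C * A) * (ζ z ^ (r+3) * ‖dd v U z‖ + ((k+1 : ℕ) : ℝ) * ∑ j, ζ z ^ (r+3) * ‖dd (b j) U z‖
            + ζ z ^ (r+3) * ‖U z‖)) +
        6 * (C * A) * ∑ i ∈ Finset.range k, cw A k (i+1) * (ζ z ^ (r+3) * sg v b u (k-(i+1)) z) := by
      intro z hz
      have h1 := z0 z
      rw [abs_of_nonneg (by positivity)]
      by_cases hz0 : ζ z = 0
      · rw [hz0]; simp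
      obtain ⟨hbd, heq⟩ := hpt z hz0 hz
      have := pw_est Q hQ (by linarith) hA hη hu hz hbd heq k (by omega)
      have := mul_le_mul_of_nonneg_left this (by positivity : 0 ≤ ζ z ^ (r+3))
      refine this.trans (le_of_eq ?_)
      unfold EE
      rw [max_eq_left hz.le]
      have p1 : ∀ x : ι → ℝ, ∑ j, ζ z ^ (r+3) * x j = ζ z ^ (r+3) * ∑ j, x j := fun x => by rw [Finset.mul_sum]
      have p2 : ∀ x : ι → ι → ℝ, ∑ j, ∑ l, ζ z ^ (r+3) * x j l = ζ z ^ (r+3) * ∑ j, ∑ l, x j l := fun x => by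
        simp only [Finset.mul_sum]
      have p3 : ∀ x : ℕ → ℝ, ∑ i ∈ Finset.range k, cw A k (i+1) * (ζ z ^ (r+3) * x i) =
          ζ z ^ (r+3) * ∑ i ∈ Finset.range k, cw A k (i+1) * x i := fun x => by
        rw [Finset.mul_sum]; refine Finset.sum_congr rfl fun i _ => by ring
      simp only [mul_assoc (ζ z ^ (r+3))]
      rw [p1 (fun j => √(X z) * ‖dd v (dd (b j) U) z‖), p1, p2, p3]
      rw [hF, hU]
      ring
    have cca := cc_mul_left (f := fun _ => C * F) continuous_const q8
    have ccb1 := cc_add (cc_add (cc_add q1 (cc_mul_left (f := fun _ => (k:ℝ)) continuous_const q2)) (cc_sum _ q3)) (cc_sum _ q4)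
    have ccb := cc_mul_left (f := fun _ => η) continuous_const ccb1
    have ccc1 := cc_add (cc_add q2 (cc_mul_left (f := fun _ => ((k+1 : ℕ) : ℝ)) continuous_const (cc_sum _ q5))) q6
    have ccc := cc_mul_left (f := fun _ => C * A) continuous_const ccc1
    have ccd1 := cc_sum _ q7
    have ccd := cc_mul_left (f := fun _ => 6 * (C * A)) continuous_const ccd1
    refine (NN_mono μ X (cc_w (hcut.cc (r+2)) (MM_cont hUs)) (cc_add (cc_add cca (cc_add ccb ccc)) ccd) big).trans ?_
    refine (NN_add μ X (cc_add cca (cc_add ccb ccc)) ccd).trans ?_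
    refine add_le_add ((NN_add μ X cca (cc_add ccb ccc)).trans (add_le_add ?_ ((NN_add μ X ccb ccc).trans
      (add_le_add ?_ ?_)))) ?_
    · rw [NN_const_mul _ _ _ (by positivity)]
      refine mul_le_mul_of_nonneg_left ?_ (by positivity)
      refine NN_mono μ X q8 ⟨hcut.sm.continuous, hcut.cpt⟩ fun z _ => ?_
      have := z0 z
      rw [abs_of_nonneg (by positivity)]
      exact pow_le_of_le_one this (z1 z) (by omega)
    · rw [NN_const_mul _ _ _ hη]
      refine mul_le_mul_of_nonneg_left ?_ hη
      rw [TTd]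
      refine (NN_add μ X (cc_add (cc_add q1 (cc_mul_left continuous_const q2)) (cc_sum _ q3)) (cc_sum _ q4)).trans
        (add_le_add ((NN_add μ X (cc_add q1 (cc_mul_left continuous_const q2)) (cc_sum _ q3)).trans
        (add_le_add ((NN_add μ X q1 (cc_mul_left continuous_const q2)).trans (add_le_add le_rfl ?_)) ?_)) ?_)
      · rw [NN_const_mul _ _ _ (by positivity)]; rfl
      · exact NN_sum μ X _ q3
      · refine (NN_sum μ X _ q4).trans (Finset.sum_le_sum fun j _ => NN_sum μ X _ (q4' j))
    · rw [NN_const_mul _ _ _ (by positivity)]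
      refine mul_le_mul_of_nonneg_left ?_ (by positivity)
      refine (NN_add μ X (cc_add q2 (cc_mul_left continuous_const (cc_sum _ q5))) q6).trans
        (add_le_add ((NN_add μ X q2 (cc_mul_left continuous_const (cc_sum _ q5))).trans
        (add_le_add le_rfl ?_)) le_rfl)
      rw [NN_const_mul _ _ _ ckk]
      exact mul_le_mul_of_nonneg_left (NN_sum μ X _ q5) ckk
    · rw [NN_const_mul _ _ _ (by positivity)]
      exact mul_le_mul_of_nonneg_left EEs (by positivity)
  -- bound of s k
  have hsk : s k ≤ ((k+1 : ℕ) : ℝ) * Nv + ((k+1 : ℕ) : ℝ) * Nj + Njl + Nu := by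
    have e : (fun z => ζ z ^ (2*k+2) * sg v b u k z) = fun z => ((k+1 : ℕ) : ℝ) * (ζ z ^ (r+3) * ‖dd v U z‖)
        + ((k+1 : ℕ) : ℝ) * (∑ j, ζ z ^ (r+3) * ‖dd (b j) U z‖)
        + (∑ j, ∑ l, ζ z ^ (r+3) * ‖dd (b j) (dd (b l) U) z‖) + ζ z ^ (r+3) * ‖U z‖ := by
      funext z
      unfold sg
      simp only [← Finset.mul_sum]
      rw [hrk, hU]; ring
    rw [hs]; unfold ss; rw [e]
    have ca := cc_mul_left (f := fun _ => ((k+1 : ℕ) : ℝ)) continuous_const q2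
    have cb := cc_mul_left (f := fun _ => ((k+1 : ℕ) : ℝ)) continuous_const (cc_sum _ q5)
    have cc := cc_sum _ q4
    refine (NN_add μ X (cc_add (cc_add ca cb) cc) q6).trans (add_le_add ((NN_add μ X (cc_add ca cb) cc).trans
      (add_le_add ((NN_add μ X ca cb).trans (add_le_add ?_ ?_)) ?_)) le_rfl)
    · rw [NN_const_mul _ _ _ ckk]; rfl
    · rw [NN_const_mul _ _ _ ckk]
      exact mul_le_mul_of_nonneg_left (NN_sum μ X _ q5) ckk
    · refine (NN_sum μ X _ q4).trans (Finset.sum_le_sum fun j _ => NN_sum μ X _ (q4' j))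
  have hn0m : n0 ≤ m := by
    rw [hm]
    have h1 : (1:ℝ) ≤ ((r+3 : ℕ) : ℝ)^2 := 
      one_le_pow₀ (by exact_mod_cast (by omega : 1 ≤ r + 3))
    exact le_mul_of_one_le_left n00 h1
  have hkpos : (0:ℝ) < k := by exact_mod_cast (by omega : 0 < k)
  have x1 : 4 * C0 * (η * T) ≤ T / 4 := by
    have := mul_le_mul_of_nonneg_right hη1 T0
    linarith
  have x2 : 4 * C0 * (C * A * Nv) ≤ T / 4 := by
    have : 16 * C0 * (C * A) * Nv ≤ k * Nv := mul_le_mul_of_nonneg_right kbig Nv0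
    linarith
  have x3 : 4 * C0 * (C * A * Y) ≤ T / 4 + 4 * C0 * (C * A * (Cε * m)) := by
    have h1 := mul_le_mul_of_nonneg_left hY (by positivity : 0 ≤ 4 * C0 * (C * A))
    have h2 : 4 * C0 * (C * A) * ε = 1/4 := by
      rw [hε]; field_simp; norm_num
    calc _ = 4 * C0 * (C * A) * Y := by ring
      _ ≤ _ := h1
      _ = 4 * C0 * (C * A) * ε * T + 4 * C0 * (C * A * (Cε * m)) := by ring
      _ = _ := by rw [h2]; ring
  have x4 : T ≤ K1 * (F + EE A s k) := by
    have h1 : T ≤ 4 * C0 * (C * F * Z + (η * T + C * A * (Nv + Y + m)) + 6 * (C * A) * EE A s k) + C2 * m := by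
      refine hT'.trans ?_
      gcongr
      refine hQ1.trans ?_
      gcongr
      linarith
    have h2 : T ≤ 4 * (4 * C0 * (C * F * Z + C * A * (Cε * m) + C * A * m + 6 * (C * A) * EE A s k) + C2 * m) := by
      have e1 : 4 * C0 * (C * F * Z + (η * T + C * A * (Nv + Y + m)) + 6 * (C * A) * EE A s k)
        = 4 * C0 * (η * T) + 4 * C0 * (C * A * Nv) + 4 * C0 * (C * A * Y) + 
          4 * C0 * (C * F * Z + C * A * m + 6 * (C * A) * EE A s k) := by ring
      have e2 : 4 * (4 * C0 * (C * F * Z + C * A * (Cε * m) + C * A * m + 6 * (C * A) * EE A s k) + C2 * m) =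
        4 * (4 * C0 * (C * F * Z + C * A * m + 6 * (C * A) * EE A s k) + 4 * C0 * (C * A * (Cε * m)) + C2 * m) := by
        ring
      rw [e1] at h1
      rw [e2]
      linarith
    refine h2.trans ?_
    have h3 : C * F * Z + C * A * (Cε * m) + C * A * m + 6 * (C * A) * EE A s k ≤
        (C * Z + C * A * Cε * 16 + C * A * 16 + 6 * (C * A)) * (F + EE A s k) := by
      have y1 : C * A * (Cε * m) ≤ C * A * (Cε * (16 * EE A s k)) := by gcongr
      have y2 : C * A * m ≤ C * A * (16 * EE A s k) := by gcongr
      have y3 : 0 ≤ C * Z * EE A s k := by positivity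
      have y4 : 0 ≤ C * A * Cε * 16 * F := by positivity
      have y5 : 0 ≤ C * A * 16 * F := by positivity
      have y6 : 0 ≤ 6 * (C * A) * F := by positivity
      have e1 : (C * Z + C * A * Cε * 16 + C * A * 16 + 6 * (C * A)) * (F + EE A s k) =
        C * F * Z + C * A * (Cε * (16 * EE A s k)) + C * A * (16 * EE A s k) + 6 * (C * A) * EE A s k
        + C * Z * EE A s k + C * A * Cε * 16 * F + C * A * 16 * F + 6 * (C * A) * F := by ring
      rw [e1]
      linarith
    have h4 : C2 * m ≤ 16 * C2 * (F + EE A s k) := by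
      have : C2 * m ≤ C2 * (16 * EE A s k) := by gcongr
      have : 0 ≤ 16 * C2 * F := by positivity
      linarith
    have h5 := mul_le_mul_of_nonneg_left h3 (by positivity : 0 ≤ 4 * C0)
    rw [hK1]
    linarith
  have x5 : ((k+1 : ℕ) : ℝ) * Nv + Njl ≤ 2 * T := by
    have : ((k+1 : ℕ) : ℝ) * Nv ≤ 2 * (k * Nv) := by
      have : ((k+1 : ℕ) : ℝ) ≤ 2 * k := by exact_mod_cast (by omega : k + 1 ≤ 2 * k)
      have := mul_le_mul_of_nonneg_right this Nv0
      linarith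
    linarith
  have x6 : Y ≤ T + Cε * m := by
    have hle : (1 + (d:ℝ)) / 1 + 2 * c * (1 + d) ≤ Cε := by
      rw [hCε]
      have : ε ≤ 1 := by
        rw [hε, div_le_one (by positivity)]
        have : 1 ≤ C0 * (C * A) := one_le_mul_of_one_le_of_one_le C00 CA1
        linarith
      gcongr
    have := mul_le_mul_of_nonneg_right hle m0
    linarith
  have x7 : s k ≤ 3 * T + (Cε + 1) * m := by
    have e1 : (Cε + 1) * m = Cε * m + m := by ring
    rw [e1]; linarith
  have x8 : (Cε + 1) * m ≤ (Cε + 1) * (16 * EE A s k) := by gcongr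
  have x9 : 0 ≤ (16 * (Cε + 1)) * F := by positivity
  have x10 : 0 ≤ F + EE A s k := by positivity
  have e1 : (3 * K1 + 16 * (Cε + 1) + 1) * (F + EE A s k) = 3 * (K1 * (F + EE A s k)) + 16 * (Cε + 1) * F
    + (Cε + 1) * (16 * EE A s k) + (F + EE A s k) := by ring
  rw [e1]
  linarith
end
end HM

namespace HM
open MeasureTheory Filter Topology

section
variable {E : Type*} [NormedAddCommGroup E] [NormedSpace ℝ E]
  {F : Type*} [NormedAddCommGroup F] [NormedSpace ℝ F]

lemma iter_smooth {f : E → F} (hf : ContDiff ℝ ∞ f) (m : ℕ) : ContDiff ℝ ∞ (iteratedFDeriv ℝ m f) :=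
  hf.iteratedFDeriv_right (m := ∞) (by norm_cast)

lemma iter_apply_smooth {f : E → F} (hf : ContDiff ℝ ∞ f) (m : ℕ) (a : Fin m → E) :
    ContDiff ℝ ∞ (fun z => iteratedFDeriv ℝ m f z a) :=
  ((ContinuousMultilinearMap.apply ℝ (fun _ : Fin m => E) F a).contDiff).comp (iter_smooth hf m)

lemma dd_iter {f : E → F} (hf : ContDiff ℝ ∞ f) (m : ℕ) (a : Fin m → E) (w : E) :
    dd w (fun z => iteratedFDeriv ℝ m f z a) = fun z => iteratedFDeriv ℝ (m+1) f z (Fin.cons w a) := by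
  funext z
  unfold dd
  have h : HasFDerivAt (fun z => iteratedFDeriv ℝ m f z a)
      ((ContinuousMultilinearMap.apply ℝ (fun _ : Fin m => E) F a).comp (fderiv ℝ (iteratedFDeriv ℝ m f) z)) z :=
    (ContinuousMultilinearMap.apply ℝ (fun _ : Fin m => E) F a).hasFDerivAt.comp z
      (sm_diff (iter_smooth hf m) z).hasFDerivAt
  rw [h.fderiv, iteratedFDeriv_succ_apply_left]
  simp

lemma ddit_iter {f : E → F} (hf : ContDiff ℝ ∞ f) (m : ℕ) (v z : E) :
    (dd v)^[m] f z = iteratedFDeriv ℝ m f z (fun _ => v) := by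
  have : (dd v)^[m] f = fun z => iteratedFDeriv ℝ m f z (fun _ => v) := by
    induction m with
    | zero => funext z; simp
    | succ m ih =>
      rw [Function.iterate_succ_apply', ih, dd_iter hf]
      funext z
      congr 1
      funext i
      refine Fin.cases ?_ (fun j => ?_) i <;> simp
  rw [this]

lemma sig_le {β : ℕ → Type*} (f : (Σ k, β k) → NNReal) (hf : Summable f) (k : ℕ) :
    ∑' b, f ⟨k, b⟩ ≤ ∑' s, f s :=
  NNReal.tsum_comp_le_tsum_of_inj hf sigma_mk_injective

lemma an_bound [CompleteSpace F] {f : E → F} {x : E} (h : AnalyticAt ℝ f x) :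
    ∃ C A : ℝ, 1 ≤ C ∧ 1 ≤ A ∧ ∀ᶠ z in 𝓝 x, ∀ (k : ℕ) (v : E),
      ‖iteratedFDeriv ℝ k f z (fun _ => v)‖ ≤ C * (A * ‖v‖)^k * k.factorial := by
  obtain ⟨P, r, hP⟩ := h
  have hr0 : 0 < P.radius := hP.r_pos.trans_le hP.r_le
  obtain ⟨ρ, hρ0, hρ⟩ := ENNReal.lt_iff_exists_nnreal_btwn.1 hr0
  have hρ0' : 0 < ρ := by exact_mod_cast hρ0
  have hsum : ((ρ/2 : NNReal) + (ρ/2 : NNReal) : ENNReal) < P.radius := by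
    rw [← ENNReal.coe_add, add_halves]; exact hρ
  have hS := P.changeOriginSeries_summable_aux₁ hsum
  set t := ρ/2 with ht
  have t0 : 0 < t := by positivity
  set M : NNReal := ∑' s : Σ k l : ℕ, { s : Finset (Fin (k + l)) // s.card = l },
      ‖P (s.1 + s.2.1)‖₊ * t ^ s.2.1 * t ^ s.1 with hM
  have key : ∀ y : E, ‖y‖₊ ≤ t → ∀ k, ‖P.changeOrigin y k‖₊ * t^k ≤ M := by
    intro y hy k
    have hyr : (‖y‖₊ : ENNReal) < P.radius := by
      refine lt_of_le_of_lt ?_ hsum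
      exact le_trans (by exact_mod_cast hy) (le_add_right le_rfl)
    have h1 := P.nnnorm_changeOrigin_le k hyr
    have htr : (t : ENNReal) < P.radius := lt_of_le_of_lt (le_add_right le_rfl) hsum
    have h2 : ∑' s : Σ l : ℕ, { s : Finset (Fin (k + l)) // s.card = l }, ‖P (k + s.1)‖₊ * ‖y‖₊ ^ s.1
        ≤ ∑' s : Σ l : ℕ, { s : Finset (Fin (k + l)) // s.card = l }, ‖P (k + s.1)‖₊ * t ^ s.1 := by
      refine Summable.tsum_le_tsum (fun s => by gcongr) (P.changeOriginSeries_summable_aux₂ hyr k) 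
        (P.changeOriginSeries_summable_aux₂ htr k)
    refine (mul_le_mul_left (h1.trans h2) (t^k)).trans ?_
    refine le_trans (le_of_eq ?_) (sig_le _ hS k)
    exact (NNReal.tsum_mul_right (fun s : Σ l : ℕ, { s : Finset (Fin (k + l)) // s.card = l } =>
      ‖P (k + s.1)‖₊ * t ^ s.1) (t^k)).symm
  refine ⟨M + 1, 1 / t + 1, by simp, by simp, ?_⟩
  have hev : ∀ᶠ z in 𝓝 x, ‖z - x‖ < t ∧ z - x ∈ Metric.eball (0:E) r := by
    have h1 : Tendsto (fun z => z - x) (𝓝 x) (𝓝 0) := by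
      have : Continuous fun z : E => z - x := by fun_prop
      simpa using this.tendsto x
    have h2 := h1 (Metric.ball_mem_nhds (0:E) (ε := t) (by exact_mod_cast t0))
    have h3 := h1 (Metric.eball_mem_nhds (0:E) hP.r_pos)
    filter_upwards [h2, h3] with z hz hz'
    exact ⟨by simpa using hz, hz'⟩
  filter_upwards [hev] with z hz k v
  have h1 := hP.changeOrigin (y := z - x) (by simpa [enorm_eq_nnnorm] using hz.2)
  rw [add_sub_cancel] at h1
  rw [← h1.factorial_smul v k]
  have h2 : ‖P.changeOrigin (z - x) k‖ * t^k ≤ M := by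
    exact_mod_cast key (z - x) (by exact_mod_cast hz.1.le) k
  have t0' : (0:ℝ) < t := by exact_mod_cast t0
  have h3 : ‖P.changeOrigin (z - x) k‖ ≤ (M + 1) * (1/t+1)^k := by
    calc ‖P.changeOrigin (z - x) k‖ = (‖P.changeOrigin (z - x) k‖ * t^k) * (1/t)^k := by
          rw [mul_assoc, ← mul_pow]; field_simp; simp
      _ ≤ (M+1) * (1/t+1)^k := by
          gcongr
          · linarith
          · linarith
  have h4 := (P.changeOrigin (z - x) k).le_opNorm (fun _ => v)
  simp only [Finset.prod_const, Finset.card_univ, Fintype.card_fin] at h4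
  rw [← Nat.cast_smul_eq_nsmul ℝ, norm_smul, mul_pow]
  simp only [RCLike.norm_natCast]
  calc (k.factorial : ℝ) * ‖P.changeOrigin (z - x) k fun _ => v‖ ≤ k.factorial * ((M + 1) * (1/t+1)^k * ‖v‖^k) := by
        gcongr; exact h4.trans (by gcongr)
    _ = _ := by ring

end
end HM

namespace HM
open MeasureTheory Filter Topology

section
variable {E : Type*} [NormedAddCommGroup E] [NormedSpace ℝ E]
  {F : Type*} [NormedAddCommGroup F] [NormedSpace ℝ F]

lemma line_hasDeriv {u : E → F} (hu : ContDiff ℝ ∞ u) (q h : E) (t : ℝ) :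
    HasDerivAt (fun s : ℝ => u (q + s • h)) (dd h u (q + t • h)) t := by
  have h1 : HasDerivAt (fun s : ℝ => q + s • h) h t := by
    simpa using ((hasDerivAt_id t).smul_const h).const_add q
  exact (sm_diff hu _).hasFDerivAt.comp_hasDerivAt t h1

lemma line_iter {u : E → F} (hu : ContDiff ℝ ∞ u) (q h : E) (k : ℕ) :
    iteratedDeriv k (fun s : ℝ => u (q + s • h)) = fun t => (dd h)^[k] u (q + t • h) := by
  induction k with
  | zero => simp
  | succ k ih =>
    rw [iteratedDeriv_succ, ih]
    funext t
    rw [(line_hasDeriv (ddit_smooth hu k) q h t).deriv, Function.iterate_succ_apply']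

lemma line_smooth {u : E → F} (hu : ContDiff ℝ ∞ u) (q h : E) :
    ContDiff ℝ ∞ (fun s : ℝ => u (q + s • h)) := hu.comp (by fun_prop)

lemma an_of_bound [CompleteSpace F] {u : E → F} (hu : ContDiff ℝ ∞ u) {q : E} {r C R : ℝ} (hr : 0 < r)
    (hR : 0 < R) (hC : 0 ≤ C)
    (h : ∀ z ∈ Metric.ball q r, ∀ m : ℕ, ‖iteratedFDeriv ℝ m u z‖ ≤ C * R^m * m.factorial) :
    ∃ w : E → F, AnalyticOnNhd ℝ w (Metric.ball q (1/R)) ∧ w =ᶠ[𝓝 q] u := by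
  set P : FormalMultilinearSeries ℝ E F := fun m => (m.factorial : ℝ)⁻¹ • iteratedFDeriv ℝ m u q with hP
  have hPn : ∀ m, ‖P m‖ ≤ C * R^m := by
    intro m
    rw [hP]; simp only [norm_smul, norm_inv, RCLike.norm_natCast]
    rw [inv_mul_le_iff₀ (by positivity)]
    exact (h q (Metric.mem_ball_self hr) m).trans (le_of_eq (by ring))
  obtain ⟨ρ, hρ⟩ : ∃ ρ : NNReal, (ρ : ℝ) = 1/R := ⟨⟨1/R, by positivity⟩, rfl⟩
  have hρ0 : 0 < ρ := by rw [← NNReal.coe_pos, hρ]; positivity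
  have hrad : (ρ : ENNReal) ≤ P.radius := by
    refine P.le_radius_of_bound C fun m => ?_
    calc _ ≤ C * R^m * (1/R)^m := by rw [hρ]; gcongr; exact hPn m
      _ = C := by rw [mul_assoc, ← mul_pow]; field_simp; simp
  have hrad0 : 0 < P.radius := lt_of_lt_of_le (by exact_mod_cast hρ0) hrad
  have hPs := P.hasFPowerSeriesOnBall hrad0
  refine ⟨fun z => P.sum (z - q), ?_, ?_⟩
  · intro z hz
    have h1 : AnalyticAt ℝ P.sum (z - q) := by
      refine hPs.analyticAt_of_mem (Metric.eball_subset_eball hrad ?_)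
      rw [Metric.mem_ball, dist_eq_norm] at hz
      rw [mem_eball_zero_iff, enorm_eq_nnnorm]
      rw [← hρ] at hz
      exact_mod_cast hz
    have h2 : AnalyticAt ℝ (fun z : E => z - q) z := by fun_prop
    exact AnalyticAt.fun_comp (g := P.sum) (f := fun z : E => z - q) h1 h2
  · have hev : ∀ᶠ z in 𝓝 q, z ∈ Metric.ball q (min r (1/(2*R))) :=
      Metric.ball_mem_nhds q (by positivity)
    filter_upwards [hev] with z hz
    rw [Metric.mem_ball, dist_eq_norm, lt_min_iff] at hz
    set y := z - q with hy
    have hyq : q + y = z := by rw [hy]; abel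
    have e1 : HasSum (fun m => P m fun _ => y) (P.sum y) := by
      have := hPs.hasSum (y := y) (Metric.eball_subset_eball hrad (by
        rw [mem_eball_zero_iff, enorm_eq_nnnorm]
        have : ‖y‖ < 1/R := hz.2.trans (by apply one_div_lt_one_div_of_lt hR; linarith)
        rw [← hρ] at this
        exact_mod_cast this))
      simpa using this
    have e2 := e1.tendsto_sum_nat.comp (tendsto_add_atTop_nat 1)
    refine tendsto_nhds_unique e2 ?_
    rw [tendsto_iff_norm_sub_tendsto_zero]
    have hx : R * ‖y‖ ≤ 1/2 := by
      have := hz.2.le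
      rw [le_div_iff₀ (by positivity)] at this
      linarith
    have hx0 : 0 ≤ R * ‖y‖ := by positivity
    have lim : Tendsto (fun n : ℕ => C * (((n+1 : ℕ):ℝ) * (R * ‖y‖)^(n+1))) atTop (𝓝 0) := by
      have := (tendsto_self_mul_const_pow_of_lt_one hx0 (by linarith)).comp (tendsto_add_atTop_nat 1)
      simpa using this.const_mul C
    refine squeeze_zero (fun _ => norm_nonneg _) (fun n => ?_) lim
    have hT := taylor_mean_remainder_bound (f := fun s : ℝ => u (q + s • y)) (a := 0) (b := 1) (x := 1) (n := n)
      (C := C * (R * ‖y‖)^(n+1) * (n+1).factorial) zero_le_one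
      ((line_smooth hu q y).contDiffOn.of_le (by exact_mod_cast le_top)) (by simp) (by
        intro t ht
        rw [iteratedDerivWithin_eq_iteratedDeriv (uniqueDiffOn_Icc zero_lt_one)
          ((line_smooth hu q y).contDiffAt.of_le (by exact_mod_cast le_top)) ht, line_iter hu]
        simp only []
        rw [ddit_iter hu]
        have hm : q + t • y ∈ Metric.ball q r := by
          rw [Metric.mem_ball, dist_eq_norm, add_sub_cancel_left, norm_smul, Real.norm_eq_abs, abs_of_nonneg ht.1]
          nlinarith [ht.2, norm_nonneg y]
        have h1 := (iteratedFDeriv ℝ (n+1) u (q + t • y)).le_opNorm (fun _ => y)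
        simp only [Finset.prod_const, Finset.card_univ, Fintype.card_fin] at h1
        refine h1.trans ?_
        calc _ ≤ C * R^(n+1) * (n+1).factorial * ‖y‖^(n+1) := by gcongr; exact h _ hm _
          _ = _ := by rw [mul_pow]; ring)
    rw [taylor_within_apply] at hT
    have e3 : ∑ k ∈ Finset.range (n + 1), (((k.factorial : ℕ) : ℝ)⁻¹ * (1 - 0) ^ k) •
        iteratedDerivWithin k (fun s : ℝ => u (q + s • y)) (Icc 0 1) 0 = ∑ k ∈ Finset.range (n+1), P k fun _ => y := by
      refine Finset.sum_congr rfl fun k _ => ?_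
      rw [iteratedDerivWithin_eq_iteratedDeriv (uniqueDiffOn_Icc zero_lt_one)
          ((line_smooth hu q y).contDiffAt.of_le (by exact_mod_cast le_top)) (by simp), line_iter hu]
      simp only []
      rw [ddit_iter hu, hP]; simp
    rw [e3] at hT
    simp only [Function.comp]
    rw [norm_sub_rev]
    simp only [one_smul, hyq] at hT
    refine hT.trans (le_of_eq ?_)
    rw [Nat.factorial_succ]; push_cast
    have : (n.factorial : ℝ) ≠ 0 := by positivity
    field_simp
    simp
end

section
variable {H : Type*} [NormedAddCommGroup H] [NormedSpace ℝ H]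

/-- all coordinate derivatives in a list -/
def Dl {d : ℕ} (l : List (Fin d)) (F : (Fin d → ℝ) → H) : (Fin d → ℝ) → H :=
  l.foldr (fun i G => dd (Pi.single i 1) G) F

lemma Dl_smooth {d : ℕ} (l : List (Fin d)) {F : (Fin d → ℝ) → H} (hF : ContDiff ℝ ∞ F) :
    ContDiff ℝ ∞ (Dl l F) := by
  induction l with
  | nil => simpa [Dl]
  | cons i l ih => exact dd_smooth ih

lemma Dl_cpt {d : ℕ} (l : List (Fin d)) {F : (Fin d → ℝ) → H} (hF : HasCompactSupport F) :
    HasCompactSupport (Dl l F) := by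
  induction l with
  | nil => simpa [Dl]
  | cons i l ih => exact dd_cpt ih

lemma cons_fderiv {d : ℕ} (t : ℝ) (y : Fin d → ℝ) (G : (Fin (d+1) → ℝ) → H) (hG : ContDiff ℝ ∞ G) (i : Fin d) :
    dd (Pi.single i 1) (fun y => G (Fin.cons t y)) y = dd (Pi.single i.succ 1) G (Fin.cons t y) := by
  have h1 : HasFDerivAt (fun y : Fin d → ℝ => (Fin.cons t y : Fin (d+1) → ℝ))
      (ContinuousLinearMap.pi (fun k : Fin (d+1) => 
        (Fin.cons (0 : (Fin d → ℝ) →L[ℝ] ℝ) (fun j => ContinuousLinearMap.proj j) : Fin (d+1) → ((Fin d → ℝ) →L[ℝ] ℝ)) k)) y := by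
    rw [hasFDerivAt_pi]
    intro k
    refine Fin.cases ?_ (fun j => ?_) k
    · simp only [Fin.cons_zero]; exact hasFDerivAt_const _ _
    · simp only [Fin.cons_succ]; exact (ContinuousLinearMap.proj (R := ℝ) (φ := fun _ : Fin d => ℝ) j).hasFDerivAt
  unfold dd
  have h2 := (sm_diff hG (Fin.cons t y)).hasFDerivAt.comp y h1
  have h3 : fderiv ℝ (fun y => G (Fin.cons t y)) y = _ := h2.fderiv
  rw [h3]
  simp only [ContinuousLinearMap.comp_apply]
  congr 1
  funext k
  refine Fin.cases ?_ (fun j => ?_) k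
  · simp [Fin.succ_ne_zero]
  · simp [Pi.single_apply]

lemma cons_Dl {d : ℕ} (t : ℝ) (G : (Fin (d+1) → ℝ) → H) (hG : ContDiff ℝ ∞ G) (l : List (Fin d)) :
    Dl l (fun y => G (Fin.cons t y)) = fun y => Dl (l.map Fin.succ) G (Fin.cons t y) := by
  induction l with
  | nil => rfl
  | cons i l ih =>
    have : Dl (i :: l) (fun y => G (Fin.cons t y)) = dd (Pi.single i 1) (Dl l (fun y => G (Fin.cons t y))) := rfl
    rw [this, ih]
    funext y
    rw [cons_fderiv t y _ (Dl_smooth _ hG)]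
    rfl

lemma cons_line {d : ℕ} (t : ℝ) (y : Fin d → ℝ) : (Fin.cons t y : Fin (d+1) → ℝ) =
    (Fin.cons 0 y : Fin (d+1) → ℝ) + t • (Pi.single 0 1 : Fin (d+1) → ℝ) := by
  funext k
  refine Fin.cases ?_ (fun j => ?_) k <;> simp

lemma sobolev (d : ℕ) {F : (Fin d → ℝ) → H} (hF : ContDiff ℝ ∞ F) (hc : HasCompactSupport F) (z : Fin d → ℝ) :
    ‖F z‖ₑ ≤ ∫⁻ y, ‖Dl (List.finRange d) F y‖ₑ := by
  induction d with
  | zero =>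
    have : ∀ y, ‖Dl (List.finRange 0) F y‖ₑ = ‖F z‖ₑ := fun y => by
      rw [Subsingleton.elim y z]; simp [Dl]
    simp only [this]
    rw [lintegral_const, volume_pi, Measure.pi_univ]; simp
  | succ d ih =>
    obtain ⟨t, y, rfl⟩ : ∃ t y, z = Fin.cons t y := ⟨z 0, Fin.tail z, (Fin.cons_self_tail z).symm⟩
    have hcons : Continuous (fun y : Fin d → ℝ => (Fin.cons t y : Fin (d+1) → ℝ)) := by
      refine continuous_pi fun k => ?_
      refine Fin.cases ?_ (fun j => ?_) k
      · simpa using continuous_const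
      · simpa using continuous_apply j
    have hce : IsClosedEmbedding (fun y : Fin d → ℝ => (Fin.cons t y : Fin (d+1) → ℝ)) := by
      refine IsClosedEmbedding.of_continuous_injective_isClosedMap hcons (fun a b hab => by
        funext j; simpa using congrFun hab j.succ) ?_
      intro s hs
      have : (fun y : Fin d → ℝ => (Fin.cons t y : Fin (d+1) → ℝ)) '' s =
          {w | w 0 = t} ∩ (fun w : Fin (d+1) → ℝ => Fin.tail w) ⁻¹' s := by
        ext w; constructor
        · rintro ⟨y, hy, rfl⟩; simpa [Fin.tail] using hy
        · rintro ⟨h1, h2⟩; exact ⟨Fin.tail w, h2, by rw [← h1]; exact Fin.cons_self_tail w⟩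
      rw [this]
      refine (isClosed_eq (continuous_apply 0) continuous_const).inter (hs.preimage ?_)
      exact continuous_pi fun j => continuous_apply _
    have hs : ContDiff ℝ ∞ (fun y : Fin d → ℝ => (Fin.cons t y : Fin (d+1) → ℝ)) := by
      rw [contDiff_pi]
      intro k
      refine Fin.cases ?_ (fun j => ?_) k
      · simpa using contDiff_const
      · simpa using contDiff_apply ℝ ℝ j
    have h1 := ih (F := fun y => F (Fin.cons t y)) (hF.comp hs) (hc.comp_isClosedEmbedding hce) y
    rw [cons_Dl t F hF] at h1
    set G := Dl ((List.finRange d).map Fin.succ) F with hG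
    have hGs : ContDiff ℝ ∞ G := Dl_smooth _ hF
    have hGc : HasCompactSupport G := Dl_cpt _ hc
    have hfin : Dl (List.finRange (d+1)) F = dd (Pi.single 0 1) G := by
      rw [List.finRange_succ]; rfl
    rw [hfin]
    have h2 : ∀ y : Fin d → ℝ, ‖G (Fin.cons t y)‖ₑ ≤ ∫⁻ s : ℝ, ‖dd (Pi.single 0 1) G (Fin.cons s y)‖ₑ := by
      intro y
      have hd : ∀ s, HasDerivAt (fun s : ℝ => G (Fin.cons s y)) (dd (Pi.single 0 1) G (Fin.cons s y)) s := by
        intro s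
        have := line_hasDeriv hGs (Fin.cons 0 y) (Pi.single 0 1) s
        simpa only [← cons_line] using this
      have hsm : ContDiff ℝ 1 (fun s : ℝ => G (Fin.cons s y)) := by
        have := (line_smooth hGs (Fin.cons 0 y) (Pi.single 0 1)).of_le (m := 1) (by norm_cast)
        simpa only [← cons_line] using this
      have hcc : HasCompactSupport (fun s : ℝ => G (Fin.cons s y)) := by
        have hK : IsCompact ((fun w : Fin (d+1) → ℝ => w 0) '' tsupport G) := hGc.isCompact.image (continuous_apply 0)
        refine HasCompactSupport.intro hK fun s hs => ?_
        by_contra hne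
        exact hs ⟨Fin.cons s y, subset_tsupport _ hne, by simp⟩
      have := hcc.enorm_le_lintegral_Ici_deriv hsm t
      refine this.trans ((setLIntegral_le_lintegral _ _).trans (le_of_eq ?_))
      simp only [(hd _).deriv]
    refine h1.trans ((lintegral_mono h2).trans (le_of_eq ?_))
    have hm : Continuous (fun w => ‖dd (Pi.single 0 1) G w‖ₑ) := (dd_smooth hGs).continuous.enorm
    have e := (volume_preserving_piFinSuccAbove (fun _ : Fin (d + 1) => ℝ) 0).symm
    rw [← e.lintegral_comp hm.measurable, Measure.volume_eq_prod, lintegral_prod_symm]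
    · refine lintegral_congr fun y => lintegral_congr fun s => ?_
      congr 2
      funext k
      simp [MeasurableEquiv.piFinSuccAbove, Fin.insertNthEquiv]
    · exact (hm.measurable.comp e.measurable).aemeasurable
end
end HM

namespace HM
open MeasureTheory Filter Topology

section
variable {E : Type*} [NormedAddCommGroup E] [NormedSpace ℝ E]
  {F : Type*} [NormedAddCommGroup F] [NormedSpace ℝ F]

/-- derivative along a word -/
def WW (l : List E) (u : E → F) : E → F := l.foldr dd u

lemma WW_smooth (l : List E) {u : E → F} (hu : ContDiff ℝ ∞ u) : ContDiff ℝ ∞ (WW l u) := by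
  induction l with
  | nil => simpa [WW]
  | cons i l ih => exact dd_smooth ih

lemma WW_perm {l l' : List E} (h : l.Perm l') {u : E → F} (hu : ContDiff ℝ ∞ u) : WW l u = WW l' u := by
  induction h with
  | nil => rfl
  | cons x h ih => show dd x (WW _ u) = dd x (WW _ u); rw [ih]
  | swap x y l => show dd y (dd x (WW l u)) = dd x (dd y (WW l u)); exact dd_comm (WW_smooth l hu)
  | trans h1 h2 ih1 ih2 => exact ih1.trans ih2

lemma iter_WW {u : E → F} (hu : ContDiff ℝ ∞ u) (m : ℕ) (a : Fin m → E) :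
    (fun z => iteratedFDeriv ℝ m u z a) = WW (List.ofFn a) u := by
  induction m with
  | zero => funext z; simp [WW]
  | succ m ih =>
    rw [List.ofFn_succ]
    show _ = dd (a 0) (WW _ u)
    rw [← ih, dd_iter hu]
    funext z
    congr 1
    exact (Fin.cons_self_tail a).symm

lemma iter_perm {u : E → F} (hu : ContDiff ℝ ∞ u) (m : ℕ) (a : Fin m → E) (s : Equiv.Perm (Fin m)) (z : E) :
    iteratedFDeriv ℝ m u z (a ∘ s) = iteratedFDeriv ℝ m u z a := by
  have h1 := congrFun (iter_WW hu m (a ∘ s)) z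
  have h2 := congrFun (iter_WW hu m a) z
  rw [h1, h2, WW_perm (Equiv.Perm.ofFn_comp_perm s a) hu]

lemma pol {m : ℕ} (f : MultilinearMap ℝ (fun _ : Fin m => E) F)
    (hs : ∀ (s : Equiv.Perm (Fin m)) (a : Fin m → E), f (a ∘ s) = f a) (w : E) (v : Fin m → E) :
    ∑ S : Finset (Fin m), ((-1 : ℝ)^(m + S.card)) • f (fun _ => w + ∑ i ∈ S, v i) = (m.factorial : ℝ) • f v := by
  classical
  set x : Option (Fin m) → E := fun o => o.elim w v with hx
  have h1 : ∀ S : Finset (Fin m), f (fun _ => w + ∑ i ∈ S, v i) =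
      ∑ r : Fin m → Option (Fin m), if (∀ i, r i ∈ Finset.insertNone S) then f (fun i => x (r i)) else 0 := by
    intro S
    have : w + ∑ i ∈ S, v i = ∑ o ∈ Finset.insertNone S, x o := by
      rw [Finset.sum_insertNone]; rfl
    rw [this, f.map_sum_finset (fun _ o => x o) (fun _ => Finset.insertNone S), ← Finset.sum_filter]
    refine Finset.sum_congr ?_ fun _ _ => rfl
    ext r; simp [Fintype.mem_piFinset]
  have h2 : ∀ r : Fin m → Option (Fin m), (∑ S : Finset (Fin m), ((-1 : ℝ)^(m + S.card)) •
      if (∀ i, r i ∈ Finset.insertNone S) then f (fun i => x (r i)) else 0) =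
      if (∀ j, ∃ i, r i = some j) then f v else 0 := by
    intro r
    split_ifs with hr
    · -- only S = univ
      rw [Finset.sum_eq_single Finset.univ]
      · rw [if_pos (by intro i; cases h : r i <;> simp)]
        simp only [Finset.card_univ, Fintype.card_fin, ← two_mul]
        rw [pow_mul]; simp only [neg_one_sq, one_pow, one_smul]
        choose g hg using hr
        have ginj : Function.Injective g := fun a b hab => by
          have := (hg a).symm.trans ((congrArg r hab).trans (hg b)); simpa using this
        have gb : Function.Bijective g := Finite.injective_iff_bijective.1 ginj
        set s := Equiv.ofBijective g gb
        have hrs : ∀ i, r i = some (s.symm i) := fun i => by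
          obtain ⟨j, rfl⟩ := gb.2 i
          rw [hg]; congr 1; exact (Equiv.ofBijective_symm_apply_apply g gb j).symm
        have : (fun i => x (r i)) = v ∘ s.symm := by
          funext i; rw [hrs]; rfl
        rw [this, hs]
      · intro S _ hS
        rw [if_neg, smul_zero]
        intro h
        apply hS
        rw [Finset.eq_univ_iff_forall]
        intro j
        obtain ⟨i, hi⟩ := hr j
        have := h i
        rw [hi] at this
        simpa using this
      · simp
    · push Not at hr
      obtain ⟨j, hj⟩ := hr
      refine Finset.sum_involution (fun S _ => symmDiff S {j}) ?_ ?_ (fun _ _ => Finset.mem_univ _) ?_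
      · intro S _
        have hiff : (∀ i, r i ∈ Finset.insertNone S) ↔ (∀ i, r i ∈ Finset.insertNone (symmDiff S {j})) := by
          refine forall_congr' fun i => ?_
          cases h : r i with
          | none => simp
          | some k =>
            have : k ≠ j := fun e => hj i (by rw [h, e])
            simp [Finset.mem_symmDiff, this]
        rw [if_congr hiff.symm rfl rfl, ← add_smul]
        have : (-1:ℝ)^(m + S.card) + (-1)^(m + (symmDiff S {j}).card) = 0 := by
          by_cases hjS : j ∈ S
          · have e1 : symmDiff S {j} = S.erase j := by
              ext k; simp [Finset.mem_symmDiff]; by_cases hk : k = j <;> simp [hk, hjS]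
            have e2 := Finset.card_erase_add_one hjS
            rw [e1, ← e2, ← add_assoc, pow_succ]; ring
          · have e1 : symmDiff S {j} = insert j S := by
              ext k; simp [Finset.mem_symmDiff]; by_cases hk : k = j <;> simp [hk, hjS]
            rw [e1, Finset.card_insert_of_notMem hjS, ← add_assoc, pow_succ]; ring
        rw [this, zero_smul]
      · intro S _ _ h
        have : ({j} : Finset (Fin m)) = ∅ := by simpa using h
        simp at this
      · intro S _; simp
  simp only [h1, Finset.smul_sum]
  rw [Finset.sum_comm, Finset.sum_congr rfl fun r _ => h2 r, ← Finset.sum_filter, Finset.sum_const,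
    ← Nat.cast_smul_eq_nsmul ℝ]
  congr 2
  have : (Finset.univ.filter fun r : Fin m → Option (Fin m) => ∀ j, ∃ i, r i = some j) =
      (Finset.univ : Finset (Equiv.Perm (Fin m))).image (fun s i => some (s i)) := by
    ext r; simp only [Finset.mem_filter, Finset.mem_univ, true_and, Finset.mem_image]
    constructor
    · intro hr
      choose g hg using hr
      have ginj : Function.Injective g := fun a b hab => by
        have := (hg a).symm.trans ((congrArg r hab).trans (hg b)); simpa using this
      have gb : Function.Bijective g := Finite.injective_iff_bijective.1 ginj
      refine ⟨(Equiv.ofBijective g gb).symm, ?_⟩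
      funext i
      obtain ⟨j, rfl⟩ := gb.2 i
      rw [hg]; congr 1; exact (Equiv.ofBijective_symm_apply_apply g gb j)
    · rintro ⟨s, rfl⟩ j
      exact ⟨s.symm j, by simp⟩
  rw [this, Finset.card_image_of_injective, Finset.card_univ, Fintype.card_perm, Fintype.card_fin]
  intro s t h
  ext i
  have := congrFun h i
  simp at this
  rw [this]

lemma pol_bound {u : E → F} (hu : ContDiff ℝ ∞ u) {m : ℕ} (w : E) (v : Fin m → E) (z : E) :
    (m.factorial : ℝ) * ‖iteratedFDeriv ℝ m u z v‖ ≤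
      ∑ S : Finset (Fin m), ‖(dd (w + ∑ i ∈ S, v i))^[m] u z‖ := by
  have := pol (iteratedFDeriv ℝ m u z).toMultilinearMap (fun s a => iter_perm hu m a s z) w v
  calc (m.factorial : ℝ) * ‖iteratedFDeriv ℝ m u z v‖ = ‖(m.factorial : ℝ) • iteratedFDeriv ℝ m u z v‖ := by
        rw [norm_smul]; simp
    _ = ‖∑ S : Finset (Fin m), ((-1 : ℝ)^(m + S.card)) • iteratedFDeriv ℝ m u z (fun _ => w + ∑ i ∈ S, v i)‖ := by
        rw [← ContinuousMultilinearMap.coe_coe, ← this]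
    _ ≤ _ := by
        refine (norm_sum_le _ _).trans (Finset.sum_le_sum fun S _ => ?_)
        rw [norm_smul, ddit_iter hu]; simp

lemma ddit_smul_vec {f : E → F} (hf : ContDiff ℝ ∞ f) (c : ℝ) (v : E) (m : ℕ) (z : E) :
    (dd (c • v))^[m] f z = c^m • (dd v)^[m] f z := by
  rw [ddit_iter hf, ddit_iter hf]
  have := (iteratedFDeriv ℝ m f z).map_smul_univ (fun _ => c) (fun _ => v)
  simpa using this

end
end HM

namespace HM
open MeasureTheory Filter Topology

section
variable {E : Type*} [NormedAddCommGroup E] [NormedSpace ℝ E] [FiniteDimensional ℝ E]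
  [MeasurableSpace E] [BorelSpace E] (μ : Measure E) [μ.IsAddHaarMeasure]
  {H : Type*} [NormedAddCommGroup H] [InnerProductSpace ℝ H]
variable {X : E →L[ℝ] ℝ} {S : Set E} {c : ℝ} {ζ : E → ℝ}
variable {ι : Type*} [Fintype ι] [DecidableEq ι]

lemma it_bd (u : E → H) (z : E) (m : ℕ) (a : Fin m → E) (ha : ∀ i, ‖a i‖ ≤ 1) :
    ‖iteratedFDeriv ℝ m u z a‖ ≤ ‖iteratedFDeriv ℝ m u z‖ := by
  refine (ContinuousMultilinearMap.le_opNorm _ _).trans ?_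
  exact mul_le_of_le_one_right (norm_nonneg _) (Finset.prod_le_one (fun _ _ => norm_nonneg _) fun i _ => ha i)

lemma it1 {u : E → H} (hu : ContDiff ℝ ∞ u) (v w : E) (k : ℕ) :
    dd w ((dd v)^[k] u) = fun z => iteratedFDeriv ℝ (k+1) u z (Fin.cons w fun _ => v) := by
  rw [← dd_iter hu]; congr 1; funext z; exact ddit_iter hu k v z

lemma it2 {u : E → H} (hu : ContDiff ℝ ∞ u) (v w w' : E) (k : ℕ) :
    dd w' (dd w ((dd v)^[k] u)) = fun z => iteratedFDeriv ℝ (k+1+1) u z (Fin.cons w' (Fin.cons w fun _ => v)) := by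
  rw [it1 hu, dd_iter hu]

lemma cons_le {m : ℕ} {w : E} {a : Fin m → E} (hw : ‖w‖ ≤ 1) (ha : ∀ i, ‖a i‖ ≤ 1) :
    ∀ i, ‖(Fin.cons w a : Fin (m+1) → E) i‖ ≤ 1 := by
  intro i; refine Fin.cases ?_ (fun i => ?_) i <;> simp [hw, ha]

lemma low_bd {ζ : E → ℝ} (hcut : Cut X S c ζ) {b : ι → E} (hb1 : ∀ j, ‖b j‖ ≤ 1)
    {u : E → H} (hu : ContDiff ℝ ∞ u) (k : ℕ) :
    ∃ M, 0 ≤ M ∧ ∀ v, ‖v‖ ≤ 1 → ss μ X ζ v b u k ≤ M := by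
  set G : E → ℝ := fun z => ((k+1:ℕ):ℝ) * ‖iteratedFDeriv ℝ (k+1) u z‖
    + ((k+1:ℕ):ℝ) * ∑ _j : ι, ‖iteratedFDeriv ℝ (k+1) u z‖
    + ∑ _j : ι, ∑ _l : ι, ‖iteratedFDeriv ℝ (k+1+1) u z‖ + ‖iteratedFDeriv ℝ k u z‖ with hG
  have hc : ∀ m, Continuous (fun z => ‖iteratedFDeriv ℝ m u z‖) := fun m =>
    (hu.continuous_iteratedFDeriv (by exact_mod_cast le_top)).norm
  have hGc : Continuous G := by
    have := hc k; have := hc (k+1); have := hc (k+1+1)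
    fun_prop
  refine ⟨NN μ X (fun z => ζ z ^ (2*k+2) * G z), NN_nonneg _ _ _, fun v hv => ?_⟩
  refine NN_mono μ X (cc_mul_right (hcut.cc _) (sg_cont hu k)) (cc_mul_right (hcut.cc _) hGc) fun z _ => ?_
  have z0 := hcut.nn z
  rw [abs_of_nonneg (mul_nonneg (pow_nonneg z0 _) (sg_nonneg _ _ _ _ _))]
  refine mul_le_mul_of_nonneg_left ?_ (pow_nonneg z0 _)
  have h1 : ∀ w, ‖w‖ ≤ 1 → ‖dd w ((dd v)^[k] u) z‖ ≤ ‖iteratedFDeriv ℝ (k+1) u z‖ := fun w hw => by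
    rw [it1 hu]; exact it_bd _ _ _ _ (cons_le hw fun _ => hv)
  have h2 : ∀ w w', ‖w‖ ≤ 1 → ‖w'‖ ≤ 1 → ‖dd w (dd w' ((dd v)^[k] u)) z‖ ≤ ‖iteratedFDeriv ℝ (k+1+1) u z‖ :=
    fun w w' hw hw' => by
    rw [it2 hu]; exact it_bd _ _ _ _ (cons_le hw (cons_le hw' fun _ => hv))
  have h0 : ‖(dd v)^[k] u z‖ ≤ ‖iteratedFDeriv ℝ k u z‖ := by
    rw [ddit_iter hu]; exact it_bd _ _ _ _ fun _ => hv
  unfold sg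
  rw [hG]; beta_reduce
  have h3 := h1 v hv
  gcongr
  · exact h1 _ (hb1 _)
  · exact h2 _ _ (hb1 _) (hb1 _)

lemma ss_all (d : ℕ) (hd : Fintype.card ι = d) (c : ℝ) (hc : 1 ≤ c) (C A : ℝ) (hC : 1 ≤ C) (hA : 1 ≤ A)
    {S : Set E} {ζ : E → ℝ} (hcut : Cut X S c ζ) {b : ι → E} (hbS : range b ⊆ S) (hb : ∀ j, X (b j) = 0)
    (hb1 : ∀ j, ‖b j‖ ≤ 1)
    {η : ℝ} (hη : 0 ≤ η) (hη1 : 16 * (3 + (d:ℝ) + d^2) * η ≤ 1)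
    {u : E → H} (hu : ContDiff ℝ ∞ u) (Q : E → Coef E H ι) (V0 : Set E) (hV0 : V0 ⊆ S)
    (hQ : ∀ v ∈ V0, (Q v).Sm) (hX : ∀ v ∈ V0, X v = 1) (hn : ∀ v ∈ V0, ‖v‖ ≤ 1)
    (h : ∀ v ∈ V0, ∀ z, ζ z ≠ 0 → 0 < X z → (Q v).Bd X v C A η z ∧ ∀ᶠ y in 𝓝 z, (Q v).LL v b u y = (Q v).f y) :
    ∃ M R : ℝ, 1 ≤ M ∧ 1 ≤ R ∧ ∀ v ∈ V0, ∀ k, NN μ X (fun z => ζ z ^ (2*k+2) * ‖(dd v)^[k] u z‖) ≤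
      M * R^k * k.factorial := by
  obtain ⟨K, hK, k0, hstep⟩ := ss_step (H := H) μ d hd c hc C A hC hA hcut hbS hb hη hη1
  choose M hM0 hM using fun k => low_bd (H := H) μ hcut hb1 hu k
  set M0 := 1 + ∑ k ∈ Finset.range k0, M k with hM0d
  have hM01 : 1 ≤ M0 := by
    have : 0 ≤ ∑ k ∈ Finset.range k0, M k := Finset.sum_nonneg fun k _ => hM0 k
    linarith
  refine ⟨M0 * K, A * (1 + 2 * K), by nlinarith, by nlinarith, fun v hv k => ?_⟩
  have := rec_bound A K hA hK k0 M0 hM01 (ss μ X ζ v b u) (fun k hk => ?_) (fun k hk => ?_) k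
  · refine le_trans ?_ this
    refine NN_mono μ X (cc_mul_right (hcut.cc _) (ddit_smooth hu k).continuous.norm)
      (cc_mul_right (hcut.cc _) (sg_cont hu k)) fun z _ => ?_
    have z0 := hcut.nn z
    rw [abs_of_nonneg (mul_nonneg (pow_nonneg z0 _) (norm_nonneg _))]
    refine mul_le_mul_of_nonneg_left ?_ (pow_nonneg z0 _)
    unfold sg
    have : 0 ≤ ((k+1 : ℕ) : ℝ) * ‖dd v ((dd v)^[k] u) z‖ + ((k+1 : ℕ) : ℝ) * ∑ j, ‖dd (b j) ((dd v)^[k] u) z‖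
      + ∑ j, ∑ l, ‖dd (b j) (dd (b l) ((dd v)^[k] u)) z‖ := by positivity
    linarith
  · refine (hM k v (hn v hv)).trans ?_
    have := Finset.single_le_sum (f := M) (fun k _ => hM0 k) (Finset.mem_range.mpr hk)
    linarith
  · exact hstep (Q v) (hQ v hv) v (hV0 hv) (hX v hv) u hu (h v hv) k hk

end
end HM

namespace HM
open MeasureTheory Filter Topology

section
variable {n : ℕ} {H : Type*} [NormedAddCommGroup H] [InnerProductSpace ℝ H]

/-- the coordinate space -/
abbrev EE' (n : ℕ) := Fin (n+1) → ℝ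

/-- first coordinate -/
def X0 (n : ℕ) : EE' n →L[ℝ] ℝ := ContinuousLinearMap.proj 0

/-- admissible directions -/
def S0 (n : ℕ) : Set (EE' n) := {v | v 0 = 1 ∧ ‖v‖ ≤ 1}

lemma e0_mem : (Pi.single 0 1 : EE' n) ∈ S0 n := by
  refine ⟨by simp, ?_⟩
  rw [pi_norm_le_iff_of_nonneg zero_le_one]
  intro i
  by_cases h : i = 0
  · subst h; simp
  · simp [h]

lemma near_e0 {y : EE' n} (hy : ‖y‖ ≤ 1/2) : ∃ (t : ℝ) (v : EE' n), 0 ≤ t ∧ t ≤ 2 ∧ v ∈ S0 n ∧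
    Pi.single 0 1 + y = t • v := by
  have hy' := (pi_norm_le_iff_of_nonneg (by norm_num : (0:ℝ) ≤ 1/2)).mp hy
  have h0 := abs_le.mp (hy' 0)
  have tp : 0 < 1 + y 0 := by linarith [h0.1]
  refine ⟨1 + y 0, (1 + y 0)⁻¹ • (Pi.single 0 1 + y), tp.le, by linarith [h0.2], ⟨?_, ?_⟩, ?_⟩
  · simp; field_simp
  · rw [pi_norm_le_iff_of_nonneg zero_le_one]
    intro i
    by_cases h : i = 0
    · subst h; simp [inv_mul_cancel₀ tp.ne']
    · simp only [Pi.smul_apply, Pi.add_apply, Pi.single_eq_of_ne h, zero_add, smul_eq_mul, norm_mul, norm_inv,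
        Real.norm_of_nonneg tp.le]
      rw [inv_mul_le_iff₀ tp]
      have := hy' i
      linarith [h0.1]
  · rw [smul_smul, mul_inv_cancel₀ tp.ne', one_smul]

lemma word_bound {S : Set (EE' n)} {c : ℝ} {ζ : EE' n → ℝ} (hcut : Cut (X0 n) S c ζ) {u : EE' n → H}
    (hu : ContDiff ℝ ∞ u) {M R : ℝ} (hM : 1 ≤ M) (hR : 1 ≤ R)
    (h : ∀ v ∈ S0 n, ∀ k, NN volume (X0 n) (fun z => ζ z ^ (2*k+2) * ‖(dd v)^[k] u z‖) ≤ M * R^k * k.factorial)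
    (m : ℕ) (a : Fin m → EE' n) (ha : ∀ i, ‖a i‖ ≤ 1) :
    NN volume (X0 n) (fun z => ζ z ^ (2*m+2) * ‖iteratedFDeriv ℝ m u z a‖) ≤
      M * (8 * Real.exp 1 * R)^m * m.factorial := by
  rcases Nat.eq_zero_or_pos m with rfl | hm
  · have := h _ e0_mem 0
    simpa using this
  have hm' : (0:ℝ) < m := by exact_mod_cast hm
  set s : ℝ := 1 / (2 * m) with hs
  have s0 : 0 < s := by positivity
  have hS : ∀ T : Finset (Fin m), ∃ (t : ℝ) (v : EE' n), 0 ≤ t ∧ t ≤ 2 ∧ v ∈ S0 n ∧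
      Pi.single 0 1 + ∑ i ∈ T, s • a i = t • v := fun T => by
    refine near_e0 ?_
    refine (norm_sum_le _ _).trans ?_
    have : ∀ i ∈ T, ‖s • a i‖ ≤ s := fun i _ => by
      rw [norm_smul, Real.norm_of_nonneg s0.le]; exact mul_le_of_le_one_right s0.le (ha i)
    refine (Finset.sum_le_card_nsmul _ _ _ this).trans ?_
    rw [nsmul_eq_mul]
    have hc : (T.card : ℝ) ≤ m := by exact_mod_cast (T.card_le_univ.trans (by simp))
    calc (T.card : ℝ) * s ≤ m * s := by gcongr
      _ = 1/2 := by rw [hs]; field_simp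
  choose t v t0 t2 hv htv using hS
  have key : ∀ z, ‖iteratedFDeriv ℝ m u z a‖ ≤ (2*m)^m * (m.factorial : ℝ)⁻¹ * ∑ T : Finset (Fin m),
      2^m * ‖(dd (v T))^[m] u z‖ := by
    intro z
    have h1 := pol_bound hu (Pi.single 0 1) (fun i => s • a i) z
    have h2 : iteratedFDeriv ℝ m u z (fun i => s • a i) = s^m • iteratedFDeriv ℝ m u z a := by
      have := (iteratedFDeriv ℝ m u z).map_smul_univ (fun _ => s) a
      simpa using this
    rw [h2, norm_smul, norm_pow, Real.norm_of_nonneg s0.le] at h1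
    have h3 : ∑ T : Finset (Fin m), ‖(dd (Pi.single 0 1 + ∑ i ∈ T, s • a i))^[m] u z‖ ≤
        ∑ T : Finset (Fin m), 2^m * ‖(dd (v T))^[m] u z‖ := by
      refine Finset.sum_le_sum fun T _ => ?_
      rw [htv T, ddit_smul_vec hu, norm_smul, norm_pow, Real.norm_of_nonneg (t0 T)]
      gcongr
      · exact t0 T
      · exact t2 T
    have h4 := h1.trans h3
    have hf : (0:ℝ) < m.factorial := by exact_mod_cast m.factorial_pos
    have h5 : (2*(m:ℝ))^m * s^m = 1 := by rw [← mul_pow, hs]; field_simp; simp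
    calc ‖iteratedFDeriv ℝ m u z a‖ = (2*(m:ℝ))^m * (m.factorial : ℝ)⁻¹ *
          (m.factorial * (s^m * ‖iteratedFDeriv ℝ m u z a‖)) := by
          field_simp
          linear_combination (-‖iteratedFDeriv ℝ m u z a‖) * h5
      _ ≤ _ := by gcongr
  have cc1 : ∀ T, Cc (fun z => ζ z ^ (2*m+2) * ‖(dd (v T))^[m] u z‖) := fun T =>
    cc_mul_right (hcut.cc _) (ddit_smooth hu m).continuous.norm
  set q : ℝ := (2*m)^m * (m.factorial : ℝ)⁻¹ with hq
  have q0 : 0 ≤ q := by positivity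
  calc NN volume (X0 n) (fun z => ζ z ^ (2*m+2) * ‖iteratedFDeriv ℝ m u z a‖)
      ≤ NN volume (X0 n) (fun z => (q * 2^m) * ∑ T : Finset (Fin m), ζ z ^ (2*m+2) * ‖(dd (v T))^[m] u z‖) := by
        refine NN_mono _ _ (cc_mul_right (hcut.cc _) (iter_apply_smooth hu m a).continuous.norm)
          (cc_mul_left continuous_const (cc_sum _ fun T _ => cc1 T)) fun z _ => ?_
        have z0 := hcut.nn z
        rw [abs_of_nonneg (mul_nonneg (pow_nonneg z0 _) (norm_nonneg _))]
        calc _ ≤ ζ z ^ (2*m+2) * (q * ∑ T : Finset (Fin m), 2^m * ‖(dd (v T))^[m] u z‖) := by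
              gcongr; exact key z
          _ = _ := by rw [← Finset.mul_sum, ← Finset.mul_sum]; ring
    _ = (q * 2^m) * NN volume (X0 n) (fun z => ∑ T : Finset (Fin m), ζ z ^ (2*m+2) * ‖(dd (v T))^[m] u z‖) :=
        NN_const_mul _ _ _ (by positivity) _
    _ ≤ (q * 2^m) * ∑ T : Finset (Fin m), (M * R^m * m.factorial) := by
        gcongr
        refine (NN_sum _ _ _ fun T _ => cc1 T).trans ?_
        exact Finset.sum_le_sum fun T _ => h _ (hv T) m
    _ = M * (8 * R)^m * (m:ℝ)^m := by
        have hf : (0:ℝ) < m.factorial := by exact_mod_cast m.factorial_pos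
        simp only [Finset.sum_const, Finset.card_univ, Fintype.card_finset, Fintype.card_fin, nsmul_eq_mul]
        rw [hq, show (8:ℝ) = 2*2*2 by norm_num]
        push_cast
        simp only [mul_pow]
        field_simp
    _ ≤ M * (8 * Real.exp 1 * R)^m * m.factorial := by
        have h1 := Real.pow_div_factorial_le_exp (m:ℝ) hm'.le m
        have hf : (0:ℝ) < m.factorial := by exact_mod_cast m.factorial_pos
        rw [div_le_iff₀ hf] at h1
        have h2 : Real.exp (m:ℝ) = Real.exp 1 ^ m := by rw [← Real.exp_nat_mul]; simp
        rw [h2] at h1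
        calc M * (8 * R)^m * (m:ℝ)^m ≤ M * (8 * R)^m * (Real.exp 1 ^ m * m.factorial) := by gcongr
          _ = _ := by simp only [mul_pow]; ring

end
end HM

namespace HM
open MeasureTheory Filter Topology

section
variable {n : ℕ} {H : Type*} [NormedAddCommGroup H] [InnerProductSpace ℝ H]

lemma Dl_dd {d : ℕ} (l : List (Fin d)) {F : (Fin d → ℝ) → H} (hF : ContDiff ℝ ∞ F) (w : Fin d → ℝ) :
    dd w (Dl l F) = Dl l (dd w F) := by
  induction l with
  | nil => rfl
  | cons i l ih =>
    show dd w (dd _ (Dl l F)) = dd _ (Dl l (dd w F))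
    rw [dd_comm (Dl_smooth l hF), ih]

lemma Dl_add {d : ℕ} (l : List (Fin d)) {F G : (Fin d → ℝ) → H} (hF : ContDiff ℝ ∞ F) (hG : ContDiff ℝ ∞ G) :
    Dl l (fun z => F z + G z) = fun z => Dl l F z + Dl l G z := by
  induction l with
  | nil => rfl
  | cons i l ih =>
    show dd _ (Dl l _) = fun z => dd _ (Dl l F) z + dd _ (Dl l G) z
    rw [ih]; funext z
    exact dd_add (sm_diff (Dl_smooth l hF) z) (sm_diff (Dl_smooth l hG) z)

lemma single_norm {d : ℕ} (i : Fin d) : ‖(Pi.single i 1 : Fin d → ℝ)‖ ≤ 1 := by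
  rw [pi_norm_le_iff_of_nonneg zero_le_one]
  intro j
  by_cases h : j = i
  · subst h; simp
  · simp [h]

lemma l1_bound {S : Set (EE' n)} {c : ℝ} {ζ : EE' n → ℝ} (hcut : Cut (X0 n) S c ζ) {u : EE' n → H}
    (hu : ContDiff ℝ ∞ u) {M R : ℝ} (hM : 1 ≤ M) (hR : 1 ≤ R)
    (h : ∀ (m : ℕ) (a : Fin m → EE' n) (_ : ∀ i, ‖a i‖ ≤ 1),
      NN volume (X0 n) (fun z => ζ z ^ (2*m+2) * ‖iteratedFDeriv ℝ m u z a‖) ≤ M * R^m * m.factorial)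
    {δ : ℝ} (hδ : 0 < δ) (l : List (Fin (n+1))) :
    ∀ (χ : EE' n → ℝ) (_ : ContDiff ℝ ∞ χ) (_ : HasCompactSupport χ)
      (_ : ∀ z ∈ tsupport χ, δ ≤ X0 n z ∧ ζ z = 1), ∃ C : ℝ, 0 ≤ C ∧
      ∀ (m : ℕ) (a : Fin m → EE' n) (_ : ∀ i, ‖a i‖ ≤ 1),
        ∫⁻ y, ‖Dl l (fun z => χ z • iteratedFDeriv ℝ m u z a) y‖ₑ ≤
          ENNReal.ofReal (C * R^(m + l.length) * (m + l.length).factorial) := by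
  induction l with
  | nil =>
    intro χ hχ hc hs
    have c1 : Cc (fun z => |χ z| / δ^2) := by
      refine ⟨by have := hχ.continuous; fun_prop, hc.mono' ?_⟩
      intro z hz; apply subset_tsupport; intro h0; apply hz; simp [h0]
    refine ⟨NN volume (X0 n) (fun z => |χ z| / δ^2) * M, mul_nonneg (NN_nonneg _ _ _) (by linarith), fun m a ha => ?_⟩
    have c2 : Cc (fun z => ζ z ^ (2*m+2) * ‖iteratedFDeriv ℝ m u z a‖) :=
      cc_mul_right (hcut.cc _) (iter_apply_smooth hu m a).continuous.norm
    have hF : Continuous (fun z => χ z • iteratedFDeriv ℝ m u z a) :=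
      hχ.continuous.smul (iter_apply_smooth hu m a).continuous
    have hFi : Integrable (fun z => χ z • iteratedFDeriv ℝ m u z a) :=
      hF.integrable_of_hasCompactSupport hc.smul_right
    show ∫⁻ y, ‖(χ y • iteratedFDeriv ℝ m u y a)‖ₑ ≤ _
    rw [← ofReal_integral_norm_eq_lintegral_enorm hFi]
    apply ENNReal.ofReal_le_ofReal
    calc ∫ z, ‖χ z • iteratedFDeriv ℝ m u z a‖
        ≤ ∫ z, pp (X0 n) 2 z * ((|χ z| / δ^2) * (ζ z ^ (2*m+2) * ‖iteratedFDeriv ℝ m u z a‖)) := by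
          refine integral_mono hFi.norm (NN_prod_integrable volume _ c1 c2.1) fun z => ?_
          by_cases hz : χ z = 0
          · simp [hz]
          · obtain ⟨h1, h2⟩ := hs z (subset_tsupport _ hz)
            beta_reduce
            rw [h2, one_pow, one_mul, norm_smul, Real.norm_eq_abs]
            have : δ^2 ≤ pp (X0 n) 2 z := by
              unfold pp; gcongr; exact h1.trans (le_max_left _ _)
            have h3 : |χ z| * ‖iteratedFDeriv ℝ m u z a‖ = δ^2 * (|χ z| / δ^2 * ‖iteratedFDeriv ℝ m u z a‖) := by
              field_simp
            rw [h3]; gcongr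
      _ ≤ NN volume (X0 n) (fun z => |χ z| / δ^2) * (M * R^m * m.factorial) := by
          refine (NN_cs volume (X0 n) c1 c2).trans ?_
          exact mul_le_mul_of_nonneg_left (h m a ha) (NN_nonneg _ _ _)
      _ = _ := by simp; ring
  | cons i l ih =>
    intro χ hχ hc hs
    set e : EE' n := Pi.single i 1 with he
    obtain ⟨C1, C10, h1⟩ := ih (dd e χ) (dd_smooth hχ) (dd_cpt hc) (fun z hz => hs z (tsupport_fderiv_apply_subset ℝ e hz))
    obtain ⟨C2, C20, h2⟩ := ih χ hχ hc hs
    refine ⟨C1 + C2, by positivity, fun m a ha => ?_⟩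
    have hs1 : ContDiff ℝ ∞ (fun z => dd e χ z • iteratedFDeriv ℝ m u z a) :=
      (dd_smooth hχ).smul (iter_apply_smooth hu m a)
    have hs2 : ContDiff ℝ ∞ (fun z => χ z • iteratedFDeriv ℝ (m+1) u z (Fin.cons e a)) :=
      hχ.smul (iter_apply_smooth hu (m+1) _)
    have eq : Dl (i :: l) (fun z => χ z • iteratedFDeriv ℝ m u z a) =
        fun z => Dl l (fun z => dd e χ z • iteratedFDeriv ℝ m u z a) z +
          Dl l (fun z => χ z • iteratedFDeriv ℝ (m+1) u z (Fin.cons e a)) z := by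
      show dd e (Dl l _) = _
      have hs3 : ContDiff ℝ ∞ (fun z => χ z • iteratedFDeriv ℝ m u z a) := hχ.smul (iter_apply_smooth hu m a)
      rw [Dl_dd l hs3, ← Dl_add l hs1 hs2]
      congr 1; funext z
      rw [dd_smul (sm_diff hχ z) (sm_diff (iter_apply_smooth hu m a) z), dd_iter hu]
    rw [eq]
    have R0 : 0 ≤ R := by linarith
    calc ∫⁻ y, ‖Dl l (fun z => dd e χ z • iteratedFDeriv ℝ m u z a) y +
          Dl l (fun z => χ z • iteratedFDeriv ℝ (m+1) u z (Fin.cons e a)) y‖ₑ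
        ≤ ∫⁻ y, (‖Dl l (fun z => dd e χ z • iteratedFDeriv ℝ m u z a) y‖ₑ +
          ‖Dl l (fun z => χ z • iteratedFDeriv ℝ (m+1) u z (Fin.cons e a)) y‖ₑ) :=
          lintegral_mono fun y => enorm_add_le _ _
      _ = (∫⁻ y, ‖Dl l (fun z => dd e χ z • iteratedFDeriv ℝ m u z a) y‖ₑ) +
          ∫⁻ y, ‖Dl l (fun z => χ z • iteratedFDeriv ℝ (m+1) u z (Fin.cons e a)) y‖ₑ :=
          lintegral_add_left ((Dl_smooth l hs1).continuous.enorm.measurable) _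
      _ ≤ ENNReal.ofReal (C1 * R^(m + l.length) * (m + l.length).factorial) +
          ENNReal.ofReal (C2 * R^(m + 1 + l.length) * (m + 1 + l.length).factorial) :=
          add_le_add (h1 m a ha) (h2 (m+1) _ (cons_le (single_norm i) ha))
      _ = ENNReal.ofReal (C1 * R^(m + l.length) * (m + l.length).factorial +
          C2 * R^(m + 1 + l.length) * (m + 1 + l.length).factorial) := by
          rw [ENNReal.ofReal_add (by positivity) (by positivity)]
      _ ≤ _ := by
          apply ENNReal.ofReal_le_ofReal
          have e1 : m + 1 + l.length = m + l.length + 1 := by ring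
          have e2 : m + (i :: l).length = m + l.length + 1 := by simp; ring
          rw [e1, e2, add_mul, add_mul]
          have f1 : R^(m + l.length) ≤ R^(m + l.length + 1) := pow_le_pow_right₀ hR (by omega)
          have f2 : ((m + l.length).factorial : ℝ) ≤ (m + l.length + 1).factorial := by
            exact_mod_cast Nat.factorial_le (by omega)
          gcongr

lemma multi_scale {m : ℕ} (f : ContinuousMultilinearMap ℝ (fun _ : Fin m => EE' n) H) {B : ℝ} (hB : 0 ≤ B)
    (h : ∀ a : Fin m → EE' n, (∀ i, ‖a i‖ ≤ 1) → ‖f a‖ ≤ B) : ‖f‖ ≤ B := by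
  refine f.opNorm_le_bound hB fun a => ?_
  have h1 : a = fun i => ‖a i‖ • (‖a i‖⁻¹ • a i) := by
    funext i
    by_cases h0 : a i = 0
    · simp [h0]
    · rw [smul_smul, mul_inv_cancel₀ (norm_ne_zero_iff.mpr h0), one_smul]
  have h2 := f.map_smul_univ (fun i => ‖a i‖) (fun i => ‖a i‖⁻¹ • a i)
  rw [← h1] at h2
  rw [h2, norm_smul, Real.norm_of_nonneg (Finset.prod_nonneg fun _ _ => norm_nonneg _), mul_comm]
  refine mul_le_mul_of_nonneg_right (h _ fun i => ?_) (Finset.prod_nonneg fun _ _ => norm_nonneg _)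
  rw [norm_smul, norm_inv, norm_norm]
  exact inv_mul_le_one

lemma an_pos [CompleteSpace H] {S : Set (EE' n)} {c : ℝ} {ζ : EE' n → ℝ} (hcut : Cut (X0 n) S c ζ) {u : EE' n → H}
    (hu : ContDiff ℝ ∞ u) {M R : ℝ} (hM : 1 ≤ M) (hR : 1 ≤ R)
    (h : ∀ v ∈ S0 n, ∀ k, NN volume (X0 n) (fun z => ζ z ^ (2*k+2) * ‖(dd v)^[k] u z‖) ≤ M * R^k * k.factorial) :
    ∃ ρ > 0, ∀ q, 0 < X0 n q → (∀ᶠ z in 𝓝 q, ζ z = 1) →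
      ∃ w : EE' n → H, AnalyticOnNhd ℝ w (Metric.ball q ρ) ∧ w =ᶠ[𝓝 q] u := by
  set R' := 8 * Real.exp 1 * R with hR'
  have R1 : 1 ≤ R' := by
    have : 1 ≤ Real.exp 1 := Real.one_le_exp (by norm_num)
    nlinarith
  have hw := word_bound hcut hu hM hR h
  refine ⟨1 / (2 * R'), by positivity, fun q hq hζ => ?_⟩
  have hX : ∀ᶠ z in 𝓝 q, X0 n q / 2 < X0 n z :=
    (X0 n).continuous.continuousAt.eventually (lt_mem_nhds (by linarith))
  obtain ⟨r, r0, hr⟩ := Metric.nhds_basis_closedBall.eventually_iff.mp (hX.and hζ)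
  let χ : ContDiffBump q := ⟨r/2, r, by positivity, by linarith⟩
  obtain ⟨C, C0, hC⟩ := l1_bound hcut hu hM R1 hw (half_pos hq) (List.finRange (n+1)) χ χ.contDiff
    χ.hasCompactSupport (fun z hz => by
      rw [χ.tsupport_eq] at hz
      exact ⟨(hr hz).1.le, (hr hz).2⟩)
  refine an_of_bound hu (r := r/2) (C := C * (2 * R')^(n+1) * (n+1).factorial) (by positivity) (by positivity)
    (by positivity) fun z hz m => ?_
  have hB : 0 ≤ C * R' ^ (m + (n+1)) * ((m + (n+1)).factorial : ℝ) := by positivity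
  have key : ‖iteratedFDeriv ℝ m u z‖ ≤ C * R' ^ (m + (n+1)) * ((m + (n+1)).factorial : ℝ) := by
    refine multi_scale _ hB fun a ha => ?_
    have h1 := sobolev (n+1) (F := fun z => χ z • iteratedFDeriv ℝ m u z a)
      (χ.contDiff.smul (iter_apply_smooth hu m a)) χ.hasCompactSupport.smul_right z
    have h2 := h1.trans (hC m a ha)
    rw [List.length_finRange] at h2
    have h3 : χ z = 1 := χ.one_of_mem_closedBall (Metric.ball_subset_closedBall hz)
    beta_reduce at h2
    rw [h3, one_smul, ← ofReal_norm, ENNReal.ofReal_le_ofReal_iff hB] at h2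
    exact h2
  refine key.trans ?_
  have h4 : ((m + (n+1)).factorial : ℝ) ≤ 2^(m+(n+1)) * (m.factorial * (n+1).factorial) := by
    have h5 := Nat.add_choose_mul_factorial_mul_factorial m (n+1)
    have h6 := Nat.choose_le_two_pow (m + (n+1)) (n+1)
    rw [← h5]
    have : ((m + (n+1)).choose (n+1) * m.factorial * (n+1).factorial : ℕ) ≤ 2^(m+(n+1)) * (m.factorial * (n+1).factorial) := by
      rw [mul_assoc]; gcongr
    exact_mod_cast this
  calc C * R' ^ (m + (n+1)) * ((m + (n+1)).factorial : ℝ)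
      ≤ C * R' ^ (m + (n+1)) * (2^(m+(n+1)) * (m.factorial * (n+1).factorial)) := by gcongr
    _ = _ := by simp only [mul_pow, pow_add]; ring

end
end HM

namespace HM
open MeasureTheory Filter Topology

section
variable {n : ℕ} {H : Type*} [NormedAddCommGroup H] [InnerProductSpace ℝ H]

lemma an_ext {u : EE' n → H} {r ρ : ℝ} (hr : 0 < r) (hρ : 0 < ρ)
    (h : ∀ q ∈ Metric.ball (0 : EE' n) r, 0 < X0 n q →
      ∃ w : EE' n → H, AnalyticOnNhd ℝ w (Metric.ball q ρ) ∧ w =ᶠ[𝓝 q] u) :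
    ∃ w : EE' n → H, AnalyticAt ℝ w 0 ∧ ∀ᶠ z in 𝓝 0, 0 < X0 n z → w z = u z := by
  set s := min r ρ / 2 with hs
  have s0 : 0 < s := by positivity
  have sr : s < r := by have := min_le_left r ρ; have := lt_min hr hρ; linarith
  have sρ : 2 * s ≤ ρ := by have := min_le_right r ρ; linarith
  set q : EE' n := (s/2) • Pi.single 0 1 with hq
  have nq : ‖q‖ ≤ s/2 := by
    rw [hq, norm_smul, Real.norm_of_nonneg (by positivity)]
    exact mul_le_of_le_one_right (by positivity) (single_norm 0)
  have Xq : X0 n q = s/2 := by simp [hq, X0]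
  have hqb : q ∈ Metric.ball (0 : EE' n) s := by rw [mem_ball_zero_iff]; linarith
  set O : Set (EE' n) := Metric.ball 0 s ∩ {z | 0 < X0 n z} with hO
  have Oconv : Convex ℝ O := (convex_ball _ _).inter (convex_halfSpace_gt (X0 n).toLinearMap.isLinear 0)
  obtain ⟨w, hw, hwu⟩ := h q (Metric.ball_subset_ball sr.le hqb) (by rw [Xq]; positivity)
  have sub : Metric.ball (0 : EE' n) s ⊆ Metric.ball q ρ := by
    intro z hz
    rw [mem_ball_zero_iff] at hz
    rw [mem_ball_iff_norm]
    have := norm_sub_le z q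
    linarith
  have hu : AnalyticOnNhd ℝ u O := fun z hz => by
    obtain ⟨w', hw', e⟩ := h z (Metric.ball_subset_ball sr.le hz.1) hz.2
    exact (hw' z (Metric.mem_ball_self hρ)).congr e
  have heq := (hw.mono (inter_subset_left.trans sub : O ⊆ _)).eqOn_of_preconnected_of_eventuallyEq hu
    Oconv.isPreconnected (z₀ := q) ⟨hqb, by rw [mem_ofPred_eq, Xq]; positivity⟩ hwu
  refine ⟨w, hw 0 (sub (Metric.mem_ball_self s0)), ?_⟩
  filter_upwards [Metric.ball_mem_nhds 0 s0] with z hz hX using heq ⟨hz, hX⟩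

end

section
variable {E : Type*} [NormedAddCommGroup E] [NormedSpace ℝ E] [FiniteDimensional ℝ E]
  {F : Type*} [NormedAddCommGroup F] [NormedSpace ℝ F]

lemma globalize {f : E → F} {x : E} (h : ∀ᶠ z in 𝓝 x, ContDiffAt ℝ ∞ f z) :
    ∃ f' : E → F, ContDiff ℝ ∞ f' ∧ f' =ᶠ[𝓝 x] f := by
  obtain ⟨r, r0, hr⟩ := Metric.eventually_nhds_iff_ball.mp h
  let χ : ContDiffBump x := ⟨r/4, r/2, by positivity, by linarith⟩
  refine ⟨fun z => χ z • f z, ?_, ?_⟩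
  · rw [contDiff_iff_contDiffAt]
    intro z
    by_cases hz : z ∈ Metric.ball x r
    · exact χ.contDiffAt.smul (hr z hz)
    · have : z ∉ tsupport χ := by
        rw [χ.tsupport_eq]; intro h2
        apply hz
        exact Metric.closedBall_subset_ball (by show r/2 < r; linarith) h2
      have h2 := notMem_tsupport_iff_eventuallyEq.mp this
      refine (contDiffAt_const (c := (0:F))).congr_of_eventuallyEq ?_
      filter_upwards [h2] with y hy
      simp [hy]
  · filter_upwards [χ.eventuallyEq_one] with z hz
    simp [hz]

lemma globalize_an [CompleteSpace F] {f : E → F} {x : E} (h : AnalyticAt ℝ f x) :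
    ∃ f' : E → F, ContDiff ℝ ∞ f' ∧ f' =ᶠ[𝓝 x] f :=
  globalize (h.eventually_analyticAt.mono fun _ hz => hz.contDiffAt)

lemma cut_exists [MeasurableSpace E] [BorelSpace E] (X : E →L[ℝ] ℝ) (S : Set E) (hS : ∀ a ∈ S, ‖a‖ ≤ 1) {r : ℝ} (hr : 0 < r)
    (hX : ∀ z ∈ Metric.ball (0:E) r, X z ≤ 1) :
    ∃ c, 1 ≤ c ∧ ∃ ζ : E → ℝ, Cut X S c ζ ∧ (∀ z, ζ z ≠ 0 → z ∈ Metric.ball (0:E) r) ∧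
      ∃ r' > 0, ∀ z ∈ Metric.ball (0:E) r', ζ z = 1 := by
  let χ : ContDiffBump (0:E) := ⟨r/4, r/2, by positivity, by linarith⟩
  have hχ : ContDiff ℝ ∞ (χ : E → ℝ) := χ.contDiff
  have h1 : ∀ m, ∃ c, ∀ z, ‖iteratedFDeriv ℝ m χ z‖ ≤ c := fun m =>
    (χ.hasCompactSupport.iteratedFDeriv m).exists_bound_of_continuous
      (hχ.continuous_iteratedFDeriv (by exact_mod_cast le_top))
  obtain ⟨c1, hc1⟩ := h1 1
  obtain ⟨c2, hc2⟩ := h1 2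
  have sup : ∀ z, χ z ≠ 0 → z ∈ Metric.ball (0:E) r := fun z hz => by
    have : z ∈ Function.support χ := hz
    rw [χ.support_eq] at this
    exact Metric.ball_subset_ball (by show r/2 ≤ r; linarith) this
  have cc1 : 1 ≤ 1 + |c1| + |c2| := by linarith [abs_nonneg c1, abs_nonneg c2]
  refine ⟨1 + |c1| + |c2|, cc1, χ, ⟨hχ, χ.hasCompactSupport, fun z => χ.nonneg, fun z => χ.le_one,
    cc1, fun z hz => hX z (sup z hz), fun a ha z => ?_, fun a ha a' ha' z => ?_⟩, sup, r/4, by positivity,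
    fun z hz => χ.one_of_mem_closedBall (Metric.ball_subset_closedBall hz)⟩
  · have := dd_iter hχ 0 ![] a
    have e : dd a χ z = iteratedFDeriv ℝ 1 χ z (Fin.cons a ![]) := by
      have h3 := congrFun this z
      simpa using h3
    rw [e, ← Real.norm_eq_abs]
    have h2 := it_bd χ z 1 (Fin.cons a ![]) (cons_le (hS a ha) (by simp))
    have := hc1 z
    linarith [le_abs_self c1, abs_nonneg c2]
  · have := dd_iter hχ 0 ![] a'
    have e : dd a (dd a' χ) z = iteratedFDeriv ℝ 2 χ z (Fin.cons a (Fin.cons a' ![])) := by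
      have e1 : dd a' χ = fun z => iteratedFDeriv ℝ 1 χ z (Fin.cons a' ![]) := by
        simpa using this
      rw [e1, dd_iter hχ]
    rw [e, ← Real.norm_eq_abs]
    have h2 := it_bd χ z 2 (Fin.cons a (Fin.cons a' ![])) (cons_le (hS a ha) (cons_le (hS a' ha') (by simp)))
    have := hc2 z
    linarith [le_abs_self c2, abs_nonneg c1]

end
end HM

namespace HM
open MeasureTheory Filter Topology

section
variable {E : Type*} [NormedAddCommGroup E] [NormedSpace ℝ E]
  {H : Type*} [NormedAddCommGroup H] [NormedSpace ℝ H]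
  {ι : Type*} [Fintype ι]

/-- change of frame -/
def Coef.shear (Q : Coef E H ι) (c : ι → ℝ) : Coef E H ι where
  a00 := Q.a00
  a0 := fun j z => Q.a0 j z + (-2 * c j) • Q.a00 z
  aa := fun j l z => Q.aa j l z + ((-c j) • Q.a0 l z + (c j * c l) • Q.a00 z)
  A0 := Q.A0
  A1 := fun j z => Q.A1 j z + (-c j) • Q.A0 z
  B := Q.B
  f := Q.f

lemma Coef.LL_shear (Q : Coef E H ι) (c : ι → ℝ) {e v : E} {b : ι → E} (hv : v = e + ∑ j, c j • b j)
    {u : E → H} (hu : ContDiff ℝ ∞ u) (z : E) : (Q.shear c).LL v b u z = Q.LL e b u z := by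
  have he : e = v + ∑ j, (-c j) • b j := by rw [hv]; simp
  have h1 : ∀ w : E → H, dd e w z = dd v w z + ∑ j, (-c j) • dd (b j) w z := fun w => by
    rw [he, dd_add_vec, dd_sum_vec]
    simp only [dd_smul_vec]
  have hub : ∀ j, dd (b j) (dd e u) = dd e (dd (b j) u) := fun j => dd_comm hu
  have hvb : ∀ j, dd (b j) (dd v u) = dd v (dd (b j) u) := fun j => dd_comm hu
  have h2 : dd e (dd e u) z = dd v (dd v u) z + ∑ j, (-c j) • dd v (dd (b j) u) z
      + ∑ j, (-c j) • (dd v (dd (b j) u) z + ∑ l, (-c l) • dd (b j) (dd (b l) u) z) := by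
    rw [h1, dd_comm hu (v := v) (w := e), h1 (dd v u)]
    simp only [hub, hvb]
    congr 1
    refine Finset.sum_congr rfl fun j _ => ?_
    rw [h1]
    congr 2
    exact Finset.sum_congr rfl fun l _ => by rw [dd_comm hu (v := b l) (w := b j)]
  have h3 : ∀ j, dd e (dd (b j) u) z = dd v (dd (b j) u) z + ∑ l, (-c l) • dd (b l) (dd (b j) u) z :=
    fun j => h1 _
  unfold Coef.LL Coef.shear
  simp only [h2, h3, h1 u]
  have s1 : ∑ j, Q.a0 j z • ∑ l, (-c l) • dd (b l) (dd (b j) u) z =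
      ∑ j, ∑ l, ((-c j) • Q.a0 l z) • dd (b j) (dd (b l) u) z := by
    rw [Finset.sum_comm]
    refine Finset.sum_congr rfl fun j _ => ?_
    rw [Finset.smul_sum]
    refine Finset.sum_congr rfl fun l _ => ?_
    rw [smul_smul, smul_eq_mul, mul_comm]
  have s2 : Q.a00 z • ∑ j, (-c j) • ∑ l, (-c l) • dd (b j) (dd (b l) u) z =
      ∑ j, ∑ l, ((c j * c l) • Q.a00 z) • dd (b j) (dd (b l) u) z := by
    simp only [Finset.smul_sum]
    refine Finset.sum_congr rfl fun j _ => Finset.sum_congr rfl fun l _ => ?_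
    simp only [smul_smul, smul_eq_mul]; congr 1; ring
  have s3 : ∑ j, ((-2 * c j) • Q.a00 z) • dd v (dd (b j) u) z =
      Q.a00 z • ∑ j, (-c j) • dd v (dd (b j) u) z + Q.a00 z • ∑ j, (-c j) • dd v (dd (b j) u) z := by
    rw [← two_smul ℝ, Finset.smul_sum, Finset.smul_sum]
    refine Finset.sum_congr rfl fun j _ => ?_
    simp only [smul_smul, smul_eq_mul]; congr 1; ring
  have s4 : Q.A0 z (∑ j, (-c j) • dd (b j) u z) = ∑ j, (-c j) • Q.A0 z (dd (b j) u z) := by simp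
  simp only [smul_add, add_smul, Finset.sum_add_distrib, s1, s2, s3, map_add, s4, add_apply,
    smul_apply]
  abel

lemma Coef.Sm.shear {Q : Coef E H ι} (h : Q.Sm) (c : ι → ℝ) : (Q.shear c).Sm where
  a00 := h.a00
  a0 := fun j => (h.a0 j).add (h.a00.const_smul _)
  aa := fun j l => (h.aa j l).add (((h.a0 l).const_smul _).add (h.a00.const_smul _))
  A0 := h.A0
  A1 := fun j => (h.A1 j).add (h.A0.const_smul _)
  B := h.B
  f := h.f

variable {F : Type*} [NormedAddCommGroup F] [NormedSpace ℝ F]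

/-- derivative bounds -/
def AB (v : E) (f : E → F) (C A : ℝ) (z : E) : Prop := ∀ i : ℕ, ‖(dd v)^[i] f z‖ ≤ C * A^i * i.factorial

lemma AB.mono {v : E} {f : E → F} {C A C' A' : ℝ} {z : E} (h : AB v f C A z) (hC : C ≤ C') (hA0 : 0 ≤ A) (hC0 : 0 ≤ C)
    (hA : A ≤ A') : AB v f C' A' z := fun i => (h i).trans (by
  have : 0 ≤ C' := hC0.trans hC
  gcongr)

lemma AB.add {v : E} {f g : E → F} {C C' A : ℝ} {z : E} (hf : ContDiff ℝ ∞ f) (hg : ContDiff ℝ ∞ g)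
    (h : AB v f C A z) (h' : AB v g C' A z) : AB v (fun z => f z + g z) (C + C') A z := fun i => by
  rw [ddit_add hf hg]
  refine (norm_add_le _ _).trans ((add_le_add (h i) (h' i)).trans (le_of_eq (by ring)))

lemma ddit_csmul {v : E} {f : E → F} (hf : ContDiff ℝ ∞ f) (c : ℝ) (k : ℕ) :
    (dd v)^[k] (fun y => c • f y) = fun z => c • (dd v)^[k] f z := by
  induction k with
  | zero => rfl
  | succ k ih =>
    rw [Function.iterate_succ_apply', ih, Function.iterate_succ_apply']
    funext z
    show fderiv ℝ (fun y => c • (dd v)^[k] f y) z v = _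
    rw [fderiv_fun_const_smul (sm_diff (ddit_smooth hf k) z)]; rfl

lemma AB.csmul {v : E} {f : E → F} {C A : ℝ} {z : E} (hf : ContDiff ℝ ∞ f) (c : ℝ) {K : ℝ} (hc : |c| ≤ K)
    (h : AB v f C A z) : AB v (fun z => c • f z) (K * C) A z := fun i => by
  rw [ddit_csmul hf, norm_smul, Real.norm_eq_abs]
  have := h i
  calc |c| * ‖(dd v)^[i] f z‖ ≤ K * (C * A^i * i.factorial) :=
        mul_le_mul hc this (norm_nonneg _) ((abs_nonneg _).trans hc)
    _ = _ := by ring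

lemma ab_ev [FiniteDimensional ℝ E] [CompleteSpace F] {f : E → F} {x : E} (hs : ContDiff ℝ ∞ f) (h : AnalyticAt ℝ f x) :
    ∃ C, 1 ≤ C ∧ ∀ᶠ z in 𝓝 x, ∀ v, ‖v‖ ≤ 1 → AB v f C C z := by
  obtain ⟨C, A, hC, hA, hh⟩ := an_bound h
  refine ⟨max C A, le_max_of_le_left hC, ?_⟩
  filter_upwards [hh] with z hz v hv
  have : AB v f C A z := fun i => by
    rw [ddit_iter hs]
    refine (hz i v).trans ?_
    gcongr
    exact mul_le_of_le_one_right (by linarith) hv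
  exact this.mono (le_max_left _ _) (by linarith) (by linarith) (le_max_right _ _)

lemma ab_ev_fam [FiniteDimensional ℝ E] [CompleteSpace F] {κ : Type*} [Fintype κ] {f : κ → E → F} {x : E}
    (hs : ∀ k, ContDiff ℝ ∞ (f k)) (h : ∀ k, AnalyticAt ℝ (f k) x) :
    ∃ C, 1 ≤ C ∧ ∀ᶠ z in 𝓝 x, ∀ k v, ‖v‖ ≤ 1 → AB v (f k) C C z := by
  choose C hC hh using fun k => ab_ev (hs k) (h k)
  have hle : ∀ k, C k ≤ 1 + ∑ k, C k := fun k => by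
    have := Finset.single_le_sum (f := C) (fun k _ => (zero_le_one.trans (hC k))) (Finset.mem_univ k)
    linarith
  refine ⟨1 + ∑ k, C k, ?_, ?_⟩
  · have : 0 ≤ ∑ k, C k := Finset.sum_nonneg fun k _ => (zero_le_one.trans (hC k))
    linarith
  filter_upwards [eventually_all.mpr hh] with z hz k v hv
  exact (hz k v hv).mono (hle k) (by linarith [hC k]) (by linarith [hC k]) (hle k)

/-- analyticity of coefficients -/
structure Coef.An (Q : Coef E H ι) (x : E) : Prop where
  a00 : AnalyticAt ℝ Q.a00 x
  a0 : ∀ j, AnalyticAt ℝ (Q.a0 j) x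
  aa : ∀ j l, AnalyticAt ℝ (Q.aa j l) x
  A0 : AnalyticAt ℝ Q.A0 x
  A1 : ∀ j, AnalyticAt ℝ (Q.A1 j) x
  B : AnalyticAt ℝ Q.B x
  f : AnalyticAt ℝ Q.f x

lemma coef_ab [FiniteDimensional ℝ E] [CompleteSpace H] {Q : Coef E H ι} (hs : Q.Sm) {x : E} (h : Q.An x) :
    ∃ C, 1 ≤ C ∧ ∀ᶠ z in 𝓝 x, ∀ v, ‖v‖ ≤ 1 → AB v Q.a00 C C z ∧ (∀ j, AB v (Q.a0 j) C C z) ∧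
      (∀ j l, AB v (Q.aa j l) C C z) ∧ AB v Q.A0 C C z ∧ (∀ j, AB v (Q.A1 j) C C z) ∧ AB v Q.B C C z ∧
      AB v Q.f C C z := by
  obtain ⟨c1, h1, e1⟩ := ab_ev hs.a00 h.a00
  obtain ⟨c2, h2, e2⟩ := ab_ev_fam hs.a0 h.a0
  obtain ⟨c3, h3, e3⟩ := ab_ev_fam (f := fun p : ι × ι => Q.aa p.1 p.2) (fun p => hs.aa _ _) (fun p => h.aa _ _)
  obtain ⟨c4, h4, e4⟩ := ab_ev hs.A0 h.A0
  obtain ⟨c5, h5, e5⟩ := ab_ev_fam hs.A1 h.A1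
  obtain ⟨c6, h6, e6⟩ := ab_ev hs.B h.B
  obtain ⟨c7, h7, e7⟩ := ab_ev hs.f h.f
  refine ⟨c1 + c2 + c3 + c4 + c5 + c6 + c7, by linarith, ?_⟩
  filter_upwards [e1, e2, e3, e4, e5, e6, e7] with z e1 e2 e3 e4 e5 e6 e7 v hv
  exact ⟨(e1 v hv).mono (by linarith) (by linarith) (by linarith) (by linarith),
    fun j => (e2 j v hv).mono (by linarith) (by linarith) (by linarith) (by linarith),
    fun j l => (e3 (j, l) v hv).mono (by linarith) (by linarith) (by linarith) (by linarith),
    (e4 v hv).mono (by linarith) (by linarith) (by linarith) (by linarith),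
    fun j => (e5 j v hv).mono (by linarith) (by linarith) (by linarith) (by linarith),
    (e6 v hv).mono (by linarith) (by linarith) (by linarith) (by linarith),
    (e7 v hv).mono (by linarith) (by linarith) (by linarith) (by linarith)⟩

end
end HM

namespace HM
open MeasureTheory Filter Topology

section
variable {n : ℕ} {F : Type*} [NormedAddCommGroup F] [NormedSpace ℝ F]

/-- first basis vector -/
def e0 (n : ℕ) : EE' n := Pi.single 0 1

/-- other basis vectors -/
def bb (n : ℕ) (j : Fin n) : EE' n := Pi.single j.succ 1

lemma e0_norm : ‖e0 n‖ ≤ 1 := single_norm 0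
lemma bb_norm (j : Fin n) : ‖bb n j‖ ≤ 1 := single_norm _
lemma X0_apply (z : EE' n) : X0 n z = z 0 := rfl
lemma X0_e0 : X0 n (e0 n) = 1 := by simp [X0_apply, e0]
lemma X0_bb (j : Fin n) : X0 n (bb n j) = 0 := by simp [X0_apply, bb]

lemma S0_expand {v : EE' n} (hv : v 0 = 1) : v = e0 n + ∑ j : Fin n, v j.succ • bb n j := by
  have := pi_eq_sum_univ' v
  rw [Fin.sum_univ_succ] at this
  funext i
  refine Fin.cases ?_ (fun i => ?_) i
  · simp [e0, bb, hv]
  · simp [e0, bb, Finset.sum_apply, Pi.single_apply]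

lemma proj_norm (z : EE' n) : ‖z - z 0 • e0 n‖ ≤ ‖z‖ := by
  rw [pi_norm_le_iff_of_nonneg (norm_nonneg _)]
  intro i
  refine Fin.cases ?_ (fun i => ?_) i
  · simp [e0]
  · simpa [e0] using norm_le_pi_norm z i.succ

lemma lip_e0 {h : EE' n → F} (hs : ContDiff ℝ ∞ h) {K : ℝ}
    (h0 : ∀ᶠ z in 𝓝 (0 : EE' n), z 0 = 0 → h z = 0) (h1 : ∀ᶠ z in 𝓝 (0 : EE' n), ‖dd (e0 n) h z‖ ≤ K) :
    ∀ᶠ z in 𝓝 (0 : EE' n), ‖h z‖ ≤ K * |z 0| := by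
  obtain ⟨r, r0, hr⟩ := Metric.eventually_nhds_iff_ball.mp (h0.and h1)
  filter_upwards [Metric.ball_mem_nhds 0 r0] with z hz
  set z' := z - z 0 • e0 n with hz'
  have hz'b : z' ∈ Metric.ball (0 : EE' n) r := by
    rw [mem_ball_zero_iff] at hz ⊢; exact (proj_norm z).trans_lt hz
  have seg : ∀ t ∈ Icc (0:ℝ) 1, z' + t • (z 0 • e0 n) ∈ Metric.ball (0 : EE' n) r := fun t ht => by
    have : z' + t • (z 0 • e0 n) = (1 - t) • z' + t • z := by rw [hz']; module
    rw [this]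
    exact (convex_ball _ _) hz'b hz (by linarith [ht.2]) ht.1 (by ring)
  have hd : ∀ t ∈ Icc (0:ℝ) 1, HasDerivWithinAt (fun t => h (z' + t • (z 0 • e0 n)))
      (fderiv ℝ h (z' + t • (z 0 • e0 n)) (z 0 • e0 n)) (Icc 0 1) t := fun t _ => by
    have h2 : HasDerivAt (fun t : ℝ => z' + t • (z 0 • e0 n)) (z 0 • e0 n) t := by
      simpa using ((hasDerivAt_id t).smul_const (z 0 • e0 n)).const_add z'
    exact ((sm_diff hs _).hasFDerivAt.comp_hasDerivAt t h2).hasDerivWithinAt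
  have := norm_image_sub_le_of_norm_deriv_le_segment_01' hd (C := K * |z 0|) fun t ht => by
    rw [map_smul, norm_smul, mul_comm, Real.norm_eq_abs]
    exact mul_le_mul_of_nonneg_right ((hr _ (seg t ⟨ht.1, ht.2.le⟩)).2) (abs_nonneg _)
  have e1 : z' + (1:ℝ) • (z 0 • e0 n) = z := by rw [hz']; module
  have e2 : h (z' + (0:ℝ) • (z 0 • e0 n)) = 0 := by
    rw [zero_smul, add_zero]
    exact (hr _ hz'b).1 (by simp [hz', e0])
  rw [e1, e2, sub_zero] at this
  exact this

lemma tang_zero {h : EE' n → F} (hs : ContDiff ℝ ∞ h)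
    (h0 : ∀ᶠ z in 𝓝 (0 : EE' n), z 0 = 0 → h z = 0) (j : Fin n) : dd (bb n j) h 0 = 0 := by
  have h2 : HasDerivAt (fun t : ℝ => t • bb n j) (bb n j) 0 := by
    simpa using (hasDerivAt_id (0:ℝ)).smul_const (bb n j)
  have h3 : HasDerivAt (fun t : ℝ => h (t • bb n j)) (dd (bb n j) h 0) 0 := by
    have := line_hasDeriv hs 0 (bb n j) 0
    simpa using this
  have h4 : Tendsto (fun t : ℝ => t • bb n j) (𝓝 0) (𝓝 0) := by
    have := h2.continuousAt.tendsto; simpa using this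
  have h5 : (fun t : ℝ => h (t • bb n j)) =ᶠ[𝓝 0] fun _ => 0 := by
    filter_upwards [h4.eventually h0] with t ht
    exact ht (by simp [bb])
  exact (h3.congr_of_eventuallyEq h5.symm).unique (hasDerivAt_const _ _) 

end

section
variable {n : ℕ} {H : Type*} [NormedAddCommGroup H] [InnerProductSpace ℝ H]

/-- horizon normalization at the origin -/
structure Coef.Hor (Q : Coef (EE' n) H (Fin n)) : Prop where
  h00 : ∀ᶠ z in 𝓝 (0 : EE' n), z 0 = 0 → Q.a00 z = 0
  h0 : ∀ j, ∀ᶠ z in 𝓝 (0 : EE' n), z 0 = 0 → Q.a0 j z = 0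
  hd : dd (e0 n) Q.a00 0 = 1
  haa : ∀ j l, Q.aa j l 0 = if j = l then 1 else 0

lemma ev_le {f : EE' n → ℝ} (hf : Continuous f) {K : ℝ} (h : f 0 < K) : ∀ᶠ z in 𝓝 (0:EE' n), f z ≤ K :=
  (hf.continuousAt.eventually (gt_mem_nhds h)).mono fun _ h => h.le

lemma near_bd {Q : Coef (EE' n) H (Fin n)} (hs : Q.Sm) (hQ : Q.Hor) {η : ℝ} (hη : 0 < η) :
    ∀ᶠ z in 𝓝 (0 : EE' n), 0 < X0 n z → ∀ v ∈ S0 n,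
      |(Q.shear fun j => v j.succ).a00 z - X0 n z| ≤ η * X0 n z ∧
      |dd v (Q.shear fun j => v j.succ).a00 z - 1| ≤ η ∧
      (∀ j, |(Q.shear fun j => v j.succ).a0 j z| ≤ η * Real.sqrt (X0 n z)) ∧
      (∀ j l, |(Q.shear fun j => v j.succ).aa j l z - if j = l then 1 else 0| ≤ η) := by
  have ha00 := hs.a00
  -- a00 - X
  have E1 : ∀ᶠ z in 𝓝 (0 : EE' n), ‖Q.a00 z - X0 n z‖ ≤ η * |z 0| := by
    have hsm : ContDiff ℝ ∞ (fun z => Q.a00 z - X0 n z) := ha00.sub (X0 n).contDiff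
    refine lip_e0 hsm (hQ.h00.mono fun z hz h => by rw [hz h, X0_apply, h, sub_zero]) ?_
    refine ev_le ((dd_smooth hsm).continuous.norm) ?_
    rw [dd_sub (sm_diff ha00 0) (X0 n).differentiableAt, hQ.hd, dd_lin, X0_e0]
    simpa using hη
  have E2 : ∀ᶠ z in 𝓝 (0 : EE' n), |dd (e0 n) Q.a00 z - 1| ≤ η/2 := by
    refine ev_le (((dd_smooth ha00).continuous.sub continuous_const).abs) ?_
    show |dd (e0 n) Q.a00 0 - 1| < η/2
    rw [hQ.hd]; simpa using hη
  have E3 : ∀ j, ∀ᶠ z in 𝓝 (0 : EE' n), |dd (bb n j) Q.a00 z| ≤ η / (2 * (n+1)) := fun j => by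
    refine ev_le ((dd_smooth ha00).continuous.abs) ?_
    rw [tang_zero ha00 hQ.h00, abs_zero]; positivity
  have E4 : ∀ j, ∀ᶠ z in 𝓝 (0 : EE' n), ‖Q.a0 j z‖ ≤ (‖dd (e0 n) (Q.a0 j) 0‖ + 1) * |z 0| := fun j =>
    lip_e0 (hs.a0 j) (hQ.h0 j) (ev_le ((dd_smooth (hs.a0 j)).continuous.norm) (by linarith))
  have E5 : ∀ j, ∀ᶠ z in 𝓝 (0 : EE' n), (‖dd (e0 n) (Q.a0 j) 0‖ + 1 + 2 * (1 + η)) * Real.sqrt (|z 0|) ≤ η :=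
    fun j => by
    refine ev_le (by fun_prop) ?_
    simpa using hη
  have E6 : ∀ j l, ∀ᶠ z in 𝓝 (0 : EE' n), |Q.aa j l z - if j = l then 1 else 0| ≤ η/4 := fun j l => by
    refine ev_le ((((hs.aa j l).continuous).sub continuous_const).abs) ?_
    show |Q.aa j l 0 - if j = l then 1 else 0| < η/4
    rw [hQ.haa, sub_self, abs_zero]; positivity
  have E7 : ∀ j, ∀ᶠ z in 𝓝 (0 : EE' n), |Q.a0 j z| ≤ η/4 := fun j => by
    refine ev_le ((hs.a0 j).continuous.abs) ?_
    rw [(hQ.h0 j).self_of_nhds rfl, abs_zero]; positivity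
  have E8 : ∀ᶠ z in 𝓝 (0 : EE' n), |Q.a00 z| ≤ η/4 := by
    refine ev_le (ha00.continuous.abs) ?_
    rw [hQ.h00.self_of_nhds rfl, abs_zero]; positivity
  filter_upwards [E1, E2, eventually_all.mpr E3, eventually_all.mpr E4, eventually_all.mpr E5,
    eventually_all.mpr fun j => eventually_all.mpr (E6 j), eventually_all.mpr E7, E8] with z E1 E2 E3 E4 E5 E6 E7 E8 hX v hv
  rw [X0_apply] at hX ⊢
  have hvj : ∀ j : Fin n, |v j.succ| ≤ 1 := fun j => (norm_le_pi_norm v j.succ).trans hv.2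
  rw [abs_of_pos hX] at E1
  rw [X0_apply, Real.norm_eq_abs] at E1
  refine ⟨E1, ?_, ?_, ?_⟩
  · show |dd v Q.a00 z - 1| ≤ η
    have e : dd v Q.a00 z = dd (e0 n) Q.a00 z + ∑ j : Fin n, v j.succ * dd (bb n j) Q.a00 z := by
      conv_lhs => rw [S0_expand hv.1]
      rw [dd_add_vec, dd_sum_vec]; simp only [dd_smul_vec, smul_eq_mul]
    have e2 : |∑ j : Fin n, v j.succ * dd (bb n j) Q.a00 z| ≤ η/2 := by
      refine (Finset.abs_sum_le_sum_abs _ _).trans ?_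
      have : ∀ j ∈ Finset.univ, |v (Fin.succ j) * dd (bb n j) Q.a00 z| ≤ η / (2 * (n+1)) := fun j _ => by
        rw [abs_mul]
        exact (mul_le_of_le_one_left (abs_nonneg _) (hvj j)).trans (E3 j)
      refine (Finset.sum_le_card_nsmul _ _ _ this).trans ?_
      simp only [Finset.card_univ, Fintype.card_fin, nsmul_eq_mul]
      rw [mul_div_assoc', div_le_div_iff₀ (by positivity) (by norm_num)]
      nlinarith
    rw [e]
    have := abs_add_le (dd (e0 n) Q.a00 z - 1) (∑ j : Fin n, v j.succ * dd (bb n j) Q.a00 z)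
    rw [show dd (e0 n) Q.a00 z + ∑ j : Fin n, v j.succ * dd (bb n j) Q.a00 z - 1 =
      dd (e0 n) Q.a00 z - 1 + ∑ j : Fin n, v j.succ * dd (bb n j) Q.a00 z by ring]
    linarith
  · intro j
    show |Q.a0 j z + (-2 * v j.succ) • Q.a00 z| ≤ _
    have h1 := E4 j
    have h2 := E5 j
    rw [abs_of_pos hX] at h1 h2
    rw [Real.norm_eq_abs] at h1
    have h3 : |Q.a00 z| ≤ (1 + η) * z 0 := by
      have := abs_add_le (Q.a00 z - z 0) (z 0)
      rw [sub_add_cancel, abs_of_pos hX] at this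
      linarith
    have h4 : |(-2 * v j.succ) • Q.a00 z| ≤ 2 * ((1 + η) * z 0) := by
      rw [smul_eq_mul, abs_mul, abs_mul]
      have := hvj j
      have h5 : |(-2:ℝ)| * |v j.succ| ≤ 2 := by norm_num; linarith
      exact mul_le_mul h5 h3 (abs_nonneg _) (by norm_num)
    refine (abs_add_le _ _).trans ?_
    have h6 : z 0 = Real.sqrt (z 0) * Real.sqrt (z 0) := (Real.mul_self_sqrt hX.le).symm
    have h7 := mul_le_mul_of_nonneg_right h2 (Real.sqrt_nonneg (z 0))
    rw [mul_assoc, ← h6] at h7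
    refine le_trans ?_ h7
    linarith
  · intro j l
    show |Q.aa j l z + ((-v j.succ) • Q.a0 l z + (v j.succ * v l.succ) • Q.a00 z) - _| ≤ _
    have h1 : |(-v j.succ) • Q.a0 l z| ≤ η/4 := by
      rw [smul_eq_mul, abs_mul, abs_neg]
      exact (mul_le_of_le_one_left (abs_nonneg _) (hvj j)).trans (E7 l)
    have h2 : |(v j.succ * v l.succ) • Q.a00 z| ≤ η/4 := by
      rw [smul_eq_mul, abs_mul, abs_mul]
      exact (mul_le_of_le_one_left (abs_nonneg _) (mul_le_one₀ (hvj j) (abs_nonneg _) (hvj l))).trans E8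
    rw [add_sub_right_comm]
    have h3 := abs_add_le ((-v j.succ) • Q.a0 l z) ((v j.succ * v l.succ) • Q.a00 z)
    refine (abs_add_le _ _).trans ?_
    linarith [E6 j l]

theorem pos_side [CompleteSpace H] {Q : Coef (EE' n) H (Fin n)} (hs : Q.Sm) (ha : Q.An 0) (hQ : Q.Hor) {u : EE' n → H}
    (hu : ContDiff ℝ ∞ u) (heq : ∀ᶠ z in 𝓝 (0 : EE' n), Q.LL (e0 n) (bb n) u z = Q.f z) :
    ∃ w : EE' n → H, AnalyticAt ℝ w 0 ∧ ∀ᶠ z in 𝓝 0, 0 < X0 n z → w z = u z := by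
  set η : ℝ := 1 / (16 * (3 + (n:ℝ) + n^2)) with hη
  have η0 : 0 < η := by positivity
  obtain ⟨C, hC, hab⟩ := coef_ab hs ha
  have hX1 : ∀ᶠ z in 𝓝 (0 : EE' n), X0 n z ≤ 1 := ev_le (X0 n).continuous (by simp)
  obtain ⟨r, r0, hr⟩ := Metric.eventually_nhds_iff_ball.mp
    (((hab.and (near_bd hs hQ η0)).and heq.eventually_nhds).and hX1)
  set S : Set (EE' n) := S0 n ∪ range (bb n) with hS
  have hS1 : ∀ a ∈ S, ‖a‖ ≤ 1 := by
    rintro a (h | ⟨j, rfl⟩)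
    · exact h.2
    · exact bb_norm j
  obtain ⟨c, hc, ζ, hcut, hζ, r', r'0, hζ1⟩ := cut_exists (X0 n) S hS1 r0 (fun z hz => (hr z hz).2)
  obtain ⟨M, R, hM, hR, hb⟩ := ss_all (H := H) (volume : Measure (EE' n)) n (by simp) c hc (4*C) C (by linarith) hC hcut
    (b := bb n) subset_union_right X0_bb bb_norm η0.le (by rw [hη]; field_simp; exact le_refl _)
    hu (fun v => Q.shear fun j => v j.succ) (S0 n) subset_union_left (fun v _ => hs.shear _) (fun v hv => hv.1)
    (fun v hv => hv.2) (fun v hv z hz hX => by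
      obtain ⟨⟨⟨h1, h2⟩, h3⟩, -⟩ := hr z (hζ z hz)
      obtain ⟨g1, g2, g3, g4, g5, g6, g7⟩ := h1 v hv.2
      obtain ⟨b1, b2, b3, b4⟩ := h2 hX v hv
      have hvj : ∀ j : Fin n, |v j.succ| ≤ 1 := fun j => (norm_le_pi_norm v j.succ).trans hv.2
      have C4 : C ≤ 4 * C := by linarith
      have CC : C ≤ C := le_rfl
      have C0 : 0 ≤ C := by linarith
      have hvj' : ∀ j : Fin n, |-v j.succ| ≤ 1 := fun j => by rw [abs_neg]; exact hvj j
      refine ⟨⟨g1.mono C4 C0 C0 CC, fun j => ?_, fun j l => ?_, g4.mono C4 C0 C0 CC, fun j => ?_,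
        g6.mono C4 C0 C0 CC, g7.mono C4 C0 C0 CC, b1, b2, b3, b4⟩, ?_⟩
      · exact ((g2 j).add (hs.a0 j) (hs.a00.const_smul _) (AB.csmul hs.a00 (-2 * v j.succ) (K := 2)
          (by rw [abs_mul]; have := hvj j; norm_num; linarith) g1)).mono (by linarith) C0 (by linarith) CC
      · exact ((g3 j l).add (hs.aa j l) (((hs.a0 l).const_smul _).add (hs.a00.const_smul _))
          (AB.add ((hs.a0 l).const_smul _) (hs.a00.const_smul _) (AB.csmul (hs.a0 l) (-v j.succ) (hvj' j) (g2 l))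
            (AB.csmul hs.a00 (v j.succ * v l.succ) (K := 1)
              (by rw [abs_mul]; exact mul_le_one₀ (hvj j) (abs_nonneg _) (hvj l)) g1))).mono
          (by linarith) C0 (by linarith) CC
      · exact ((g5 j).add (hs.A1 j) (hs.A0.const_smul _) (AB.csmul hs.A0 (-v j.succ) (hvj' j) g4)).mono
          (by linarith) C0 (by linarith) CC
      · filter_upwards [h3] with y hy
        rw [Q.LL_shear _ (S0_expand hv.1) hu]; exact hy)
  obtain ⟨ρ, ρ0, hρ⟩ := an_pos hcut hu hM hR hb
  refine an_ext r'0 ρ0 fun q hq hX => hρ q hX ?_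
  filter_upwards [Metric.isOpen_ball.mem_nhds hq] with z hz using hζ1 z hz

end
end HM

namespace HM
open MeasureTheory Filter Topology

section
variable {n : ℕ} {F : Type*} [NormedAddCommGroup F] [NormedSpace ℝ F]

lemma lip_pow {h : EE' n → F} (hs : ContDiff ℝ ∞ h) {K : ℝ} (hK : 0 ≤ K) (m : ℕ)
    (h0 : ∀ᶠ z in 𝓝 (0 : EE' n), z 0 = 0 → h z = 0)
    (h1 : ∀ᶠ z in 𝓝 (0 : EE' n), ‖dd (e0 n) h z‖ ≤ K * |z 0|^m) :
    ∀ᶠ z in 𝓝 (0 : EE' n), ‖h z‖ ≤ K * |z 0|^(m+1) := by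
  obtain ⟨r, r0, hr⟩ := Metric.eventually_nhds_iff_ball.mp (h0.and h1)
  filter_upwards [Metric.ball_mem_nhds 0 r0] with z hz
  set z' := z - z 0 • e0 n with hz'
  have hz'b : z' ∈ Metric.ball (0 : EE' n) r := by
    rw [mem_ball_zero_iff] at hz ⊢; exact (proj_norm z).trans_lt hz
  have seg : ∀ t ∈ Icc (0:ℝ) 1, z' + t • (z 0 • e0 n) ∈ Metric.ball (0 : EE' n) r := fun t ht => by
    have : z' + t • (z 0 • e0 n) = (1 - t) • z' + t • z := by rw [hz']; module
    rw [this]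
    exact (convex_ball _ _) hz'b hz (by linarith [ht.2]) ht.1 (by ring)
  have hd : ∀ t ∈ Icc (0:ℝ) 1, HasDerivWithinAt (fun t => h (z' + t • (z 0 • e0 n)))
      (dd (z 0 • e0 n) h (z' + t • (z 0 • e0 n))) (Icc 0 1) t := fun t _ =>
    (line_hasDeriv hs _ _ t).hasDerivWithinAt
  have := norm_image_sub_le_of_norm_deriv_le_segment_01' hd (C := K * |z 0|^(m+1)) fun t ht => by
    rw [dd_smul_vec, norm_smul, mul_comm, Real.norm_eq_abs, pow_succ, ← mul_assoc]
    refine mul_le_mul_of_nonneg_right ((hr _ (seg t ⟨ht.1, ht.2.le⟩)).2.trans ?_) (abs_nonneg _)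
    have e : (z' + t • (z 0 • e0 n)) 0 = t * z 0 := by simp [hz', e0]
    rw [e, abs_mul, abs_of_nonneg ht.1]
    exact mul_le_mul_of_nonneg_left (pow_le_pow_left₀ (mul_nonneg ht.1 (abs_nonneg _))
      (mul_le_of_le_one_left (abs_nonneg _) ht.2.le) m) hK
  have e1 : z' + (1:ℝ) • (z 0 • e0 n) = z := by rw [hz']; module
  have e2 : h (z' + (0:ℝ) • (z 0 • e0 n)) = 0 := by
    rw [zero_smul, add_zero]
    exact (hr _ hz'b).1 (by simp [hz', e0])
  rw [e1, e2, sub_zero] at this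
  exact this

/-- vanishing for positive first coordinate, near zero -/
def VP (h : EE' n → F) : Prop := ∀ᶠ z in 𝓝 (0 : EE' n), 0 < z 0 → h z = 0

lemma VP.dd {h : EE' n → F} (hh : VP h) (v : EE' n) : VP (dd v h) := by
  have h1 := hh.eventually_nhds
  filter_upwards [h1] with z hz h0
  have : h =ᶠ[𝓝 z] fun _ => 0 := by
    filter_upwards [hz, (continuous_apply (0 : Fin (n+1))).continuousAt.eventually (lt_mem_nhds h0)] with y hy h2 using hy h2
  rw [dd_congr this]; simp [HM.dd]

lemma VP.closed {h : EE' n → F} (hh : VP h) (hc : Continuous h) : ∀ᶠ z in 𝓝 (0 : EE' n), 0 ≤ z 0 → h z = 0 := by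
  filter_upwards [hh.eventually_nhds] with z hz h0
  have t : Tendsto (fun t : ℝ => z + t • e0 n) (𝓝[>] 0) (𝓝 z) := by
    have : Continuous (fun t : ℝ => z + t • e0 n) := by fun_prop
    have := this.tendsto 0
    simp only [zero_smul, add_zero] at this
    exact this.mono_left nhdsWithin_le_nhds
  have t2 : Tendsto (fun t : ℝ => h (z + t • e0 n)) (𝓝[>] 0) (𝓝 (h z)) := (hc.tendsto z).comp t
  have t3 : Tendsto (fun t : ℝ => h (z + t • e0 n)) (𝓝[>] 0) (𝓝 0) := by
    refine tendsto_const_nhds.congr' ?_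
    filter_upwards [t.eventually hz, self_mem_nhdsWithin] with s hs h1
    refine (hs ?_).symm
    have : (0:ℝ) < s := h1
    simp [e0]; linarith
  exact tendsto_nhds_unique t2 t3

lemma flat {h : EE' n → F} (hs : ContDiff ℝ ∞ h) (hh : VP h) (m : ℕ) :
    ∃ K, 0 ≤ K ∧ ∀ᶠ z in 𝓝 (0 : EE' n), ‖h z‖ ≤ K * |z 0|^m := by
  induction m generalizing h with
  | zero =>
    refine ⟨‖h 0‖ + 1, by positivity, ?_⟩
    have := ev_le (hs.continuous.norm) (K := ‖h 0‖ + 1) (by linarith)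
    simpa using this
  | succ m ih =>
    obtain ⟨K, K0, hK⟩ := ih (dd_smooth hs) (hh.dd (e0 n))
    exact ⟨K, K0, lip_pow hs K0 m ((hh.closed hs.continuous).mono fun z hz h => hz h.ge) hK⟩

end

section
variable {n : ℕ}

/-- defining function of the lens -/
def ls (c : ℝ) (z : EE' n) : ℝ := c - Real.sqrt (-z 0) - ∑ j : Fin n, (z j.succ)^2

/-- the weight -/
def Th (J : ℕ) (c : ℝ) (z : EE' n) : ℝ :=
  if z 0 < 0 then ((-z 0)⁻¹)^J * (max (ls c z) 0)^2 else 0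

lemma Th_nonneg (J : ℕ) (c : ℝ) (z : EE' n) : 0 ≤ Th J c z := by
  unfold Th
  split_ifs with h
  · have : 0 < -z 0 := by linarith
    positivity
  · exact le_rfl

lemma ls_supp {c : ℝ} (hc : 0 < c) (hc1 : c ≤ 1) {z : EE' n} (h : z 0 < 0) (h1 : 0 < ls c z) :
    -z 0 ≤ 1 ∧ (∀ j : Fin n, |z j.succ| ≤ Real.sqrt c) ∧ ‖z‖ ≤ Real.sqrt c ∧ ls c z ≤ 1 := by
  have s0 : 0 ≤ Real.sqrt (-z 0) := Real.sqrt_nonneg _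
  have y0 : 0 ≤ ∑ j : Fin n, (z j.succ)^2 := Finset.sum_nonneg fun _ _ => sq_nonneg _
  have l1 : ls c z ≤ 1 := by unfold ls; linarith
  unfold ls at h1
  have h2 : Real.sqrt (-z 0) ≤ c := by linarith
  have h3 : -z 0 ≤ c^2 := by
    have := Real.sq_sqrt (show 0 ≤ -z 0 by linarith)
    rw [← this]; gcongr
  have h4 : ∀ j : Fin n, |z j.succ| ≤ Real.sqrt c := fun j => by
    apply Real.abs_le_sqrt
    have := Finset.single_le_sum (f := fun j : Fin n => (z j.succ)^2) (fun _ _ => sq_nonneg _) (Finset.mem_univ j)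
    beta_reduce at this
    linarith
  have h5 : c ≤ Real.sqrt c := by
    apply Real.le_sqrt_of_sq_le; nlinarith
  refine ⟨by nlinarith, h4, ?_, l1⟩
  rw [pi_norm_le_iff_of_nonneg (Real.sqrt_nonneg _)]
  intro i
  refine Fin.cases ?_ h4 i
  rw [Real.norm_eq_abs, abs_of_neg h]
  nlinarith

/-- derivative of the weight -/
def ThD (J : ℕ) (c : ℝ) (z v : EE' n) : ℝ :=
  (J * ((-z 0)⁻¹)^(J+1) * (max (ls c z) 0)^2 + ((-z 0)⁻¹)^J * (2 * max (ls c z) 0) * (1 / (2 * Real.sqrt (-z 0)))) * v 0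
  - ((-z 0)⁻¹)^J * (2 * max (ls c z) 0) * ∑ j : Fin n, 2 * z j.succ * v j.succ

lemma line_coord (z v : EE' n) (i : Fin (n+1)) : HasDerivAt (fun t : ℝ => (z + t • v) i) (v i) 0 := by
  simpa using ((hasDerivAt_id (0:ℝ)).mul_const (v i)).const_add (z i)

lemma Th_diff (J : ℕ) (c : ℝ) {z : EE' n} (hz : z 0 < 0) : DifferentiableAt ℝ (Th J c) z := by
  have e : Th J c =ᶠ[𝓝 z] fun z => ((-z 0)⁻¹)^J * (max (ls c z) 0)^2 := by
    filter_upwards [(continuous_apply (0 : Fin (n+1))).continuousAt.eventually (gt_mem_nhds hz)] with y hy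
    unfold Th; rw [if_pos hy]
  refine DifferentiableAt.congr_of_eventuallyEq ?_ e
  have h1 : DifferentiableAt ℝ (fun z : EE' n => -z 0) z := by fun_prop
  have h2 : DifferentiableAt ℝ (fun z : EE' n => ls c z) z := by
    unfold ls
    refine DifferentiableAt.sub ((differentiableAt_const c).sub (h1.sqrt (by linarith))) ?_
    fun_prop
  have h3 : DifferentiableAt ℝ (fun z : EE' n => (max (ls c z) 0)^2) z :=
    ((posPow_hasDerivAt 0 (ls c z)).comp_hasFDerivAt z h2.hasFDerivAt).differentiableAt
  exact ((h1.inv (by linarith)).pow J).mul h3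

lemma Th_dd (J : ℕ) (c : ℝ) {z : EE' n} (hz : z 0 < 0) (v : EE' n) : dd v (Th J c) z = ThD J c z v := by
  have h2 : HasDerivAt (fun t : ℝ => z + t • v) v 0 := by
    simpa using ((hasDerivAt_id (0:ℝ)).smul_const v).const_add z
  have h3 : HasDerivAt (fun t : ℝ => Th J c (z + t • v)) (dd v (Th J c) z) 0 := by
    have e : z + (0:ℝ) • v = z := by simp
    have h4 : HasFDerivAt (Th J c) (fderiv ℝ (Th J c) z) (z + (0:ℝ) • v) := by
      rw [e]; exact (Th_diff J c hz).hasFDerivAt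
    exact h4.comp_hasDerivAt (0:ℝ) h2
  have p0 : 0 < -z 0 := by linarith
  have hx := line_coord z v 0
  have hl : HasDerivAt (fun t : ℝ => ls c (z + t • v))
      (v 0 * (1 / (2 * Real.sqrt (-z 0))) - ∑ j : Fin n, 2 * z j.succ * v j.succ) 0 := by
    unfold ls
    have a1 : HasDerivAt (fun t : ℝ => Real.sqrt (-(z + t • v) 0)) (-v 0 / (2 * Real.sqrt (-z 0))) 0 := by
      have := hx.neg.sqrt (by simpa using hz.ne)
      simpa using this
    have a2 : HasDerivAt (fun t : ℝ => ∑ j : Fin n, ((z + t • v) j.succ)^2) (∑ j : Fin n, 2 * z j.succ * v j.succ) 0 := by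
      refine HasDerivAt.fun_sum fun j _ => ?_
      have := (line_coord z v j.succ).fun_pow 2
      simpa using this
    refine (((hasDerivAt_const (0:ℝ) c).sub a1).sub a2).congr_deriv ?_
    ring
  have hm : HasDerivAt (fun t : ℝ => (max (ls c (z + t • v)) 0)^2)
      ((2 * max (ls c z) 0) * (v 0 * (1 / (2 * Real.sqrt (-z 0))) - ∑ j : Fin n, 2 * z j.succ * v j.succ)) 0 := by
    have h5 := posPow_hasDerivAt 0 (ls c (z + (0:ℝ) • v))
    have h7 := HasDerivAt.comp (0:ℝ) h5 hl
    simp only [Function.comp_def, zero_smul, add_zero] at h7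
    simpa using h7
  have hi : HasDerivAt (fun t : ℝ => ((-(z + t • v) 0)⁻¹)^J) (J * ((-z 0)⁻¹)^(J+1) * v 0) 0 := by
    have h6 := (hx.fun_neg.fun_inv (by simpa using hz.ne)).fun_pow J
    refine h6.congr_deriv ?_
    rcases J with _ | J
    · simp
    · simp only [zero_smul, add_zero, Nat.add_sub_cancel]
      rw [pow_succ (-z 0)⁻¹ (J+1), pow_succ (-z 0)⁻¹ J]
      field_simp
  have hT := hi.fun_mul hm
  have e : (fun t : ℝ => Th J c (z + t • v)) =ᶠ[𝓝 0] fun t =>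
      ((-(z + t • v) 0)⁻¹)^J * (max (ls c (z + t • v)) 0)^2 := by
    have : ∀ᶠ t : ℝ in 𝓝 0, (z + t • v) 0 < 0 :=
      hx.continuousAt.eventually (gt_mem_nhds (by simpa using hz))
    filter_upwards [this] with t ht
    unfold Th; rw [if_pos ht]
  rw [h3.unique (hT.congr_of_eventuallyEq e)]
  unfold ThD
  simp only [zero_smul, add_zero]
  ring

end
end HM

namespace HM
open MeasureTheory Filter Topology

section
variable {n : ℕ}

lemma Th_zero {J : ℕ} {c : ℝ} {z : EE' n} (h : ¬ (z 0 < 0 ∧ 0 < ls c z)) : Th J c z = 0 := by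
  unfold Th
  split_ifs with h1
  · rw [max_eq_right (by by_contra h2; exact h ⟨h1, by linarith⟩)]; simp
  · rfl

lemma ThD_zero {J : ℕ} {c : ℝ} {z : EE' n} (h : ls c z ≤ 0) (v : EE' n) : ThD J c z v = 0 := by
  unfold ThD
  rw [max_eq_right h]; simp

lemma Th_le {J : ℕ} {c : ℝ} (hc : 0 < c) (hc1 : c ≤ 1) {z : EE' n} (h : z 0 < 0) (h1 : 0 < ls c z) :
    Th J c z ≤ ((-z 0)⁻¹)^J := by
  obtain ⟨_, _, _, h2⟩ := ls_supp hc hc1 h h1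
  unfold Th
  rw [if_pos h, max_eq_left h1.le]
  have p0 : 0 < -z 0 := by linarith
  refine mul_le_of_le_one_right (by positivity) ?_
  exact pow_le_one₀ h1.le h2

lemma ThD_le {J : ℕ} {c : ℝ} (hc : 0 < c) (hc1 : c ≤ 1) {z : EE' n} (h : z 0 < 0) (h1 : 0 < ls c z) (v : EE' n) :
    |ThD J c z v| ≤ ((-z 0)⁻¹)^(J+1) * ((J + 1 + 4 * n) * ‖v‖) := by
  obtain ⟨h3, h4, _, h2⟩ := ls_supp hc hc1 h h1
  unfold ThD
  rw [max_eq_left h1.le]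
  have p0 : 0 < -z 0 := by linarith
  set i := (-z 0)⁻¹ with hi
  have i1 : 1 ≤ i := (one_le_inv₀ p0).mpr h3
  have sq1 : 1 / (2 * Real.sqrt (-z 0)) ≤ i / 2 := by
    have : -z 0 ≤ Real.sqrt (-z 0) := Real.le_sqrt_of_sq_le (by nlinarith)
    rw [one_div, mul_inv, hi]
    have := inv_anti₀ p0 this
    linarith
  have sq0 : 0 ≤ 1 / (2 * Real.sqrt (-z 0)) := by positivity
  have vi : ∀ k, |v k| ≤ ‖v‖ := fun k => norm_le_pi_norm v k
  have c1 : Real.sqrt c ≤ 1 := Real.sqrt_le_one.mpr hc1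
  have S : |∑ j : Fin n, 2 * z j.succ * v j.succ| ≤ 2 * n * ‖v‖ := by
    refine (Finset.abs_sum_le_sum_abs _ _).trans ?_
    calc _ ≤ ∑ j : Fin n, 2 * ‖v‖ := by
          refine Finset.sum_le_sum fun j _ => ?_
          rw [abs_mul, abs_mul, abs_two]
          have := (h4 j).trans c1
          have := mul_le_mul this (vi j.succ) (abs_nonneg _) zero_le_one
          nlinarith
      _ = _ := by simp; ring
  have iJ : i^J ≤ i^(J+1) := pow_le_pow_right₀ i1 (Nat.le_succ _)
  have iJ0 : 0 < i^J := by positivity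
  have l1 : (ls c z)^2 ≤ 1 := pow_le_one₀ h1.le h2
  set T := 1 / (2 * Real.sqrt (-z 0)) with hT
  have b1 : |(J * i^(J+1) * (ls c z)^2 + i^J * (2 * ls c z) * T) * v 0| ≤ i^(J+1) * ((J+1) * ‖v‖) := by
    rw [abs_mul, abs_of_nonneg (by positivity)]
    have x1 : J * i^(J+1) * (ls c z)^2 ≤ J * i^(J+1) := mul_le_of_le_one_right (by positivity) l1
    have x2 : i^J * (2 * ls c z) * T ≤ i^J * 2 * (i/2) := by
      refine mul_le_mul ?_ sq1 sq0 (by positivity)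
      nlinarith
    have x3 : i^J * 2 * (i/2) = i^(J+1) := by rw [pow_succ]; ring
    calc _ ≤ (J * i^(J+1) + i^(J+1)) * ‖v‖ := mul_le_mul (by linarith) (vi 0) (abs_nonneg _) (by positivity)
      _ = _ := by ring
  have b2 : |i^J * (2 * ls c z) * ∑ j : Fin n, 2 * z j.succ * v j.succ| ≤ i^(J+1) * (4 * n * ‖v‖) := by
    rw [abs_mul, abs_of_nonneg (by positivity)]
    calc _ ≤ (i^(J+1) * 2) * (2 * n * ‖v‖) := by
          refine mul_le_mul ?_ S (abs_nonneg _) (by positivity)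
          exact mul_le_mul iJ (by linarith) (by linarith) (by positivity)
      _ = _ := by ring
  calc _ ≤ _ := abs_sub _ _
    _ ≤ _ := add_le_add b1 b2
    _ = _ := by ring

lemma theta_int {h : EE' n → ℝ} (hs : ContDiff ℝ ∞ h) (hh : VP h) (J : ℕ) (v : EE' n) :
    ∃ c0, 0 < c0 ∧ c0 ≤ 1 ∧ ∀ c, 0 < c → c ≤ c0 →
      Integrable (dd v (fun z => Th J c z * h z)) volume ∧ ∫ z, dd v (fun z => Th J c z * h z) z = 0 ∧
      (∀ z, z 0 < 0 → dd v (fun z => Th J c z * h z) z = ThD J c z v * h z + Th J c z * dd v h z) ∧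
      (∀ z, 0 ≤ z 0 → dd v (fun z => Th J c z * h z) z = 0) := by
  obtain ⟨K, K0, hK⟩ := flat hs hh (J+2)
  obtain ⟨K', K0', hK'⟩ := flat (dd_smooth hs) (hh.dd v) (J+2)
  obtain ⟨r, r0, hr⟩ := Metric.eventually_nhds_iff_ball.mp (hK.and hK')
  refine ⟨min 1 (r^2/4), by positivity, min_le_left _ _, fun c hc hc0 => ?_⟩
  have hc1 : c ≤ 1 := hc0.trans (min_le_left _ _)
  have hcr : Real.sqrt c < r := by
    rw [Real.sqrt_lt' r0]
    have := hc0.trans (min_le_right _ _)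
    nlinarith
  set G := fun z => Th J c z * h z with hG
  have bd : ∀ z : EE' n, z 0 < 0 → 0 < ls c z → |h z| ≤ K * (-z 0)^(J+2) ∧ |dd v h z| ≤ K' * (-z 0)^(J+2) := by
    intro z h1 h2
    have hz := (ls_supp hc hc1 h1 h2).2.2.1
    have := hr z (by rw [mem_ball_zero_iff]; linarith)
    rwa [Real.norm_eq_abs, Real.norm_eq_abs, abs_of_neg h1] at this
  have G2 : ∀ z : EE' n, |G z| ≤ K * |z 0|^2 := by
    intro z
    by_cases hz : z 0 < 0 ∧ 0 < ls c z
    · obtain ⟨h1, h2⟩ := hz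
      have p0 : 0 < -z 0 := by linarith
      rw [hG]; beta_reduce
      rw [abs_mul, abs_of_nonneg (Th_nonneg _ _ _), abs_of_neg h1]
      calc _ ≤ ((-z 0)⁻¹)^J * (K * (-z 0)^(J+2)) :=
            mul_le_mul (Th_le hc hc1 h1 h2) (bd z h1 h2).1 (abs_nonneg _) (by positivity)
        _ = K * (-z 0)^2 * (((-z 0)⁻¹) * (-z 0))^J := by rw [mul_pow]; ring
        _ = _ := by rw [inv_mul_cancel₀ p0.ne', one_pow, mul_one]
    · rw [hG]; beta_reduce
      rw [Th_zero hz, zero_mul, abs_zero]; positivity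
  have dneg : ∀ z : EE' n, z 0 < 0 → DifferentiableAt ℝ G z := fun z hz => (Th_diff J c hz).mul (sm_diff hs z)
  have dzero : ∀ z : EE' n, z 0 = 0 → HasFDerivAt G (0 : EE' n →L[ℝ] ℝ) z := by
    intro z hz
    have g0 : G z = 0 := by
      have := G2 z
      rw [hz] at this
      simpa using this
    refine Asymptotics.IsBigO.hasFDerivAt (n := 2) ?_ one_lt_two
    refine Asymptotics.IsBigO.of_bound K (Eventually.of_forall fun y => ?_)
    have e1 := G2 y
    have e2 : |y 0| ≤ ‖y - z‖ := by
      have := norm_le_pi_norm (y - z) 0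
      rw [Pi.sub_apply, hz, sub_zero] at this
      exact this
    rw [Real.norm_eq_abs, Real.norm_eq_abs, abs_of_nonneg (show 0 ≤ ‖y - z‖^2 by positivity)]
    exact e1.trans (mul_le_mul_of_nonneg_left (pow_le_pow_left₀ (abs_nonneg _) e2 2) K0)
  have dpos : ∀ z : EE' n, 0 < z 0 → HasFDerivAt G (0 : EE' n →L[ℝ] ℝ) z := by
    intro z hz
    have e : G =ᶠ[𝓝 z] fun _ => 0 := by
      filter_upwards [(continuous_apply (0 : Fin (n+1))).continuousAt.eventually (lt_mem_nhds hz)] with y hy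
      rw [hG]; beta_reduce
      rw [Th_zero (by intro h; linarith [h.1]), zero_mul]
    exact (hasFDerivAt_const (0:ℝ) z).congr_of_eventuallyEq e
  have hd : Differentiable ℝ G := by
    intro z
    rcases lt_trichotomy (z 0) 0 with h1 | h1 | h1
    · exact dneg z h1
    · exact (dzero z h1).differentiableAt
    · exact (dpos z h1).differentiableAt
  have f1 : ∀ z, z 0 < 0 → dd v G z = ThD J c z v * h z + Th J c z * dd v h z := by
    intro z hz
    have := ((Th_diff J c hz).hasFDerivAt.mul (sm_diff hs z).hasFDerivAt).fderiv
    have e : dd v G z = (Th J c z • fderiv ℝ h z + h z • fderiv ℝ (Th J c) z) v := by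
      rw [← this]; rfl
    rw [e, ← Th_dd J c hz v]
    simp [dd]; ring
  have f2 : ∀ z, 0 ≤ z 0 → dd v G z = 0 := by
    intro z hz
    rcases hz.eq_or_lt with h1 | h1
    · unfold dd; rw [(dzero z h1.symm).fderiv]; rfl
    · unfold dd; rw [(dpos z h1).fderiv]; rfl
  have outG : ∀ z : EE' n, z ∉ Metric.closedBall (0 : EE' n) (Real.sqrt c) → ¬ (z 0 < 0 ∧ 0 < ls c z) := by
    rintro z hz ⟨h1, h2⟩
    exact hz (by rw [mem_closedBall_zero_iff]; exact (ls_supp hc hc1 h1 h2).2.2.1)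
  have cs : HasCompactSupport G := by
    refine HasCompactSupport.intro (isCompact_closedBall 0 (Real.sqrt c)) fun z hz => ?_
    rw [hG]; beta_reduce
    rw [Th_zero (outG z hz), zero_mul]
  have dz : ∀ z : EE' n, ¬ (z 0 < 0 ∧ 0 < ls c z) → dd v G z = 0 := by
    intro z hz
    by_cases h1 : z 0 < 0
    · rw [f1 z h1, Th_zero hz, ThD_zero (by by_contra h2; exact hz ⟨h1, by linarith⟩)]; simp
    · exact f2 z (by linarith)
  have M : ∀ z : EE' n, ‖dd v G z‖ ≤ (J + 1 + 4 * n) * ‖v‖ * K + K' := by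
    intro z
    by_cases hz : z 0 < 0 ∧ 0 < ls c z
    · obtain ⟨h1, h2⟩ := hz
      have p0 : 0 < -z 0 := by linarith
      have p1 := (ls_supp hc hc1 h1 h2).1
      obtain ⟨k1, k2⟩ := bd z h1 h2
      rw [f1 z h1, Real.norm_eq_abs]
      refine (abs_add_le _ _).trans ?_
      rw [abs_mul, abs_mul, abs_of_nonneg (Th_nonneg _ _ _)]
      refine add_le_add ?_ ?_
      · calc _ ≤ (((-z 0)⁻¹)^(J+1) * ((J + 1 + 4 * n) * ‖v‖)) * (K * (-z 0)^(J+2)) :=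
              mul_le_mul (ThD_le hc hc1 h1 h2 v) k1 (abs_nonneg _) (by positivity)
          _ = ((J + 1 + 4 * n) * ‖v‖ * K) * (-z 0) * (((-z 0)⁻¹) * (-z 0))^(J+1) := by rw [mul_pow]; ring
          _ ≤ _ := by
              rw [inv_mul_cancel₀ p0.ne', one_pow, mul_one]
              exact mul_le_of_le_one_right (by positivity) p1
      · calc _ ≤ ((-z 0)⁻¹)^J * (K' * (-z 0)^(J+2)) :=
              mul_le_mul (Th_le hc hc1 h1 h2) k2 (abs_nonneg _) (by positivity)
          _ = K' * (-z 0)^2 * (((-z 0)⁻¹) * (-z 0))^J := by rw [mul_pow]; ring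
          _ ≤ _ := by
              rw [inv_mul_cancel₀ p0.ne', one_pow, mul_one]
              exact mul_le_of_le_one_right (by positivity) (pow_le_one₀ p0.le p1)
    · rw [dz z hz, norm_zero]; positivity
  have meas : Measurable (dd v G) := measurable_fderiv_apply_const ℝ G v
  have int : Integrable (dd v G) volume := by
    have sup : Function.support (dd v G) ⊆ Metric.closedBall (0 : EE' n) (Real.sqrt c) := by
      intro z hz
      by_contra h1
      exact hz (dz z (outG z h1))
    rw [← integrableOn_iff_integrable_of_support_subset sup]
    exact Measure.integrableOn_of_bounded (M := (J + 1 + 4 * n) * ‖v‖ * K + K')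
      ((isCompact_closedBall (0 : EE' n) (Real.sqrt c)).measure_lt_top.ne) meas.aestronglyMeasurable
      (Eventually.of_forall M)
  exact ⟨int, integral_dd_eq_zero volume hd cs int, f1, f2⟩

end
end HM

namespace HM
open MeasureTheory Filter Topology

section
variable {n : ℕ}

lemma ThD_e0 (J : ℕ) (c : ℝ) (z : EE' n) : ThD J c z (e0 n) =
    J * ((-z 0)⁻¹)^(J+1) * (max (ls c z) 0)^2 + ((-z 0)⁻¹)^J * (2 * max (ls c z) 0) * (1 / (2 * Real.sqrt (-z 0))) := by
  unfold ThD
  simp [e0]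

lemma ThD_bb (J : ℕ) (c : ℝ) (z : EE' n) (j : Fin n) : ThD J c z (bb n j) =
    - (((-z 0)⁻¹)^J * (2 * max (ls c z) 0) * (2 * z j.succ)) := by
  unfold ThD
  have : ∑ l : Fin n, 2 * z l.succ * bb n j l.succ = 2 * z j.succ := by
    rw [Finset.sum_eq_single j]
    · simp [bb]
    · intro l _ hl; simp [bb, hl]
    · simp
  rw [this]
  simp [bb]

lemma I_low {J : ℕ} {C i q L e N d S Y : ℝ} {n : ℕ} (y F : Fin n → ℝ) (hi : 0 < i) (hq : 0 < q) (hL : 0 < L) (hN : 0 ≤ N)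
    (hJ : 2 * C + 2 ≤ J) (hd : |d| ≤ i * (C * N)) (he : N / 2 ≤ e) (hF : ∀ j, |F j| ≤ q * (C * N))
    (hY : ∑ j, |y j| ≤ Y) (hYC : 4 * Y * C ≤ 1/2) (hC : 0 ≤ C) (hS : S = ∑ j, 2 * y j * F j) :
    i^(J+1) * L^2 * N ≤ (J * i^(J+1) * L^2 + i^J * (2 * L) * (q / 2)) * e + i^J * L^2 * d + i^J * (2 * L) * S := by
  have a1 : (J * i^(J+1) * L^2 + i^J * (2 * L) * (q / 2)) * (N/2) ≤ (J * i^(J+1) * L^2 + i^J * (2 * L) * (q / 2)) * e :=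
    mul_le_mul_of_nonneg_left he (by positivity)
  have a2 : - (i^J * L^2 * (i * (C * N))) ≤ i^J * L^2 * d := by
    have := mul_le_mul_of_nonneg_left (neg_le_of_abs_le hd) (show 0 ≤ i^J * L^2 by positivity)
    linarith
  have a3 : |S| ≤ 2 * Y * (q * (C * N)) := by
    rw [hS]
    refine (Finset.abs_sum_le_sum_abs _ _).trans ?_
    calc _ ≤ ∑ j, 2 * |y j| * (q * (C * N)) := by
          refine Finset.sum_le_sum fun j _ => ?_
          rw [abs_mul, abs_mul, abs_two]
          exact mul_le_mul_of_nonneg_left (hF j) (by positivity)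
      _ = 2 * (∑ j, |y j|) * (q * (C * N)) := by rw [← Finset.sum_mul, ← Finset.mul_sum]
      _ ≤ _ := by gcongr
  have a4 : - (i^J * (2 * L) * (2 * Y * (q * (C * N)))) ≤ i^J * (2 * L) * S := by
    have := mul_le_mul_of_nonneg_left (neg_le_of_abs_le a3) (show 0 ≤ i^J * (2 * L) by positivity)
    linarith
  have a5 : i^J * L * q * N * (4 * Y * C) ≤ i^J * L * q * N * (1/2) := mul_le_mul_of_nonneg_left hYC (by positivity)
  have a6 : i^(J+1) * L^2 * N * (2 * C + 2) ≤ i^(J+1) * L^2 * N * J := mul_le_mul_of_nonneg_left hJ (by positivity)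
  have e1 : i^J * L^2 * (i * (C * N)) = i^(J+1) * L^2 * N * C := by rw [pow_succ]; ring
  rw [e1] at a2
  linarith

theorem energy_zero {e : EE' n → ℝ} {F : Fin n → EE' n → ℝ} {Nn : EE' n → ℝ} (he : ContDiff ℝ ∞ e) (hev : VP e)
    (hF : ∀ j, ContDiff ℝ ∞ (F j)) (hFv : ∀ j, VP (F j)) (hN : Continuous Nn) {C : ℝ} (hC : 0 ≤ C)
    (hb : ∀ᶠ z in 𝓝 (0 : EE' n), z 0 < 0 → 0 ≤ Nn z ∧
      (-z 0) * |dd (e0 n) e z - ∑ j, dd (bb n j) (F j) z| ≤ C * Nn z ∧ Nn z / 2 ≤ e z ∧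
      ∀ j, Real.sqrt (-z 0) * |F j z| ≤ C * Nn z) :
    ∀ᶠ z in 𝓝 (0 : EE' n), z 0 < 0 → Nn z = 0 := by
  obtain ⟨J, hJ⟩ := exists_nat_ge (2 * C + 2)
  obtain ⟨c1, c1p, c11, h1⟩ := theta_int he hev J (e0 n)
  choose c2 c2p c21 h2 using fun j => theta_int (hF j) (hFv j) J (bb n j)
  obtain ⟨r, r0, hr⟩ := Metric.eventually_nhds_iff_ball.mp hb
  -- choose c
  obtain ⟨c, cp, cc1, cc2, ccr, ccC⟩ : ∃ c, 0 < c ∧ c ≤ c1 ∧ (∀ j, c ≤ c2 j) ∧ Real.sqrt c < r ∧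
      4 * (n * Real.sqrt c) * C ≤ 1/2 := by
    have hcont : Continuous fun c : ℝ => 4 * (n * Real.sqrt c) * C := by fun_prop
    have E1 : ∀ᶠ c in 𝓝[>] (0:ℝ), 4 * (n * Real.sqrt c) * C ≤ 1/2 := by
      have := (hcont.continuousAt (x := 0)).eventually (gt_mem_nhds (show 4 * (n * Real.sqrt 0) * C < 1/2 by simp))
      exact (this.filter_mono nhdsWithin_le_nhds).mono fun _ h => h.le
    have E2 : ∀ᶠ c in 𝓝[>] (0:ℝ), Real.sqrt c < r := by
      have := (Real.continuous_sqrt.continuousAt (x := 0)).eventually (gt_mem_nhds (show Real.sqrt 0 < r by simpa using r0))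
      exact this.filter_mono nhdsWithin_le_nhds
    have E3 : ∀ᶠ c in 𝓝[>] (0:ℝ), c ≤ c1 := ((gt_mem_nhds c1p).filter_mono nhdsWithin_le_nhds).mono fun _ h => le_of_lt h
    have E4 : ∀ᶠ c in 𝓝[>] (0:ℝ), ∀ j, c ≤ c2 j := eventually_all.mpr fun j =>
      ((gt_mem_nhds (c2p j)).filter_mono nhdsWithin_le_nhds).mono fun _ h => le_of_lt h
    have E5 : ∀ᶠ c in 𝓝[>] (0:ℝ), 0 < c := self_mem_nhdsWithin
    obtain ⟨c, h1, h2, h3, h4, h5⟩ := (E1.and (E2.and (E3.and (E4.and E5)))).exists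
    exact ⟨c, h5, h3, h4, h2, h1⟩
  have c1' : c ≤ 1 := cc1.trans c11
  obtain ⟨i1, z1, n1, p1⟩ := h1 c cp cc1
  have H2 := fun j => h2 j c cp (cc2 j)
  set I := fun z => dd (e0 n) (fun z => Th J c z * e z) z - ∑ j, dd (bb n j) (fun z => Th J c z * F j z) z with hI
  have Iint : Integrable I volume := i1.sub (integrable_finsetSum _ fun j _ => (H2 j).1)
  have I0 : ∫ z, I z = 0 := by
    rw [hI, integral_sub i1 (integrable_finsetSum _ fun j _ => (H2 j).1), z1, integral_finsetSum _ fun j _ => (H2 j).1]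
    rw [Finset.sum_eq_zero fun j _ => (H2 j).2.1, sub_zero]
  have Ilow : ∀ z : EE' n, z 0 < 0 → 0 < ls c z → ((-z 0)⁻¹)^(J+1) * (ls c z)^2 * Nn z ≤ I z ∧ 0 ≤ Nn z := by
    intro z hz hl
    have p0 : 0 < -z 0 := by linarith
    obtain ⟨s1, s2, s3, s4⟩ := ls_supp cp c1' hz hl
    obtain ⟨b0, b1, b2, b3⟩ := hr z (by rw [mem_ball_zero_iff]; linarith) hz
    have sp : 0 < Real.sqrt (-z 0) := Real.sqrt_pos.mpr p0
    have := I_low (J := J) (C := C) (i := (-z 0)⁻¹) (q := (Real.sqrt (-z 0))⁻¹) (L := ls c z) (e := e z) (N := Nn z)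
      (d := dd (e0 n) e z - ∑ j, dd (bb n j) (F j) z) (Y := n * Real.sqrt c) (fun j => z j.succ) (fun j => F j z)
      (by positivity) (by positivity) hl b0 hJ (by rw [le_inv_mul_iff₀ p0]; exact b1) b2
      (fun j => by rw [le_inv_mul_iff₀ sp]; exact b3 j)
      ((Finset.sum_le_sum fun j _ => s2 j).trans (by simp)) ccC hC rfl
    refine ⟨this.trans (le_of_eq ?_), b0⟩
    rw [hI]; beta_reduce
    rw [n1 z hz, Finset.sum_congr rfl fun j _ => (H2 j).2.2.1 z hz]
    simp only [ThD_e0, ThD_bb]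
    have t : Th J c z = ((-z 0)⁻¹)^J * (ls c z)^2 := by unfold Th; rw [if_pos hz, max_eq_left hl.le]
    rw [t, max_eq_left hl.le, Finset.sum_add_distrib, ← Finset.mul_sum]
    have e2 : ∑ x : Fin n, -(((-z 0)⁻¹)^J * (2 * ls c z) * (2 * z x.succ)) * F x z =
        - (((-z 0)⁻¹)^J * (2 * ls c z) * ∑ x : Fin n, 2 * z x.succ * F x z) := by
      rw [Finset.mul_sum, ← Finset.sum_neg_distrib]
      exact Finset.sum_congr rfl fun _ _ => by ring
    rw [e2]
    have e3 : (Real.sqrt (-z 0))⁻¹ / 2 = 1 / (2 * Real.sqrt (-z 0)) := by field_simp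
    rw [e3]
    ring
  have Iz : ∀ z : EE' n, ¬ (z 0 < 0 ∧ 0 < ls c z) → I z = 0 := by
    intro z hz
    rw [hI]; beta_reduce
    by_cases h0 : z 0 < 0
    · have hl : ls c z ≤ 0 := by by_contra h2; exact hz ⟨h0, by linarith⟩
      rw [n1 z h0, Finset.sum_congr rfl fun j _ => (H2 j).2.2.1 z h0]
      simp [Th_zero hz, ThD_zero hl]
    · push Not at h0
      rw [p1 z h0, Finset.sum_eq_zero fun j _ => (H2 j).2.2.2 z h0, sub_zero]
  have Inn : 0 ≤ I := by
    intro z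
    by_cases hz : z 0 < 0 ∧ 0 < ls c z
    · obtain ⟨a, b⟩ := Ilow z hz.1 hz.2
      have p0 : 0 < -z 0 := by linarith [hz.1]
      exact le_trans (by simp only [Pi.zero_apply]; positivity) a
    · rw [Iz z hz]; exact le_rfl
  have Iae := (integral_eq_zero_iff_of_nonneg Inn Iint).mp I0
  have lsc : Continuous fun z : EE' n => ls c z := by unfold ls; fun_prop
  have Oo : IsOpen {z : EE' n | z 0 < 0 ∧ 0 < ls c z} :=
    (isOpen_lt (continuous_apply 0) continuous_const).inter (isOpen_lt continuous_const lsc)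
  have Nae : Nn =ᵐ[volume.restrict {z : EE' n | z 0 < 0 ∧ 0 < ls c z}] fun _ => 0 := by
    rw [EventuallyEq, ae_restrict_iff' Oo.measurableSet]
    filter_upwards [Iae] with z hz hzO
    obtain ⟨h0, hl⟩ := hzO
    obtain ⟨a, b⟩ := Ilow z h0 hl
    rw [hz] at a
    have p0 : 0 < -z 0 := by linarith
    have p2 : 0 < ((-z 0)⁻¹)^(J+1) * (ls c z)^2 := by positivity
    by_contra h3
    have : 0 < Nn z := lt_of_le_of_ne b (Ne.symm h3)
    have := mul_pos p2 this
    simp only [Pi.zero_apply] at a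
    linarith
  have key := Measure.eqOn_open_of_ae_eq Nae Oo hN.continuousOn continuousOn_const
  have lpos : ∀ᶠ z in 𝓝 (0 : EE' n), 0 < ls c z :=
    lsc.continuousAt.eventually (lt_mem_nhds (by simpa [ls] using cp))
  filter_upwards [lpos] with z hl hz
  exact key ⟨hz, hl⟩

end
end HM

namespace HM
open MeasureTheory Filter Topology

section
variable {n : ℕ} {H : Type*} [NormedAddCommGroup H] [InnerProductSpace ℝ H]

/-- energy density -/
def En (Q : Coef (EE' n) H (Fin n)) (w : EE' n → H) (z : EE' n) : ℝ :=
  ∑ j, ∑ l, Q.aa j l z * inner ℝ (dd (bb n j) w z) (dd (bb n l) w z)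
    - Q.a00 z * inner ℝ (dd (e0 n) w z) (dd (e0 n) w z) + inner ℝ (w z) (w z)

/-- energy flux -/
def Fl (Q : Coef (EE' n) H (Fin n)) (w : EE' n → H) (j : Fin n) (z : EE' n) : ℝ :=
  Q.a0 j z * inner ℝ (dd (e0 n) w z) (dd (e0 n) w z)
    + ∑ l, Q.aa j l z * (2 * inner ℝ (dd (bb n l) w z) (dd (e0 n) w z))

lemma En_smooth {Q : Coef (EE' n) H (Fin n)} (hs : Q.Sm) {w : EE' n → H} (hw : ContDiff ℝ ∞ w) :
    ContDiff ℝ ∞ (En Q w) := by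
  unfold En
  exact ((ContDiff.sum fun j _ => ContDiff.sum fun l _ => (hs.aa j l).mul ((dd_smooth hw).inner ℝ (dd_smooth hw))).sub
    (hs.a00.mul ((dd_smooth hw).inner ℝ (dd_smooth hw)))).add (hw.inner ℝ hw)

lemma Fl_smooth {Q : Coef (EE' n) H (Fin n)} (hs : Q.Sm) {w : EE' n → H} (hw : ContDiff ℝ ∞ w) (j : Fin n) :
    ContDiff ℝ ∞ (Fl Q w j) := by
  unfold Fl
  exact ((hs.a0 j).mul ((dd_smooth hw).inner ℝ (dd_smooth hw))).add
    (ContDiff.sum fun l _ => (hs.aa j l).mul (contDiff_const.mul ((dd_smooth hw).inner ℝ (dd_smooth hw))))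

lemma alg_id {n : ℕ} (a0 : Fin n → ℝ) (aa : Fin n → Fin n → ℝ) (a00 : ℝ) (wx wxx R : H) (W Wx : Fin n → H)
    (Wb : Fin n → Fin n → H) (hsym : ∀ j l, aa j l = aa l j)
    (heq : a00 • wxx + ∑ j, a0 j • Wx j + ∑ j, ∑ l, aa j l • Wb j l + R = 0) :
    ∑ j, ∑ l, aa j l * (inner ℝ (Wx j) (W l) + inner ℝ (W j) (Wx l)) - a00 * (2 * inner ℝ wxx wx)
      - ∑ j, (a0 j * (2 * inner ℝ (Wx j) wx) + ∑ l, aa j l * (2 * (inner ℝ (Wb j l) wx + inner ℝ (W l) (Wx j))))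
      = 2 * inner ℝ R wx := by
  have h := congrArg (fun v => (inner ℝ v wx : ℝ)) heq
  simp only [inner_add_left, sum_inner, inner_smul_left, inner_zero_left, RCLike.conj_to_real] at h
  have e1 : ∑ j, ∑ l, aa j l * (inner ℝ (Wx j) (W l) + inner ℝ (W j) (Wx l) : ℝ) =
      ∑ j, ∑ l, aa j l * (2 * inner ℝ (W l) (Wx j)) := by
    have e2 : ∑ j, ∑ l, aa j l * (inner ℝ (W j) (Wx l) : ℝ) = ∑ j, ∑ l, aa j l * inner ℝ (W l) (Wx j) := by
      rw [Finset.sum_comm]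
      exact Finset.sum_congr rfl fun j _ => Finset.sum_congr rfl fun l _ => by rw [hsym]
    simp only [mul_add, Finset.sum_add_distrib]
    rw [e2, ← Finset.sum_add_distrib]
    refine Finset.sum_congr rfl fun j _ => ?_
    rw [← Finset.sum_add_distrib]
    refine Finset.sum_congr rfl fun l _ => ?_
    rw [real_inner_comm (W l) (Wx j)]; ring
  rw [e1]
  have e3 : ∑ j, (a0 j * (2 * inner ℝ (Wx j) wx) + ∑ l, aa j l * (2 * (inner ℝ (Wb j l) wx + inner ℝ (W l) (Wx j))) : ℝ)
      = 2 * (∑ j, a0 j * inner ℝ (Wx j) wx) + 2 * (∑ j, ∑ l, aa j l * inner ℝ (Wb j l) wx)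
        + ∑ j, ∑ l, aa j l * (2 * inner ℝ (W l) (Wx j)) := by
    rw [Finset.mul_sum, Finset.mul_sum, ← Finset.sum_add_distrib, ← Finset.sum_add_distrib]
    refine Finset.sum_congr rfl fun j _ => ?_
    rw [Finset.mul_sum, add_assoc, ← Finset.sum_add_distrib]
    congr 1
    · ring
    · exact Finset.sum_congr rfl fun l _ => by ring
  rw [e3]
  linarith

lemma en_identity {Q : Coef (EE' n) H (Fin n)} (hs : Q.Sm) {w : EE' n → H} (hw : ContDiff ℝ ∞ w) {z : EE' n}
    (hsym : ∀ j l, Q.aa j l z = Q.aa l j z) (heq : Q.LL (e0 n) (bb n) w z = 0) :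
    dd (e0 n) (En Q w) z - ∑ j, dd (bb n j) (Fl Q w j) z =
      ∑ j, ∑ l, dd (e0 n) (Q.aa j l) z * inner ℝ (dd (bb n j) w z) (dd (bb n l) w z)
      - dd (e0 n) Q.a00 z * inner ℝ (dd (e0 n) w z) (dd (e0 n) w z) + 2 * inner ℝ (w z) (dd (e0 n) w z)
      - ∑ j, (dd (bb n j) (Q.a0 j) z * inner ℝ (dd (e0 n) w z) (dd (e0 n) w z)
        + ∑ l, dd (bb n j) (Q.aa j l) z * (2 * inner ℝ (dd (bb n l) w z) (dd (e0 n) w z)))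
      + 2 * inner ℝ (Q.A0 z (dd (e0 n) w z) + ∑ j, Q.A1 j z (dd (bb n j) w z) + Q.B z (w z)) (dd (e0 n) w z) := by
  have hx : ∀ v, ContDiff ℝ ∞ (dd v w) := fun v => dd_smooth hw
  have ip : ∀ {a b : EE' n → H}, ContDiff ℝ ∞ a → ContDiff ℝ ∞ b → ContDiff ℝ ∞ (fun z => (inner ℝ (a z) (b z) : ℝ)) :=
    fun ha hb => ha.inner ℝ hb
  have d1 : dd (e0 n) (En Q w) z =
      ∑ j, ∑ l, (dd (e0 n) (Q.aa j l) z * inner ℝ (dd (bb n j) w z) (dd (bb n l) w z) +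
        Q.aa j l z * (inner ℝ (dd (e0 n) (dd (bb n j) w) z) (dd (bb n l) w z) +
          inner ℝ (dd (bb n j) w z) (dd (e0 n) (dd (bb n l) w) z)))
      - (dd (e0 n) Q.a00 z * inner ℝ (dd (e0 n) w z) (dd (e0 n) w z) +
        Q.a00 z * (inner ℝ (dd (e0 n) (dd (e0 n) w) z) (dd (e0 n) w z) + inner ℝ (dd (e0 n) w z) (dd (e0 n) (dd (e0 n) w) z)))
      + (inner ℝ (dd (e0 n) w z) (w z) + inner ℝ (w z) (dd (e0 n) w z)) := by
    have s1 : ∀ j l, ContDiff ℝ ∞ (fun z => Q.aa j l z * (inner ℝ (dd (bb n j) w z) (dd (bb n l) w z) : ℝ)) :=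
      fun j l => (hs.aa j l).mul (ip (hx _) (hx _))
    have s2 : ∀ j, ContDiff ℝ ∞ (fun z => ∑ l, Q.aa j l z * (inner ℝ (dd (bb n j) w z) (dd (bb n l) w z) : ℝ)) :=
      fun j => ContDiff.sum fun l _ => s1 j l
    have s3 : ContDiff ℝ ∞ (fun z => ∑ j, ∑ l, Q.aa j l z * (inner ℝ (dd (bb n j) w z) (dd (bb n l) w z) : ℝ)) :=
      ContDiff.sum fun j _ => s2 j
    have s4 : ContDiff ℝ ∞ (fun z => Q.a00 z * (inner ℝ (dd (e0 n) w z) (dd (e0 n) w z) : ℝ)) :=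
      hs.a00.mul (ip (hx _) (hx _))
    unfold En
    rw [dd_add (sm_diff (s3.sub s4) z) (sm_diff (ip hw hw) z), dd_sub (sm_diff s3 z) (sm_diff s4 z),
      dd_sum fun j _ => sm_diff (s2 j) z, dd_inner (sm_diff hw z) (sm_diff hw z),
      dd_mul (sm_diff hs.a00 z) (sm_diff (ip (hx _) (hx _)) z), dd_inner (sm_diff (hx _) z) (sm_diff (hx _) z)]
    congr 2
    refine Finset.sum_congr rfl fun j _ => ?_
    rw [dd_sum fun l _ => sm_diff (s1 j l) z]
    refine Finset.sum_congr rfl fun l _ => ?_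
    rw [dd_mul (sm_diff (hs.aa j l) z) (sm_diff (ip (hx _) (hx _)) z), dd_inner (sm_diff (hx _) z) (sm_diff (hx _) z)]
  have d2 : ∀ j, dd (bb n j) (Fl Q w j) z =
      (dd (bb n j) (Q.a0 j) z * inner ℝ (dd (e0 n) w z) (dd (e0 n) w z) +
        Q.a0 j z * (2 * inner ℝ (dd (e0 n) (dd (bb n j) w) z) (dd (e0 n) w z)))
      + ∑ l, (dd (bb n j) (Q.aa j l) z * (2 * inner ℝ (dd (bb n l) w z) (dd (e0 n) w z)) +
        Q.aa j l z * (2 * (inner ℝ (dd (bb n j) (dd (bb n l) w) z) (dd (e0 n) w z) +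
          inner ℝ (dd (bb n l) w z) (dd (e0 n) (dd (bb n j) w) z)))) := by
    intro j
    have t1 : ContDiff ℝ ∞ (fun z => Q.a0 j z * (inner ℝ (dd (e0 n) w z) (dd (e0 n) w z) : ℝ)) :=
      (hs.a0 j).mul (ip (hx _) (hx _))
    have t0 : ∀ l, ContDiff ℝ ∞ (fun z => 2 * (inner ℝ (dd (bb n l) w z) (dd (e0 n) w z) : ℝ)) :=
      fun l => contDiff_const.mul (ip (hx _) (hx _))
    have t2 : ∀ l, ContDiff ℝ ∞ (fun z => Q.aa j l z * (2 * (inner ℝ (dd (bb n l) w z) (dd (e0 n) w z) : ℝ))) :=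
      fun l => (hs.aa j l).mul (t0 l)
    have t3 : ContDiff ℝ ∞ (fun z => ∑ l, Q.aa j l z * (2 * (inner ℝ (dd (bb n l) w z) (dd (e0 n) w z) : ℝ))) :=
      ContDiff.sum fun l _ => t2 l
    have c2 : dd (bb n j) (fun _ : EE' n => (2:ℝ)) z = 0 := by simp [dd]
    unfold Fl
    rw [dd_add (sm_diff t1 z) (sm_diff t3 z), dd_sum fun l _ => sm_diff (t2 l) z,
      dd_mul (sm_diff (hs.a0 j) z) (sm_diff (ip (hx _) (hx _)) z), dd_inner (sm_diff (hx _) z) (sm_diff (hx _) z)]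
    congr 1
    · rw [dd_comm hw (v := bb n j) (w := e0 n), real_inner_comm (dd (e0 n) (dd (bb n j) w) z) (dd (e0 n) w z)]; ring
    · refine Finset.sum_congr rfl fun l _ => ?_
      rw [dd_mul (sm_diff (hs.aa j l) z) (sm_diff (t0 l) z), dd_mul (sm_diff contDiff_const z) (sm_diff (ip (hx _) (hx _)) z),
        dd_inner (sm_diff (hx _) z) (sm_diff (hx _) z), c2, dd_comm hw (v := bb n j) (w := e0 n)]
      ring
  rw [d1, Finset.sum_congr rfl fun j _ => d2 j]
  have h := alg_id (fun j => Q.a0 j z) (fun j l => Q.aa j l z) (Q.a00 z) (dd (e0 n) w z) (dd (e0 n) (dd (e0 n) w) z)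
    (Q.A0 z (dd (e0 n) w z) + ∑ j, Q.A1 j z (dd (bb n j) w z) + Q.B z (w z)) (fun j => dd (bb n j) w z)
    (fun j => dd (e0 n) (dd (bb n j) w) z) (fun j l => dd (bb n j) (dd (bb n l) w) z) hsym (by
      rw [← heq]; unfold Coef.LL; abel)
  rw [← h, real_inner_comm (w z) (dd (e0 n) w z), real_inner_comm (dd (e0 n) w z) (dd (e0 n) (dd (e0 n) w) z)]
  simp only [Finset.sum_add_distrib]
  ring

end
end HM

namespace HM
open MeasureTheory Filter Topology

section
variable {n : ℕ} {H : Type*} [NormedAddCommGroup H] [InnerProductSpace ℝ H]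

lemma bdK {f : EE' n → ℝ} (hf : Continuous f) : ∀ᶠ K in atTop, ∀ᶠ z in 𝓝 (0 : EE' n), f z ≤ K := by
  filter_upwards [eventually_gt_atTop (f 0)] with K hK using ev_le hf hK

lemma bdKn {F : Type*} [NormedAddCommGroup F] {f : EE' n → F} (hf : Continuous f) :
    ∀ᶠ K in atTop, ∀ᶠ z in 𝓝 (0 : EE' n), ‖f z‖ ≤ K := bdK hf.norm

lemma bdKf {F ι : Type*} [Finite ι] [NormedAddCommGroup F] {f : ι → EE' n → F} (hf : ∀ i, Continuous (f i)) :
    ∀ᶠ K in atTop, ∀ᶠ z in 𝓝 (0 : EE' n), ∀ i, ‖f i z‖ ≤ K :=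
  (eventually_all.mpr fun i => bdKn (hf i)).mono fun _ h => eventually_all.mpr h

/-- the algebraic bound on the remainder -/
lemma rem_bd {n : ℕ} {K P : ℝ} (hK : 1 ≤ K) (wx w : H) (W : Fin n → H) (A0 B : H →L[ℝ] H) (A1 : Fin n → (H →L[ℝ] H))
    (d00 : ℝ) (d0 : Fin n → ℝ) (da db : Fin n → Fin n → ℝ) (hP : P = ‖wx‖^2 + ∑ j, ‖W j‖^2 + ‖w‖^2)
    (h1 : |d00| ≤ K) (h2 : ∀ j, |d0 j| ≤ K) (h3 : ∀ j l, |da j l| ≤ K) (h4 : ∀ j l, |db j l| ≤ K)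
    (h5 : ‖A0‖ ≤ K) (h6 : ∀ j, ‖A1 j‖ ≤ K) (h7 : ‖B‖ ≤ K) :
    |∑ j, ∑ l, da j l * inner ℝ (W j) (W l) - d00 * inner ℝ wx wx + 2 * inner ℝ w wx
      - ∑ j, (d0 j * inner ℝ wx wx + ∑ l, db j l * (2 * inner ℝ (W l) wx))
      + 2 * inner ℝ (A0 wx + ∑ j, A1 j (W j) + B w) wx| ≤ (K * (3 * n^2 + 3 * n + 7)) * P := by
  have S0 : 0 ≤ ∑ j, ‖W j‖^2 := Finset.sum_nonneg fun _ _ => sq_nonneg _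
  have P0 : 0 ≤ P := by rw [hP]; positivity
  have K0 : 0 ≤ K := by linarith
  have qx : ‖wx‖^2 ≤ P := by rw [hP]; nlinarith [sq_nonneg ‖w‖]
  have qw : ‖w‖^2 ≤ P := by rw [hP]; nlinarith [sq_nonneg ‖wx‖]
  have qj : ∀ j, ‖W j‖^2 ≤ P := fun j => by
    have := Finset.single_le_sum (f := fun j : Fin n => ‖W j‖^2) (fun _ _ => sq_nonneg _) (Finset.mem_univ j)
    beta_reduce at this
    rw [hP]; nlinarith [sq_nonneg ‖wx‖, sq_nonneg ‖w‖]
  have pr : ∀ a b : H, ‖a‖^2 ≤ P → ‖b‖^2 ≤ P → ‖a‖ * ‖b‖ ≤ P := fun a b ha hb => by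
    nlinarith [sq_nonneg (‖a‖ - ‖b‖)]
  have ii : ∀ a b : H, ‖a‖^2 ≤ P → ‖b‖^2 ≤ P → |(inner ℝ a b : ℝ)| ≤ P := fun a b ha hb =>
    (abs_real_inner_le_norm a b).trans (pr a b ha hb)
  have li : ∀ (A : H →L[ℝ] H) (a b : H), ‖A‖ ≤ K → ‖a‖^2 ≤ P → ‖b‖^2 ≤ P → |(inner ℝ (A a) b : ℝ)| ≤ K * P := by
    intro A a b hA ha hb
    refine (abs_real_inner_le_norm _ _).trans ?_
    calc ‖A a‖ * ‖b‖ ≤ (K * ‖a‖) * ‖b‖ := by gcongr; exact A.le_of_opNorm_le hA a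
      _ = K * (‖a‖ * ‖b‖) := by ring
      _ ≤ _ := mul_le_mul_of_nonneg_left (pr a b ha hb) K0
  have sc : ∀ c x : ℝ, |c| ≤ K → |x| ≤ P → |c * x| ≤ K * P := fun c x hc hx => by
    rw [abs_mul]; exact mul_le_mul hc hx (abs_nonneg _) K0
  have T1 : |∑ j, ∑ l, da j l * inner ℝ (W j) (W l)| ≤ n * (n * (K * P)) := by
    refine (Finset.abs_sum_le_sum_abs _ _).trans ((Finset.sum_le_sum fun j _ => ?_).trans (by simp : ∑ _j : Fin n, (n * (K * P)) ≤ n * (n * (K * P))))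
    refine (Finset.abs_sum_le_sum_abs _ _).trans ((Finset.sum_le_sum fun l _ => ?_).trans (by simp : ∑ _j : Fin n, (K * P) ≤ n * (K * P)))
    exact sc _ _ (h3 j l) (ii _ _ (qj j) (qj l))
  have T2 : |d00 * inner ℝ wx wx| ≤ K * P := sc _ _ h1 (ii _ _ qx qx)
  have T3 : |2 * inner ℝ w wx| ≤ 2 * (K * P) := by
    rw [abs_mul, abs_two]
    have := ii _ _ qw qx
    nlinarith
  have T4 : |∑ j, (d0 j * inner ℝ wx wx + ∑ l, db j l * (2 * inner ℝ (W l) wx))| ≤ n * (K * P + n * (2 * (K * P))) := by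
    refine (Finset.abs_sum_le_sum_abs _ _).trans ((Finset.sum_le_sum fun j _ => ?_).trans (le_of_eq (by simp; ring) : ∑ _j : Fin n, (K * P + n * (2 * (K * P))) ≤ n * (K * P + n * (2 * (K * P)))))
    refine (abs_add_le _ _).trans (add_le_add (sc _ _ (h2 j) (ii _ _ qx qx)) ?_)
    refine (Finset.abs_sum_le_sum_abs _ _).trans ((Finset.sum_le_sum fun l _ => ?_).trans (by simp : ∑ _j : Fin n, (2 * (K * P)) ≤ n * (2 * (K * P))))
    have := sc _ _ (h4 j l) (ii _ _ (qj l) qx)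
    rw [show db j l * (2 * inner ℝ (W l) wx) = 2 * (db j l * inner ℝ (W l) wx) by ring, abs_mul, abs_two]
    linarith
  have T5 : |2 * inner ℝ (A0 wx + ∑ j, A1 j (W j) + B w) wx| ≤ 2 * (K * P + n * (K * P) + K * P) := by
    rw [abs_mul, abs_two, inner_add_left, inner_add_left, sum_inner]
    refine mul_le_mul_of_nonneg_left ?_ (by norm_num)
    refine (abs_add_le _ _).trans (add_le_add ((abs_add_le _ _).trans (add_le_add (li _ _ _ h5 qx qx) ?_)) (li _ _ _ h7 qw qx))
    refine (Finset.abs_sum_le_sum_abs _ _).trans ((Finset.sum_le_sum fun l _ => ?_).trans (by simp : ∑ _j : Fin n, (K * P) ≤ n * (K * P)))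
    exact li _ _ _ (h6 l) (qj l) qx
  calc _ ≤ n * (n * (K * P)) + K * P + 2 * (K * P) + n * (K * P + n * (2 * (K * P))) + 2 * (K * P + n * (K * P) + K * P) := by
        refine (abs_add_le _ _).trans (add_le_add ((abs_sub _ _).trans (add_le_add ((abs_add_le _ _).trans
          (add_le_add ((abs_sub _ _).trans (add_le_add T1 T2)) T3)) T4)) T5)
    _ = _ := by ring

lemma fl_bd {n : ℕ} {K t Nn : ℝ} (hK : 0 ≤ K) (wx : H) (W : Fin n → H) (a0 : ℝ) (aa : Fin n → ℝ)
    (t0 : 0 ≤ t) (t1 : t ≤ 1) (h0 : |a0| ≤ K * t) (h1 : ∀ l, |aa l| ≤ K) (hN : t * ‖wx‖^2 ≤ Nn) (hNj : ∀ l, t * ‖wx‖^2 + ‖W l‖^2 ≤ Nn) :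
    Real.sqrt t * |a0 * inner ℝ wx wx + ∑ l, aa l * (2 * inner ℝ (W l) wx)| ≤ (K * (n + 1)) * Nn := by
  have s0 := Real.sqrt_nonneg t
  have s1 : Real.sqrt t ≤ 1 := Real.sqrt_le_one.mpr t1
  have ss := Real.sq_sqrt t0
  have N0 : 0 ≤ Nn := le_trans (by positivity) hN
  have T1 : Real.sqrt t * |a0 * inner ℝ wx wx| ≤ K * Nn := by
    rw [abs_mul, real_inner_self_eq_norm_sq, abs_of_nonneg (sq_nonneg ‖wx‖)]
    calc _ ≤ 1 * ((K * t) * ‖wx‖^2) := mul_le_mul s1 (mul_le_mul_of_nonneg_right h0 (by positivity)) (by positivity) zero_le_one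
      _ = K * (t * ‖wx‖^2) := by ring
      _ ≤ _ := mul_le_mul_of_nonneg_left hN hK
  have T2 : ∀ l, Real.sqrt t * |aa l * (2 * inner ℝ (W l) wx)| ≤ K * Nn := by
    intro l
    rw [abs_mul, abs_mul, abs_two]
    have c := abs_real_inner_le_norm (W l) wx
    have q : Real.sqrt t * (2 * |(inner ℝ (W l) wx : ℝ)|) ≤ Nn := by
      calc _ ≤ Real.sqrt t * (2 * (‖W l‖ * ‖wx‖)) := by gcongr
        _ ≤ t * ‖wx‖^2 + ‖W l‖^2 := by
            rw [show t * ‖wx‖^2 = (Real.sqrt t * ‖wx‖)^2 by rw [mul_pow, ss]]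
            nlinarith [sq_nonneg (Real.sqrt t * ‖wx‖ - ‖W l‖)]
        _ ≤ _ := hNj l
    calc _ = |aa l| * (Real.sqrt t * (2 * |(inner ℝ (W l) wx : ℝ)|)) := by ring
      _ ≤ _ := mul_le_mul (h1 l) q (by positivity) hK
  calc _ ≤ Real.sqrt t * (|a0 * inner ℝ wx wx| + ∑ l, |aa l * (2 * inner ℝ (W l) wx)|) :=
        mul_le_mul_of_nonneg_left ((abs_add_le _ _).trans (add_le_add_right (Finset.abs_sum_le_sum_abs _ _) _)) s0
    _ = Real.sqrt t * |a0 * inner ℝ wx wx| + ∑ l, Real.sqrt t * |aa l * (2 * inner ℝ (W l) wx)| := by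
        rw [mul_add, Finset.mul_sum]
    _ ≤ K * Nn + ∑ _l : Fin n, K * Nn := add_le_add T1 (Finset.sum_le_sum fun l _ => T2 l)
    _ = _ := by simp; ring

lemma en_low {n : ℕ} {t : ℝ} (wx w : H) (W : Fin n → H) (a00 : ℝ) (aa : Fin n → Fin n → ℝ)
    (h0 : t / 2 ≤ -a00) (h1 : ∀ j l, |aa j l - if j = l then 1 else 0| ≤ 1 / (2 * (n + 1))) :
    (t * ‖wx‖^2 + ∑ j, ‖W j‖^2 + ‖w‖^2) / 2 ≤
      ∑ j, ∑ l, aa j l * inner ℝ (W j) (W l) - a00 * inner ℝ wx wx + inner ℝ w w := by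
  set S := ∑ j, ‖W j‖^2 with hS
  have S0 : 0 ≤ S := Finset.sum_nonneg fun _ _ => sq_nonneg _
  have n0 : (0:ℝ) < n + 1 := by positivity
  have e1 : ∑ j, ∑ l, aa j l * inner ℝ (W j) (W l) = S +
      ∑ j, ∑ l, (aa j l - if j = l then 1 else 0) * (inner ℝ (W j) (W l) : ℝ) := by
    have : S = ∑ j, ∑ l, (if j = l then (1:ℝ) else 0) * (inner ℝ (W j) (W l) : ℝ) := by
      rw [hS]
      refine Finset.sum_congr rfl fun j _ => ?_
      simp
    rw [this, ← Finset.sum_add_distrib]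
    refine Finset.sum_congr rfl fun j _ => ?_
    rw [← Finset.sum_add_distrib]
    exact Finset.sum_congr rfl fun l _ => by ring
  have e2 : |∑ j, ∑ l, (aa j l - if j = l then 1 else 0) * (inner ℝ (W j) (W l) : ℝ)| ≤ S / 2 := by
    calc _ ≤ ∑ j, ∑ l, 1 / (2 * (n + 1)) * ((‖W j‖^2 + ‖W l‖^2) / 2) := by
          refine (Finset.abs_sum_le_sum_abs _ _).trans (Finset.sum_le_sum fun j _ => ?_)
          refine (Finset.abs_sum_le_sum_abs _ _).trans (Finset.sum_le_sum fun l _ => ?_)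
          rw [abs_mul]
          refine mul_le_mul (h1 j l) ((abs_real_inner_le_norm _ _).trans ?_) (abs_nonneg _) (by positivity)
          nlinarith [sq_nonneg (‖W j‖ - ‖W l‖)]
      _ = 1 / (2 * (n + 1)) * (n * S) := by
          simp only [← Finset.mul_sum, ← Finset.sum_div, Finset.sum_add_distrib]
          simp [← hS, ← Finset.mul_sum]
      _ ≤ _ := by
          rw [div_mul_eq_mul_div, one_mul, div_le_div_iff₀ (by positivity) (by norm_num)]
          nlinarith
  rw [e1, real_inner_self_eq_norm_sq, real_inner_self_eq_norm_sq]
  have := neg_le_of_abs_le e2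
  nlinarith [mul_le_mul_of_nonneg_right h0 (sq_nonneg ‖wx‖), sq_nonneg ‖w‖]

end
end HM

namespace HM
open MeasureTheory Filter Topology

section
variable {n : ℕ} {H : Type*} [NormedAddCommGroup H] [InnerProductSpace ℝ H]

lemma dc {F : Type*} [NormedAddCommGroup F] [NormedSpace ℝ F] {f : EE' n → F} (v : EE' n) (hf : ContDiff ℝ ∞ f) :
    Continuous (dd v f) := (dd_smooth hf).continuous

theorem uniq {Q : Coef (EE' n) H (Fin n)} (hs : Q.Sm) (hQ : Q.Hor)
    (hsym : ∀ᶠ z in 𝓝 (0 : EE' n), ∀ j l, Q.aa j l z = Q.aa l j z) {w : EE' n → H} (hw : ContDiff ℝ ∞ w) (hv : VP w)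
    (heq : ∀ᶠ z in 𝓝 (0 : EE' n), Q.LL (e0 n) (bb n) w z = 0) : ∀ᶠ z in 𝓝 (0 : EE' n), w z = 0 := by
  obtain ⟨K, K1, k1, k2, k3, k4, k5, k6, k7, k8, k9⟩ := ((eventually_ge_atTop (1:ℝ)).and ((bdKn (dc (e0 n) hs.a00)).and
    ((bdKf fun j => dc (bb n j) (hs.a0 j)).and ((bdKf fun p : Fin n × Fin n => dc (e0 n) (hs.aa p.1 p.2)).and
    ((bdKf fun p : Fin n × Fin n => dc (bb n p.1) (hs.aa p.1 p.2)).and ((bdKn hs.A0.continuous).and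
    ((bdKf fun j => (hs.A1 j).continuous).and ((bdKn hs.B.continuous).and
    ((bdKf fun p : Fin n × Fin n => (hs.aa p.1 p.2).continuous).and (bdKf fun j => dc (e0 n) (hs.a0 j))))))))))).exists
  have K0 : 0 ≤ K := by linarith
  -- a0 j is O(x)
  have m1 : ∀ᶠ z in 𝓝 (0 : EE' n), ∀ j, ‖Q.a0 j z‖ ≤ K * |z 0| := eventually_all.mpr fun j =>
    lip_e0 (hs.a0 j) (hQ.h0 j) (k9.mono fun z h => h j)
  -- a00 close to x
  have m2 : ∀ᶠ z in 𝓝 (0 : EE' n), ‖Q.a00 z - X0 n z‖ ≤ 1/2 * |z 0| := by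
    have hX : ContDiff ℝ ∞ (fun z : EE' n => X0 n z) := (X0 n).contDiff
    have hs' : ContDiff ℝ ∞ (fun z => Q.a00 z - X0 n z) := hs.a00.sub hX
    have hdd : ∀ z, dd (e0 n) (fun z => Q.a00 z - X0 n z) z = dd (e0 n) Q.a00 z - 1 := by
      intro z
      rw [dd_sub (sm_diff hs.a00 z) (sm_diff hX z)]
      congr 1
      unfold dd
      rw [(X0 n).fderiv]
      exact X0_e0
    refine lip_e0 hs' ?_ ?_
    · filter_upwards [hQ.h00] with z h h0
      rw [h h0, X0_apply, h0, sub_zero]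
    · have : Continuous fun z => ‖dd (e0 n) Q.a00 z - 1‖ := ((dc (e0 n) hs.a00).sub continuous_const).norm
      filter_upwards [ev_le this (K := 1/2) (by simp [hQ.hd])] with z h
      rw [hdd]; exact h
  have m3 : ∀ᶠ z in 𝓝 (0 : EE' n), ∀ j l, |Q.aa j l z - if j = l then 1 else 0| ≤ 1 / (2 * ((n:ℝ) + 1)) :=
    eventually_all.mpr fun j => eventually_all.mpr fun l => by
      have : Continuous fun z => |Q.aa j l z - if j = l then 1 else 0| := ((hs.aa j l).continuous.sub continuous_const).abs
      refine ev_le this ?_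
      rw [hQ.haa j l, sub_self, abs_zero]; positivity
  have m4 : ∀ᶠ z in 𝓝 (0 : EE' n), |z 0| ≤ 1 := ev_le (f := fun z : EE' n => |z 0|) (by fun_prop) (by simp)
  set Nn := fun z : EE' n => max (-z 0) 0 * ‖dd (e0 n) w z‖^2 + ∑ j, ‖dd (bb n j) w z‖^2 + ‖w z‖^2 with hN
  have hNc : Continuous Nn := by
    have c1 := dc (e0 n) hw
    have c2 := fun j => dc (bb n j) hw
    have c3 := hw.continuous
    exact (((((continuous_apply 0).neg).max continuous_const).mul (c1.norm.pow 2)).add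
      (continuous_finsetSum _ fun j _ => ((c2 j).norm.pow 2))).add (c3.norm.pow 2)
  have vE : VP (En Q w) := by
    filter_upwards [hv, hv.dd (e0 n), eventually_all.mpr fun j => hv.dd (bb n j)] with z h1 h2 h3 h0
    unfold En
    simp [h1 h0, h2 h0, fun j => h3 j h0]
  have vF : ∀ j, VP (Fl Q w j) := fun j => by
    filter_upwards [hv, hv.dd (e0 n), eventually_all.mpr fun j => hv.dd (bb n j)] with z h1 h2 h3 h0
    unfold Fl
    simp [h2 h0, fun j => h3 j h0]
  set C := K * (3 * n^2 + 3 * n + 7) with hC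
  have C0 : 0 ≤ C := by positivity
  have main := energy_zero (En_smooth hs hw) vE (fun j => Fl_smooth hs hw j) vF hNc C0 (by
    filter_upwards [k1, k2, k3, k4, k5, k6, k7, k8, m1, m2, m3, m4, hsym, heq] with z k1 k2 k3 k4 k5 k6 k7 k8 m1 m2 m3 m4 hsym heq h0
    have t0 : 0 < -z 0 := by linarith
    have ab : |z 0| = -z 0 := abs_of_neg h0
    rw [ab] at m4 m2
    have S0 : 0 ≤ ∑ j, ‖dd (bb n j) w z‖^2 := Finset.sum_nonneg fun _ _ => sq_nonneg _
    have hNz : Nn z = (-z 0) * ‖dd (e0 n) w z‖^2 + ∑ j, ‖dd (bb n j) w z‖^2 + ‖w z‖^2 := by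
      rw [hN]; beta_reduce; rw [max_eq_left t0.le]
    have N0 : 0 ≤ Nn z := by rw [hNz]; positivity
    refine ⟨N0, ?_, ?_, fun j => ?_⟩
    · rw [en_identity hs hw hsym heq]
      have := rem_bd (P := ‖dd (e0 n) w z‖^2 + ∑ j, ‖dd (bb n j) w z‖^2 + ‖w z‖^2) K1 (dd (e0 n) w z) (w z) (fun j => dd (bb n j) w z) (Q.A0 z) (Q.B z) (fun j => Q.A1 j z)
        (dd (e0 n) Q.a00 z) (fun j => dd (bb n j) (Q.a0 j) z) (fun j l => dd (e0 n) (Q.aa j l) z)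
        (fun j l => dd (bb n j) (Q.aa j l) z) rfl k1 k2 (fun j l => k3 (j, l)) (fun j l => k4 (j, l)) k5 k6 k7
      refine (mul_le_mul_of_nonneg_left this t0.le).trans ?_
      rw [← hC, hNz, mul_left_comm]
      refine mul_le_mul_of_nonneg_left ?_ C0
      nlinarith [mul_nonneg (sub_nonneg.mpr m4) S0, mul_nonneg (sub_nonneg.mpr m4) (sq_nonneg ‖w z‖)]
    · rw [hNz]
      unfold En
      refine en_low (dd (e0 n) w z) (w z) (fun j => dd (bb n j) w z) (Q.a00 z) (fun j l => Q.aa j l z) ?_ m3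
      rw [X0_apply, Real.norm_eq_abs, abs_le] at m2
      linarith [m2.2]
    · unfold Fl
      have := fl_bd (Nn := Nn z) K0 (dd (e0 n) w z) (fun j => dd (bb n j) w z) (Q.a0 j z) (fun l => Q.aa j l z) t0.le m4
        (by rw [← ab]; exact m1 j) (fun l => k8 (j, l)) (by rw [hNz]; nlinarith [sq_nonneg ‖w z‖]) (fun l => by
          have := Finset.single_le_sum (f := fun j : Fin n => ‖dd (bb n j) w z‖^2) (fun _ _ => sq_nonneg _) (Finset.mem_univ l)
          beta_reduce at this
          rw [hNz]; nlinarith [sq_nonneg ‖w z‖])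
      refine this.trans (mul_le_mul_of_nonneg_right ?_ N0)
      rw [hC]
      refine mul_le_mul_of_nonneg_left ?_ K0
      have : (0:ℝ) ≤ n := Nat.cast_nonneg n
      nlinarith [sq_nonneg (n:ℝ)])
  filter_upwards [main, hv.closed hw.continuous] with z h1 h2
  rcases lt_or_ge (z 0) 0 with h | h
  · have := h1 h
    have S0 : 0 ≤ ∑ j, ‖dd (bb n j) w z‖^2 := Finset.sum_nonneg fun _ _ => sq_nonneg _
    rw [hN] at this; beta_reduce at this
    have x1 : 0 ≤ max (-z 0) 0 * ‖dd (e0 n) w z‖^2 := by positivity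
    have : ‖w z‖^2 = 0 := le_antisymm (by linarith) (sq_nonneg _)
    simpa using this
  · exact h2 h

end
end HM

namespace HM
open MeasureTheory Filter Topology

section
variable {n : ℕ} {H : Type*} [NormedAddCommGroup H] [InnerProductSpace ℝ H]

lemma dd_an {F : Type*} [NormedAddCommGroup F] [NormedSpace ℝ F] [CompleteSpace F] {f : EE' n → F} {x : EE' n} (v : EE' n) (hf : AnalyticAt ℝ f x) :
    AnalyticAt ℝ (dd v f) x := by
  have := hf.fderiv
  exact ((ContinuousLinearMap.apply ℝ F v).analyticAt _).comp this

lemma LL_sub (Q : Coef (EE' n) H (Fin n)) {u w : EE' n → H} (hu : ContDiff ℝ ∞ u) (hw : ContDiff ℝ ∞ w)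
    (v : EE' n) (b : Fin n → EE' n) (z : EE' n) :
    Q.LL v b (fun z => w z - u z) z = Q.LL v b w z - Q.LL v b u z := by
  have e : ∀ (a : EE' n) {f g : EE' n → H}, ContDiff ℝ ∞ f → ContDiff ℝ ∞ g → dd a (fun z => f z - g z) = fun z => dd a f z - dd a g z :=
    fun a f g hf hg => funext fun z => dd_sub (sm_diff hf z) (sm_diff hg z)
  unfold Coef.LL
  simp only [e _ hw hu, e _ (dd_smooth hw) (dd_smooth hu), smul_sub, map_sub, Finset.sum_sub_distrib]
  abel

lemma LL_congr {Q Q' : Coef (EE' n) H (Fin n)} {u w : EE' n → H} {v : EE' n} {b : Fin n → EE' n} {z : EE' n}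
    (h00 : Q.a00 z = Q'.a00 z) (h0 : ∀ j, Q.a0 j z = Q'.a0 j z) (ha : ∀ j l, Q.aa j l z = Q'.aa j l z)
    (hA0 : Q.A0 z = Q'.A0 z) (hA1 : ∀ j, Q.A1 j z = Q'.A1 j z) (hB : Q.B z = Q'.B z) (hu : u =ᶠ[𝓝 z] w) :
    Q.LL v b u z = Q'.LL v b w z := by
  have e1 : ∀ a, dd a u z = dd a w z := fun a => dd_congr hu
  have e2 : ∀ a c, dd a (dd c u) z = dd a (dd c w) z := fun a c => dd_congr (dd_congr_nhds hu)
  unfold Coef.LL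
  simp only [e1, e2, h00, h0, ha, hA0, hA1, hB, hu.eq_of_nhds]

lemma LL_an [CompleteSpace H] {Q : Coef (EE' n) H (Fin n)} {x : EE' n} (ha : Q.An x) {w : EE' n → H} (hw : AnalyticAt ℝ w x)
    (v : EE' n) (b : Fin n → EE' n) : AnalyticAt ℝ (fun z => Q.LL v b w z) x := by
  unfold Coef.LL
  have ap : ∀ {A : EE' n → (H →L[ℝ] H)} {f : EE' n → H}, AnalyticAt ℝ A x → AnalyticAt ℝ f x → AnalyticAt ℝ (fun z => A z (f z)) x :=
    fun {A f} hA hf => ((ContinuousLinearMap.id ℝ (H →L[ℝ] H)).analyticAt_bilinear (A x, f x)).comp₂ hA hf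
  refine AnalyticAt.fun_add (AnalyticAt.fun_add (AnalyticAt.fun_add (AnalyticAt.fun_add (AnalyticAt.fun_add ?_ ?_) ?_) ?_) ?_) ?_
  · exact ha.a00.smul (dd_an _ (dd_an _ hw))
  · exact Finset.analyticAt_fun_sum _ fun j _ => (ha.a0 j).smul (dd_an _ (dd_an _ hw))
  · exact Finset.analyticAt_fun_sum _ fun j _ => Finset.analyticAt_fun_sum _ fun l _ => (ha.aa j l).smul (dd_an _ (dd_an _ hw))
  · exact ap ha.A0 (dd_an _ hw)
  · exact Finset.analyticAt_fun_sum _ fun j _ => ap (ha.A1 j) (dd_an _ hw)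
  · exact ap ha.B hw

lemma vp_zero {F : Type*} [NormedAddCommGroup F] [NormedSpace ℝ F] [CompleteSpace F] {h : EE' n → F} (ha : AnalyticAt ℝ h 0)
    (hv : VP h) : ∀ᶠ z in 𝓝 (0 : EE' n), h z = 0 := by
  obtain ⟨r, r0, hr⟩ := Metric.eventually_nhds_iff_ball.mp (ha.eventually_analyticAt.and hv)
  have an : AnalyticOnNhd ℝ h (Metric.ball 0 r) := fun z hz => (hr z hz).1
  have mem : (r/2) • e0 n ∈ Metric.ball (0 : EE' n) r := by
    rw [mem_ball_zero_iff, norm_smul, Real.norm_eq_abs, abs_of_pos (by positivity)]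
    nlinarith [e0_norm (n := n)]
  have ev : h =ᶠ[𝓝 ((r/2) • e0 n)] 0 := by
    have p : 0 < ((r/2) • e0 n) 0 := by simp [e0]; linarith
    filter_upwards [Metric.isOpen_ball.mem_nhds mem,
      (continuous_apply (0 : Fin (n+1))).continuousAt.eventually (lt_mem_nhds p)] with y hy hy0
    exact (hr y hy).2 hy0
  have := an.eqOn_zero_of_preconnected_of_eventuallyEq_zero (convex_ball _ _).isPreconnected mem ev
  filter_upwards [Metric.ball_mem_nhds 0 r0] with z hz using this hz

theorem mft_sm [CompleteSpace H] {Q : Coef (EE' n) H (Fin n)} (hs : Q.Sm) (ha : Q.An 0) (hQ : Q.Hor)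
    (hsym : ∀ᶠ z in 𝓝 (0 : EE' n), ∀ j l, Q.aa j l z = Q.aa l j z) {u : EE' n → H} (hu : ContDiff ℝ ∞ u)
    (heq : ∀ᶠ z in 𝓝 (0 : EE' n), Q.LL (e0 n) (bb n) u z = Q.f z) : AnalyticAt ℝ u 0 := by
  obtain ⟨w0, wa0, hw0⟩ := pos_side hs ha hQ hu heq
  obtain ⟨w, ws, hww⟩ := globalize_an wa0
  have wa : AnalyticAt ℝ w 0 := wa0.congr hww.symm
  have vW : VP (fun z => w z - u z) := by
    filter_upwards [hww, hw0] with z h1 h2 h0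
    rw [h1, h2 h0, sub_self]
  have hz := vp_zero (h := fun z => Q.LL (e0 n) (bb n) w z - Q.f z) ((LL_an ha wa _ _).sub ha.f) (by
    filter_upwards [vW.eventually_nhds, heq] with z h1 h2 h0
    have : w =ᶠ[𝓝 z] u := by
      filter_upwards [h1, (continuous_apply (0 : Fin (n+1))).continuousAt.eventually (lt_mem_nhds h0)] with y a b
      exact sub_eq_zero.mp (a b)
    rw [LL_congr (Q' := Q) (w := u) rfl (fun _ => rfl) (fun _ _ => rfl) rfl (fun _ => rfl) rfl this, h2, sub_self])
  have := uniq hs hQ hsym (w := fun z => w z - u z) (ws.sub hu) vW (by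
    filter_upwards [hz, heq] with z h1 h2
    rw [LL_sub Q hu ws, h2, h1])
  refine wa.congr ?_
  filter_upwards [this] with z hz using sub_eq_zero.mp hz

theorem mft [CompleteSpace H] {Q : Coef (EE' n) H (Fin n)} (ha : Q.An 0) (hQ : Q.Hor)
    (hsym : ∀ᶠ z in 𝓝 (0 : EE' n), ∀ j l, Q.aa j l z = Q.aa l j z) {u : EE' n → H} (hu : ∀ᶠ z in 𝓝 (0 : EE' n), ContDiffAt ℝ ∞ u z)
    (heq : ∀ᶠ z in 𝓝 (0 : EE' n), Q.LL (e0 n) (bb n) u z = Q.f z) : AnalyticAt ℝ u 0 := by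
  obtain ⟨a00, s00, c00⟩ := globalize_an ha.a00
  choose a0 s0 c0 using fun j => globalize_an (ha.a0 j)
  choose aa sa ca using fun j l => globalize_an (ha.aa j l)
  obtain ⟨A0, sA0, cA0⟩ := globalize_an ha.A0
  choose A1 sA1 cA1 using fun j => globalize_an (ha.A1 j)
  obtain ⟨B, sB, cB⟩ := globalize_an ha.B
  obtain ⟨f, sf, cf⟩ := globalize_an ha.f
  obtain ⟨u', su, cu⟩ := globalize hu
  set Q' : Coef (EE' n) H (Fin n) := ⟨a00, a0, aa, A0, A1, B, f⟩ with hQ'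
  have hs' : Q'.Sm := ⟨s00, s0, sa, sA0, sA1, sB, sf⟩
  have ha' : Q'.An 0 := ⟨ha.a00.congr c00.symm, fun j => (ha.a0 j).congr (c0 j).symm, fun j l => (ha.aa j l).congr (ca j l).symm,
    ha.A0.congr cA0.symm, fun j => (ha.A1 j).congr (cA1 j).symm, ha.B.congr cB.symm, ha.f.congr cf.symm⟩
  have c0' := eventually_all.mpr c0
  have ca' := eventually_all.mpr fun j => eventually_all.mpr fun l => ca j l
  have hH : Q'.Hor := by
    refine ⟨?_, fun j => ?_, ?_, fun j l => ?_⟩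
    · filter_upwards [hQ.h00, c00] with z h1 h2 h0
      exact h2.trans (h1 h0)
    · filter_upwards [hQ.h0 j, c0 j] with z h1 h2 h0
      exact h2.trans (h1 h0)
    · exact (dd_congr c00).trans hQ.hd
    · exact ((ca j l).eq_of_nhds).trans (hQ.haa j l)
  have := mft_sm (u := u') hs' ha' hH (by
    filter_upwards [hsym, ca'] with z h1 h2 j l
    exact (h2 j l).trans ((h1 j l).trans (h2 l j).symm)) su (by
    filter_upwards [heq, cu.eventuallyEq_nhds, c00, c0', ca', cA0, eventually_all.mpr cA1, cB, cf] with z e1 e2 e3 e4 e5 e6 e7 e8 e9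
    rw [LL_congr (Q := Q') (Q' := Q) (w := u) e3 e4 e5 e6 e7 e8 e2, e1]
    exact e9.symm)
  exact this.congr cu

end
end HM

namespace HM
open MeasureTheory Filter Topology

section
variable {n : ℕ}

/-- block linear map -/
def Lm (s : ℝ) (M : Matrix (Fin n) (Fin n) ℝ) : EE' n →L[ℝ] EE' n :=
  LinearMap.toContinuousLinearMap
    { toFun := fun y => Fin.cons (s * y 0) (fun k => ∑ l, M k l * y l.succ)
      map_add' := fun x y => by
        funext i
        refine Fin.cases ?_ (fun k => ?_) i
        · simp [mul_add]
        · simp [mul_add, Finset.sum_add_distrib]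
      map_smul' := fun c x => by
        funext i
        refine Fin.cases ?_ (fun k => ?_) i
        · simp; ring
        · simp only [Fin.cons_succ, Pi.smul_apply, smul_eq_mul, RingHom.id_apply, Finset.mul_sum]
          exact Finset.sum_congr rfl fun _ _ => by ring }

lemma Lm_zero (s : ℝ) (M : Matrix (Fin n) (Fin n) ℝ) (y : EE' n) : Lm s M y 0 = s * y 0 := rfl

lemma Lm_succ (s : ℝ) (M : Matrix (Fin n) (Fin n) ℝ) (y : EE' n) (k : Fin n) :
    Lm s M y k.succ = ∑ l, M k l * y l.succ := rfl

lemma Lm_inv {s t : ℝ} {M T : Matrix (Fin n) (Fin n) ℝ} (h : s * t = 1) (hM : M * T = 1) (y : EE' n) :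
    Lm s M (Lm t T y) = y := by
  funext i
  refine Fin.cases ?_ (fun k => ?_) i
  · rw [Lm_zero, Lm_zero, ← mul_assoc, h, one_mul]
  · have : Lm s M (Lm t T y) k.succ = (M.mulVec (T.mulVec fun l => y l.succ)) k := rfl
    rw [this, Matrix.mulVec_mulVec, hM, Matrix.one_mulVec]

lemma Lm_e0 (s : ℝ) (M : Matrix (Fin n) (Fin n) ℝ) : Lm s M (e0 n) = s • e0 n := by
  funext i
  refine Fin.cases ?_ (fun k => ?_) i
  · rw [Lm_zero]; rfl
  · rw [Lm_succ]; simp [e0]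

lemma Lm_bb (s : ℝ) (M : Matrix (Fin n) (Fin n) ℝ) (k : Fin n) : Lm s M (bb n k) = ∑ l, M l k • bb n l := by
  funext i
  refine Fin.cases ?_ (fun m => ?_) i
  · rw [Lm_zero]; simp [bb]
  · rw [Lm_succ, Finset.sum_apply]
    simp [bb, Pi.single_apply]

variable {H : Type*} [NormedAddCommGroup H] [InnerProductSpace ℝ H]

lemma dd_affine {F : Type*} [NormedAddCommGroup F] [NormedSpace ℝ F] {f : EE' n → F} (hf : ContDiff ℝ ∞ f) (R : EE' n →L[ℝ] EE' n) (p a : EE' n) :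
    dd a (fun z => f (R (z - p))) = fun z => dd (R a) f (R (z - p)) := by
  funext z
  have h1 : HasFDerivAt (fun z => R (z - p)) R z := by
    have := R.hasFDerivAt.comp z ((hasFDerivAt_id z).sub_const p)
    simpa using this
  have h2 := (sm_diff hf (R (z - p))).hasFDerivAt.comp z h1
  unfold dd
  have h3 : fderiv ℝ (fun z => f (R (z - p))) z = _ := h2.fderiv
  rw [h3]; rfl

/-- transformed coefficients -/
def Coef.tr (Q : Coef (EE' n) H (Fin n)) (s : ℝ) (T : Matrix (Fin n) (Fin n) ℝ) (Φ : EE' n → EE' n) : Coef (EE' n) H (Fin n) where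
  a00 := fun y => s^2 * Q.a00 (Φ y)
  a0 := fun l y => ∑ k, s * T l k * Q.a0 k (Φ y)
  aa := fun l m y => ∑ j, ∑ k, T l j * T m k * Q.aa j k (Φ y)
  A0 := fun y => s • Q.A0 (Φ y)
  A1 := fun l y => ∑ k, T l k • Q.A1 k (Φ y)
  B := fun y => Q.B (Φ y)
  f := fun y => Q.f (Φ y)

lemma tr_LL (Q : Coef (EE' n) H (Fin n)) (s : ℝ) (T : Matrix (Fin n) (Fin n) ℝ) (Φ : EE' n → EE' n) {w : EE' n → H}
    (hw : ContDiff ℝ ∞ w) (p y : EE' n) (hy : Lm s T (Φ y - p) = y) :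
    Q.LL (e0 n) (bb n) (fun z => w (Lm s T (z - p))) (Φ y) = (Q.tr s T Φ).LL (e0 n) (bb n) w y := by
  have hd : ∀ a, ContDiff ℝ ∞ (dd a w) := fun a => dd_smooth hw
  have e1 : ∀ a, dd a (fun z => w (Lm s T (z - p))) (Φ y) = dd (Lm s T a) w y := fun a => by
    rw [dd_affine hw]; beta_reduce; rw [hy]
  have e2 : ∀ a b, dd a (dd b (fun z => w (Lm s T (z - p)))) (Φ y) = dd (Lm s T a) (dd (Lm s T b) w) y := fun a b => by
    rw [dd_affine hw, dd_affine (hd _)]; beta_reduce; rw [hy]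
  have e3 : y = Lm s T (Φ y - p) := hy.symm
  have sb : ∀ (k : Fin n) (a : EE' n), dd a (dd (Lm s T (bb n k)) w) y = ∑ l, T l k • dd a (dd (bb n l) w) y := by
    intro k a
    rw [Lm_bb, dd_sum_vec]
    simp only [dd_smul_vec]
    have : ∀ l, ContDiff ℝ ∞ (fun z => T l k • dd (bb n l) w z) := fun l => contDiff_const.smul (hd _)
    rw [dd_sum fun l _ => sm_diff (this l) y]
    refine Finset.sum_congr rfl fun l _ => ?_
    rw [dd_smul (sm_diff contDiff_const y) (sm_diff (hd _) y)]
    simp [dd]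
  have s0 : ∀ (a : EE' n), dd a (dd (Lm s T (e0 n)) w) y = s • dd a (dd (e0 n) w) y := by
    intro a
    rw [Lm_e0, dd_smul_vec, dd_smul (sm_diff contDiff_const y) (sm_diff (hd _) y)]
    simp [dd]
  unfold Coef.LL Coef.tr
  simp only [e1, e2, sb, s0]
  simp only [Lm_e0, Lm_bb, dd_smul_vec, dd_sum_vec, hy]
  have t1 : Q.a00 (Φ y) • s • s • dd (e0 n) (dd (e0 n) w) y = (s^2 * Q.a00 (Φ y)) • dd (e0 n) (dd (e0 n) w) y := by
    rw [smul_smul, smul_smul]; congr 1; ring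
  have t2 : ∑ x, Q.a0 x (Φ y) • ∑ l, T l x • s • dd (e0 n) (dd (bb n l) w) y =
      ∑ j, (∑ k, s * T j k * Q.a0 k (Φ y)) • dd (e0 n) (dd (bb n j) w) y := by
    simp only [Finset.smul_sum, Finset.sum_smul]
    rw [Finset.sum_comm]
    refine Finset.sum_congr rfl fun l _ => Finset.sum_congr rfl fun k _ => ?_
    rw [smul_smul, smul_smul]; congr 1; ring
  have t3 : ∑ j, ∑ k, Q.aa j k (Φ y) • ∑ m, T m k • ∑ l, T l j • dd (bb n l) (dd (bb n m) w) y =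
      ∑ l, ∑ m, (∑ j, ∑ k, T l j * T m k * Q.aa j k (Φ y)) • dd (bb n l) (dd (bb n m) w) y := by
    simp only [Finset.smul_sum, Finset.sum_smul]
    have r1 : ∀ j, ∑ k, ∑ m, ∑ l, Q.aa j k (Φ y) • T m k • T l j • dd (bb n l) (dd (bb n m) w) y =
        ∑ l, ∑ m, ∑ k, Q.aa j k (Φ y) • T m k • T l j • dd (bb n l) (dd (bb n m) w) y := by
      intro j
      rw [Finset.sum_comm]
      rw [Finset.sum_congr rfl fun m _ => Finset.sum_comm]
      rw [Finset.sum_comm]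
    rw [Finset.sum_congr rfl fun j _ => r1 j, Finset.sum_comm]
    refine Finset.sum_congr rfl fun l _ => ?_
    rw [Finset.sum_comm]
    refine Finset.sum_congr rfl fun m _ => Finset.sum_congr rfl fun j _ => Finset.sum_congr rfl fun k _ => ?_
    rw [smul_smul, smul_smul]; congr 1; ring
  have t4 : ∑ x, Q.A1 x (Φ y) (∑ i, T i x • dd (bb n i) w y) = ∑ j, (∑ k, T j k • Q.A1 k (Φ y)) (dd (bb n j) w y) := by
    simp only [map_sum, map_smul, sum_apply, smul_apply]
    rw [Finset.sum_comm]
  rw [t1, t2, t3, t4]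
  simp only [map_smul, smul_apply]

open scoped MatrixOrder in
lemma psd_fac {S : Matrix (Fin n) (Fin n) ℝ} (h : S.PosSemidef) : ∃ R : Matrix (Fin n) (Fin n) ℝ, S = R.transpose * R := by
  obtain ⟨R, hR⟩ := CStarAlgebra.nonneg_iff_eq_star_mul_self.mp h.nonneg
  refine ⟨R, ?_⟩
  rw [hR, Matrix.star_eq_conjTranspose, Matrix.conjTranspose_eq_transpose_of_trivial]

theorem mft_p [CompleteSpace H] {Q : Coef (EE' n) H (Fin n)} {p : EE' n} (hp : p 0 = 0) (ha : Q.An p)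
    (h00 : ∀ᶠ z in 𝓝 p, z 0 = 0 → Q.a00 z = 0) (h0 : ∀ j, ∀ᶠ z in 𝓝 p, z 0 = 0 → Q.a0 j z = 0)
    {c : ℝ} (hc : c ≠ 0) (hd : dd (e0 n) Q.a00 p = c)
    (hpos : (Matrix.of fun j l => Q.aa j l p).PosDef)
    (hsym : ∀ᶠ z in 𝓝 p, ∀ j l, Q.aa j l z = Q.aa l j z) {u : EE' n → H} (hu : ∀ᶠ z in 𝓝 p, ContDiffAt ℝ ∞ u z)
    (heq : ∀ᶠ z in 𝓝 p, Q.LL (e0 n) (bb n) u z = Q.f z) : AnalyticAt ℝ u p := by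
  -- the matrix
  obtain ⟨M, T, hMT, hTM, hT⟩ : ∃ M T : Matrix (Fin n) (Fin n) ℝ, M * T = 1 ∧ T * M = 1 ∧
      T * (Matrix.of fun j l => Q.aa j l p) * T.transpose = 1 := by
    obtain ⟨S, hS⟩ := psd_fac hpos.posSemidef
    have hdet : IsUnit S.det := by
      have := hpos.det_pos
      rw [hS, Matrix.det_mul, Matrix.det_transpose] at this
      refine isUnit_iff_ne_zero.mpr fun h => ?_
      rw [h] at this; simp at this
    have hdet' : IsUnit S.transpose.det := by rwa [Matrix.det_transpose]
    refine ⟨S.transpose, S.transpose⁻¹, Matrix.mul_nonsing_inv _ hdet', Matrix.nonsing_inv_mul _ hdet', ?_⟩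
    rw [hS, ← Matrix.mul_assoc, Matrix.nonsing_inv_mul _ hdet', Matrix.one_mul, Matrix.transpose_nonsing_inv,
      Matrix.transpose_transpose, Matrix.mul_nonsing_inv _ hdet]
  obtain ⟨u', su, cu⟩ := globalize hu
  set Φ : EE' n → EE' n := fun y => p + Lm c M y with hΦ
  set R := Lm c⁻¹ T with hR
  have Φ0 : Φ 0 = p := by simp [hΦ]
  have RΦ : ∀ y, R (Φ y - p) = y := fun y => by
    rw [hΦ]; beta_reduce; rw [add_sub_cancel_left]; exact Lm_inv (inv_mul_cancel₀ hc) hTM y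
  have ΦR : ∀ z, Φ (R (z - p)) = z := fun z => by
    rw [hΦ]; beta_reduce; rw [hR, Lm_inv (mul_inv_cancel₀ hc) hMT]; abel
  have Φa : AnalyticAt ℝ Φ 0 := analyticAt_const.add ((Lm c M).analyticAt 0)
  have Φs : ContDiff ℝ ∞ Φ := contDiff_const.add (Lm c M).contDiff
  have Φt : Tendsto Φ (𝓝 0) (𝓝 p) := by
    have := Φs.continuous.tendsto 0
    rwa [Φ0] at this
  have Φz : ∀ y, Φ y 0 = c * y 0 := fun y => by
    rw [hΦ]; beta_reduce; rw [Pi.add_apply, hp, zero_add, Lm_zero]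
  set Q' := Q.tr c⁻¹ T Φ with hQ'
  have cmp : ∀ {F : Type _} [NormedAddCommGroup F] [NormedSpace ℝ F] {f : EE' n → F}, AnalyticAt ℝ f p → AnalyticAt ℝ (fun y => f (Φ y)) 0 := by
    intro F _ _ f hf
    rw [← Φ0] at hf
    exact hf.comp Φa
  have cmpR : ∀ {f : EE' n → ℝ}, AnalyticAt ℝ f p → AnalyticAt ℝ (fun y => f (Φ y)) 0 := by
    intro f hf
    rw [← Φ0] at hf
    exact hf.comp Φa
  have ha' : Q'.An 0 :=
    ⟨analyticAt_const.mul (cmpR ha.a00),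
      fun l => by
        show AnalyticAt ℝ (fun y => ∑ k, c⁻¹ * T l k * Q.a0 k (Φ y)) 0
        exact Finset.analyticAt_fun_sum _ fun k _ => analyticAt_const.fun_mul (cmpR (ha.a0 k)),
      fun l m => by
        show AnalyticAt ℝ (fun y => ∑ j, ∑ k, T l j * T m k * Q.aa j k (Φ y)) 0
        exact Finset.analyticAt_fun_sum _ fun j _ => Finset.analyticAt_fun_sum _ fun k _ => analyticAt_const.fun_mul (cmpR (ha.aa j k)),
      by
        show AnalyticAt ℝ (fun y => c⁻¹ • Q.A0 (Φ y)) 0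
        exact analyticAt_const.fun_smul (cmp ha.A0),
      fun l => by
        show AnalyticAt ℝ (fun y => ∑ k, T l k • Q.A1 k (Φ y)) 0
        exact Finset.analyticAt_fun_sum _ fun k _ => analyticAt_const.fun_smul (cmp (ha.A1 k)),
      cmp ha.B, cmp ha.f⟩
  have hH : Q'.Hor := by
    refine ⟨?_, fun l => ?_, ?_, fun l m => ?_⟩
    · filter_upwards [Φt.eventually h00] with y h hy
      show c⁻¹^2 * Q.a00 (Φ y) = 0
      rw [h (by rw [Φz, hy, mul_zero]), mul_zero]
    · filter_upwards [Φt.eventually (eventually_all.mpr h0)] with y h hy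
      show ∑ k, c⁻¹ * T l k * Q.a0 k (Φ y) = 0
      exact Finset.sum_eq_zero fun k _ => by rw [h k (by rw [Φz, hy, mul_zero]), mul_zero]
    · show dd (e0 n) (fun y => c⁻¹^2 * Q.a00 (Φ y)) 0 = 1
      have d1 : HasFDerivAt Φ (Lm c M) 0 := (Lm c M).hasFDerivAt.const_add p
      have d2 : HasFDerivAt Q.a00 (fderiv ℝ Q.a00 p) (Φ 0) := by
        rw [Φ0]; exact ha.a00.differentiableAt.hasFDerivAt
      have d3 : HasFDerivAt (fun y => c⁻¹^2 * Q.a00 (Φ y)) (c⁻¹^2 • (fderiv ℝ Q.a00 p).comp (Lm c M)) 0 :=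
        (d2.comp (0 : EE' n) d1).const_mul _
      unfold dd
      rw [d3.fderiv, smul_apply, ContinuousLinearMap.comp_apply, Lm_e0, map_smul]
      have : fderiv ℝ Q.a00 p (e0 n) = c := hd
      rw [this, smul_eq_mul, smul_eq_mul]
      field_simp
    · show ∑ j, ∑ k, T l j * T m k * Q.aa j k (Φ 0) = _
      have := congrFun (congrFun hT l) m
      rw [Matrix.one_apply] at this
      rw [← this, Φ0, Matrix.mul_apply]
      simp only [Matrix.mul_apply, Matrix.transpose_apply, Matrix.of_apply, Finset.sum_mul]
      rw [Finset.sum_comm]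
      exact Finset.sum_congr rfl fun _ _ => Finset.sum_congr rfl fun _ _ => by ring
  have key := mft (Q := Q') (u := fun y => u' (Φ y)) ha' hH (by
    filter_upwards [Φt.eventually hsym] with y h l m
    show ∑ j, ∑ k, T l j * T m k * Q.aa j k (Φ y) = ∑ j, ∑ k, T m j * T l k * Q.aa j k (Φ y)
    rw [Finset.sum_comm]
    exact Finset.sum_congr rfl fun _ _ => Finset.sum_congr rfl fun _ _ => by rw [h]; ring)
    (Eventually.of_forall fun z => (su.comp Φs).contDiffAt) (by
    filter_upwards [Φt.eventually heq, Φt.eventually cu.eventuallyEq_nhds] with y h1 h2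
    have := tr_LL Q c⁻¹ T Φ (w := fun y => u' (Φ y)) (su.comp Φs) p y (RΦ y)
    rw [← this]
    have e : (fun z => u' (Φ (Lm c⁻¹ T (z - p)))) = u' := funext fun z => by rw [ΦR]
    rw [e, LL_congr (Q' := Q) (w := u) rfl (fun _ => rfl) (fun _ _ => rfl) rfl (fun _ => rfl) rfl h2, h1]
    rfl)
  have Ra : AnalyticAt ℝ (fun z => R (z - p)) p := (R.analyticAt _).comp (analyticAt_id.sub analyticAt_const)
  have k2 : AnalyticAt ℝ (fun y => u' (Φ y)) (R (p - p)) := by rw [sub_self, map_zero]; exact key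
  have k3 : AnalyticAt ℝ (fun z => u' (Φ (R (z - p)))) p := k2.comp (f := fun z => R (z - p)) Ra
  have e : (fun z => u' (Φ (R (z - p)))) = u' := funext fun z => by rw [ΦR]
  rw [e] at k3
  exact k3.congr cu

end
end HM

namespace HM
open MeasureTheory Filter Topology

section
variable {n : ℕ} {F : Type*} [NormedAddCommGroup F] [NormedSpace ℝ F] {H : Type*} [NormedAddCommGroup H] [InnerProductSpace ℝ H]

/-- coefficients conjugated by a linear isomorphism of the target -/
def Coef.cj (Q : Coef (EE' n) F (Fin n)) (e : F ≃L[ℝ] H) : Coef (EE' n) H (Fin n) where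
  a00 := Q.a00
  a0 := Q.a0
  aa := Q.aa
  A0 := fun y => e.arrowCongrEquiv e (Q.A0 y)
  A1 := fun l y => e.arrowCongrEquiv e (Q.A1 l y)
  B := fun y => e.arrowCongrEquiv e (Q.B y)
  f := fun y => e (Q.f y)

lemma cj_an {W : Type*} [NormedAddCommGroup W] [NormedSpace ℝ W] {A : W → (F →L[ℝ] F)} {p : W} (e : F ≃L[ℝ] H) (h : AnalyticAt ℝ A p) :
    AnalyticAt ℝ (fun y => e.arrowCongrEquiv e (A y)) p := by
  have : (fun y => e.arrowCongrEquiv e (A y)) = fun y =>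
      ((ContinuousLinearMap.compL ℝ H F H) (e : F →L[ℝ] H)) (((ContinuousLinearMap.compL ℝ H F F).flip (e.symm : H →L[ℝ] F)) (A y)) := by
    funext y; ext x; rfl
  rw [this]
  exact (ContinuousLinearMap.analyticAt _ _).comp ((ContinuousLinearMap.analyticAt _ _).comp h)

lemma dd_equiv (e : F ≃L[ℝ] H) (a : EE' n) (v : EE' n → F) : dd a (fun z => e (v z)) = fun z => e (dd a v z) := by
  funext z
  unfold dd
  have := e.comp_fderiv (f := v) (x := z)
  have h2 : fderiv ℝ (fun z => e (v z)) z = _ := this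
  rw [h2]; rfl

lemma cj_LL (Q : Coef (EE' n) F (Fin n)) (e : F ≃L[ℝ] H) (v : EE' n → F) (z : EE' n) :
    (Q.cj e).LL (e0 n) (bb n) (fun z => e (v z)) z = e (Q.LL (e0 n) (bb n) v z) := by
  unfold Coef.LL Coef.cj
  simp only [dd_equiv, map_add, map_sum, map_smul]
  have : ∀ (S : F →L[ℝ] F) (x : F), (e.arrowCongrEquiv e S) (e x) = e (S x) := fun S x => by simp
  simp only [this]

theorem mft_F [FiniteDimensional ℝ F] {Q : Coef (EE' n) F (Fin n)} {p : EE' n} (hp : p 0 = 0) (ha : Q.An p)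
    (h00 : ∀ᶠ z in 𝓝 p, z 0 = 0 → Q.a00 z = 0) (h0 : ∀ j, ∀ᶠ z in 𝓝 p, z 0 = 0 → Q.a0 j z = 0)
    {c : ℝ} (hc : c ≠ 0) (hd : dd (e0 n) Q.a00 p = c)
    (hpos : (Matrix.of fun j l => Q.aa j l p).PosDef)
    (hsym : ∀ᶠ z in 𝓝 p, ∀ j l, Q.aa j l z = Q.aa l j z) {u : EE' n → F} (hu : ∀ᶠ z in 𝓝 p, ContDiffAt ℝ ∞ u z)
    (heq : ∀ᶠ z in 𝓝 p, Q.LL (e0 n) (bb n) u z = Q.f z) : AnalyticAt ℝ u p := by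
  let e : F ≃L[ℝ] EuclideanSpace ℝ (Fin (Module.finrank ℝ F)) := toEuclidean
  have key : AnalyticAt ℝ (fun z => e (u z)) p := by
    refine mft_p (Q := Q.cj e) hp ?_ h00 h0 hc hd hpos hsym ?_ ?_
    · exact ⟨ha.a00, ha.a0, ha.aa, cj_an e ha.A0, fun l => cj_an e (ha.A1 l), cj_an e ha.B,
        (e.analyticAt _).comp ha.f⟩
    · filter_upwards [hu] with z hz
      exact e.contDiff.contDiffAt.comp z hz
    · filter_upwards [heq] with z hz
      rw [cj_LL, hz]; rfl
  have h2 : AnalyticAt ℝ (fun z => e.symm (e (u z))) p := (e.symm.analyticAt _).comp key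
  simpa using h2

end
end HM

namespace HM
open MeasureTheory Filter Topology

section
variable {n : ℕ}

lemma fin2 (β : Fin (n+2)) : β = 0 ∨ β = 1 ∨ 2 ≤ (β : ℕ) := by
  rcases β with ⟨i, hi⟩
  rcases i with _ | _ | i
  · left; rfl
  · right; left; rfl
  · right; right; simp

lemma g_row0 {g : Matrix (Fin (n+2)) (Fin (n+2)) ℝ} 
    (h00 : g 0 0 = 0) (h01 : g 0 1 = 1) (h0j : ∀ j : Fin (n+2), 2 ≤ (j : ℕ) → g 0 j = 0) (β : Fin (n+2)) :
    g 0 β = if β = 1 then 1 else 0 := by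
  rcases fin2 β with h | h | h
  · rw [h, h00]; simp
  · rw [h, h01]; simp
  · rw [h0j β h, if_neg]
    rintro rfl
    simp at h

lemma g_row1 {g : Matrix (Fin (n+2)) (Fin (n+2)) ℝ} (hs : g.IsSymm) (h01 : g 0 1 = 1)
    (h11 : g 1 1 = 0) (h1j : ∀ j : Fin (n+2), 2 ≤ (j : ℕ) → g 1 j = 0) (β : Fin (n+2)) :
    g 1 β = if β = 0 then 1 else 0 := by
  rcases fin2 β with h | h | h
  · rw [h, hs.apply, h01]; simp
  · rw [h, h11]; simp
  · rw [h1j β h, if_neg]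
    rintro rfl
    simp at h

lemma G_row1 {g : Matrix (Fin (n+2)) (Fin (n+2)) ℝ} (hi : IsUnit g)
    (h : ∀ β, g 0 β = if β = 1 then 1 else 0) (γ : Fin (n+2)) : g⁻¹ 1 γ = if γ = 0 then 1 else 0 := by
  have := congrFun (congrFun (Matrix.mul_nonsing_inv _ ((Matrix.isUnit_iff_isUnit_det _).mp hi)) 0) γ
  rw [Matrix.mul_apply] at this
  simp only [h, ite_mul, one_mul, zero_mul, Finset.sum_ite_eq', Finset.mem_univ, if_true, Matrix.one_apply] at this
  rw [this]; simp only [eq_comm]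

lemma G_row0 {g : Matrix (Fin (n+2)) (Fin (n+2)) ℝ} (hi : IsUnit g)
    (h : ∀ β, g 1 β = if β = 0 then 1 else 0) (γ : Fin (n+2)) : g⁻¹ 0 γ = if γ = 1 then 1 else 0 := by
  have := congrFun (congrFun (Matrix.mul_nonsing_inv _ ((Matrix.isUnit_iff_isUnit_det _).mp hi)) 1) γ
  rw [Matrix.mul_apply] at this
  simp only [h, ite_mul, one_mul, zero_mul, Finset.sum_ite_eq', Finset.mem_univ, if_true, Matrix.one_apply] at this
  rw [this]; simp only [eq_comm]

lemma G_symm {g : Matrix (Fin (n+2)) (Fin (n+2)) ℝ} (hs : g.IsSymm) (i j) : g⁻¹ i j = g⁻¹ j i := by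
  have : (g⁻¹).IsSymm := by
    unfold Matrix.IsSymm
    rw [Matrix.transpose_nonsing_inv, hs.eq]
  exact this.apply j i

lemma G_pos {g : Matrix (Fin (n+2)) (Fin (n+2)) ℝ} (hi : IsUnit g) (hs : g.IsSymm)
    (h0 : ∀ β, g 0 β = if β = 1 then 1 else 0) (h1 : ∀ β, g 1 β = if β = 0 then 1 else 0)
    (hpos : ∀ ξ : Fin (n + 2) → ℝ, ξ 0 = 0 → ξ 1 = 0 → ξ ≠ 0 →
        0 < ∑ i : Fin (n + 2), ∑ j : Fin (n + 2), g i j * ξ i * ξ j) :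
    (Matrix.of fun j l : Fin n => g⁻¹ j.succ.succ l.succ.succ).PosDef := by
  refine Matrix.PosDef.of_dotProduct_mulVec_pos ?_ ?_
  · ext j l
    simp [G_symm hs j.succ.succ]
  · intro η hη
    set η' : Fin (n+2) → ℝ := Fin.cons 0 (Fin.cons 0 η) with hη'
    have e0 : η' 0 = 0 := rfl
    have e1 : η' 1 = 0 := rfl
    have e2 : ∀ j : Fin n, η' j.succ.succ = η j := fun j => rfl
    set ξ := (g⁻¹).mulVec η' with hξ
    have gx : g.mulVec ξ = η' := by
      rw [hξ, Matrix.mulVec_mulVec, Matrix.mul_nonsing_inv _ ((Matrix.isUnit_iff_isUnit_det _).mp hi), Matrix.one_mulVec]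
    have x0 : ξ 0 = 0 := by
      rw [hξ]; simp [Matrix.mulVec, dotProduct, G_row0 hi h1, e1]
    have x1 : ξ 1 = 0 := by
      rw [hξ]; simp [Matrix.mulVec, dotProduct, G_row1 hi h0, e0]
    have xn : ξ ≠ 0 := by
      intro h
      rw [h, Matrix.mulVec_zero] at gx
      apply hη
      funext j
      rw [← e2 j, ← gx]; rfl
    have := hpos ξ x0 x1 xn
    have q : ∑ i, ∑ j, g i j * ξ i * ξ j = ∑ i, ξ i * η' i := by
      refine Finset.sum_congr rfl fun i _ => ?_
      rw [← gx, Matrix.mulVec, dotProduct, Finset.mul_sum]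
      exact Finset.sum_congr rfl fun j _ => by ring
    rw [q, Fin.sum_univ_succ, Fin.sum_univ_succ] at this
    have e1' : η' (Fin.succ 0) = 0 := rfl
    rw [e0, e1', mul_zero, mul_zero, zero_add, zero_add] at this
    refine lt_of_lt_of_eq this (Eq.symm ?_)
    simp only [dotProduct, star_trivial, Matrix.mulVec, Matrix.of_apply]
    refine Finset.sum_congr rfl fun j _ => ?_
    rw [e2, mul_comm]
    congr 1
    rw [hξ, Matrix.mulVec, dotProduct, Fin.sum_univ_succ, Fin.sum_univ_succ, e0, e1', mul_zero, mul_zero, zero_add, zero_add]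
    exact Finset.sum_congr rfl fun l _ => by rw [e2]

lemma det_an {W : Type*} [NormedAddCommGroup W] [NormedSpace ℝ W] {m : ℕ} {M : W → Matrix (Fin m) (Fin m) ℝ} {p : W}
    (h : ∀ i j, AnalyticAt ℝ (fun x => M x i j) p) : AnalyticAt ℝ (fun x => (M x).det) p := by
  simp only [Matrix.det_apply']
  refine Finset.analyticAt_fun_sum _ fun s _ => ?_
  exact analyticAt_const.fun_mul (Finset.analyticAt_fun_prod _ fun i _ => h _ _)

lemma G_an {W : Type*} [NormedAddCommGroup W] [NormedSpace ℝ W] {m : ℕ} {M : W → Matrix (Fin m) (Fin m) ℝ} {p : W}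
    (h : ∀ i j, AnalyticAt ℝ (fun x => M x i j) p) (hi : IsUnit (M p)) (i j) : AnalyticAt ℝ (fun x => (M x)⁻¹ i j) p := by
  have e : (fun x => (M x)⁻¹ i j) = fun x => ((M x).det)⁻¹ * ((M x).updateRow j (Pi.single i 1)).det := by
    funext x
    rw [Matrix.inv_def, Matrix.smul_apply, Matrix.adjugate_apply, Ring.inverse_eq_inv, smul_eq_mul]
  rw [e]
  refine ((det_an h).fun_inv ?_).fun_mul (det_an fun k l => ?_)
  · exact ((Matrix.isUnit_iff_isUnit_det _).mp hi).ne_zero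
  · by_cases hk : k = j
    · subst hk
      simp only [Matrix.updateRow_self]
      exact analyticAt_const
    · simp only [Matrix.updateRow_ne hk]
      exact h k l

lemma deriv_upd {F : Type*} [NormedAddCommGroup F] [NormedSpace ℝ F] {f : EE' n → F} {x : EE' n} (hf : DifferentiableAt ℝ f x) (i : Fin (n+1)) :
    deriv (fun s => f (Function.update x i s)) (x i) = dd (Pi.single i 1) f x := by
  have h1 := hasDerivAt_update x i (x i)
  have h2 : HasFDerivAt f (fderiv ℝ f x) (Function.update x i (x i)) := by
    rw [Function.update_eq_self]; exact hf.hasFDerivAt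
  exact (h2.comp_hasDerivAt (x i) h1).deriv

lemma G_dd {U : Set (EE' n)} (hU : IsOpen U) {g : EE' n → Matrix (Fin (n + 2)) (Fin (n + 2)) ℝ} {p : EE' n} (hp : p ∈ U)
    (hg : ∀ i j, AnalyticAt ℝ (fun x => g x i j) p) (hs : (g p).IsSymm) (hi : ∀ x ∈ U, IsUnit (g x))
    (h0 : ∀ β, g p 0 β = if β = 1 then 1 else 0) :
    dd (e0 n) (fun x => (g x)⁻¹ 1 1) p = - dd (e0 n) (fun x => g x 0 0) p := by
  have hG := G_an hg (hi p hp)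
  have e : (fun x => ∑ α, (g x)⁻¹ 1 α * g x α 0) =ᶠ[𝓝 p] fun _ => 0 := by
    filter_upwards [hU.mem_nhds hp] with x hx
    have := congrFun (congrFun (Matrix.nonsing_inv_mul _ ((Matrix.isUnit_iff_isUnit_det _).mp (hi x hx))) 1) 0
    rw [Matrix.mul_apply] at this
    rw [this]; simp
  have d := dd_congr (v := e0 n) e
  rw [dd_sum fun α _ => ((hG 1 α).fun_mul (hg α 0)).differentiableAt] at d
  have d0 : dd (e0 n) (fun _ : EE' n => (0:ℝ)) p = 0 := by simp [dd]
  rw [d0] at d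
  have d1 : ∀ α, dd (e0 n) (fun x => (g x)⁻¹ 1 α * g x α 0) p =
      (if α = 1 then dd (e0 n) (fun x => (g x)⁻¹ 1 α) p else 0) + (if α = 0 then dd (e0 n) (fun x => g x α 0) p else 0) := by
    intro α
    rw [dd_mul (hG 1 α).differentiableAt (hg α 0).differentiableAt, hs.apply 0 α, h0, G_row1 (hi p hp) h0]
    split_ifs <;> simp
  simp only [d1, Finset.sum_add_distrib, Finset.sum_ite_eq', Finset.mem_univ, if_true] at d
  linarith

end
end HM

namespace HM
open MeasureTheory Filter Topology

section
variable {n N : ℕ}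

lemma cexp_deriv (c : ℂ) (t : ℝ) : HasDerivAt (fun s : ℝ => Complex.exp (c * s)) (c * Complex.exp (c * t)) t := by
  have h1 : HasDerivAt (fun s : ℝ => c * (s:ℂ)) c t := by
    simpa using (Complex.ofRealCLM.hasDerivAt (x := t)).const_mul c
  have := h1.cexp
  rwa [mul_comm] at this

lemma mode_form {c : ℂ} {f : ℝ → Fin N → ℂ} (hf : Differentiable ℝ f) (hd : ∀ t, deriv f t = c • f t) (t : ℝ) :
    f t = Complex.exp (c * t) • f 0 := by
  have h1 : ∀ s, HasDerivAt (fun s : ℝ => Complex.exp ((-c) * s) • f s) 0 s := by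
    intro s
    have h2 := (hf s).hasDerivAt
    rw [hd] at h2
    have h3 := (cexp_deriv (-c) s).fun_smul h2
    have e : Complex.exp (-c * s) • c • f s + (-c * Complex.exp (-c * s)) • f s = 0 := by
      rw [smul_smul, ← add_smul]
      have : Complex.exp (-c * s) * c + -c * Complex.exp (-c * s) = 0 := by ring
      rw [this, zero_smul]
    rw [e] at h3
    exact h3
  have h4 := is_const_of_deriv_eq_zero (fun s => (h1 s).differentiableAt) (fun s => (h1 s).deriv) t 0
  simp only [Complex.ofReal_zero, mul_zero, Complex.exp_zero, one_smul] at h4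
  rw [← h4, smul_smul, ← Complex.exp_add]
  simp

/-- the derivative acting on mode profiles -/
def dl (c : ℂ) (α : Fin (n+2)) (φ : EE' n → ℂ) : EE' n → ℂ :=
  Fin.cases (fun x => c * φ x) (fun j => dd (Pi.single j 1) φ) α

lemma dl_zero (c : ℂ) (φ : EE' n → ℂ) : dl c 0 φ = fun x => c * φ x := rfl

lemma dl_succ (c : ℂ) (j : Fin (n+1)) (φ : EE' n → ℂ) : dl c j.succ φ = dd (Pi.single j 1) φ := rfl

lemma dl_smooth (c : ℂ) (α : Fin (n+2)) {φ : EE' n → ℂ} (h : ContDiff ℝ ∞ φ) : ContDiff ℝ ∞ (dl c α φ) := by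
  refine Fin.cases ?_ (fun j => ?_) α
  · rw [dl_zero]; exact contDiff_const.mul h
  · rw [dl_succ]; exact dd_smooth h

lemma D_mode {c : ℂ} {V : Set (EE' n)} (hV : IsOpen V) {w : ℝ × EE' n → ℂ} {φ : EE' n → ℂ} (hφ : ContDiff ℝ ∞ φ)
    (hw : ∀ t, ∀ x ∈ V, w (t, x) = Complex.exp (c * t) * φ x) (α : Fin (n+2)) (t : ℝ) {x : EE' n} (hx : x ∈ V) :
    D α w (t, x) = Complex.exp (c * t) * dl c α φ x := by
  refine Fin.cases ?_ (fun j => ?_) α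
  · unfold D
    rw [dif_pos rfl, dl_zero]
    have e : (fun s => w (s, x)) = fun s : ℝ => Complex.exp (c * s) * φ x := funext fun s => hw s x hx
    simp only
    rw [e, ((cexp_deriv c t).mul_const (φ x)).deriv]
    ring
  · unfold D
    rw [dif_neg (Fin.succ_ne_zero j), dl_succ]
    simp only [Fin.pred_succ]
    have ct : ContinuousAt (fun s => Function.update x j s) (x j) := (hasDerivAt_update x j (x j)).continuousAt
    have e : (fun s => w (t, Function.update x j s)) =ᶠ[𝓝 (x j)] fun s => Complex.exp (c * t) * φ (Function.update x j s) := by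
      have : V ∈ 𝓝 (Function.update x j (x j)) := by rw [Function.update_eq_self]; exact hV.mem_nhds hx
      filter_upwards [ct.eventually this] with s hs using hw t _ hs
    rw [e.deriv_eq]
    have h1 := deriv_upd (f := fun y => Complex.exp (c * t) * φ y) (x := x) ((sm_diff hφ x).const_mul _) j
    rw [h1]
    unfold dd
    rw [fderiv_const_mul (sm_diff hφ x)]
    rfl

lemma DD_mode {c : ℂ} {V : Set (EE' n)} (hV : IsOpen V) {w : ℝ × EE' n → ℂ} {φ : EE' n → ℂ} (hφ : ContDiff ℝ ∞ φ)
    (hw : ∀ t, ∀ x ∈ V, w (t, x) = Complex.exp (c * t) * φ x) (α β : Fin (n+2)) (t : ℝ) {x : EE' n} (hx : x ∈ V) :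
    D α (fun q => D β w q) (t, x) = Complex.exp (c * t) * dl c α (dl c β φ) x :=
  D_mode hV (dl_smooth c β hφ) (fun t x hx => D_mode hV hφ hw β t hx) α t hx

/-- matrix as a real continuous linear map -/
def mop (M : Fin N → Fin N → ℂ) : (Fin N → ℂ) →L[ℝ] (Fin N → ℂ) :=
  ∑ i, ∑ j, (ContinuousLinearMap.single ℝ (fun _ : Fin N => ℂ) i).comp
    ((ContinuousLinearMap.mul ℝ ℂ (M i j)).comp (ContinuousLinearMap.proj j))

lemma mop_apply (M : Fin N → Fin N → ℂ) (w : Fin N → ℂ) (k : Fin N) : mop M w k = ∑ m, M k m * w m := by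
  unfold mop
  simp [sum_apply, Pi.single_apply]

lemma mop_an {W : Type*} [NormedAddCommGroup W] [NormedSpace ℝ W] {M : W → Fin N → Fin N → ℂ} {p : W}
    (h : ∀ i j, AnalyticAt ℝ (fun x => M x i j) p) : AnalyticAt ℝ (fun x => mop (M x)) p := by
  unfold mop
  refine Finset.analyticAt_fun_sum _ fun i _ => Finset.analyticAt_fun_sum _ fun j _ => ?_
  have e : (fun x => (ContinuousLinearMap.single ℝ (fun _ : Fin N => ℂ) i).comp
      ((ContinuousLinearMap.mul ℝ ℂ (M x i j)).comp (ContinuousLinearMap.proj (R := ℝ) (φ := fun _ : Fin N => ℂ) j))) =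
      fun x => (ContinuousLinearMap.compL ℝ (Fin N → ℂ) ℂ (Fin N → ℂ) (ContinuousLinearMap.single ℝ (fun _ : Fin N => ℂ) i))
        ((ContinuousLinearMap.compL ℝ (Fin N → ℂ) ℂ ℂ).flip (ContinuousLinearMap.proj (R := ℝ) (φ := fun _ : Fin N => ℂ) j)
          (ContinuousLinearMap.mul ℝ ℂ (M x i j))) := rfl
  rw [e]
  exact (ContinuousLinearMap.analyticAt _ _).comp ((ContinuousLinearMap.analyticAt _ _).comp ((ContinuousLinearMap.analyticAt _ _).comp (h i j)))

/-- the reduced operator -/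
def QQ (c : ℂ) (g : EE' n → Matrix (Fin (n + 2)) (Fin (n + 2)) ℝ)
    (A : Fin (n + 2) → EE' n → Matrix (Fin N) (Fin N) ℂ) (B : EE' n → Matrix (Fin N) (Fin N) ℂ)
    (f : EE' n → Fin N → ℂ) : Coef (EE' n) (Fin N → ℂ) (Fin n) where
  a00 := fun x => (g x)⁻¹ 1 1
  a0 := fun j x => (g x)⁻¹ 1 j.succ.succ + (g x)⁻¹ j.succ.succ 1
  aa := fun j l x => (g x)⁻¹ j.succ.succ l.succ.succ
  A0 := fun x => mop fun i m => (if i = m then c * ((((g x)⁻¹ 0 1 : ℝ) : ℂ) + (((g x)⁻¹ 1 0 : ℝ) : ℂ)) else 0) - A 1 x i m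
  A1 := fun j x => mop fun i m => (if i = m then c * ((((g x)⁻¹ 0 j.succ.succ : ℝ) : ℂ) + (((g x)⁻¹ j.succ.succ 0 : ℝ) : ℂ)) else 0)
    - A j.succ.succ x i m
  B := fun x => mop fun i m => (if i = m then c * (c * (((g x)⁻¹ 0 0 : ℝ) : ℂ)) else 0) - (c * A 0 x i m + B x i m)
  f := f

lemma of_an {W : Type*} [NormedAddCommGroup W] [NormedSpace ℝ W] {f : W → ℝ} {p : W} (h : AnalyticAt ℝ f p) : AnalyticAt ℝ (fun x => ((f x : ℝ) : ℂ)) p :=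
  (Complex.ofRealCLM.analyticAt _).comp h

lemma QQ_an (c : ℂ) {g : EE' n → Matrix (Fin (n + 2)) (Fin (n + 2)) ℝ}
    {A : Fin (n + 2) → EE' n → Matrix (Fin N) (Fin N) ℂ} {B : EE' n → Matrix (Fin N) (Fin N) ℂ}
    {f : EE' n → Fin N → ℂ} {p : EE' n} (hg : ∀ i j, AnalyticAt ℝ (fun x => g x i j) p) (hi : IsUnit (g p))
    (hA : ∀ α i j, AnalyticAt ℝ (fun x => A α x i j) p) (hB : ∀ i j, AnalyticAt ℝ (fun x => B x i j) p) (hf : AnalyticAt ℝ f p) :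
    (QQ c g A B f).An p := by
  have hG := G_an hg hi
  have hGc : ∀ i j, AnalyticAt ℝ (fun x => (((g x)⁻¹ i j : ℝ) : ℂ)) p := fun i j => of_an (hG i j)
  have hit : ∀ (q : Prop) [Decidable q] (s : EE' n → ℂ), AnalyticAt ℝ s p → AnalyticAt ℝ (fun x => if q then s x else 0) p := by
    intro q _ s hs
    split_ifs
    · exact hs
    · exact analyticAt_const
  refine ⟨hG 1 1, fun j => (hG _ _).fun_add (hG _ _), fun j l => hG _ _, ?_, fun j => ?_, ?_, hf⟩
  · refine mop_an fun i j => (hit _ _ ?_).fun_sub (hA _ _ _)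
    exact analyticAt_const.fun_mul ((hGc _ _).fun_add (hGc _ _))
  · refine mop_an fun i j => (hit _ _ ?_).fun_sub (hA _ _ _)
    exact analyticAt_const.fun_mul ((hGc _ _).fun_add (hGc _ _))
  · refine mop_an fun i j => (hit _ _ ?_).fun_sub ((analyticAt_const.fun_mul (hA _ _ _)).fun_add (hB _ _))
    exact analyticAt_const.fun_mul (analyticAt_const.fun_mul (hGc _ _))

lemma ite_sub_sum (s : ℂ) (a w : Fin N → ℂ) (k : Fin N) :
    ∑ m, ((if k = m then s else 0) - a m) * w m = s * w k - ∑ m, a m * w m := by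
  simp [sub_mul, Finset.sum_sub_distrib]

lemma dd_comp {v : EE' n → Fin N → ℂ} (hv : ContDiff ℝ ∞ v) (a : EE' n) (x : EE' n) (k : Fin N) :
    dd a v x k = dd a (fun y => v y k) x := by
  unfold dd
  have h := (hasFDerivAt_pi'.mp (sm_diff hv x).hasFDerivAt) k
  have h2 : fderiv ℝ (fun y => v y k) x = _ := h.fderiv
  rw [h2]; rfl

lemma dd_cmul (c : ℂ) {φ : EE' n → ℂ} (h : ContDiff ℝ ∞ φ) (a : EE' n) (x : EE' n) :
    dd a (fun y => c * φ y) x = c * dd a φ x := by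
  unfold dd
  rw [fderiv_const_mul (sm_diff h x)]
  rfl

lemma LL_ev {F : Type*} [NormedAddCommGroup F] [NormedSpace ℝ F] (Q : Coef (EE' n) F (Fin n)) {v w : EE' n → F} {x : EE' n} (h : v =ᶠ[𝓝 x] w) :
    Q.LL (e0 n) (bb n) v x = Q.LL (e0 n) (bb n) w x := by
  unfold Coef.LL
  have h1 : ∀ a, dd a v x = dd a w x := fun a => dd_congr h
  have h2 : ∀ a b, dd a (dd b v) x = dd a (dd b w) x := fun a b => dd_congr (dd_congr_nhds h)
  simp only [h1, h2, h.self_of_nhds]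

lemma QQ_LL (c : ℂ) (g : EE' n → Matrix (Fin (n + 2)) (Fin (n + 2)) ℝ)
    (A : Fin (n + 2) → EE' n → Matrix (Fin N) (Fin N) ℂ) (B : EE' n → Matrix (Fin N) (Fin N) ℂ)
    (f : EE' n → Fin N → ℂ) {v : EE' n → Fin N → ℂ} (hv : ContDiff ℝ ∞ v) (x : EE' n) (k : Fin N) :
    (QQ c g A B f).LL (e0 n) (bb n) v x k =
      ∑ α, ∑ β, (((g x)⁻¹ α β : ℝ) : ℂ) * dl c α (dl c β fun y => v y k) x
        - ∑ α, ∑ j, A α x k j * dl c α (fun y => v y j) x - ∑ j, B x k j * v x j := by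
  have hk : ∀ k, ContDiff ℝ ∞ fun y => v y k := fun k => contDiff_pi.mp hv k
  have d2 : ∀ a b, dd a (dd b v) x k = dd a (dd b fun y => v y k) x := fun a b => by
    rw [dd_comp (dd_smooth hv)]
    congr 1; funext y; exact dd_comp hv b y k
  have s1 : ∀ φ, dl c (1 : Fin (n+2)) φ = dd (e0 n) φ := fun φ => rfl
  have s1' : ∀ φ, dl c (Fin.succ 0 : Fin (n+2)) φ = dd (e0 n) φ := fun φ => rfl
  have s2 : ∀ (j : Fin n) φ, dl c j.succ.succ φ = dd (bb n j) φ := fun j φ => rfl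
  unfold Coef.LL QQ
  simp only [Pi.add_apply, Finset.sum_apply, Pi.smul_apply, Complex.real_smul, mop_apply, ite_sub_sum, d2]
  have dc : ∀ j, dd (bb n j) (dd (e0 n) fun y => v y k) x = dd (e0 n) (dd (bb n j) fun y => v y k) x := fun j => by
    rw [dd_comm (hk k)]
  simp only [Fin.sum_univ_succ (n := n+1), Fin.sum_univ_succ (n := n), s1, s2, dl_zero, dd_cmul c (hk _), Fin.succ_zero_eq_one,
    dc, dd_comp hv]
  simp only [Finset.sum_add_distrib, Finset.sum_sub_distrib, Complex.ofReal_add, add_mul, mul_add, mul_assoc,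
    mul_left_comm _ c]
  ring

end
end HM

/-- **Real analyticity of modes near a non-degenerate Killing horizon in adapted
(Gaussian null) coordinates** (coordinate version of Theorem 3 of the paper).
The spatial dimension is `n + 1 ≥ 1`.  Coordinates: `x₀ ∈ ℝ` (the Killing direction) and
`x' = (x₁,…,x_{n+1}) ∈ U ⊂ ℝ^{n+1}` (indexed by `Fin (n+1)`, so `x₁` has index `0`); the
metric coefficient indices `0,…,n+1` are elements of `Fin (n+2)`, index `α` corresponding
to the coordinate `x_α`.  The horizon is `{x₁ = 0}` and the surface gravity is `κ ≠ 0`.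
If `u` is a smooth `σ`-mode (`∂₀u = −iσu`) and `Pu` is real analytic on `ℝ × U`, then `u`
is real analytic on `ℝ × V` for some open `V ⊂ U` containing `U ∩ {x₁ = 0}`. -/
theorem modes_analytic_near_nondegenerate_horizon
    (n N : ℕ) (hN : 1 ≤ N)
    (κ : ℝ) (hκ : κ ≠ 0) (σ : ℂ)
    (U : Set (Fin (n + 1) → ℝ)) (hU : IsOpen U) (hUne : (U ∩ {x | x 0 = 0}).Nonempty)
    (g : (Fin (n + 1) → ℝ) → Matrix (Fin (n + 2)) (Fin (n + 2)) ℝ)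
    (hgan : ∀ i j : Fin (n + 2), AnalyticOnNhd ℝ (fun x => g x i j) U)
    (hgsymm : ∀ x ∈ U, (g x).IsSymm)
    (hginv : ∀ x ∈ U, IsUnit (g x))
    (h00 : ∀ x ∈ U, x 0 = 0 → g x 0 0 = 0)
    (h01 : ∀ x ∈ U, x 0 = 0 → g x 0 1 = 1)
    (h0j : ∀ x ∈ U, x 0 = 0 → ∀ j : Fin (n + 2), 2 ≤ (j : ℕ) → g x 0 j = 0)
    (h11 : ∀ x ∈ U, x 0 = 0 → g x 1 1 = 0)
    (h1j : ∀ x ∈ U, x 0 = 0 → ∀ j : Fin (n + 2), 2 ≤ (j : ℕ) → g x 1 j = 0)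
    (hpos : ∀ x ∈ U, x 0 = 0 → ∀ ξ : Fin (n + 2) → ℝ,
      ξ 0 = 0 → ξ 1 = 0 → ξ ≠ 0 →
        0 < ∑ i : Fin (n + 2), ∑ j : Fin (n + 2), g x i j * ξ i * ξ j)
    (hkappa : ∀ x ∈ U, x 0 = 0 →
      deriv (fun s => g (Function.update x 0 s) 0 0) (x 0) = -2 * κ)
    (A : Fin (n + 2) → (Fin (n + 1) → ℝ) → Matrix (Fin N) (Fin N) ℂ)
    (B : (Fin (n + 1) → ℝ) → Matrix (Fin N) (Fin N) ℂ)
    (hAan : ∀ (α : Fin (n + 2)) (i j : Fin N), AnalyticOnNhd ℝ (fun x => A α x i j) U)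
    (hBan : ∀ i j : Fin N, AnalyticOnNhd ℝ (fun x => B x i j) U)
    (u : ℝ × (Fin (n + 1) → ℝ) → (Fin N → ℂ))
    (hu : ContDiffOn ℝ (⊤ : ℕ∞) u ((univ : Set ℝ) ×ˢ U))
    (hmode : ∀ (t : ℝ), ∀ x ∈ U, deriv (fun s => u (s, x)) t = (-Complex.I * σ) • u (t, x))
    (Pu : ℝ × (Fin (n + 1) → ℝ) → Fin N → ℂ)
    (hPu : ∀ (p : ℝ × (Fin (n + 1) → ℝ)) (k : Fin N), Pu p k =
      -(∑ α : Fin (n + 2), ∑ β : Fin (n + 2),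
          (((g p.2)⁻¹ α β : ℝ) : ℂ) * D α (fun q => D β (fun q' => u q' k) q) p)
        + ∑ α : Fin (n + 2), ∑ j : Fin N, A α p.2 k j * D α (fun q => u q j) p
        + ∑ j : Fin N, B p.2 k j * u p j)
    (hPan : AnalyticOnNhd ℝ Pu ((univ : Set ℝ) ×ˢ U)) :
    ∃ V : Set (Fin (n + 1) → ℝ), IsOpen V ∧ V ⊆ U ∧ (U ∩ {x | x 0 = 0}) ⊆ V ∧
      AnalyticOnNhd ℝ u ((univ : Set ℝ) ×ˢ V) := by
  set c : ℂ := -Complex.I * σ with hcdef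
  set v : HM.EE' n → Fin N → ℂ := fun x => u (0, x) with hv
  have hUo : IsOpen ((univ : Set ℝ) ×ˢ U) := isOpen_univ.prod hU
  have hua : ∀ t, ∀ x ∈ U, ContDiffAt ℝ (⊤ : ℕ∞) u (t, x) := fun t x hx =>
    hu.contDiffAt (hUo.mem_nhds ⟨mem_univ _, hx⟩)
  have hform : ∀ t : ℝ, ∀ x ∈ U, u (t, x) = Complex.exp (c * t) • v x := by
    intro t x hx
    refine HM.mode_form (f := fun s => u (s, x)) (c := c) (fun s => ?_) (fun s => hmode s x hx) t
    have h1 : DifferentiableAt ℝ u (s, x) := (hua s x hx).differentiableAt (by simp)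
    exact h1.comp s (by fun_prop : DifferentiableAt ℝ (fun s : ℝ => (s, x)) s)
  have hvs : ∀ x ∈ U, ContDiffAt ℝ (⊤ : ℕ∞) v x := fun x hx =>
    (hua 0 x hx).comp x (contDiffAt_const.prodMk contDiffAt_id)
  have hP0 : ∀ x ∈ U, AnalyticAt ℝ (fun x => - Pu (0, x)) x := by
    intro x hx
    have h1 : AnalyticAt ℝ Pu ((fun y : HM.EE' n => ((0:ℝ), y)) x) := hPan (0, x) ⟨mem_univ _, hx⟩
    have h2 : AnalyticAt ℝ (fun y : HM.EE' n => ((0:ℝ), y)) x := analyticAt_const.prod analyticAt_id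
    exact (h1.comp h2).fun_neg
  have key : ∀ p ∈ U, p 0 = 0 → AnalyticAt ℝ v p := by
    intro p hp hp0
    have hr0 : ∀ x ∈ U, x 0 = 0 → ∀ β, g x 0 β = if β = 1 then 1 else 0 := fun x hx hx0 =>
      HM.g_row0 (h00 x hx hx0) (h01 x hx hx0) (h0j x hx hx0)
    have hr1 : ∀ x ∈ U, x 0 = 0 → ∀ β, g x 1 β = if β = 0 then 1 else 0 := fun x hx hx0 =>
      HM.g_row1 (hgsymm x hx) (h01 x hx hx0) (h11 x hx hx0) (h1j x hx hx0)
    have hgp : ∀ i j, AnalyticAt ℝ (fun x => g x i j) p := fun i j => hgan i j p hp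
    have hUp : ∀ᶠ z in nhds p, z ∈ U := hU.mem_nhds hp
    refine HM.mft_F (Q := HM.QQ c g A B (fun x => - Pu (0, x))) (c := 2 * κ) hp0
      (HM.QQ_an c hgp (hginv p hp) (fun α i j => hAan α i j p hp) (fun i j => hBan i j p hp) (hP0 p hp)) ?_ ?_
      (mul_ne_zero two_ne_zero hκ) ?_ ?_ ?_ ?_ ?_
    · filter_upwards [hUp] with z hz hz0
      show (g z)⁻¹ 1 1 = 0
      rw [HM.G_row1 (hginv z hz) (hr0 z hz hz0)]; simp
    · intro j
      filter_upwards [hUp] with z hz hz0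
      show (g z)⁻¹ 1 j.succ.succ + (g z)⁻¹ j.succ.succ 1 = 0
      rw [HM.G_symm (hgsymm z hz) j.succ.succ 1, HM.G_row1 (hginv z hz) (hr0 z hz hz0)]
      simp [Fin.succ_ne_zero]
    · show HM.dd (HM.e0 n) (fun x => (g x)⁻¹ 1 1) p = 2 * κ
      rw [HM.G_dd hU hp hgp (hgsymm p hp) hginv (hr0 p hp hp0)]
      have h1 := HM.deriv_upd (f := fun x => g x 0 0) (hgp 0 0).differentiableAt 0
      rw [hkappa p hp hp0] at h1
      have h2 : HM.dd (HM.e0 n) (fun x => g x 0 0) p = -2 * κ := h1.symm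
      rw [h2]; ring
    · exact HM.G_pos (hginv p hp) (hgsymm p hp) (hr0 p hp hp0) (hr1 p hp hp0) (hpos p hp hp0)
    · filter_upwards [hUp] with z hz j l
      exact HM.G_symm (hgsymm z hz) _ _
    · filter_upwards [hUp] with z hz using hvs z hz
    · obtain ⟨v', sv, cv⟩ := HM.globalize (f := v) (x := p) (hUp.mono fun z hz => hvs z hz)
      obtain ⟨V, hVs, hVo, hpV⟩ := eventually_nhds_iff.mp (hUp.and cv)
      filter_upwards [hVo.mem_nhds hpV] with x hx
      have hxU := (hVs x hx).1
      have hev : v =ᶠ[nhds x] v' := by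
        filter_upwards [hVo.mem_nhds hx] with y hy using (hVs y hy).2.symm
      rw [HM.LL_ev _ hev]
      funext k
      have hw : ∀ k, ∀ t : ℝ, ∀ x ∈ V, (fun q => u q k) (t, x) = Complex.exp (c * t) * (fun y => v' y k) x := by
        intro k t y hy
        have := congrFun (hform t y (hVs y hy).1) k
        rw [← (hVs y hy).2] at this
        exact this
      have hk : ∀ k, ContDiff ℝ (⊤ : ℕ∞) fun y => v' y k := fun k => contDiff_pi.mp sv k
      have e2 : ∀ α β, D α (fun q => D β (fun q' => u q' k) q) (0, x) = HM.dl c α (HM.dl c β fun y => v' y k) x := by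
        intro α β
        have := HM.DD_mode (c := c) (w := fun q => u q k) hVo (hk k) (hw k) α β 0 hx
        simpa using this
      have e1 : ∀ j α, D α (fun q => u q j) (0, x) = HM.dl c α (fun y => v' y j) x := by
        intro j α
        have := HM.D_mode (c := c) (w := fun q => u q j) hVo (hk j) (hw j) α 0 hx
        simpa using this
      have e0 : ∀ j, u (0, x) j = v' x j := by
        intro j
        have := hw j 0 x hx
        simpa using this
      rw [HM.QQ_LL c g A B _ sv]
      show _ = - Pu (0, x) k
      rw [hPu]
      simp only [e2, e1, e0]
      ring
  refine ⟨{x | x ∈ U ∧ AnalyticAt ℝ v x}, hU.inter (isOpen_analyticAt ℝ v), fun x hx => hx.1,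
    fun x hx => ⟨hx.1, key x hx.1 hx.2⟩, ?_⟩
  rintro ⟨t, x⟩ ⟨-, hx, hax⟩
  have h1 : AnalyticAt ℝ (fun q : ℝ × HM.EE' n => v q.2) (t, x) :=
    AnalyticAt.comp (g := v) (f := fun q : ℝ × HM.EE' n => q.2) hax analyticAt_snd
  have h2 : AnalyticAt ℝ (fun q : ℝ × HM.EE' n => c * (q.1 : ℂ)) (t, x) :=
    analyticAt_const.fun_mul ((Complex.ofRealCLM.analyticAt _).comp analyticAt_fst)
  have h3 : AnalyticAt ℝ (fun q : ℝ × HM.EE' n => Complex.exp (c * (q.1 : ℂ))) (t, x) :=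
    AnalyticAt.comp (g := Complex.exp) (f := fun q : ℝ × HM.EE' n => c * (q.1 : ℂ))
      (analyticAt_cexp.restrictScalars (𝕜 := ℝ)) h2
  have h4 : AnalyticAt ℝ (fun q : ℝ × HM.EE' n => Complex.exp (c * (q.1 : ℂ)) • v q.2) (t, x) := h3.fun_smul h1
  refine h4.congr ?_
  filter_upwards [hUo.mem_nhds (⟨mem_univ _, hx⟩ : (t, x) ∈ (univ : Set ℝ) ×ˢ U)] with q hq
  exact (hform q.1 q.2 hq.2).symm
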